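/- For n ≥ 2, if the sphere S^{n−1} is projectively parallelizable (its tangent bundle splits as a direct sum of n−1 line subbundles), then S^{n−1} is parallelizable; consequently S^{n−1} is projectively parallelizable only when n ∈ {2, 4, 8}. -/

import Mathlib

namespace PK
open Matrix

/-- idempotent matrices -/
structure IdM (A : Type) [CommRing A] : Type 1 where
  ι : Type
  [ft : Fintype ι]
  [de : DecidableEq ι]
  e : Matrix ι ι A
  he : e * e = e

attribute [instance] IdM.ft IdM.de

section
variable {A : Type} [CommRing A]

/-- isomorphism of the images of two idempotent matrices -/
def Iso {ι κ : Type} [Fintype ι] [Fintype κ] (e : Matrix ι ι A) (f : Matrix κ κ A) : Prop :=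
  ∃ (u : Matrix κ ι A) (v : Matrix ι κ A), u * v = f ∧ v * u = e

theorem Iso.refl {ι : Type} [Fintype ι] {e : Matrix ι ι A} (he : e * e = e) : Iso e e :=
  ⟨e, e, he, he⟩

theorem Iso.symm {ι κ : Type} [Fintype ι] [Fintype κ] {e : Matrix ι ι A} {f : Matrix κ κ A}
    (h : Iso e f) : Iso f e := by
  obtain ⟨u, v, h1, h2⟩ := h
  exact ⟨v, u, h2, h1⟩

theorem Iso.trans {ι κ l : Type} [Fintype ι] [Fintype κ] [Fintype l]
    {e : Matrix ι ι A} {f : Matrix κ κ A} {g : Matrix l l A} (he : e * e = e) (hg : g * g = g)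
    (h : Iso e f) (h' : Iso f g) : Iso e g := by
  obtain ⟨u, v, h1, h2⟩ := h
  obtain ⟨u', v', h1', h2'⟩ := h'
  refine ⟨u' * u, v * v', ?_, ?_⟩
  · calc u' * u * (v * v') = u' * (u * v) * v' := by simp only [Matrix.mul_assoc]
      _ = (u' * v') * (u' * v') := by rw [h1, ← h2']; simp only [Matrix.mul_assoc]
      _ = g := by rw [h1', hg]
  · calc v * v' * (u' * u) = v * (v' * u') * u := by simp only [Matrix.mul_assoc]
      _ = (v * u) * (v * u) := by rw [h2', ← h1]; simp only [Matrix.mul_assoc]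
      _ = e := by rw [h2, he]

theorem Iso.of_equiv {ι κ : Type} [Fintype ι] [Fintype κ] {e : Matrix ι ι A} {f : Matrix κ κ A}
    (he : e * e = e) (σ : κ ≃ ι) (h : f = e.submatrix σ σ) : Iso e f := by
  classical
  subst h
  refine ⟨e.submatrix σ id, e.submatrix id σ, ?_, ?_⟩
  · rw [← Matrix.submatrix_mul _ _ σ id σ Function.bijective_id, he]
  · rw [← Matrix.submatrix_mul _ _ id σ id σ.bijective, he]
    rfl

theorem Iso.add {ι κ ι' κ' : Type} [Fintype ι] [Fintype κ] [Fintype ι'] [Fintype κ']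
    {e : Matrix ι ι A} {f : Matrix κ κ A}
    {e' : Matrix ι' ι' A} {f' : Matrix κ' κ' A} (h : Iso e f) (h' : Iso e' f') :
    Iso (fromBlocks e 0 0 e') (fromBlocks f 0 0 f') := by
  obtain ⟨u, v, h1, h2⟩ := h
  obtain ⟨u', v', h1', h2'⟩ := h'
  refine ⟨fromBlocks u 0 0 u', fromBlocks v 0 0 v', ?_, ?_⟩ <;>
  simp [fromBlocks_multiply, *]

open scoped Kronecker

theorem Iso.mul {ι κ ι' κ' : Type} [Fintype ι] [Fintype κ] [Fintype ι'] [Fintype κ']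
    {e : Matrix ι ι A} {f : Matrix κ κ A}
    {e' : Matrix ι' ι' A} {f' : Matrix κ' κ' A} (h : Iso e f) (h' : Iso e' f') :
    Iso (e ⊗ₖ e') (f ⊗ₖ f') := by
  obtain ⟨u, v, h1, h2⟩ := h
  obtain ⟨u', v', h1', h2'⟩ := h'
  refine ⟨u ⊗ₖ u', v ⊗ₖ v', ?_, ?_⟩ <;>
  simp [← mul_kronecker_mul, *]

theorem Iso.map {B : Type} [CommRing B] (φ : A →+* B) {ι κ : Type} [Fintype ι] [Fintype κ]
    {e : Matrix ι ι A} {f : Matrix κ κ A} (h : Iso e f) : Iso (e.map φ) (f.map φ) := by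
  obtain ⟨u, v, h1, h2⟩ := h
  exact ⟨u.map φ, v.map φ, by rw [← Matrix.map_mul, h1], by rw [← Matrix.map_mul, h2]⟩

theorem idem_blocks {ι κ : Type} [Fintype ι] [Fintype κ] {e : Matrix ι ι A} {f : Matrix κ κ A}
    (he : e * e = e) (hf : f * f = f) :
    (fromBlocks e 0 0 f) * (fromBlocks e 0 0 f) = fromBlocks e 0 0 f := by
  simp [fromBlocks_multiply, *]

theorem idem_kron {ι κ : Type} [Fintype ι] [Fintype κ] {e : Matrix ι ι A} {f : Matrix κ κ A}
    (he : e * e = e) (hf : f * f = f) :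
    (e ⊗ₖ f) * (e ⊗ₖ f) = e ⊗ₖ f := by
  simp [← mul_kronecker_mul, *]

theorem idem_map {B : Type} [CommRing B] (φ : A →+* B) {ι : Type} [Fintype ι]
    {e : Matrix ι ι A} (he : e * e = e) : e.map φ * e.map φ = e.map φ := by
  rw [← Matrix.map_mul, he]

/-- orthogonal sums are direct sums -/
theorem Iso.orth {ι : Type} [Fintype ι] {e f : Matrix ι ι A} (he : e * e = e) (hf : f * f = f)
    (h1 : e * f = 0) (h2 : f * e = 0) : Iso (e + f) (fromBlocks e 0 0 f) := by
  refine ⟨fromRows e f, fromCols e f, ?_, ?_⟩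
  · rw [fromRows_mul_fromCols]; simp [*]
  · rw [fromCols_mul_fromRows]; simp [*]

end

variable (A : Type) [CommRing A]

instance idSetoid : Setoid (IdM A) where
  r a b := Iso a.e b.e
  iseqv := ⟨fun a => Iso.refl a.he, Iso.symm, fun {a _ c} h h' => Iso.trans a.he c.he h h'⟩

/-- the semiring of isomorphism classes -/
def V : Type 1 := Quotient (idSetoid A)

variable {A}

/-- class of an idempotent -/
def vcl {ι : Type} [Fintype ι] [DecidableEq ι] (e : Matrix ι ι A) (he : e * e = e) : V A :=
  Quotient.mk _ ⟨ι, e, he⟩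

theorem vcl_eq {ι κ : Type} [Fintype ι] [DecidableEq ι] [Fintype κ] [DecidableEq κ]
    {e : Matrix ι ι A} {he : e * e = e}
    {f : Matrix κ κ A} {hf : f * f = f} : vcl e he = vcl f hf ↔ Iso e f :=
  ⟨fun h => Quotient.exact h, fun h => Quotient.sound h⟩

theorem V.ind {p : V A → Prop} (h : ∀ (ι : Type) (_ : Fintype ι) (_ : DecidableEq ι)
    (e : Matrix ι ι A) (he : e * e = e), p (vcl e he)) (a : V A) : p a := by
  induction a using Quotient.inductionOn with
  | h a => exact h a.ι a.ft a.de a.e a.he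

open scoped Kronecker

instance : Zero (V A) := ⟨vcl (0 : Matrix Empty Empty A) (by simp)⟩
instance : One (V A) := ⟨vcl (1 : Matrix Unit Unit A) (by simp)⟩
instance : Add (V A) := ⟨Quotient.map₂ (fun a b => ⟨a.ι ⊕ b.ι, fromBlocks a.e 0 0 b.e,
  idem_blocks a.he b.he⟩) (fun _ _ h _ _ h' => Iso.add h h')⟩
instance : Mul (V A) := ⟨Quotient.map₂ (fun a b => ⟨a.ι × b.ι, a.e ⊗ₖ b.e,
  idem_kron a.he b.he⟩) (fun _ _ h _ _ h' => Iso.mul h h')⟩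

theorem vcl_add {ι κ : Type} [Fintype ι] [DecidableEq ι] [Fintype κ] [DecidableEq κ]
    {e : Matrix ι ι A} {he : e * e = e} {f : Matrix κ κ A} {hf : f * f = f} :
    vcl e he + vcl f hf = vcl (fromBlocks e 0 0 f) (idem_blocks he hf) := rfl

theorem vcl_mul {ι κ : Type} [Fintype ι] [DecidableEq ι] [Fintype κ] [DecidableEq κ]
    {e : Matrix ι ι A} {he : e * e = e} {f : Matrix κ κ A} {hf : f * f = f} :
    vcl e he * vcl f hf = vcl (e ⊗ₖ f) (idem_kron he hf) := rfl

theorem vzero_def : (0 : V A) = vcl (0 : Matrix Empty Empty A) (by simp) := rfl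
theorem vone_def : (1 : V A) = vcl (1 : Matrix Unit Unit A) (by simp) := rfl

theorem V.add_comm' (a b : V A) : a + b = b + a := by
  induction a using V.ind with | h ι _ _ e he => ?_
  induction b using V.ind with | h κ _ _ f hf => ?_
  rw [vcl_add, vcl_add, vcl_eq]
  refine Iso.of_equiv (idem_blocks he hf) (Equiv.sumComm _ _) ?_
  ext (i | i) (j | j) <;> rfl

theorem V.add_assoc' (a b c : V A) : a + b + c = a + (b + c) := by
  induction a using V.ind with | h ι _ _ e he => ?_
  induction b using V.ind with | h κ _ _ f hf => ?_
  induction c using V.ind with | h κ _ _ g hg => ?_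
  rw [vcl_add, vcl_add, vcl_add, vcl_add, vcl_eq]
  refine Iso.of_equiv (idem_blocks (idem_blocks he hf) hg) (Equiv.sumAssoc _ _ _).symm ?_
  ext (i | i | i) (j | j | j) <;> rfl

theorem V.zero_add' (a : V A) : 0 + a = a := by
  induction a using V.ind with | h ι _ _ e he => ?_
  rw [vzero_def, vcl_add, vcl_eq]
  refine Iso.of_equiv (idem_blocks (by simp) he) (Equiv.emptySum _ _).symm ?_
  ext i j; rfl

theorem V.mul_comm' (a b : V A) : a * b = b * a := by
  induction a using V.ind with | h ι _ _ e he => ?_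
  induction b using V.ind with | h κ _ _ f hf => ?_
  rw [vcl_mul, vcl_mul, vcl_eq]
  refine Iso.of_equiv (idem_kron he hf) (Equiv.prodComm _ _) ?_
  ext ⟨i, i'⟩ ⟨j, j'⟩; simp [mul_comm]

theorem V.mul_assoc' (a b c : V A) : a * b * c = a * (b * c) := by
  induction a using V.ind with | h ι _ _ e he => ?_
  induction b using V.ind with | h κ _ _ f hf => ?_
  induction c using V.ind with | h κ _ _ g hg => ?_
  rw [vcl_mul, vcl_mul, vcl_mul, vcl_mul, vcl_eq]
  refine Iso.of_equiv (idem_kron (idem_kron he hf) hg) (Equiv.prodAssoc _ _ _).symm ?_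
  ext ⟨i, i', i''⟩ ⟨j, j', j''⟩; simp [mul_assoc]

theorem V.one_mul' (a : V A) : 1 * a = a := by
  induction a using V.ind with | h ι _ _ e he => ?_
  rw [vone_def, vcl_mul, vcl_eq]
  refine Iso.of_equiv (idem_kron (by simp) he) (Equiv.punitProd _).symm ?_
  ext i j; simp

theorem V.add_mul' (a b c : V A) : (a + b) * c = a * c + b * c := by
  induction a using V.ind with | h ι _ _ e he => ?_
  induction b using V.ind with | h κ _ _ f hf => ?_
  induction c using V.ind with | h κ _ _ g hg => ?_
  rw [vcl_mul, vcl_mul, vcl_add, vcl_mul, vcl_add, vcl_eq]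
  refine Iso.of_equiv (idem_kron (idem_blocks he hf) hg) (Equiv.sumProdDistrib _ _ _).symm ?_
  ext (⟨i, i'⟩ | ⟨i, i'⟩) (⟨j, j'⟩ | ⟨j, j'⟩) <;> simp

theorem V.zero_mul' (a : V A) : 0 * a = 0 := by
  induction a using V.ind with | h ι _ _ e he => ?_
  rw [vzero_def, vcl_mul, vcl_eq]
  refine Iso.of_equiv (idem_kron (by simp) he) (Equiv.equivOfIsEmpty _ _) ?_
  ext i j; exact i.elim

instance : CommSemiring (V A) where
  add_assoc := V.add_assoc'
  zero_add := V.zero_add'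
  add_zero a := by rw [V.add_comm', V.zero_add']
  add_comm := V.add_comm'
  left_distrib a b c := by rw [V.mul_comm', V.add_mul', V.mul_comm' b, V.mul_comm' c]
  right_distrib := V.add_mul'
  zero_mul := V.zero_mul'
  mul_zero a := by rw [V.mul_comm', V.zero_mul']
  mul_assoc := V.mul_assoc'
  one_mul := V.one_mul'
  mul_one a := by rw [V.mul_comm', V.one_mul']
  mul_comm := V.mul_comm'
  nsmul := nsmulRec
  npow := npowRec

/-- base change -/
def V.map {B : Type} [CommRing B] (φ : A →+* B) : V A →+* V B where
  toFun := Quotient.map (fun a => ⟨a.ι, a.e.map φ, idem_map φ a.he⟩) (fun _ _ h => Iso.map φ h)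
  map_one' := by
    refine Quotient.sound ?_
    change Iso _ _
    simp only [Matrix.map_one _ (map_zero φ) (map_one φ)]
    exact Iso.refl (by simp)
  map_zero' := by
    refine Quotient.sound ?_
    change Iso _ _
    simp only [Matrix.map_zero _ (map_zero φ)]
    exact Iso.refl (by simp)
  map_add' a b := by
    induction a using V.ind with | h ι _ _ e he => ?_
    induction b using V.ind with | h κ _ _ f hf => ?_
    refine Quotient.sound ?_
    change Iso _ _
    simp only [fromBlocks_map, Matrix.map_zero _ (map_zero φ)]
    exact Iso.refl (idem_blocks (idem_map φ he) (idem_map φ hf))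
  map_mul' a b := by
    induction a using V.ind with | h ι _ _ e he => ?_
    induction b using V.ind with | h κ _ _ f hf => ?_
    refine Quotient.sound ?_
    change Iso _ _
    have : (e ⊗ₖ f).map φ = e.map φ ⊗ₖ f.map φ := by ext; simp
    simp only [this]
    exact Iso.refl (idem_kron (idem_map φ he) (idem_map φ hf))

theorem V.map_vcl {B : Type} [CommRing B] (φ : A →+* B) {ι : Type} [Fintype ι] [DecidableEq ι]
    {e : Matrix ι ι A} {he : e * e = e} :
    V.map φ (vcl e he) = vcl (e.map φ) (idem_map φ he) := rfl

theorem vcl_congr {ι : Type} [Fintype ι] [DecidableEq ι]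
    {e f : Matrix ι ι A} {he : e * e = e} (h : e = f) : vcl e he = vcl f (h ▸ he) := by
  subst h; rfl

theorem vcl_unit_one : vcl (1 : Matrix Unit Unit A) (by simp) = 1 := rfl

theorem vcl_one_fin (n : ℕ) : vcl (1 : Matrix (Fin n) (Fin n) A) (by simp) = n := by
  induction n with
  | zero =>
    rw [Nat.cast_zero, vzero_def, vcl_eq]
    exact Iso.of_equiv (by simp) (Equiv.equivOfIsEmpty _ _) (by ext i; exact i.elim)
  | succ n ih =>
    rw [Nat.cast_succ, ← ih, ← vcl_unit_one, vcl_add, vcl_eq]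
    refine Iso.of_equiv (by simp) (finSumFinEquiv (m := n) (n := 1) |>.symm.trans
      (Equiv.sumCongr (Equiv.refl _) (Equiv.ofUnique (Fin 1) Unit)) |>.symm) ?_
    ext (i | i) (j | j)
    · simp [Matrix.one_apply]
    · have : Fin.castAdd 1 i ≠ Fin.natAdd n 0 := by
        intro h; have := congrArg Fin.val h; simp at this; omega
      simp [this]
    · have : Fin.natAdd n 0 ≠ Fin.castAdd 1 j := by
        intro h; have := congrArg Fin.val h; simp at this; omega
      simp [this]
    · simp [Matrix.one_apply]

theorem vcl_one {ι : Type} [Fintype ι] [DecidableEq ι] :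
    vcl (1 : Matrix ι ι A) (by simp) = Fintype.card ι := by
  rw [← vcl_one_fin, vcl_eq]
  refine Iso.of_equiv (by simp) (Fintype.equivFin ι).symm ?_
  ext i j; simp [Matrix.one_apply]

theorem vcl_zero {ι : Type} [Fintype ι] [DecidableEq ι] :
    vcl (0 : Matrix ι ι A) (by simp) = 0 := by
  rw [vzero_def, vcl_eq]
  exact ⟨0, 0, by simp, by simp⟩

theorem vcl_orth {ι : Type} [Fintype ι] [DecidableEq ι] {e f : Matrix ι ι A}
    (he : e * e = e) (hf : f * f = f)
    (h1 : e * f = 0) (h2 : f * e = 0) :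
    vcl (e + f) (by simp [add_mul, mul_add, *]) = vcl e he + vcl f hf := by
  rw [vcl_add, vcl_eq]
  exact Iso.orth he hf h1 h2

theorem idem_compl {ι : Type} [Fintype ι] [DecidableEq ι] {e : Matrix ι ι A}
    (he : e * e = e) : (1 - e) * (1 - e) = 1 - e := by
  simp [sub_mul, mul_sub, he]

theorem vcl_compl {ι : Type} [Fintype ι] [DecidableEq ι] {e : Matrix ι ι A}
    (he : e * e = e) : vcl e he + vcl (1 - e) (idem_compl he) = Fintype.card ι := by
  rw [← vcl_orth he (idem_compl he) (by simp [mul_sub, he]) (by simp [sub_mul, he]), ← vcl_one]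
  apply vcl_congr; simp

theorem V.exists_compl (a : V A) : ∃ (b : V A) (n : ℕ), a + b = n := by
  induction a using V.ind with | h ι _ _ e he => ?_
  exact ⟨_, _, vcl_compl he⟩

/-! Grothendieck ring -/

/-- relations -/
noncomputable def relIdeal (W : Type 1) [CommSemiring W] : Ideal (MonoidAlgebra ℤ W) :=
  Ideal.span {x | ∃ a b : W, x = MonoidAlgebra.single (a + b) 1 - MonoidAlgebra.single a 1
    - MonoidAlgebra.single b 1}

variable (A) in
/-- K_0 of the ring `A` -/
noncomputable def K : Type 1 := MonoidAlgebra ℤ (V A) ⧸ relIdeal (V A)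

noncomputable instance : CommRing (K A) := inferInstanceAs (CommRing (_ ⧸ relIdeal (V A)))

/-- quotient map -/
noncomputable def mkK : MonoidAlgebra ℤ (V A) →+* K A := Ideal.Quotient.mk (relIdeal (V A))

theorem mkK_eq_zero (x : MonoidAlgebra ℤ (V A)) : mkK x = 0 ↔ x ∈ relIdeal (V A) :=
  Ideal.Quotient.eq_zero_iff_mem

theorem mkK_surj (x : K A) : ∃ y, mkK y = x := Ideal.Quotient.mk_surjective x

theorem mkK_add (a b : V A) : mkK (MonoidAlgebra.single (a + b) 1) =
    mkK (MonoidAlgebra.single a 1) + mkK (MonoidAlgebra.single b 1) := by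
  have h : (MonoidAlgebra.single (a + b) (1 : ℤ) - MonoidAlgebra.single a 1
      - MonoidAlgebra.single b 1) ∈ relIdeal (V A) := Ideal.subset_span ⟨a, b, rfl⟩
  rw [← mkK_eq_zero, map_sub, map_sub] at h
  linear_combination h

/-- the canonical map -/
noncomputable def cl : V A →+* K A where
  toFun a := mkK (MonoidAlgebra.single a 1)
  map_one' := by rw [← MonoidAlgebra.one_def, map_one]
  map_mul' a b := by rw [← map_mul, MonoidAlgebra.single_mul_single, one_mul]
  map_zero' := by
    have := mkK_add (0 : V A) 0
    rw [add_zero] at this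
    linear_combination -this
  map_add' := mkK_add

theorem cl_def (a : V A) : cl a = mkK (MonoidAlgebra.single a 1) := rfl

theorem cl_eq_iff (a b : V A) : cl a = cl b ↔ ∃ c, a + c = b + c := by
  constructor
  · intro h
    let θ : MonoidAlgebra ℤ (V A) →+ Algebra.GrothendieckAddGroup (V A) :=
      (Finsupp.liftAddHom (fun a => zmultiplesHom _ (Algebra.GrothendieckAddGroup.of a))).comp
        MonoidAlgebra.coeffAddEquiv.toAddMonoidHom
    have hθ1 : ∀ (m : V A) (k : ℤ), θ (MonoidAlgebra.single m k) =
        k • Algebra.GrothendieckAddGroup.of m := by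
      intro m k
      exact Finsupp.liftAddHom_apply_single _ _ _
    have hθ : ∀ x ∈ relIdeal (V A), θ x = 0 := by
      intro x hx
      unfold relIdeal at hx
      rw [Ideal.span] at hx
      induction hx using Submodule.closure_induction with
      | zero => simp
      | add x y _ _ hx hy => rw [map_add, hx, hy, add_zero]
      | smul_mem r x hx =>
        obtain ⟨a, b, rfl⟩ := hx
        induction r using MonoidAlgebra.induction_linear with
        | zero => simp
        | add f g hf hg => rw [add_smul, map_add, hf, hg, add_zero]
        | single m k =>
          simp only [smul_eq_mul, mul_sub, MonoidAlgebra.single_mul_single, mul_one, map_sub, hθ1,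
            mul_add, map_add, smul_add]
          abel
    have h1 : MonoidAlgebra.single a (1 : ℤ) - MonoidAlgebra.single b 1 ∈ relIdeal (V A) :=
      by rw [← mkK_eq_zero, map_sub, sub_eq_zero]; exact h
    have h2 := hθ _ h1
    rw [map_sub, hθ1, hθ1, one_smul, one_smul, sub_eq_zero] at h2
    have h3 := (AddLocalization.mk_eq_mk_iff.1 h2)
    rw [AddLocalization.r_iff_exists] at h3
    obtain ⟨c, hc⟩ := h3
    refine ⟨c, ?_⟩
    simpa [add_comm] using hc
  · rintro ⟨c, hc⟩
    have := congrArg cl hc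
    rw [map_add, map_add] at this
    exact add_right_cancel this

/-- functoriality of K -/
noncomputable def K.lift {R : Type*} [CommRing R] (ψ : V A →+* R) : K A →+* R :=
  Ideal.Quotient.lift (relIdeal (V A)) (MonoidAlgebra.lift ℤ R (V A) (ψ : V A →* R)).toRingHom (by
    intro x hx
    have : relIdeal (V A) ≤
        RingHom.ker (MonoidAlgebra.lift ℤ R (V A) (ψ : V A →* R)).toRingHom := by
      unfold relIdeal
      rw [Ideal.span_le]
      rintro x ⟨a, b, rfl⟩
      simp [RingHom.mem_ker]
    exact this hx)

theorem K.lift_cl {R : Type*} [CommRing R] (ψ : V A →+* R) (a : V A) : K.lift ψ (cl a) = ψ a := by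
  have : K.lift ψ (mkK (MonoidAlgebra.single a 1)) =
    (MonoidAlgebra.lift ℤ R (V A) (ψ : V A →* R)).toRingHom (MonoidAlgebra.single a 1) :=
    Ideal.Quotient.lift_mk _ _ _
  rw [cl_def, this]
  simp

noncomputable def K.map {B : Type} [CommRing B] (φ : A →+* B) : K A →+* K B :=
  K.lift (cl.comp (V.map φ))

theorem K.map_cl {B : Type} [CommRing B] (φ : A →+* B) (a : V A) :
    K.map φ (cl a) = cl (V.map φ a) := K.lift_cl _ _

theorem K.exists_rep (x : K A) : ∃ (a : V A) (n : ℕ), x = cl a - n := by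
  obtain ⟨y, rfl⟩ := mkK_surj x
  induction y using MonoidAlgebra.induction_linear with
  | zero => exact ⟨0, 0, by simp⟩
  | add f g hf hg =>
    obtain ⟨a, n, h⟩ := hf
    obtain ⟨b, m, h'⟩ := hg
    refine ⟨a + b, n + m, ?_⟩
    rw [map_add, h, h', map_add]; push_cast; ring
  | single v k =>
    have h0 : mkK (MonoidAlgebra.single v k) = k * cl v := by
      have : (MonoidAlgebra.single v k : MonoidAlgebra ℤ (V A)) = k • MonoidAlgebra.single v 1 := by
        simp
      rw [this, map_zsmul, zsmul_eq_mul, cl_def]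
    obtain ⟨w, n, hw⟩ := V.exists_compl v
    have hw' := congrArg cl hw
    rw [map_add, map_natCast] at hw'
    rcases Int.eq_nat_or_neg k with ⟨j, rfl | rfl⟩
    · refine ⟨j * v, 0, ?_⟩
      rw [h0]; simp
    · refine ⟨j * w, j * n, ?_⟩
      rw [h0]; push_cast
      rw [map_mul, map_natCast, ← hw']; ring

theorem K.ext_hom {R : Type*} [CommRing R] {f g : K A →+* R} (h : ∀ a, f (cl a) = g (cl a)) :
    f = g := by
  ext x
  obtain ⟨a, n, rfl⟩ := K.exists_rep x
  simp [h]

theorem K.map_comp {B C : Type} [CommRing B] [CommRing C] (φ : A →+* B) (ψ : B →+* C) (x : K A) :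
    K.map ψ (K.map φ x) = K.map (ψ.comp φ) x := by
  have : (K.map ψ).comp (K.map φ) = K.map (ψ.comp φ) := by
    apply K.ext_hom
    intro a
    induction a using V.ind with | h ι _ _ e he => ?_
    simp only [RingHom.comp_apply, K.map_cl, V.map_vcl]
    congr 1
  exact DFunLike.congr_fun this x

theorem K.map_id (x : K A) : K.map (RingHom.id A) x = x := by
  have : K.map (RingHom.id A) = RingHom.id _ := by
    apply K.ext_hom
    intro a
    induction a using V.ind with | h ι _ _ e he => ?_
    simp only [RingHom.id_apply, K.map_cl, V.map_vcl]
    congr 1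
  exact DFunLike.congr_fun this x

/-- class in K of an idempotent -/
noncomputable def kcl {ι : Type} [Fintype ι] [DecidableEq ι] (e : Matrix ι ι A) (he : e * e = e) :
    K A := cl (vcl e he)

theorem kcl_eq_iff {ι κ : Type} [Fintype ι] [DecidableEq ι] [Fintype κ] [DecidableEq κ]
    {e : Matrix ι ι A} {he : e * e = e} {f : Matrix κ κ A} {hf : f * f = f} :
    kcl e he = kcl f hf ↔ ∃ n : ℕ, Iso (fromBlocks e 0 0 (1 : Matrix (Fin n) (Fin n) A))
      (fromBlocks f 0 0 (1 : Matrix (Fin n) (Fin n) A)) := by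
  constructor
  · intro h
    obtain ⟨c, hc⟩ := (cl_eq_iff _ _).1 h
    obtain ⟨b, n, hb⟩ := V.exists_compl c
    refine ⟨n, ?_⟩
    have : vcl e he + n = vcl f hf + n := by rw [← hb, ← add_assoc, hc, add_assoc]
    rw [← vcl_one_fin, vcl_add, vcl_add, vcl_eq] at this
    exact this
  · rintro ⟨n, h⟩
    refine (cl_eq_iff _ _).2 ⟨n, ?_⟩
    rw [← vcl_one_fin, vcl_add, vcl_add, vcl_eq]
    exact h

theorem kcl_eq {ι κ : Type} [Fintype ι] [DecidableEq ι] [Fintype κ] [DecidableEq κ]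
    {e : Matrix ι ι A} {he : e * e = e} {f : Matrix κ κ A} {hf : f * f = f} (h : Iso e f) :
    kcl e he = kcl f hf := congrArg cl (vcl_eq.2 h)

end PK

namespace PK
open Matrix Topology

section
variable {𝕜 : Type} [RCLike 𝕜]
variable {X Y Z : Type} [TopologicalSpace X] [TopologicalSpace Y] [TopologicalSpace Z]

/-- pullback of functions -/
def pb (φ : C(X, Y)) : C(Y, 𝕜) →+* C(X, 𝕜) where
  toFun f := f.comp φ
  map_one' := rfl
  map_zero' := rfl
  map_add' _ _ := rfl
  map_mul' _ _ := rfl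

@[simp] theorem pb_apply (φ : C(X, Y)) (f : C(Y, 𝕜)) (x : X) : pb φ f x = f (φ x) := rfl

theorem pb_comp (φ : C(X, Y)) (ψ : C(Y, Z)) :
    (pb φ).comp (pb ψ) = (pb (ψ.comp φ) : C(Z, 𝕜) →+* C(X, 𝕜)) := rfl

/-- evaluation -/
def ev (x : X) : C(X, 𝕜) →+* 𝕜 where
  toFun f := f x
  map_one' := rfl
  map_zero' := rfl
  map_add' _ _ := rfl
  map_mul' _ _ := rfl

@[simp] theorem ev_apply (x : X) (f : C(X, 𝕜)) : ev x f = f x := rfl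

theorem mat_ext {ι κ : Type} {M N : Matrix ι κ C(X, 𝕜)}
    (h : ∀ x, M.map (ev x) = N.map (ev x)) : M = N := by
  ext i j x
  exact congrFun (congrFun (h x) i) j

theorem isUnit_mat_iff {ι : Type} [Fintype ι] [DecidableEq ι] {M : Matrix ι ι C(X, 𝕜)} :
    IsUnit M ↔ ∀ x, (M.map (ev x)).det ≠ 0 := by
  rw [Matrix.isUnit_iff_isUnit_det, ContinuousMap.isUnit_iff_forall_ne_zero]
  refine forall_congr' fun x => ?_
  have : M.det x = (M.map (ev x)).det := (RingHom.map_det (ev x) M)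
  rw [this]

theorem Iso.of_close {A : Type} [CommRing A] {ι : Type} [Fintype ι] [DecidableEq ι]
    {e f : Matrix ι ι A}
    (he : e * e = e) (hf : f * f = f) (h : IsUnit (f * e + (1 - f) * (1 - e))) : Iso e f := by
  obtain ⟨u, hu⟩ := h
  have h1 : (u : Matrix ι ι A) * e = f * u := by
    rw [hu]
    simp only [sub_mul, mul_sub, mul_add, add_mul, one_mul, mul_one, Matrix.mul_assoc, he]
    simp only [← Matrix.mul_assoc, hf]
    abel
  refine ⟨(u : Matrix ι ι A) * e, (↑u⁻¹ : Matrix ι ι A), ?_, ?_⟩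
  · rw [h1, Matrix.mul_assoc, Units.mul_inv, mul_one]
  · rw [← Matrix.mul_assoc, Units.inv_mul, one_mul]

/-- slice inclusion -/
def sl (t : unitInterval) : C(Z, unitInterval × Z) := ⟨fun z => (t, z), by fun_prop⟩

theorem Iso.slices [CompactSpace Z] {ι : Type} [Fintype ι] [DecidableEq ι]
    {e : Matrix ι ι C(unitInterval × Z, 𝕜)} (he : e * e = e) (s t : unitInterval) :
    Iso (e.map (pb (sl s))) (e.map (pb (sl t))) := by
  let P : unitInterval → unitInterval → Prop := fun s t =>
    Iso (e.map (pb (sl s))) (e.map (pb (sl t)))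
  refine PreconnectedSpace.induction₂' P ?_ ⟨?_⟩ s t
  · intro s
    have key : ∀ᶠ t in 𝓝 s, ∀ z ∈ (Set.univ : Set Z),
        (((e.map (ev (t, z))) * (e.map (ev (s, z))) +
        (1 - (e.map (ev (t, z)))) * (1 - (e.map (ev (s, z))))).det ≠ 0) := by
      refine isCompact_univ.eventually_forall_of_forall_eventually ?_
      intro z _
      have hc : Continuous fun p : unitInterval × Z =>
        (((e.map (ev (p.1, p.2))) * (e.map (ev (s, p.2))) +
        (1 - (e.map (ev (p.1, p.2)))) * (1 - (e.map (ev (s, p.2))))).det) := by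
        have h1 : Continuous fun p : unitInterval × Z => e.map (ev (p.1, p.2)) := by
          refine continuous_matrix fun i j => ?_
          simp only [map_apply, ev_apply]
          fun_prop
        have h2 : Continuous fun p : unitInterval × Z => e.map (ev (s, p.2)) := by
          refine continuous_matrix fun i j => ?_
          simp only [map_apply, ev_apply]
          fun_prop
        fun_prop
      refine (hc.tendsto (s, z)).eventually_ne ?_
      have := idem_map (ev (s, z)) he
      have h3 : (1 - e.map (ev (s, z))) * (1 - e.map (ev (s, z))) = 1 - e.map (ev (s, z)) :=
        idem_compl this
      simp only [this, h3, add_sub_cancel, det_one, ne_eq, one_ne_zero, not_false_eq_true]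
    filter_upwards [key] with t ht
    have hi : P s t := by
      refine Iso.of_close (idem_map _ he) (idem_map _ he) ?_
      rw [isUnit_mat_iff]
      intro z
      have := ht z (Set.mem_univ z)
      have h1 : ∀ r, (ev z).mapMatrix (e.map (pb (sl r))) = e.map (ev (r, z)) := fun r => rfl
      rw [← RingHom.mapMatrix_apply]
      rw [map_add, map_mul, map_mul, map_sub, map_sub, map_one, h1, h1]
      exact this
    exact ⟨hi, hi.symm⟩
  · exact fun a b c h1 h2 => Iso.trans (idem_map _ he) (idem_map _ he) h1 h2

theorem Iso.homotopic [CompactSpace Z] {ι : Type} [Fintype ι] [DecidableEq ι]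
    {e : Matrix ι ι C(Y, 𝕜)} (he : e * e = e) {φ ψ : C(Z, Y)} (h : φ.Homotopic ψ) :
    Iso (e.map (pb φ)) (e.map (pb ψ)) := by
  obtain ⟨H⟩ := h
  have := Iso.slices (idem_map (pb (𝕜 := 𝕜) H.toContinuousMap) he) 0 1
  have h0 : (e.map (pb H.toContinuousMap)).map (pb (sl 0)) = e.map (pb φ) := by
    ext i j z; simp [sl]
  have h1 : (e.map (pb H.toContinuousMap)).map (pb (sl 1)) = e.map (pb ψ) := by
    ext i j z; simp [sl]
  rwa [h0, h1] at this

end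

/-- an idempotent matrix over a field is trivial -/
theorem Iso.field {F : Type} [Field F] {ι : Type} [Fintype ι] [DecidableEq ι]
    {e : Matrix ι ι F} (he : e * e = e) :
    Iso e (1 : Matrix (Fin e.rank) (Fin e.rank) F) := by
  let W := LinearMap.range (Matrix.toLin' e)
  have hr : Module.finrank F W = e.rank := by
    rw [Matrix.rank_eq_finrank_range_toLin e (Pi.basisFun F ι) (Pi.basisFun F ι)]
    rw [Matrix.toLin_eq_toLin']
  let b : Module.Basis (Fin e.rank) F W := Module.finBasisOfFinrankEq F W hr
  let i : (Fin e.rank → F) →ₗ[F] (ι → F) := W.subtype ∘ₗ b.equivFun.symm.toLinearMap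
  let p : (ι → F) →ₗ[F] (Fin e.rank → F) := b.equivFun.toLinearMap ∘ₗ
    (Matrix.toLin' e).rangeRestrict
  have hee : (Matrix.toLin' e) ∘ₗ (Matrix.toLin' e) = Matrix.toLin' e := by
    rw [← Matrix.toLin'_mul, he]
  refine ⟨LinearMap.toMatrix' p, LinearMap.toMatrix' i, ?_, ?_⟩
  · rw [← LinearMap.toMatrix'_comp, ← LinearMap.toMatrix'_id]
    congr 1
    apply LinearMap.ext
    intro x
    simp only [p, i, LinearMap.comp_apply, LinearEquiv.coe_coe, LinearMap.id_apply]
    rw [LinearEquiv.eq_symm_apply _ |>.symm]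
    apply Subtype.ext
    simp only [LinearMap.codRestrict_apply, LinearMap.rangeRestrict, Submodule.subtype_apply]
    obtain ⟨y, hy⟩ := (b.equivFun.symm x).2
    rw [← hy]
    exact LinearMap.congr_fun hee y
  · rw [← LinearMap.toMatrix'_comp]
    have : i ∘ₗ p = Matrix.toLin' e := by
      apply LinearMap.ext
      intro x
      simp [p, i, LinearMap.rangeRestrict]
    rw [this, LinearMap.toMatrix'_toLin']

theorem idem_trace {F : Type} [Field F] {ι : Type} [Fintype ι] [DecidableEq ι]
    {e : Matrix ι ι F} (he : e * e = e) : e.trace = e.rank := by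
  obtain ⟨u, v, h1, h2⟩ := Iso.field he
  rw [← h2, Matrix.trace_mul_comm, h1]; simp [h2]

end PK

namespace PK
open Matrix Topology
open scoped Kronecker

/-- A Milnor square of rings. -/
structure MSq (S D C : Type) [CommRing S] [CommRing D] [CommRing C] where
  rp : S →+* D
  rm : S →+* D
  b : D →+* C
  comm : ∀ s, b (rp s) = b (rm s)
  inj : ∀ s s', rp s = rp s' → rm s = rm s' → s = s'
  glue : ∀ x y, b x = b y → ∃ s, rp s = x ∧ rm s = y

section Alg
variable {S D C : Type} [CommRing S] [CommRing D] [CommRing C] (q : MSq S D C)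
variable {ι κ ι' κ' : Type} [Fintype ι] [Fintype κ] [Fintype ι'] [Fintype κ']
  [DecidableEq ι] [DecidableEq κ] [DecidableEq ι'] [DecidableEq κ']

/-- `e` is clutched by `g` -/
def Clut (e : Matrix ι ι S) (g : Matrix κ κ C) : Prop :=
  ∃ (Up Um : Matrix ι κ D) (Wp Wm : Matrix κ ι D), Up * Wp = e.map q.rp ∧ Um * Wm = e.map q.rm ∧
    Wp * Up = 1 ∧ Wm * Um = 1 ∧ Wm.map q.b * Up.map q.b = g

theorem MSq.glueMat (x y : Matrix ι κ D) (h : x.map q.b = y.map q.b) :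
    ∃ s : Matrix ι κ S, s.map q.rp = x ∧ s.map q.rm = y := by
  choose f hf using fun i j => q.glue (x i j) (y i j) (congrFun (congrFun h i) j)
  exact ⟨Matrix.of f, by ext i j; exact (hf i j).1, by ext i j; exact (hf i j).2⟩

theorem MSq.injMat (x y : Matrix ι κ S) (h : x.map q.rp = y.map q.rp)
    (h' : x.map q.rm = y.map q.rm) : x = y := by
  ext i j
  exact q.inj _ _ (congrFun (congrFun h i) j) (congrFun (congrFun h' i) j)

theorem MSq.commMat (x : Matrix ι κ S) : (x.map q.rp).map q.b = (x.map q.rm).map q.b := by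
  ext i j; exact q.comm _

theorem Clut.glue_aux {e : Matrix ι ι S} {e' : Matrix ι' ι' S}
    {Up Um : Matrix ι κ D} {Wp Wm : Matrix κ ι D} {Up' Um' : Matrix ι' κ D}
    {Wp' Wm' : Matrix κ ι' D} (h1 : Up * Wp = e.map q.rp) (h2 : Um * Wm = e.map q.rm)
    (h4 : Wm * Um = 1)
    (h1' : Up' * Wp' = e'.map q.rp) (h2' : Um' * Wm' = e'.map q.rm)
    (h3' : Wp' * Up' = 1)
    (h : Wm.map q.b * Up.map q.b = Wm'.map q.b * Up'.map q.b) :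
    ∃ M : Matrix ι' ι S, M.map q.rp = Up' * Wp ∧ M.map q.rm = Um' * Wm := by
  apply q.glueMat
  have e1 : Up.map q.b * Wp.map q.b = Um.map q.b * Wm.map q.b := by
    rw [← Matrix.map_mul, ← Matrix.map_mul, h1, h2, q.commMat]
  have e2 : Up'.map q.b * Wp'.map q.b = Um'.map q.b * Wm'.map q.b := by
    rw [← Matrix.map_mul, ← Matrix.map_mul, h1', h2', q.commMat]
  have e3 : Wm.map q.b * Um.map q.b = 1 := by
    rw [← Matrix.map_mul, h4, Matrix.map_one _ (map_zero _) (map_one _)]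
  have e4 : Wp'.map q.b * Up'.map q.b = 1 := by
    rw [← Matrix.map_mul, h3', Matrix.map_one _ (map_zero _) (map_one _)]
  rw [Matrix.map_mul, Matrix.map_mul]
  symm
  calc Um'.map q.b * Wm.map q.b
      = Um'.map q.b * ((Wm.map q.b * Um.map q.b) * Wm.map q.b) := by rw [e3, Matrix.one_mul]
    _ = Um'.map q.b * (Wm.map q.b * Up.map q.b) * Wp.map q.b := by
        rw [Matrix.mul_assoc (Wm.map q.b), ← e1]; simp only [Matrix.mul_assoc]
    _ = Um'.map q.b * Wm'.map q.b * Up'.map q.b * Wp.map q.b := by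
        rw [h]; simp only [Matrix.mul_assoc]
    _ = Up'.map q.b * (Wp'.map q.b * Up'.map q.b) * Wp.map q.b := by
        rw [← e2]; simp only [Matrix.mul_assoc]
    _ = Up'.map q.b * Wp.map q.b := by rw [e4, Matrix.mul_one]

theorem Clut.iso {e : Matrix ι ι S} {e' : Matrix ι' ι' S} {g : Matrix κ κ C}
    (h : Clut q e g) (h' : Clut q e' g) : Iso e e' := by
  obtain ⟨Up, Um, Wp, Wm, h1, h2, h3, h4, h5⟩ := h
  obtain ⟨Up', Um', Wp', Wm', h1', h2', h3', h4', h5'⟩ := h'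
  obtain ⟨M, hM1, hM2⟩ := Clut.glue_aux q h1 h2 h4 h1' h2' h3' (h5.trans h5'.symm)
  obtain ⟨M', hM1', hM2'⟩ := Clut.glue_aux q h1' h2' h4' h1 h2 h3 (h5'.trans h5.symm)
  have aux : ∀ {a b c : Type} [Fintype a] [Fintype b] [Fintype c] (U : Matrix a κ D)
    (W : Matrix κ b D) (U' : Matrix b κ D) (W' : Matrix κ c D), W * U' = 1 →
    U * W * (U' * W') = U * W' := by
    intro a b c _ _ _ U W U' W' h
    rw [Matrix.mul_assoc, ← Matrix.mul_assoc W, h, Matrix.one_mul]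
  refine ⟨M, M', ?_, ?_⟩ <;> apply q.injMat <;> rw [Matrix.map_mul, ‹M.map _ = _›, ‹M'.map _ = _›,
    aux] <;> assumption

theorem Clut.change {e : Matrix ι ι S} {g : Matrix κ κ C} (h : Clut q e g)
    (wp wm : (Matrix κ κ D)ˣ) :
    Clut q e ((wm : Matrix κ κ D).map q.b * g * (↑wp⁻¹ : Matrix κ κ D).map q.b) := by
  obtain ⟨Up, Um, Wp, Wm, h1, h2, h3, h4, h5⟩ := h
  refine ⟨Up * (↑wp⁻¹ : Matrix κ κ D), Um * (↑wm⁻¹ : Matrix κ κ D), (wp : Matrix κ κ D) * Wp,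
    (wm : Matrix κ κ D) * Wm,
    ?_, ?_, ?_, ?_, ?_⟩
  · rw [Matrix.mul_assoc, ← Matrix.mul_assoc _ _ Wp, Units.inv_mul, Matrix.one_mul, h1]
  · rw [Matrix.mul_assoc, ← Matrix.mul_assoc _ _ Wm, Units.inv_mul, Matrix.one_mul, h2]
  · rw [Matrix.mul_assoc, ← Matrix.mul_assoc Wp, h3, Matrix.one_mul, Units.mul_inv]
  · rw [Matrix.mul_assoc, ← Matrix.mul_assoc Wm, h4, Matrix.one_mul, Units.mul_inv]
  · rw [Matrix.map_mul, Matrix.map_mul, ← h5]; simp only [Matrix.mul_assoc]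

theorem Clut.conv {e : Matrix ι ι S} {e' : Matrix ι' ι' S} {g g' : Matrix κ κ C}
    (h : Clut q e g) (h' : Clut q e' g') (hi : Iso e e') :
    ∃ wp wm : (Matrix κ κ D)ˣ, (wm : Matrix κ κ D).map q.b * g = g' * (wp : Matrix κ κ D).map q.b := by
  obtain ⟨Up, Um, Wp, Wm, h1, h2, h3, h4, h5⟩ := h
  obtain ⟨Up', Um', Wp', Wm', h1', h2', h3', h4', h5'⟩ := h'
  obtain ⟨u, v, huv, hvu⟩ := hi
  have mk : ∀ (r : S →+* D) (U : Matrix ι κ D) (W : Matrix κ ι D) (U' : Matrix ι' κ D)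
      (W' : Matrix κ ι' D), U * W = e.map r → W * U = 1 → U' * W' = e'.map r → W' * U' = 1 →
      (W' * u.map r * U) * (W * v.map r * U') = 1 ∧ (W * v.map r * U') * (W' * u.map r * U) = 1 := by
    intro r U W U' W' a1 a2 a3 a4
    have b1 : u.map r * v.map r = e'.map r := by rw [← Matrix.map_mul, huv]
    have b2 : v.map r * u.map r = e.map r := by rw [← Matrix.map_mul, hvu]
    constructor
    · calc (W' * u.map r * U) * (W * v.map r * U')
          = W' * (u.map r * (U * W) * v.map r) * U' := by simp only [Matrix.mul_assoc]
        _ = W' * ((u.map r * v.map r) * (u.map r * v.map r)) * U' := by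
            rw [a1, ← b2]; simp only [Matrix.mul_assoc]
        _ = (W' * U') * (W' * U') * (W' * U') := by
            rw [b1, ← a3]; simp only [Matrix.mul_assoc]
        _ = 1 := by simp [a4]
    · calc (W * v.map r * U') * (W' * u.map r * U)
          = W * (v.map r * (U' * W') * u.map r) * U := by simp only [Matrix.mul_assoc]
        _ = W * ((v.map r * u.map r) * (v.map r * u.map r)) * U := by
            rw [a3, ← b1]; simp only [Matrix.mul_assoc]
        _ = (W * U) * (W * U) * (W * U) := by
            rw [b2, ← a1]; simp only [Matrix.mul_assoc]
        _ = 1 := by simp [a2]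
  obtain ⟨p1, p2⟩ := mk q.rp Up Wp Up' Wp' h1 h3 h1' h3'
  obtain ⟨m1, m2⟩ := mk q.rm Um Wm Um' Wm' h2 h4 h2' h4'
  refine ⟨⟨_, _, p1, p2⟩, ⟨_, _, m1, m2⟩, ?_⟩
  simp only [Matrix.map_mul]
  rw [← h5, ← h5']
  have e1 : Up.map q.b * Wp.map q.b = Um.map q.b * Wm.map q.b := by
    rw [← Matrix.map_mul, ← Matrix.map_mul, h1, h2, q.commMat]
  have e2 : Up'.map q.b * Wp'.map q.b = Um'.map q.b * Wm'.map q.b := by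
    rw [← Matrix.map_mul, ← Matrix.map_mul, h1', h2', q.commMat]
  have e3 : Wp.map q.b * Up.map q.b = 1 := by
    rw [← Matrix.map_mul, h3, Matrix.map_one _ (map_zero _) (map_one _)]
  have e4 : Wm'.map q.b * Um'.map q.b = 1 := by
    rw [← Matrix.map_mul, h4', Matrix.map_one _ (map_zero _) (map_one _)]
  calc Wm'.map q.b * (u.map q.rm).map q.b * Um.map q.b * (Wm.map q.b * Up.map q.b)
      = Wm'.map q.b * (u.map q.rm).map q.b * (Um.map q.b * Wm.map q.b) * Up.map q.b := by
        simp only [Matrix.mul_assoc]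
    _ = Wm'.map q.b * (u.map q.rm).map q.b * Up.map q.b * (Wp.map q.b * Up.map q.b) := by
        rw [← e1]; simp only [Matrix.mul_assoc]
    _ = (Wm'.map q.b * Um'.map q.b) * Wm'.map q.b * (u.map q.rp).map q.b * Up.map q.b := by
        rw [e3, e4, q.commMat, Matrix.one_mul, Matrix.mul_one]
    _ = Wm'.map q.b * (Um'.map q.b * Wm'.map q.b) * (u.map q.rp).map q.b * Up.map q.b := by
        simp only [Matrix.mul_assoc]
    _ = _ := by rw [← e2]; simp only [Matrix.mul_assoc]

theorem Clut.add {e : Matrix ι ι S} {e' : Matrix ι' ι' S} {g : Matrix κ κ C} {g' : Matrix κ' κ' C}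
    (h : Clut q e g) (h' : Clut q e' g') : Clut q (fromBlocks e 0 0 e') (fromBlocks g 0 0 g') := by
  obtain ⟨Up, Um, Wp, Wm, h1, h2, h3, h4, h5⟩ := h
  obtain ⟨Up', Um', Wp', Wm', h1', h2', h3', h4', h5'⟩ := h'
  refine ⟨fromBlocks Up 0 0 Up', fromBlocks Um 0 0 Um', fromBlocks Wp 0 0 Wp',
    fromBlocks Wm 0 0 Wm', ?_, ?_, ?_, ?_, ?_⟩ <;>
  simp [fromBlocks_map, fromBlocks_multiply, Matrix.map_zero, *]

theorem Clut.mul {e : Matrix ι ι S} {e' : Matrix ι' ι' S} {g : Matrix κ κ C} {g' : Matrix κ' κ' C}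
    (h : Clut q e g) (h' : Clut q e' g') : Clut q (e ⊗ₖ e') (g ⊗ₖ g') := by
  obtain ⟨Up, Um, Wp, Wm, h1, h2, h3, h4, h5⟩ := h
  obtain ⟨Up', Um', Wp', Wm', h1', h2', h3', h4', h5'⟩ := h'
  have kmap : ∀ {R R' : Type} [CommRing R] [CommRing R'] (φ : R →+* R') {a b c d : Type}
    (x : Matrix a b R) (y : Matrix c d R), (x ⊗ₖ y).map φ = x.map φ ⊗ₖ y.map φ := by
    intros; ext; simp
  refine ⟨Up ⊗ₖ Up', Um ⊗ₖ Um', Wp ⊗ₖ Wp', Wm ⊗ₖ Wm', ?_, ?_, ?_, ?_, ?_⟩ <;>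
  simp [kmap, ← mul_kronecker_mul, *]

theorem Clut.one : Clut q (1 : Matrix κ κ S) (1 : Matrix κ κ C) := by
  refine ⟨1, 1, 1, 1, ?_⟩
  simp [Matrix.map_one]

theorem Clut.conj {e : Matrix ι ι S} {g : Matrix κ κ C} (h : Clut q e g) (σ : κ' ≃ κ) :
    Clut q e (g.submatrix σ σ) := by
  obtain ⟨Up, Um, Wp, Wm, h1, h2, h3, h4, h5⟩ := h
  refine ⟨Up.submatrix id σ, Um.submatrix id σ, Wp.submatrix σ id, Wm.submatrix σ id,
    ?_, ?_, ?_, ?_, ?_⟩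
  · rw [← Matrix.submatrix_mul _ _ _ _ _ σ.bijective, h1]; rfl
  · rw [← Matrix.submatrix_mul _ _ _ _ _ σ.bijective, h2]; rfl
  · rw [← Matrix.submatrix_mul _ _ _ _ _ Function.bijective_id, h3]; simp
  · rw [← Matrix.submatrix_mul _ _ _ _ _ Function.bijective_id, h4]; simp
  · rw [← h5]
    exact (Matrix.submatrix_mul (Wm.map q.b) (Up.map q.b) _ _ _ Function.bijective_id).symm

end Alg
end PK

namespace PK
open Matrix Topology
open scoped Kronecker
set_option linter.all false

/-- the two-sphere -/
abbrev S2 : Type := {p : ℂ × ℝ // ‖p.1‖ ^ 2 + p.2 ^ 2 = 1}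
/-- the closed disc -/
abbrev Dsk : Type := {z : ℂ // ‖z‖ ≤ 1}

/-- the circle -/
abbrev S1 : Type := {z : ℂ // ‖z‖ = 1}

instance : CompactSpace S2 := by
  refine isCompact_iff_compactSpace.1 (?_ : IsCompact {p : ℂ × ℝ | ‖p.1‖ ^ 2 + p.2 ^ 2 = 1})
  refine Metric.isCompact_of_isClosed_isBounded ?_ ?_
  · exact isClosed_eq (by fun_prop) continuous_const
  · refine (Metric.isBounded_closedBall (x := (0 : ℂ × ℝ)) (r := 1)).subset ?_
    rintro ⟨z, s⟩ h
    simp only [Set.mem_setOf_eq] at h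
    simp only [Metric.mem_closedBall, dist_zero_right, Prod.norm_def, sup_le_iff, Real.norm_eq_abs]
    constructor
    · nlinarith [norm_nonneg z, sq_nonneg s]
    · rw [abs_le]; constructor <;> nlinarith [norm_nonneg z, sq_nonneg ‖z‖]

instance : CompactSpace S1 := by
  refine isCompact_iff_compactSpace.1 (?_ : IsCompact {z : ℂ | ‖z‖ = 1})
  convert isCompact_sphere (0 : ℂ) 1 using 1
  ext; simp

instance : CompactSpace Dsk := by
  refine isCompact_iff_compactSpace.1 (?_ : IsCompact {z : ℂ | ‖z‖ ≤ 1})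
  convert isCompact_closedBall (0 : ℂ) 1 using 1
  ext; simp

theorem dsk_sq (z : Dsk) : 0 ≤ 1 - ‖z.1‖ ^ 2 := by
  nlinarith [norm_nonneg z.1, z.2]

theorem s2_le (p : S2) : ‖p.1.1‖ ≤ 1 := by
  nlinarith [norm_nonneg p.1.1, p.2, sq_nonneg p.1.2]

/-- upper hemisphere -/
noncomputable def jp : C(Dsk, S2) where
  toFun z := ⟨(z.1, √(1 - ‖z.1‖ ^ 2)), by simp [Real.sq_sqrt (dsk_sq z)]⟩
  continuous_toFun := by fun_prop

/-- lower hemisphere -/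
noncomputable def jm : C(Dsk, S2) where
  toFun z := ⟨(z.1, -√(1 - ‖z.1‖ ^ 2)), by simp [Real.sq_sqrt (dsk_sq z)]⟩
  continuous_toFun := by fun_prop

/-- projection -/
noncomputable def prj : C(S2, Dsk) where
  toFun p := ⟨p.1.1, s2_le p⟩
  continuous_toFun := by fun_prop

/-- boundary -/
noncomputable def bd : C(S1, Dsk) where
  toFun z := ⟨z.1, z.2.le⟩
  continuous_toFun := by fun_prop

section
variable (X : Type) [TopologicalSpace X]

/-- map on the second factor -/
noncomputable def idx {A B : Type} [TopologicalSpace A] [TopologicalSpace B] (f : C(A, B)) : C(X × A, X × B) :=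
  ⟨fun p => (p.1, f p.2), by fun_prop⟩

@[simp] theorem idx_apply {A B : Type} [TopologicalSpace A] [TopologicalSpace B] (f : C(A, B))
    (p : X × A) : idx X f p = (p.1, f p.2) := rfl

/-- the Milnor square -/
noncomputable def sq : MSq C(X × S2, ℂ) C(X × Dsk, ℂ) C(X × S1, ℂ) where
  rp := pb (idx X jp)
  rm := pb (idx X jm)
  b := pb (idx X bd)
  comm s := by
    ext ⟨x, z⟩
    simp only [pb_apply, idx_apply]
    congr 2
    apply Subtype.ext
    simp [jp, jm, bd, z.2]
  inj s s' hp hm := by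
    ext ⟨x, p⟩
    rcases le_total 0 p.1.2 with h | h
    · have := DFunLike.congr_fun hp (x, prj p)
      have e : jp (prj p) = p := by
        apply Subtype.ext
        refine Prod.ext rfl ?_
        simp only [jp, prj, ContinuousMap.coe_mk]
        rw [show 1 - ‖p.1.1‖ ^ 2 = p.1.2 ^ 2 by linarith [p.2], Real.sqrt_sq h]
      simpa [e] using this
    · have := DFunLike.congr_fun hm (x, prj p)
      have e : jm (prj p) = p := by
        apply Subtype.ext
        refine Prod.ext rfl ?_
        simp only [jm, prj, ContinuousMap.coe_mk]
        rw [show 1 - ‖p.1.1‖ ^ 2 = p.1.2 ^ 2 by linarith [p.2], Real.sqrt_sq_eq_abs, abs_of_nonpos h, neg_neg]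
      simpa [e] using this
  glue f g h := by
    refine ⟨⟨fun q => if 0 ≤ q.2.1.2 then f (q.1, prj q.2) else g (q.1, prj q.2), ?_⟩, ?_, ?_⟩
    · refine Continuous.if_le (by fun_prop) (by fun_prop) (by fun_prop) (by fun_prop) ?_
      rintro ⟨x, p⟩ hp
      have hn : ‖p.1.1‖ = 1 := by
        have := p.2
        simp only at hp
        rw [← hp] at this
        nlinarith [norm_nonneg p.1.1]
      have := DFunLike.congr_fun h (x, ⟨p.1.1, hn⟩)
      exact this
    · ext ⟨x, z⟩
      simp only [pb_apply, idx_apply, ContinuousMap.coe_mk]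
      rw [if_pos (by simp [jp])]; rfl
    · ext ⟨x, z⟩
      simp only [pb_apply, idx_apply, ContinuousMap.coe_mk]
      split_ifs with h0
      · have : √(1 - ‖z.1‖ ^ 2) = 0 := by
          simp only [jm, ContinuousMap.coe_mk] at h0
          linarith [Real.sqrt_nonneg (1 - ‖z.1‖ ^ 2)]
        rw [Real.sqrt_eq_zero (dsk_sq z)] at this
        have hn : ‖z.1‖ = 1 := by nlinarith [norm_nonneg z.1]
        exact DFunLike.congr_fun h (x, ⟨z.1, hn⟩)
      · rfl

end

/-- direction of a complex number -/
noncomputable def dir (z : ℂ) : S1 := if h : z = 0 then ⟨1, by simp⟩ else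
  ⟨z / ‖z‖, by simp [h]⟩

theorem norm_mul_dir (z : ℂ) : (‖z‖ : ℂ) * (dir z).1 = z := by
  unfold dir
  split_ifs with h
  · simp [h]
  · have : (‖z‖ : ℂ) ≠ 0 := by simpa using h
    simp only
    field_simp

theorem dir_circle (z : S1) : dir z.1 = z := by
  apply Subtype.ext
  have := norm_mul_dir z.1
  rw [z.2] at this
  simpa using this

section cone
variable {X Y : Type} [TopologicalSpace X] [CompactSpace X] [TopologicalSpace Y] [CompactSpace Y]

theorem cone_cont (h : C(X × S1, ℂ)) :
    Continuous (fun p : X × ℂ => (‖p.2‖ : ℂ) * h (p.1, dir p.2)) := by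
  rw [continuous_iff_continuousAt]
  rintro ⟨x, z⟩
  by_cases hz : z = 0
  · subst hz
    rw [ContinuousAt]
    simp only [norm_zero, Complex.ofReal_zero, zero_mul]
    refine squeeze_zero_norm (a := fun p : X × ℂ => ‖p.2‖ * ‖h‖) ?_ ?_
    · intro p
      rw [norm_mul]
      gcongr
      · simp
      · exact h.norm_coe_le_norm _
    · have : Continuous (fun p : X × ℂ => ‖p.2‖ * ‖h‖) := by fun_prop
      simpa using this.tendsto (x, 0)
  · have hd : ContinuousAt dir z := by
      rw [ContinuousAt, tendsto_subtype_rng]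
      have : ContinuousAt (fun z : ℂ => z / ‖z‖) z := by
        refine continuousAt_id.div (by fun_prop) (by simpa using hz)
      refine (this.tendsto.congr' ?_).trans_eq ?_
      · filter_upwards [isOpen_ne.mem_nhds hz] with w hw
        have hw : w ≠ 0 := hw
        simp [dir, hw]
      · simp [dir, hz]
    refine ContinuousAt.mul (by fun_prop) ?_
    have h1 : ContinuousAt (fun p : X × ℂ => (p.1, dir p.2)) (x, z) :=
      continuousAt_fst.prodMk (ContinuousAt.comp (g := dir) (f := Prod.snd) hd continuousAt_snd)
    exact (h.continuous.continuousAt).comp h1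

/-- cone of a function -/
noncomputable def cone (h : C(X × S1, ℂ)) : C(X × ℂ, ℂ) := ⟨_, cone_cont h⟩

@[simp] theorem cone_apply (h : C(X × S1, ℂ)) (x : X) (z : ℂ) :
    cone h (x, z) = (‖z‖ : ℂ) * h (x, dir z) := rfl

variable {κ κ' : Type} [Fintype κ] [DecidableEq κ] [Fintype κ'] [DecidableEq κ']

/-- units of matrices over functions on `X × S¹` -/
abbrev GLc (κ : Type) [Fintype κ] [DecidableEq κ] (X : Type) [TopologicalSpace X] : Type :=
  (Matrix κ κ C(X × S1, ℂ))ˣ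

/-- the clutched projector -/
noncomputable def eg (g : GLc κ X) : Matrix (κ ⊕ κ) (κ ⊕ κ) C(X × S2, ℂ) :=
  fromBlocks (scalar κ ⟨fun p => ((1 + p.2.1.2) / 2 : ℂ), by fun_prop⟩)
    ((↑g⁻¹ : Matrix κ κ C(X × S1, ℂ)).map (fun h => ⟨fun p => cone h (p.1, p.2.1.1) / 2, by fun_prop⟩))
    ((g : Matrix κ κ C(X × S1, ℂ)).map (fun h => ⟨fun p => cone h (p.1, p.2.1.1) / 2, by fun_prop⟩))
    (scalar κ ⟨fun p => ((1 - p.2.1.2) / 2 : ℂ), by fun_prop⟩)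

theorem eg_ev (g : GLc κ X) (x : X) (p : S2) : (eg g).map (ev (x, p)) =
    fromBlocks ((((1 + p.1.2) / 2 : ℂ)) • (1 : Matrix κ κ ℂ))
      ((‖p.1.1‖ / 2 : ℂ) • (↑g⁻¹ : Matrix κ κ C(X × S1, ℂ)).map (ev (x, dir p.1.1)))
      ((‖p.1.1‖ / 2 : ℂ) • (g : Matrix κ κ C(X × S1, ℂ)).map (ev (x, dir p.1.1)))
      (((1 - p.1.2) / 2 : ℂ) • (1 : Matrix κ κ ℂ)) := by
  rw [eg, fromBlocks_map]
  congr 1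
  · ext i j; by_cases h : i = j <;> simp [h, Matrix.one_apply, diagonal_apply]
  · ext i j; simp; ring
  · ext i j; simp; ring
  · ext i j; by_cases h : i = j <;> simp [h, Matrix.one_apply, diagonal_apply]

theorem gl_ev1 (g : GLc κ X) (y : X × S1) : (g : Matrix κ κ C(X × S1, ℂ)).map (ev y) *
    (↑g⁻¹ : Matrix κ κ C(X × S1, ℂ)).map (ev y) = 1 := by
  rw [← Matrix.map_mul, Units.mul_inv, Matrix.map_one _ (map_zero _) (map_one _)]

theorem gl_ev2 (g : GLc κ X) (y : X × S1) : (↑g⁻¹ : Matrix κ κ C(X × S1, ℂ)).map (ev y) *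
    (g : Matrix κ κ C(X × S1, ℂ)).map (ev y) = 1 := by
  rw [← Matrix.map_mul, Units.inv_mul, Matrix.map_one _ (map_zero _) (map_one _)]

theorem eg_idem (g : GLc κ X) : eg g * eg g = eg g := by
  apply mat_ext
  rintro ⟨x, p⟩
  rw [Matrix.map_mul, eg_ev]
  have hp : ((‖p.1.1‖ : ℂ)) ^ 2 + (p.1.2 : ℂ) ^ 2 = 1 := by exact_mod_cast p.2
  rw [fromBlocks_multiply]
  simp only [smul_mul_smul_comm, gl_ev1, gl_ev2, one_mul, mul_one, ← add_smul]
  congr 2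
  · linear_combination hp / 4
  · ring
  · ring
  · linear_combination hp / 4

theorem eg_clut (g : GLc κ X) : Clut (sq X) (eg g) (g : Matrix κ κ C(X × S1, ℂ)) := by
  have hne : ∀ z : Dsk, ((1 + √(1 - ‖z.1‖ ^ 2) : ℝ) : ℂ) ≠ 0 := by
    intro z
    have := Real.sqrt_nonneg (1 - ‖z.1‖ ^ 2)
    norm_cast
    positivity
  have hc : Continuous (fun p : X × Dsk => ((1 + √(1 - ‖p.2.1‖ ^ 2) : ℝ) : ℂ)) := by fun_prop
  let r : C(X × Dsk, ℂ) := ⟨fun p => ((1 + √(1 - ‖p.2.1‖ ^ 2) : ℝ) : ℂ) / 2, by fun_prop⟩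
  let c1 : C(X × S1, ℂ) → C(X × Dsk, ℂ) := fun h => ⟨fun p => cone h (p.1, p.2.1) / 2, by fun_prop⟩
  let c2 : C(X × S1, ℂ) → C(X × Dsk, ℂ) := fun h =>
    ⟨fun p => cone h (p.1, p.2.1) / ((1 + √(1 - ‖p.2.1‖ ^ 2) : ℝ) : ℂ),
      Continuous.div (by fun_prop) hc (fun p => hne p.2)⟩
  have er : ∀ (x : X) (z : Dsk), (scalar κ r).map (ev (x, z)) =
      ((((1 + √(1 - ‖z.1‖ ^ 2) : ℝ) : ℂ)) / 2) • (1 : Matrix κ κ ℂ) := by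
    intro x z
    ext i j; by_cases h : i = j <;> simp [h, Matrix.one_apply, diagonal_apply, r]
  have e1 : ∀ (M : Matrix κ κ C(X × S1, ℂ)) (x : X) (z : Dsk), (M.map c1).map (ev (x, z)) =
      (‖z.1‖ / 2 : ℂ) • M.map (ev (x, dir z.1)) := by
    intro M x z; ext i j; simp [c1]; ring
  have e2 : ∀ (M : Matrix κ κ C(X × S1, ℂ)) (x : X) (z : Dsk), (M.map c2).map (ev (x, z)) =
      (‖z.1‖ / ((1 + √(1 - ‖z.1‖ ^ 2) : ℝ) : ℂ)) • M.map (ev (x, dir z.1)) := by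
    intro M x z; ext i j; simp [c2]; ring
  have key : ∀ z : Dsk, (‖z.1‖ : ℂ) ^ 2 = ((1 + √(1 - ‖z.1‖ ^ 2) : ℝ) : ℂ) * (2 - ((1 + √(1 - ‖z.1‖ ^ 2) : ℝ) : ℂ)) := by
    intro z
    have := Real.sq_sqrt (dsk_sq z)
    norm_cast
    linarith
  have m1 : ∀ x : X × Dsk, (1 : Matrix κ κ C(X × Dsk, ℂ)).map (ev x) = 1 := fun x =>
    Matrix.map_one _ (map_zero _) (map_one _)
  refine ⟨fromRows 1 ((g : Matrix κ κ C(X × S1, ℂ)).map c2),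
    fromRows ((↑g⁻¹ : Matrix κ κ C(X × S1, ℂ)).map c2) 1,
    fromCols (scalar κ r) ((↑g⁻¹ : Matrix κ κ C(X × S1, ℂ)).map c1),
    fromCols ((g : Matrix κ κ C(X × S1, ℂ)).map c1) (scalar κ r), ?_, ?_, ?_, ?_, ?_⟩
  · apply mat_ext
    rintro ⟨x, z⟩
    have : ((eg g).map (sq X).rp).map (ev (x, z)) = (eg g).map (ev (x, jp z)) := rfl
    rw [this, eg_ev, fromRows_mul_fromCols, fromBlocks_map]
    simp only [Matrix.map_mul, er, e1, e2, smul_mul_smul_comm, gl_ev1, gl_ev2, one_mul, mul_one, m1, mul_smul_one, smul_one_mul, smul_smul]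
    congr 2
    · simp [jp]
    · have := hne z; simp only [jp, ContinuousMap.coe_mk]; field_simp
    · have := hne z; have := key z; simp only [jp, ContinuousMap.coe_mk]; field_simp; rw [this]; push_cast; ring
  · apply mat_ext
    rintro ⟨x, z⟩
    have : ((eg g).map (sq X).rm).map (ev (x, z)) = (eg g).map (ev (x, jm z)) := rfl
    rw [this, eg_ev, fromRows_mul_fromCols, fromBlocks_map]
    simp only [Matrix.map_mul, er, e1, e2, smul_mul_smul_comm, gl_ev1, gl_ev2, one_mul, mul_one, m1, mul_smul_one, smul_one_mul, smul_smul]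
    congr 2
    · have := hne z; have := key z; simp only [jm, ContinuousMap.coe_mk]; field_simp; rw [this]; push_cast; ring
    · have := hne z; simp only [jm, ContinuousMap.coe_mk]; field_simp
    · simp [jm]
  · apply mat_ext
    rintro ⟨x, z⟩
    rw [fromCols_mul_fromRows, m1, Matrix.map_add _ (by simp), Matrix.map_mul, Matrix.map_mul, er, e1, e2, m1]
    simp only [smul_mul_smul_comm, gl_ev1, gl_ev2, one_mul, mul_one, ← add_smul]
    have := hne z; have := key z
    rw [show ∀ c : ℂ, c = 1 → c • (1 : Matrix κ κ ℂ) = 1 from fun c h => by rw [h, one_smul]]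
    field_simp; rw [this]; push_cast; ring
  · apply mat_ext
    rintro ⟨x, z⟩
    rw [fromCols_mul_fromRows, m1, Matrix.map_add _ (by simp), Matrix.map_mul, Matrix.map_mul, er, e1, e2, m1]
    simp only [smul_mul_smul_comm, gl_ev1, gl_ev2, one_mul, mul_one, ← add_smul]
    have := hne z; have := key z
    rw [show ∀ c : ℂ, c = 1 → c • (1 : Matrix κ κ ℂ) = 1 from fun c h => by rw [h, one_smul]]
    field_simp; rw [this]; push_cast; ring
  · apply mat_ext
    rintro ⟨x, z⟩
    rw [← Matrix.map_mul, fromCols_mul_fromRows]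
    have : ∀ M : Matrix κ κ C(X × Dsk, ℂ), (M.map (sq X).b).map (ev (x, z)) = M.map (ev (x, bd z)) := fun _ => rfl
    rw [this, Matrix.map_add _ (by simp), Matrix.map_mul, Matrix.map_mul, er, e1, e2, m1]
    have hz : ‖(bd z).1‖ = 1 := z.2
    have hd : dir (bd z).1 = z := dir_circle z
    rw [hz, hd]
    simp only [mul_one, smul_mul_smul_comm, one_mul, ← add_smul]
    norm_num
end cone
end PK

namespace PK
open Matrix Topology
open scoped Kronecker
set_option linter.all false

section units
variable {R S : Type} [CommRing R] [CommRing S]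
variable {κ κ' : Type} [Fintype κ] [DecidableEq κ] [Fintype κ'] [DecidableEq κ']

/-- map units of matrices -/
def umap (φ : R →+* S) : (Matrix κ κ R)ˣ →* (Matrix κ κ S)ˣ := Units.map φ.mapMatrix.toMonoidHom

theorem umap_coe (φ : R →+* S) (g : (Matrix κ κ R)ˣ) :
    (umap φ g : Matrix κ κ S) = (g : Matrix κ κ R).map φ := rfl

theorem umap_inv_coe (φ : R →+* S) (g : (Matrix κ κ R)ˣ) :
    (↑(umap φ g)⁻¹ : Matrix κ κ S) = (↑g⁻¹ : Matrix κ κ R).map φ := rfl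

/-- block sum of units -/
def uadd (g : (Matrix κ κ R)ˣ) (h : (Matrix κ' κ' R)ˣ) : (Matrix (κ ⊕ κ') (κ ⊕ κ') R)ˣ where
  val := fromBlocks g 0 0 h
  inv := fromBlocks (↑g⁻¹ : Matrix κ κ R) 0 0 (↑h⁻¹ : Matrix κ' κ' R)
  val_inv := by simp [fromBlocks_multiply]
  inv_val := by simp [fromBlocks_multiply]

/-- kronecker product of units -/
def ukron (g : (Matrix κ κ R)ˣ) (h : (Matrix κ' κ' R)ˣ) : (Matrix (κ × κ') (κ × κ') R)ˣ where
  val := (g : Matrix κ κ R) ⊗ₖ (h : Matrix κ' κ' R)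
  inv := (↑g⁻¹ : Matrix κ κ R) ⊗ₖ (↑h⁻¹ : Matrix κ' κ' R)
  val_inv := by simp [← mul_kronecker_mul]
  inv_val := by simp [← mul_kronecker_mul]

/-- `1 - Q + a Q` -/
def qmat (a : R) (Q : Matrix κ κ R) : Matrix κ κ R := 1 - Q + a • Q

theorem qmat_apply (a : R) (Q : Matrix κ κ R) (i j : κ) :
    qmat a Q i j = (1 : Matrix κ κ R) i j - Q i j + a * Q i j := rfl

theorem qmat_mul {a b : R} (h : a * b = 1) {Q : Matrix κ κ R} (hQ : Q * Q = Q) :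
    qmat a Q * qmat b Q = 1 := by
  simp only [qmat, add_mul, mul_add, sub_mul, mul_sub, one_mul, mul_one, Matrix.smul_mul,
      Matrix.mul_smul, hQ, smul_smul, (mul_comm b a).trans h, one_smul]
  abel

theorem qmat_map (φ : R →+* S) (a : R) (Q : Matrix κ κ R) :
    (qmat a Q).map φ = qmat (φ a) (Q.map φ) := by
  ext i j
  by_cases h : i = j <;> simp [qmat_apply, Matrix.one_apply, h]

end units

section
variable {X Y : Type} [TopologicalSpace X] [CompactSpace X] [TopologicalSpace Y] [CompactSpace Y]
variable {κ κ' : Type} [Fintype κ] [DecidableEq κ] [Fintype κ'] [DecidableEq κ']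

theorem ev_one {Z : Type} [TopologicalSpace Z] (p : Z) :
    (1 : Matrix κ κ C(Z, ℂ)).map (ev p) = 1 := Matrix.map_one _ (map_zero _) (map_one _)

theorem ev_zero {Z : Type} [TopologicalSpace Z] (p : Z) :
    (0 : Matrix κ κ' C(Z, ℂ)).map (ev p) = 0 := Matrix.map_zero _ (map_zero _)

/-- map on first factor -/
def lft (A : Type) [TopologicalSpace A] (f : C(X, Y)) : C(X × A, Y × A) :=
  ⟨fun p => (f p.1, p.2), by fun_prop⟩

@[simp] theorem lft_apply (A : Type) [TopologicalSpace A] (f : C(X, Y)) (p : X × A) :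
    lft A f p = (f p.1, p.2) := rfl

/-- the class of the clutched bundle -/
noncomputable def cls (g : GLc κ X) : K C(X × S2, ℂ) := kcl (eg g) (eg_idem g)

theorem cls_of_clut {ι : Type} [Fintype ι] [DecidableEq ι] {e : Matrix ι ι C(X × S2, ℂ)}
    (he : e * e = e) {g : GLc κ X} (h : Clut (sq X) e (g : Matrix κ κ C(X × S1, ℂ))) :
    cls g = kcl e he := kcl_eq (Clut.iso _ (eg_clut g) h)

theorem eg_pb (f : C(X, Y)) (g : GLc κ Y) :
    (eg g).map (pb (lft S2 f)) = eg (umap (pb (lft S1 f)) g) := by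
  apply mat_ext
  rintro ⟨x, p⟩
  have : ((eg g).map (pb (lft S2 f))).map (ev (x, p)) = (eg g).map (ev (f x, p)) := rfl
  rw [this, eg_ev, eg_ev]; rfl

theorem kcl_map {A B : Type} [CommRing A] [CommRing B] (φ : A →+* B) {ι : Type} [Fintype ι]
    [DecidableEq ι] {e : Matrix ι ι A} (he : e * e = e) :
    K.map φ (kcl e he) = kcl (e.map φ) (idem_map φ he) := K.map_cl _ _

theorem kcl_congr {A : Type} [CommRing A] {ι : Type} [Fintype ι] [DecidableEq ι]
    {e f : Matrix ι ι A} {he : e * e = e} {hf : f * f = f} (h : e = f) : kcl e he = kcl f hf := by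
  subst h; rfl

theorem cls_pb (f : C(X, Y)) (g : GLc κ Y) :
    K.map (pb (lft S2 f)) (cls g) = cls (umap (pb (lft S1 f)) g) := by
  rw [cls, kcl_map, cls]
  exact kcl_congr (eg_pb f g)

theorem cls_slices (G : GLc κ (unitInterval × X)) (s t : unitInterval) :
    cls (umap (pb (lft S1 (sl s))) G) = cls (umap (pb (lft S1 (sl t))) G) := by
  rw [cls, cls]
  apply kcl_eq
  rw [← eg_pb, ← eg_pb]
  refine Iso.homotopic (eg_idem G) ⟨⟨⟨fun p => ((⟨(1 - p.1) * s + p.1 * t, ?_⟩, p.2.1), p.2.2), ?_⟩, ?_, ?_⟩⟩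
  · exact (convex_Icc (0 : ℝ) 1) s.2 t.2 (by linarith [p.1.2.2]) p.1.2.1 (by ring)
  · fun_prop
  · intro p; simp [sl]
  · intro p; simp [sl]

/-- homotopic units have the same class -/
theorem cls_hom {g h : GLc κ X} (G : unitInterval → X × S1 → Matrix κ κ ℂ)
    (hG : ∀ i j, Continuous (fun p : unitInterval × X × S1 => G p.1 p.2 i j))
    (hu : ∀ t p, (G t p).det ≠ 0)
    (h0 : ∀ p, G 0 p = (g : Matrix κ κ C(X × S1, ℂ)).map (ev p))
    (h1 : ∀ p, G 1 p = (h : Matrix κ κ C(X × S1, ℂ)).map (ev p)) : cls g = cls h := by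
  let M : Matrix κ κ C((unitInterval × X) × S1, ℂ) := Matrix.of fun i j =>
    ⟨fun p => G p.1.1 (p.1.2, p.2) i j,
      (hG i j).comp (g := fun p : unitInterval × X × S1 => G p.1 p.2 i j)
      (f := fun p : (unitInterval × X) × S1 => (p.1.1, p.1.2, p.2)) (by fun_prop)⟩
  have hM : ∀ p : (unitInterval × X) × S1, M.map (ev p) = G p.1.1 (p.1.2, p.2) := fun p => rfl
  have hMu : IsUnit M := isUnit_mat_iff.2 fun p => by rw [hM]; exact hu _ _
  obtain ⟨U, hU⟩ := hMu
  have := cls_slices U 0 1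
  have e0 : umap (pb (lft S1 (sl 0))) U = g := by
    apply Units.ext
    rw [umap_coe, hU]
    apply mat_ext
    rintro ⟨x, z⟩
    exact h0 (x, z)
  have e1 : umap (pb (lft S1 (sl 1))) U = h := by
    apply Units.ext
    rw [umap_coe, hU]
    apply mat_ext
    rintro ⟨x, z⟩
    exact h1 (x, z)
  rwa [e0, e1] at this

theorem kcl_blocks {A : Type} [CommRing A] {ι ι' : Type} [Fintype ι] [DecidableEq ι] [Fintype ι']
    [DecidableEq ι'] {e : Matrix ι ι A} {f : Matrix ι' ι' A} (he : e * e = e) (hf : f * f = f) :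
    kcl (fromBlocks e 0 0 f) (idem_blocks he hf) = kcl e he + kcl f hf := by
  rw [kcl, kcl, kcl, ← map_add, vcl_add]

theorem kcl_kron {A : Type} [CommRing A] {ι ι' : Type} [Fintype ι] [DecidableEq ι] [Fintype ι']
    [DecidableEq ι'] {e : Matrix ι ι A} {f : Matrix ι' ι' A} (he : e * e = e) (hf : f * f = f) :
    kcl (e ⊗ₖ f) (idem_kron he hf) = kcl e he * kcl f hf := by
  rw [kcl, kcl, kcl, ← map_mul, vcl_mul]

theorem kcl_one {A : Type} [CommRing A] {ι : Type} [Fintype ι] [DecidableEq ι] :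
    kcl (1 : Matrix ι ι A) (by simp) = Fintype.card ι := by
  rw [kcl, vcl_one, map_natCast]

theorem kcl_orth {A : Type} [CommRing A] {ι : Type} [Fintype ι] [DecidableEq ι] {e f : Matrix ι ι A}
    (he : e * e = e) (hf : f * f = f)
    (h1 : e * f = 0) (h2 : f * e = 0) :
    kcl (e + f) (by simp [add_mul, mul_add, *]) = kcl e he + kcl f hf := by
  rw [kcl, kcl, kcl, ← map_add, vcl_orth he hf h1 h2]

theorem kcl_compl {A : Type} [CommRing A] {ι : Type} [Fintype ι] [DecidableEq ι] {e : Matrix ι ι A}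
    (he : e * e = e) : kcl (1 - e) (idem_compl he) = Fintype.card ι - kcl e he := by
  rw [eq_sub_iff_add_eq', kcl, kcl, ← map_add, vcl_compl, map_natCast]

theorem cls_add (g : GLc κ X) (h : GLc κ' X) : cls (uadd g h) = cls g + cls h := by
  rw [cls_of_clut (idem_blocks (eg_idem g) (eg_idem h)) (g := uadd g h)
    (Clut.add _ (eg_clut g) (eg_clut h)), kcl_blocks]; rfl

theorem cls_kron (g : GLc κ X) (h : GLc κ' X) : cls (ukron g h) = cls g * cls h := by
  rw [cls_of_clut (idem_kron (eg_idem g) (eg_idem h)) (g := ukron g h)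
    (Clut.mul _ (eg_clut g) (eg_clut h)), kcl_kron]; rfl

theorem cls_ext (u : (Matrix κ κ C(X × Dsk, ℂ))ˣ) :
    cls (umap (pb (idx X bd)) u) = Fintype.card κ := by
  have h := Clut.change (sq X) (Clut.one (sq X) (κ := κ)) 1 u
  rw [inv_one, Units.val_one, Matrix.map_one _ (map_zero _) (map_one _), mul_one, mul_one] at h
  rw [cls_of_clut (by simp) (g := umap (pb (idx X bd)) u) h, kcl_one]

theorem cls_one : cls (1 : GLc κ X) = Fintype.card κ := by
  have := cls_ext (1 : (Matrix κ κ C(X × Dsk, ℂ))ˣ)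
  rwa [map_one] at this

/-- units pulled back from the base have trivial class -/
theorem cls_const (u : (Matrix κ κ C(X, ℂ))ˣ) :
    cls (umap (pb (ContinuousMap.fst : C(X × S1, X))) u) = Fintype.card κ := by
  rw [← cls_ext (umap (pb (ContinuousMap.fst : C(X × Dsk, X))) u)]
  rfl

theorem cls_reindex (g : GLc κ X) (σ : κ' ≃ κ) (h : GLc κ' X)
    (hh : (h : Matrix κ' κ' C(X × S1, ℂ)) = (g : Matrix κ κ C(X × S1, ℂ)).submatrix σ σ) :
    cls h = cls g := by
  refine cls_of_clut (eg_idem g) (g := h) ?_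
  rw [hh]
  exact Clut.conj _ (eg_clut g) σ

theorem cls_mul (g h : GLc κ X) : cls (g * h) + Fintype.card κ = cls g + cls h := by
  rw [← cls_one (X := X), ← cls_add, ← cls_add]
  let g1 : GLc (κ ⊕ κ) X := uadd g 1
  let h1 : GLc (κ ⊕ κ) X := uadd h 1
  let R : unitInterval → Matrix (κ ⊕ κ) (κ ⊕ κ) ℂ := fun t =>
    fromBlocks ((Real.cos (t * (Real.pi / 2)) : ℂ) • 1) ((-Real.sin (t * (Real.pi / 2)) : ℂ) • 1)
      ((Real.sin (t * (Real.pi / 2)) : ℂ) • 1) ((Real.cos (t * (Real.pi / 2)) : ℂ) • 1)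
  let R' : unitInterval → Matrix (κ ⊕ κ) (κ ⊕ κ) ℂ := fun t =>
    fromBlocks ((Real.cos (t * (Real.pi / 2)) : ℂ) • 1) ((Real.sin (t * (Real.pi / 2)) : ℂ) • 1)
      ((-Real.sin (t * (Real.pi / 2)) : ℂ) • 1) ((Real.cos (t * (Real.pi / 2)) : ℂ) • 1)
  have hRR : ∀ t, R t * R' t = 1 := by
    intro t
    have := Real.sin_sq_add_cos_sq (t * (Real.pi / 2))
    have hc : (Real.cos (t * (Real.pi / 2)) : ℂ) * Real.cos (t * (Real.pi / 2)) +
      (Real.sin (t * (Real.pi / 2)) : ℂ) * Real.sin (t * (Real.pi / 2)) = 1 := by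
      norm_cast; linarith
    simp only [R, R', fromBlocks_multiply, smul_mul_smul_comm, mul_one, ← add_smul]
    rw [← fromBlocks_one]
    congr 1
    · rw [neg_mul_neg, hc, one_smul]
    · rw [show ∀ a b : ℂ, a * b + -b * a = 0 by intros; ring, zero_smul]
    · rw [show ∀ a b : ℂ, b * a + a * -b = 0 by intros; ring, zero_smul]
    · rw [add_comm, hc, one_smul]
  have cR : Continuous R := by
    refine continuous_matrix ?_
    rintro (i | i) (j | j) <;> simp only [R, fromBlocks_apply₁₁, fromBlocks_apply₁₂, fromBlocks_apply₂₁, fromBlocks_apply₂₂, Matrix.smul_apply] <;> fun_prop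
  have cR' : Continuous R' := by
    refine continuous_matrix ?_
    rintro (i | i) (j | j) <;> simp only [R', fromBlocks_apply₁₁, fromBlocks_apply₁₂, fromBlocks_apply₂₁, fromBlocks_apply₂₂, Matrix.smul_apply] <;> fun_prop
  have cM : ∀ {l : Type} [Fintype l] (M : Matrix l l C(X × S1, ℂ)), Continuous (fun p => M.map (ev p)) := by
    intro l _ M
    refine continuous_matrix fun i j => ?_
    exact (M i j).continuous
  refine cls_hom (fun t p => (g1 : Matrix (κ ⊕ κ) (κ ⊕ κ) C(X × S1, ℂ)).map (ev p) * R t *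
    (h1 : Matrix (κ ⊕ κ) (κ ⊕ κ) C(X × S1, ℂ)).map (ev p) * R' t) ?_ ?_ ?_ ?_
  · intro i j
    have : Continuous (fun q : unitInterval × X × S1 =>
      (g1 : Matrix (κ ⊕ κ) (κ ⊕ κ) C(X × S1, ℂ)).map (ev q.2) * R q.1 *
    (h1 : Matrix (κ ⊕ κ) (κ ⊕ κ) C(X × S1, ℂ)).map (ev q.2) * R' q.1) := by
      refine (((((cM _).comp continuous_snd).matrix_mul (cR.comp continuous_fst)).matrix_mul
        ((cM _).comp continuous_snd)).matrix_mul (cR'.comp continuous_fst))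
    exact this.matrix_elem i j
  · intro t p
    have k1 : ((g1 : Matrix (κ ⊕ κ) (κ ⊕ κ) C(X × S1, ℂ)).map (ev p)).det ≠ 0 :=
      isUnit_mat_iff.1 g1.isUnit p
    have k2 : ((h1 : Matrix (κ ⊕ κ) (κ ⊕ κ) C(X × S1, ℂ)).map (ev p)).det ≠ 0 :=
      isUnit_mat_iff.1 h1.isUnit p
    have h3 : (R t).det * (R' t).det = 1 := by rw [← det_mul, hRR, det_one]
    rw [det_mul, det_mul, det_mul]
    refine mul_ne_zero (mul_ne_zero (mul_ne_zero k1 ?_) k2) ?_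
    · exact left_ne_zero_of_mul_eq_one h3
    · exact right_ne_zero_of_mul_eq_one h3
  · intro p
    have : R 0 = 1 := by simp [R]
    have : R' 0 = 1 := by simp [R']
    simp only [*, mul_one]
    rw [← Matrix.map_mul]
    congr 1
    simp [g1, h1, uadd, fromBlocks_multiply]
  · intro p
    have e1 : R 1 = fromBlocks 0 (-1) 1 0 := by simp [R]
    have e2 : R' 1 = fromBlocks 0 1 (-1) 0 := by simp [R']
    simp only [g1, h1, e1, e2, uadd, fromBlocks_map, fromBlocks_multiply]
    simp [ev_one, ev_zero]

/-- unipotent units have trivial class -/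
theorem cls_nil (g : GLc κ X) (n : Matrix κ κ C(X × S1, ℂ)) (hn : IsNilpotent n)
    (hg : (g : Matrix κ κ C(X × S1, ℂ)) = 1 + n) : cls g = Fintype.card κ := by
  rw [← cls_one (X := X)]
  symm
  refine cls_hom (fun t p => 1 + (t : ℂ) • n.map (ev p)) ?_ ?_ ?_ ?_
  · intro i j
    simp only [Matrix.add_apply, Matrix.smul_apply, map_apply, ev_apply]
    fun_prop
  · intro t p
    have : IsNilpotent ((t : ℂ) • n.map (ev p)) := by
      have h1 : IsNilpotent (n.map (ev p)) := hn.map (RingHom.mapMatrix (ev p))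
      obtain ⟨k, hk⟩ := h1
      exact ⟨k, by rw [smul_pow, hk, smul_zero]⟩
    have h2 := (IsNilpotent.isUnit_one_add this)
    exact ((Matrix.isUnit_iff_isUnit_det _).1 h2).ne_zero
  · intro p; simp [ev_one]
  · intro p
    rw [hg, Matrix.map_add _ (by simp)]; simp [ev_one]

/-- the coordinate on the circle -/
def zf : C(X × S1, ℂ) := ⟨fun p => p.2.1, by fun_prop⟩
/-- the inverse coordinate on the circle -/
noncomputable def zi : C(X × S1, ℂ) := ⟨fun p => p.2.1⁻¹, by
  refine Continuous.inv₀ (by fun_prop) ?_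
  intro p h
  have := p.2.2
  simp [h] at this⟩

theorem s1_ne (z : S1) : z.1 ≠ 0 := by
  intro h
  have := z.2
  simp [h] at this

@[simp] theorem zf_apply (p : X × S1) : (zf : C(X × S1, ℂ)) p = p.2.1 := rfl
@[simp] theorem zi_apply (p : X × S1) : (zi : C(X × S1, ℂ)) p = p.2.1⁻¹ := rfl

theorem zf_zi : (zf : C(X × S1, ℂ)) * zi = 1 := by
  ext p; simp [mul_inv_cancel₀ (s1_ne p.2)]

theorem zi_zf : (zi : C(X × S1, ℂ)) * zf = 1 := by
  rw [mul_comm, zf_zi]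

variable (X) in
/-- the tautological unit -/
noncomputable def zu : GLc Unit X where
  val := scalar Unit zf
  inv := scalar Unit zi
  val_inv := by rw [← map_mul, zf_zi, map_one]
  inv_val := by rw [← map_mul, zi_zf, map_one]

variable (X) in
/-- the Bott class -/
noncomputable def tt : K C(X × S2, ℂ) := cls (zu X) - 1

theorem tt_sq : tt X * tt X = 0 := by
  have h1 := cls_mul (zu X) (zu X)
  have h2 := cls_kron (zu X) (zu X)
  have h3 : cls (ukron (zu X) (zu X)) = cls (zu X * zu X) := by
    refine cls_reindex _ (Equiv.punitProd Unit) _ ?_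
    apply mat_ext
    rintro p
    ext i j
    obtain rfl : i = j := Subsingleton.elim _ _
    simp [ukron, zu]
  rw [h3] at h2
  rw [h2] at h1
  simp only [Fintype.card_unit, Nat.cast_one] at h1
  unfold tt
  linear_combination h1

theorem tt_pb (f : C(X, Y)) : K.map (pb (lft S2 f)) (tt Y) = tt X := by
  rw [tt, map_sub, map_one, cls_pb, tt]
  have : umap (pb (lft S1 f)) (zu Y) = zu X := by
    apply Units.ext
    apply mat_ext
    intro p
    ext i j
    simp [zu, umap_coe]
  rw [this]

/-- the unit `1 - Q + Q z` -/
noncomputable def qu (Q : Matrix κ κ C(X, ℂ)) (hQ : Q * Q = Q) : GLc κ X where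
  val := qmat zf (Q.map (pb ContinuousMap.fst))
  inv := qmat zi (Q.map (pb ContinuousMap.fst))
  val_inv := qmat_mul zf_zi (idem_map _ hQ)
  inv_val := qmat_mul zi_zf (idem_map _ hQ)

theorem cls_qu (Q : Matrix κ κ C(X, ℂ)) (hQ : Q * Q = Q) :
    cls (qu Q hQ) = (Fintype.card κ : K C(X × S2, ℂ)) + K.map (pb ContinuousMap.fst) (kcl Q hQ) * tt X := by
  let Q' := Q.map (pb (ContinuousMap.fst : C(X × S2, X)))
  have hQ' : Q' * Q' = Q' := idem_map _ hQ
  have i1 := idem_kron hQ' (eg_idem (zu X))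
  have i2 := idem_kron (idem_compl hQ') (eg_idem (1 : GLc Unit X))
  have o1 : (Q' ⊗ₖ eg (zu X)) * ((1 - Q') ⊗ₖ eg (1 : GLc Unit X)) = 0 := by
    rw [← mul_kronecker_mul, mul_sub, hQ', mul_one, sub_self, zero_kronecker]
  have o2 : ((1 - Q') ⊗ₖ eg (1 : GLc Unit X)) * (Q' ⊗ₖ eg (zu X)) = 0 := by
    rw [← mul_kronecker_mul, sub_mul, hQ', one_mul, sub_self, zero_kronecker]
  have key := kcl_orth i1 i2 o1 o2
  rw [kcl_kron hQ' (eg_idem (zu X)), kcl_kron (idem_compl hQ') (eg_idem (1 : GLc Unit X)),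
    kcl_compl hQ'] at key
  have e1 : kcl (eg (1 : GLc Unit X)) (eg_idem 1) = 1 := by
    have := cls_one (κ := Unit) (X := X)
    simpa [cls] using this
  have e2 : kcl (eg (zu X)) (eg_idem (zu X)) = 1 + tt X := by simp [tt, cls]
  rw [e1, e2] at key
  rw [kcl_map]
  have e3 : cls (qu Q hQ) = kcl (Q' ⊗ₖ eg (zu X) + (1 - Q') ⊗ₖ eg (1 : GLc Unit X))
      (by simp [add_mul, mul_add, i1, i2, o1, o2]) := by
    apply kcl_eq
    refine Iso.symm (Iso.of_equiv (by simp [add_mul, mul_add, i1, i2, o1, o2])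
      ((Equiv.sumCongr (Equiv.prodPUnit κ).symm (Equiv.prodPUnit κ).symm).trans
        (Equiv.prodSumDistrib κ Unit Unit).symm) ?_)
    apply mat_ext
    rintro ⟨x, p⟩
    ext i j
    have hz := norm_mul_dir p.1.1
    rcases i with i | i <;> rcases j with j | j <;>
      simp [eg, qu, qmat_apply, Q', zu, Matrix.one_apply, diagonal_apply] <;> 
      by_cases h : i = j <;> simp [h] <;> ring
  rw [e3, key]
  ring

end
end PK

namespace PK
open Matrix Topology
open scoped Kronecker
set_option linter.all false

section Pointwise
variable {ν : Type} [Fintype ν] [DecidableEq ν]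

/-- standard parametrisation of the circle -/
noncomputable def ee (v : ℝ) : S1 := ⟨Complex.exp ((2 * Real.pi * v : ℝ) * Complex.I),
  Complex.norm_exp_ofReal_mul_I _⟩

theorem ee_cont : Continuous ee := by
  unfold ee; fun_prop

theorem ee_coe (v : ℝ) : (ee v : ℂ) = Complex.exp ((2 * Real.pi * v : ℝ) * Complex.I) := rfl

theorem ee_zpow (v : ℝ) (n : ℤ) : (ee v : ℂ) ^ n =
    Complex.exp ((2 * Real.pi * (n * v) : ℝ) * Complex.I) := by
  rw [ee_coe, ← Complex.exp_int_mul]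
  congr 1; push_cast; ring

/-- the linear clutching function -/
def lm (B : Matrix ν ν ℂ) (z : ℂ) : Matrix ν ν ℂ := 1 + (z - 1) • B

/-- Fourier coefficients of the resolvent -/
noncomputable def fc (B : Matrix ν ν ℂ) (n : ℤ) : Matrix ν ν ℂ :=
  Matrix.of fun i j => ∫ v in (0:ℝ)..1, (ee v : ℂ) ^ n * (lm B (ee v))⁻¹ i j

/-- spectral projection -/
noncomputable def spr (B : Matrix ν ν ℂ) : Matrix ν ν ℂ := B * fc B 1

def Good (B : Matrix ν ν ℂ) : Prop := ∀ z : S1, (lm B z).det ≠ 0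

theorem inv_cont {Z : Type*} [TopologicalSpace Z] {M : Z → Matrix ν ν ℂ} (hM : Continuous M)
    (h : ∀ z, (M z).det ≠ 0) : Continuous fun z => (M z)⁻¹ := by
  simp only [Matrix.inv_def, Ring.inverse_eq_inv']
  exact (hM.matrix_det.inv₀ h).smul hM.matrix_adjugate

theorem lm_cont (B : Matrix ν ν ℂ) : Continuous fun v : ℝ => lm B (ee v) := by
  have := ee_cont
  unfold lm; fun_prop

theorem zp_cont (n : ℤ) : Continuous fun v : ℝ => (ee v : ℂ) ^ n := by
  have := ee_cont
  exact Continuous.zpow₀ (by fun_prop) n (fun v => Or.inl (s1_ne _))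

theorem fi_cont {B : Matrix ν ν ℂ} (hB : Good B) (n : ℤ) (i j : ν) :
    Continuous fun v : ℝ => (ee v : ℂ) ^ n * (lm B (ee v))⁻¹ i j :=
  (zp_cont n).mul ((inv_cont (lm_cont B) (fun v => hB _)).matrix_elem i j)

theorem int_zpow (n : ℤ) : (∫ v in (0:ℝ)..1, (ee v : ℂ) ^ n) = if n = 0 then 1 else 0 := by
  split_ifs with h
  · simp [h]
  · have hc : ((2 * Real.pi * n : ℝ) * Complex.I : ℂ) ≠ 0 := by
      have : (2 * Real.pi * n : ℝ) ≠ 0 := by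
        have := Real.pi_ne_zero
        have : (n:ℝ) ≠ 0 := by exact_mod_cast h
        positivity
      simpa using this
    have := integral_exp_mul_complex (a := 0) (b := 1) hc
    have e : ∀ v : ℝ, (ee v : ℂ) ^ n = Complex.exp (((2 * Real.pi * n : ℝ) * Complex.I : ℂ) * v) := by
      intro v; rw [ee_zpow]; congr 1; push_cast; ring
    simp only [e, this]
    have h1 : Complex.exp (((2 * Real.pi * n : ℝ) * Complex.I : ℂ) * (1:ℝ)) = 1 := by
      rw [← Complex.exp_int_mul_two_pi_mul_I n]; congr 1; push_cast; ring
    rw [h1]; simp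

theorem fc_mul {B : Matrix ν ν ℂ} (hB : Good B) (A : Matrix ν ν ℂ) (n : ℤ) (i j : ν) :
    (A * fc B n) i j = ∫ v in (0:ℝ)..1, (ee v : ℂ) ^ n * (A * (lm B (ee v))⁻¹) i j := by
  simp only [Matrix.mul_apply, fc, Matrix.of_apply, Finset.mul_sum]
  rw [intervalIntegral.integral_finset_sum]
  · refine Finset.sum_congr rfl fun k _ => ?_
    rw [← intervalIntegral.integral_const_mul]
    congr 1; ext v; ring
  · intro k _
    apply Continuous.intervalIntegrable
    have := (fi_cont hB n k j).const_mul (A i k)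
    refine this.congr fun v => ?_
    ring

theorem fc_mul' {B : Matrix ν ν ℂ} (hB : Good B) (A : Matrix ν ν ℂ) (n : ℤ) (i j : ν) :
    (fc B n * A) i j = ∫ v in (0:ℝ)..1, (ee v : ℂ) ^ n * ((lm B (ee v))⁻¹ * A) i j := by
  simp only [Matrix.mul_apply, fc, Matrix.of_apply, Finset.mul_sum]
  rw [intervalIntegral.integral_finset_sum]
  · refine Finset.sum_congr rfl fun k _ => ?_
    rw [← intervalIntegral.integral_mul_const]
    congr 1; ext v; ring
  · intro k _
    apply Continuous.intervalIntegrable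
    have := (fi_cont hB n i k).mul_const (A k j)
    refine this.congr fun v => ?_
    ring

theorem lm_inv {B : Matrix ν ν ℂ} (hB : Good B) (z : S1) : lm B z * (lm B z)⁻¹ = 1 :=
  Matrix.mul_nonsing_inv _ (isUnit_iff_ne_zero.2 (hB z))
theorem lm_inv' {B : Matrix ν ν ℂ} (hB : Good B) (z : S1) : (lm B z)⁻¹ * lm B z = 1 :=
  Matrix.nonsing_inv_mul _ (isUnit_iff_ne_zero.2 (hB z))

theorem comm_inv {A M : Matrix ν ν ℂ} (h : A * M = M * A) : A * M⁻¹ = M⁻¹ * A := by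
  by_cases hM : IsUnit M.det
  · calc A * M⁻¹ = M⁻¹ * M * (A * M⁻¹) := by rw [Matrix.nonsing_inv_mul _ hM, one_mul]
      _ = M⁻¹ * (A * M) * M⁻¹ := by rw [h]; simp only [mul_assoc]
      _ = M⁻¹ * A * (M * M⁻¹) := by simp only [mul_assoc]
      _ = _ := by rw [Matrix.mul_nonsing_inv _ hM, mul_one]
  · rw [Matrix.nonsing_inv_apply_not_isUnit _ hM]; simp

theorem lm_comm {A B : Matrix ν ν ℂ} (h : A * B = B * A) (z : ℂ) : A * lm B z = lm B z * A := by
  simp [lm, mul_add, add_mul, h]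

theorem fc_comm {A B : Matrix ν ν ℂ} (hB : Good B) (h : A * B = B * A) (n : ℤ) :
    A * fc B n = fc B n * A := by
  ext i j
  rw [fc_mul hB, fc_mul' hB]
  simp only [comm_inv (lm_comm h _)]

theorem fc_rec {B : Matrix ν ν ℂ} (hB : Good B) (n : ℤ) :
    (1 - B) * fc B n + B * fc B (n+1) = if n = 0 then 1 else 0 := by
  ext i j
  rw [Matrix.add_apply, fc_mul hB, fc_mul hB, ← intervalIntegral.integral_add]
  · have : ∀ v : ℝ, (ee v : ℂ) ^ n * ((1-B) * (lm B (ee v))⁻¹) i j +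
        (ee v : ℂ) ^ (n+1) * (B * (lm B (ee v))⁻¹) i j = (ee v : ℂ) ^ n * (1 : Matrix ν ν ℂ) i j := by
      intro v
      have hh := lm_inv hB (ee v)
      generalize (lm B (ee v))⁻¹ = W at hh ⊢
      have h2 := congrFun (congrFun hh i) j
      rw [← h2, zpow_add_one₀ (s1_ne _), mul_assoc, ← mul_add]
      congr 1
      rw [lm]
      simp only [add_mul, sub_mul, one_mul, Matrix.add_apply, Matrix.sub_apply, Matrix.smul_mul,
        Matrix.smul_apply, smul_eq_mul]
      ring
    simp only [this]
    rw [intervalIntegral.integral_mul_const, int_zpow]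
    split_ifs <;> simp
  all_goals
    apply Continuous.intervalIntegrable
    refine (zp_cont _).mul (Continuous.matrix_elem ?_ i j)
    exact continuous_const.matrix_mul (inv_cont (lm_cont B) (fun v => hB _))

theorem fc_tendsto (B : Matrix ν ν ℂ) (l : ℕ → ℤ) (hl : Filter.Tendsto (fun n => |(l n : ℝ)|) Filter.atTop Filter.atTop) :
    Filter.Tendsto (fun k => fc B (l k)) Filter.atTop (𝓝 0) := by
  refine tendsto_pi_nhds.2 fun i => tendsto_pi_nhds.2 fun j => ?_
  have h := Real.tendsto_integral_exp_smul_cocompact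
    ((Set.Ioc (0:ℝ) 1).indicator fun v => (lm B (ee v))⁻¹ i j)
  have hl' : Filter.Tendsto (fun k => -(l k : ℝ)) Filter.atTop (Filter.cocompact ℝ) := by
    rw [← Metric.cobounded_eq_cocompact, ← comap_norm_atTop, Filter.tendsto_comap_iff]
    refine hl.congr fun k => ?_
    simp
  refine (h.comp hl').congr fun k => ?_
  simp only [Function.comp, fc, Matrix.of_apply]
  rw [intervalIntegral.integral_of_le zero_le_one, ← MeasureTheory.integral_indicator measurableSet_Ioc]
  congr 1
  ext v
  by_cases hv : v ∈ Set.Ioc (0:ℝ) 1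
  · simp only [Set.indicator_of_mem hv]
    rw [ee_zpow, Circle.smul_def, Real.fourierChar_apply, smul_eq_mul]
    congr 2; push_cast; ring
  · simp only [Set.indicator_of_notMem hv, smul_zero]

theorem spr_compl {B : Matrix ν ν ℂ} (hB : Good B) : 1 - spr B = (1 - B) * fc B 0 := by
  have := fc_rec hB 0
  rw [if_pos rfl, zero_add] at this
  rw [spr, sub_eq_iff_eq_add, this]

theorem tend_nat : Filter.Tendsto (fun n : ℕ => |(((n:ℤ)+1 : ℤ) : ℝ)|) Filter.atTop Filter.atTop := by
  refine Filter.tendsto_atTop_mono (fun n => ?_) tendsto_natCast_atTop_atTop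
  push_cast
  exact le_trans (by linarith) (le_abs_self _)
theorem tend_nat' : Filter.Tendsto (fun n : ℕ => |((-(n:ℤ) : ℤ) : ℝ)|) Filter.atTop Filter.atTop := by
  refine Filter.tendsto_atTop_mono (fun n => ?_) tendsto_natCast_atTop_atTop
  push_cast
  rw [abs_neg]; exact (le_abs_self _)

theorem spr_idem {B : Matrix ν ν ℂ} (hB : Good B) : spr B * spr B = spr B := by
  have key : ∀ k : ℕ, spr B * (1 - spr B) = B * fc B ((k:ℤ)+1) * ((1 - B) * fc B (-(k:ℤ))) := by
    intro k
    induction k with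
    | zero => rw [spr_compl hB]; simp [spr]
    | succ k ih =>
      rw [ih]
      have h1 := fc_rec hB ((k:ℤ)+1)
      have h2 := fc_rec hB (-(k:ℤ)-1)
      rw [if_neg (by omega)] at h1 h2
      rw [show -(k:ℤ)-1+1 = -k by ring] at h2
      push_cast
      rw [show -((k:ℤ)+1) = -k-1 by ring]
      have h1' := eq_neg_of_add_eq_zero_left h1
      have h2' := eq_neg_of_add_eq_zero_right h2
      have c1 : B * fc B ((k:ℤ)+1) = fc B ((k:ℤ)+1) * B := fc_comm hB rfl _
      have c2 : (1-B) * fc B ((k:ℤ)+1) = fc B ((k:ℤ)+1) * (1-B) := fc_comm hB (by noncomm_ring) _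
      calc _ = fc B ((k:ℤ)+1) * (B * (1-B)) * fc B (-(k:ℤ)) := by rw [c1]; simp only [mul_assoc]
        _ = fc B ((k:ℤ)+1) * (1-B) * (B * fc B (-(k:ℤ))) := by
          rw [show B * (1-B) = (1-B)*B by noncomm_ring]; simp only [mul_assoc]
        _ = _ := by rw [← c2, h1', h2']; simp
  have lim : Filter.Tendsto (fun k : ℕ => B * fc B ((k:ℤ)+1) * ((1 - B) * fc B (-(k:ℤ))))
      Filter.atTop (𝓝 (B * 0 * ((1-B)*0))) := by
    have t1 := fc_tendsto B (fun k => (k:ℤ)+1) tend_nat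
    have t2 := fc_tendsto B (fun k => -(k:ℤ)) tend_nat'
    exact (t1.const_mul B).mul (t2.const_mul (1-B))
  have : spr B * (1 - spr B) = 0 := by
    have := tendsto_nhds_unique (lim.congr fun k => (key k).symm) tendsto_const_nhds
    simpa using this.symm
  rw [mul_sub, mul_one, sub_eq_zero] at this
  exact this.symm

theorem good_re {μ z : ℂ} (hz : ‖z‖ = 1) (h : 1 + (z-1)*μ = 0) : μ.re = 1/2 := by
  have h1 : z * μ = μ - 1 := by linear_combination h
  have h2 : ‖μ‖ = ‖μ - 1‖ := by rw [← h1, norm_mul, hz, one_mul]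
  have h3 : Complex.normSq μ = Complex.normSq (μ-1) := by
    rw [Complex.normSq_eq_norm_sq, Complex.normSq_eq_norm_sq, h2]
  simp [Complex.normSq_apply] at h3
  linarith

theorem re_good {μ : ℂ} (h : μ.re = 1/2) : ∃ z : S1, 1 + ((z:ℂ)-1)*μ = 0 := by
  have h0 : μ ≠ 0 := by rintro rfl; norm_num at h
  refine ⟨⟨(μ-1)/μ, ?_⟩, ?_⟩
  · rw [norm_div, div_eq_one_iff_eq (by simpa using h0)]
    have : Complex.normSq μ = Complex.normSq (μ-1) := by
      simp [Complex.normSq_apply, h]; ring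
    rw [Complex.normSq_eq_norm_sq, Complex.normSq_eq_norm_sq] at this
    exact ((sq_eq_sq₀ (norm_nonneg _) (norm_nonneg _)).1 this).symm
  · field_simp; ring

theorem geom_zero {E : Type*} [NormedAddCommGroup E] [NormedSpace ℂ E] {x : ℕ → E} {r : ℂ}
    (hr : ‖r‖ ≤ 1) (hx : Filter.Tendsto x Filter.atTop (𝓝 0)) (h : ∀ k, x k = r • x (k+1)) : x 0 = 0 := by
  have : ∀ k, ‖x 0‖ ≤ ‖x k‖ := by
    intro k
    induction k with
    | zero => rfl
    | succ k ih =>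
      refine ih.trans ?_
      rw [h k, norm_smul]
      exact mul_le_of_le_one_left (norm_nonneg _) hr
  have := ge_of_tendsto' hx.norm this
  simpa using this

theorem spr_eig {B : Matrix ν ν ℂ} (hB : Good B) {μ : ℂ} {v : ν → ℂ} (hv : v ≠ 0)
    (h : B *ᵥ v = μ • v) :
    (μ.re < 1/2 ∧ spr B *ᵥ v = 0) ∨ (1/2 < μ.re ∧ spr B *ᵥ v = v) := by
  have hrec : ∀ n : ℤ, n ≠ 0 → (1-μ) • (fc B n *ᵥ v) = - (μ • (fc B (n+1) *ᵥ v)) := by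
    intro n hn
    have := congrArg (· *ᵥ v) (fc_rec hB n)
    simp only [if_neg hn, Matrix.add_mulVec, Matrix.zero_mulVec] at this
    rw [fc_comm hB (A := B) rfl, fc_comm hB (A := 1-B) (by noncomm_ring), ← Matrix.mulVec_mulVec,
      ← Matrix.mulVec_mulVec, Matrix.sub_mulVec, h, Matrix.one_mulVec, Matrix.mulVec_smul,
      Matrix.mulVec_sub, Matrix.mulVec_smul] at this
    rw [← eq_neg_iff_add_eq_zero] at this
    rw [← this, sub_smul, one_smul]
  have tend : ∀ l : ℕ → ℤ, Filter.Tendsto (fun n => |(l n : ℝ)|) Filter.atTop Filter.atTop →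
      Filter.Tendsto (fun k => fc B (l k) *ᵥ v) Filter.atTop (𝓝 0) := by
    intro l hl
    have := ((Continuous.matrix_mulVec continuous_id (continuous_const (y := v))).tendsto
      (0 : Matrix ν ν ℂ)).comp (fc_tendsto B l hl)
    simpa [Function.comp_def] using this
  have P1 : spr B *ᵥ v = μ • (fc B 1 *ᵥ v) := by
    rw [spr, fc_comm hB (A := B) rfl, ← Matrix.mulVec_mulVec, h, Matrix.mulVec_smul]
  have P2 : v - spr B *ᵥ v = (1-μ) • (fc B 0 *ᵥ v) := by
    have : (1 - spr B) *ᵥ v = v - spr B *ᵥ v := by rw [Matrix.sub_mulVec, Matrix.one_mulVec]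
    rw [← this, spr_compl hB, fc_comm hB (A := 1-B) (by noncomm_ring), ← Matrix.mulVec_mulVec,
       Matrix.sub_mulVec, h, Matrix.one_mulVec, Matrix.mulVec_sub, Matrix.mulVec_smul, sub_smul, one_smul]
  have nsq : ∀ a b : ℂ, Complex.normSq a ≤ Complex.normSq b → ‖a‖ ≤ ‖b‖ := by
    intro a b hab
    rw [Complex.normSq_eq_norm_sq, Complex.normSq_eq_norm_sq] at hab
    exact (sq_le_sq₀ (norm_nonneg _) (norm_nonneg _)).1 hab
  rcases lt_trichotomy μ.re (1/2) with hμ | hμ | hμ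
  · left
    refine ⟨hμ, ?_⟩
    have h1 : 1 - μ ≠ 0 := by
      intro h0
      have := congrArg Complex.re h0
      simp at this; linarith
    have : fc B (((0:ℕ):ℤ)+1) *ᵥ v = 0 := by
      refine geom_zero (x := fun k : ℕ => fc B ((k:ℤ)+1) *ᵥ v) (r := -(μ/(1-μ))) ?_ (tend _ tend_nat) ?_
      · rw [norm_neg, norm_div]
        refine div_le_one_of_le₀ (nsq _ _ ?_) (norm_nonneg _)
        simp [Complex.normSq_apply]; nlinarith
      · intro k
        have := hrec ((k:ℤ)+1) (by omega)
        push_cast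
        rw [neg_smul, div_eq_inv_mul, ← smul_smul, ← smul_neg, ← this, smul_smul, inv_mul_cancel₀ h1, one_smul]
    rw [P1]
    simp only [Nat.cast_zero, zero_add] at this
    rw [this, smul_zero]
  · obtain ⟨z, hz⟩ := re_good hμ
    exfalso
    refine hB z (Matrix.exists_mulVec_eq_zero_iff.1 ⟨v, hv, ?_⟩)
    rw [lm, Matrix.add_mulVec, Matrix.one_mulVec, Matrix.smul_mulVec, h, smul_smul]
    conv_lhs => enter [1]; rw [← one_smul ℂ v]
    rw [← add_smul, hz, zero_smul]
  · right
    refine ⟨hμ, ?_⟩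
    have h1 : μ ≠ 0 := by
      rintro rfl
      simp at hμ; linarith
    have : fc B (-((0:ℕ):ℤ)) *ᵥ v = 0 := by
      refine geom_zero (x := fun k : ℕ => fc B (-(k:ℤ)) *ᵥ v) (r := -((1-μ)/μ)) ?_ (tend _ tend_nat') ?_
      · rw [norm_neg, norm_div]
        refine div_le_one_of_le₀ (nsq _ _ ?_) (norm_nonneg _)
        simp [Complex.normSq_apply]; nlinarith
      · intro k
        have := hrec (-((k:ℤ)+1)) (by omega)
        rw [show -((k:ℤ)+1)+1 = -k by ring] at this
        push_cast
        rw [neg_smul, div_eq_inv_mul, ← smul_smul, this, smul_neg, neg_neg, smul_smul, inv_mul_cancel₀ h1, one_smul]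
    simp only [Nat.cast_zero, neg_zero] at this
    rw [this, smul_zero, sub_eq_zero] at P2
    exact P2.symm

theorem spr_comm {B : Matrix ν ν ℂ} (hB : Good B) : B * spr B = spr B * B := by
  rw [spr, mul_assoc, fc_comm hB rfl]

/-- common eigenvector -/
theorem exists_eig {B M : Matrix ν ν ℂ} (h : B * M = M * B) (hM : M.det = 0) :
    ∃ v : ν → ℂ, v ≠ 0 ∧ M *ᵥ v = 0 ∧ ∃ μ : ℂ, B *ᵥ v = μ • v := by
  obtain ⟨v0, hv0, hMv0⟩ := Matrix.exists_mulVec_eq_zero_iff.2 hM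
  let Ks : Submodule ℂ (ν → ℂ) := LinearMap.ker (Matrix.mulVecLin M)
  have hv0' : v0 ∈ Ks := hMv0
  haveI : Nontrivial Ks := ⟨⟨⟨v0, hv0'⟩, 0, fun h => hv0 (congrArg Subtype.val h)⟩⟩
  have hinv : ∀ x ∈ Ks, Matrix.mulVecLin B x ∈ Ks := by
    intro x hx
    have hx' : M *ᵥ x = 0 := hx
    change M *ᵥ (B *ᵥ x) = 0
    rw [Matrix.mulVec_mulVec, ← h, ← Matrix.mulVec_mulVec, hx', Matrix.mulVec_zero]
  obtain ⟨μ, hμ⟩ := Module.End.exists_eigenvalue ((Matrix.mulVecLin B).restrict hinv)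
  obtain ⟨w, hw⟩ := hμ.exists_hasEigenvector
  refine ⟨w.1, fun h0 => hw.2 (Subtype.ext h0), w.2, μ, ?_⟩
  exact congrArg Subtype.val hw.apply_eq_smul

theorem spr_hom {B : Matrix ν ν ℂ} (hB : Good B) (s : unitInterval) (z : S1) :
    (lm ((1 - (s:ℝ) : ℂ) • B + (s:ℝ) • spr B) z).det ≠ 0 := by
  intro h0
  have hc : B * lm ((1 - (s:ℝ) : ℂ) • B + (s:ℝ) • spr B) z = lm ((1 - (s:ℝ) : ℂ) • B + (s:ℝ) • spr B) z * B := by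
    apply lm_comm
    simp [mul_add, add_mul, spr_comm hB]
  obtain ⟨v, hv, hMv, μ, hμ⟩ := exists_eig hc h0
  have s0 := s.2.1
  have s1 := s.2.2
  have fin : ∀ σ : ℝ, spr B *ᵥ v = (σ:ℂ) • v → ((1 - (s:ℝ)) * μ.re + s * σ ≠ 1/2) → False := by
    intro σ hσ hne
    have : (1 + ((z:ℂ)-1)*((1 - (s:ℝ)) * μ + (s:ℝ) * (σ:ℝ))) • v = 0 := by
      rw [← hMv, lm, Matrix.add_mulVec, Matrix.one_mulVec, Matrix.smul_mulVec, Matrix.add_mulVec, 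
        Matrix.smul_mulVec, Matrix.smul_mulVec, hμ, hσ]
      ext i; simp; ring
    rcases smul_eq_zero.1 this with h | h
    · have := good_re z.2 h
      apply hne
      rw [← this]; simp
    · exact hv h
  rcases spr_eig hB hv hμ with ⟨h1, h2⟩ | ⟨h1, h2⟩
  · refine fin 0 (by simp [h2]) ?_
    rcases s0.eq_or_lt with h | h
    · rw [← h]; intro h; linarith
    · nlinarith
  · refine fin 1 (by simp [h2]) ?_
    rcases s0.eq_or_lt with h | h
    · rw [← h]; intro h; linarith
    · nlinarith

end Pointwise

section Global
variable {Y : Type} [TopologicalSpace Y] [CompactSpace Y]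
variable {ν : Type} [Fintype ν] [DecidableEq ν]

theorem mat_cont {Z : Type} [TopologicalSpace Z] {ι ι' : Type} (M : Matrix ι ι' C(Z, ℂ)) :
    Continuous fun z : Z => M.map (ev z) :=
  continuous_matrix fun i j => (M i j).continuous

theorem fc_cont {M : Y → Matrix ν ν ℂ} (hM : Continuous M) (h : ∀ y, Good (M y)) (n : ℤ) :
    Continuous fun y => fc (M y) n := by
  refine continuous_matrix fun i j => ?_
  simp only [fc, Matrix.of_apply]
  have hl : Continuous fun p : Y × ℝ => lm (M p.1) (ee p.2) := by
    have := ee_cont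
    unfold lm; fun_prop
  have hi := (inv_cont hl (fun p => h p.1 _)).matrix_elem i j
  have : Continuous fun p : Y × ℝ => (ee p.2 : ℂ) ^ n * (lm (M p.1) (ee p.2))⁻¹ i j :=
    ((zp_cont n).comp continuous_snd).mul hi
  exact intervalIntegral.continuous_parametric_intervalIntegral_of_continuous' this 0 1

def GoodC (B : Matrix ν ν C(Y, ℂ)) : Prop := ∀ y, Good (B.map (ev y))

/-- the spectral projection of a family -/
noncomputable def sprC (B : Matrix ν ν C(Y, ℂ)) (hB : GoodC B) : Matrix ν ν C(Y, ℂ) :=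
  Matrix.of fun i j => ⟨fun y => spr (B.map (ev y)) i j, by
    refine Continuous.matrix_elem ?_ i j
    exact (mat_cont B).matrix_mul (fc_cont (mat_cont B) hB 1)⟩

theorem sprC_ev (B : Matrix ν ν C(Y, ℂ)) (hB : GoodC B) (y : Y) :
    (sprC B hB).map (ev y) = spr (B.map (ev y)) := rfl

theorem sprC_idem (B : Matrix ν ν C(Y, ℂ)) (hB : GoodC B) : sprC B hB * sprC B hB = sprC B hB := by
  apply mat_ext
  intro y
  rw [Matrix.map_mul, sprC_ev, spr_idem (hB y)]

theorem exists_glc {Z : Type} [TopologicalSpace Z] [CompactSpace Z] (M : Matrix ν ν C(Z × S1, ℂ))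
    (h : ∀ p, (M.map (ev p)).det ≠ 0) : ∃ g : GLc ν Z, (g : Matrix ν ν C(Z × S1, ℂ)) = M := by
  have : IsUnit M := isUnit_mat_iff.2 h
  exact ⟨this.unit, rfl⟩

/-- class of a linear clutching function -/
theorem cls_lin (B : Matrix ν ν C(Y, ℂ)) (hB : GoodC B) (g : GLc ν Y)
    (hg : ∀ y z, (g : Matrix ν ν C(Y × S1, ℂ)).map (ev (y, z)) = lm (B.map (ev y)) z) :
    cls g = (Fintype.card ν : K C(Y × S2, ℂ)) +
      K.map (pb ContinuousMap.fst) (kcl (sprC B hB) (sprC_idem B hB)) * tt Y := by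
  rw [← cls_qu]
  refine cls_hom (fun s p => lm ((1 - (s:ℝ) : ℂ) • B.map (ev p.1) + (s:ℝ) • spr (B.map (ev p.1))) p.2)
    ?_ ?_ ?_ ?_
  · intro i j
    refine Continuous.matrix_elem ?_ i j
    have h1 := mat_cont B
    have h2 : Continuous fun y => spr (B.map (ev y)) := mat_cont (sprC B hB)
    unfold lm
    have h3 : Continuous fun p : unitInterval × Y × S1 => B.map (ev p.2.1) := h1.comp (by fun_prop)
    have h4 : Continuous fun p : unitInterval × Y × S1 => spr (B.map (ev p.2.1)) := h2.comp (by fun_prop)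
    fun_prop
  · intro t p
    exact spr_hom (hB p.1) t p.2
  · rintro ⟨y, z⟩
    simp [hg]
  · rintro ⟨y, z⟩
    ext i j
    simp [qu, qmat_apply, lm, Matrix.one_apply, ← sprC_ev B hB]
    split_ifs <;> simp <;> ring

end Global

end PK

namespace PK
open Matrix Topology
open scoped Kronecker
set_option linter.all false

section Comp
variable {κ : Type} [Fintype κ] [DecidableEq κ] {d : ℕ}

/-- companion matrix -/
def Bc {R : Type*} [Ring R] (c : Fin (d+1) → Matrix κ κ R) : Matrix (Fin (d+1) × κ) (Fin (d+1) × κ) R :=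
  Matrix.of fun p q => (if p.1 = 0 then c q.1 p.2 q.2 else 0) -
    (if (p.1:ℕ) = q.1 + 1 ∧ p.2 = q.2 then 1 else 0)

def Hc (a : Fin (d+1) → Matrix κ κ ℂ) (b : ℂ) : Matrix (Fin (d+1) × κ) (Fin (d+1) × κ) ℂ :=
  Matrix.of fun p q => (1 : Matrix (Fin (d+1) × κ) (Fin (d+1) × κ) ℂ) p q +
    (if p.1 = 0 then a q.1 p.2 q.2 else 0) - (if (p.1:ℕ) = q.1 + 1 ∧ p.2 = q.2 then b else 0)

theorem lm_Bc (c : Fin (d+1) → Matrix κ κ ℂ) (z : ℂ) :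
    lm (Bc c) z = Hc (fun j => (z-1) • c j) (z-1) := by
  ext p q
  simp only [lm, Bc, Hc, Matrix.add_apply, Matrix.smul_apply, Matrix.of_apply, smul_eq_mul, mul_sub,
    mul_ite, mul_zero, mul_one]
  ring

theorem Bc_map {R S : Type*} [Ring R] [Ring S] (φ : R →+* S) (c : Fin (d+1) → Matrix κ κ R) :
    (Bc c).map φ = Bc (fun j => (c j).map φ) := by
  ext p q
  simp only [Bc, Matrix.of_apply, Matrix.map_apply, map_sub]
  split_ifs <;> simp

theorem sh_cond (i : Fin d) (k : κ) (q : Fin (d+1) × κ) :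
    ((i.succ : Fin (d+1)).val = q.1.val + 1 ∧ k = q.2) ↔ (i.castSucc, k) = q := by
  constructor
  · rintro ⟨h1, h2⟩
    refine Prod.ext (Fin.ext ?_) h2
    simpa using h1
  · rintro rfl
    simp

theorem Hc_succ (a : Fin (d+1) → Matrix κ κ ℂ) (b : ℂ) (v : Fin (d+1) × κ → ℂ) (i : Fin d) (k : κ) :
    (Hc a b *ᵥ v) (i.succ, k) = v (i.succ, k) - b * v (i.castSucc, k) := by
  simp only [Matrix.mulVec, dotProduct, Hc, Matrix.of_apply, Fin.succ_ne_zero, if_false, add_zero,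
    sub_mul, Finset.sum_sub_distrib, sh_cond, Matrix.one_apply, ite_mul, one_mul, zero_mul,
    Finset.sum_ite_eq, Finset.mem_univ, if_true]

theorem Hc_zero (a : Fin (d+1) → Matrix κ κ ℂ) (b : ℂ) (v : Fin (d+1) × κ → ℂ) (k : κ) :
    (Hc a b *ᵥ v) (0, k) = v (0, k) + ∑ j, (a j *ᵥ fun l => v (j, l)) k := by
  simp only [Matrix.mulVec, dotProduct, Hc, Matrix.of_apply, if_true, add_mul, sub_mul,
    Finset.sum_add_distrib, Finset.sum_sub_distrib, Matrix.one_apply, ite_mul, one_mul, zero_mul,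
    Finset.sum_ite_eq, Finset.mem_univ, Fintype.sum_prod_type]
  simp

theorem Hc_det (a : Fin (d+1) → Matrix κ κ ℂ) (b : ℂ)
    (h : (1 + ∑ j : Fin (d+1), b ^ (j:ℕ) • a j).det ≠ 0) : (Hc a b).det ≠ 0 := by
  intro h0
  obtain ⟨v, hv, hH⟩ := Matrix.exists_mulVec_eq_zero_iff.2 h0
  have hs : ∀ (i : Fin (d+1)) k, v (i, k) = b ^ (i:ℕ) * v (0, k) := by
    intro i
    induction i using Fin.induction with
    | zero => simp
    | succ i ih =>
      intro k
      have := congrFun hH (i.succ, k)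
      rw [Hc_succ, Pi.zero_apply, sub_eq_zero] at this
      rw [this, ih k]
      simp [pow_succ]; ring
  have hz : (1 + ∑ j : Fin (d+1), b ^ (j:ℕ) • a j) *ᵥ (fun l => v (0, l)) = 0 := by
    ext k
    have := congrFun hH (0, k)
    rw [Hc_zero, Pi.zero_apply] at this
    rw [Pi.zero_apply]
    rw [← this, Matrix.add_mulVec, Matrix.one_mulVec, Matrix.sum_mulVec, Pi.add_apply, Finset.sum_apply]
    congr 1
    refine Finset.sum_congr rfl fun j _ => ?_
    have e : (fun l => v (j, l)) = b ^ (j:ℕ) • (fun l => v (0, l)) := by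
      ext l; rw [hs]; rfl
    rw [e, Matrix.mulVec_smul, Matrix.smul_mulVec]
  refine h (Matrix.exists_mulVec_eq_zero_iff.1 ⟨_, ?_, hz⟩)
  intro h1
  apply hv
  ext ⟨i, k⟩
  rw [hs i k]
  have := congrFun h1 k
  simp only [Pi.zero_apply] at this
  rw [this, mul_zero, Pi.zero_apply]

/-- normalised polynomial -/
noncomputable def pw (c : Fin (d+1) → Matrix κ κ ℂ) (w : ℂ) : Matrix κ κ ℂ :=
  1 + ∑ j : Fin (d+1), w ^ ((j:ℕ)+1) • c j

theorem Bc_good {c : Fin (d+1) → Matrix κ κ ℂ} (h : ∀ z : S1, (pw c (z-1)).det ≠ 0) : Good (Bc c) := by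
  intro z
  rw [lm_Bc]
  apply Hc_det
  refine fun h0 => h z ?_
  rw [← h0, pw]
  simp only [smul_smul, pow_succ]

variable {Y : Type} [TopologicalSpace Y] [CompactSpace Y]

theorem Hc_cont {Z : Type*} [TopologicalSpace Z] {a : Z → Fin (d+1) → Matrix κ κ ℂ} {b : Z → ℂ}
    (ha : ∀ j, Continuous fun z => a z j) (hb : Continuous b) : Continuous fun z => Hc (a z) (b z) := by
  refine continuous_matrix fun p q => ?_
  simp only [Hc, Matrix.of_apply]
  have := (ha q.1).matrix_elem p.2 q.2
  refine Continuous.sub (Continuous.add continuous_const ?_) ?_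
  · split_ifs
    · exact this
    · exact continuous_const
  · split_ifs
    · exact hb
    · exact continuous_const

theorem pw_cont (c : Fin (d+1) → Matrix κ κ C(Y, ℂ)) :
    Continuous fun p : Y × S1 => ∑ j : Fin (d+1), ((p.2:ℂ)-1) ^ ((j:ℕ)+1) • (c j).map (ev p.1) := by
  refine continuous_finsetSum _ fun j _ => ?_
  have h : Continuous fun p : Y × S1 => ((p.2:ℂ)-1) ^ ((j:ℕ)+1) := by fun_prop
  exact h.smul ((mat_cont (c j)).comp continuous_fst)

/-- class of polynomial clutching -/
theorem cls_poly (c : Fin (d+1) → Matrix κ κ C(Y, ℂ)) (g : GLc κ Y)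
    (hg : ∀ y z, (g : Matrix κ κ C(Y × S1, ℂ)).map (ev (y, z)) = pw (fun j => (c j).map (ev y)) ((z:ℂ)-1)) :
    ∃ x : K C(Y, ℂ), cls g = (Fintype.card κ : K C(Y × S2, ℂ)) + K.map (pb ContinuousMap.fst) x * tt Y := by
  have hu : ∀ y z, (pw (fun j => (c j).map (ev y)) ((z:S1)-1 : ℂ)).det ≠ 0 := by
    intro y z
    rw [← hg]
    exact isUnit_mat_iff.1 g.isUnit (y, z)
  have hB : GoodC (Bc c) := by
    intro y
    rw [Bc_map]
    exact Bc_good (hu y)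
  have hlm : ∀ (y : Y) (z : S1), lm ((Bc c).map (ev y)) z =
      Hc (fun j => ((z:ℂ)-1) • (c j).map (ev y)) ((z:ℂ)-1) := by
    intro y z
    rw [Bc_map, lm_Bc]
  let mk : (a : Y × S1 → Fin (d+1) → Matrix κ κ ℂ) → (b : Y × S1 → ℂ) →
      (∀ j, Continuous fun z => a z j) → Continuous b →
      Matrix (Fin (d+1) × κ) (Fin (d+1) × κ) C(Y × S1, ℂ) := fun a b ha hb =>
    Matrix.of fun i j => ⟨fun p => Hc (a p) (b p) i j, (Hc_cont ha hb).matrix_elem i j⟩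
  have hmk : ∀ a b ha hb p, (mk a b ha hb).map (ev p) = Hc (a p) (b p) := fun _ _ _ _ _ => rfl
  have hc1 : ∀ j, Continuous fun p : Y × S1 => ((p.2:ℂ)-1) • (c j).map (ev p.1) := fun j =>
    Continuous.smul (f := fun p : Y × S1 => (p.2:ℂ)-1) (by fun_prop) ((mat_cont (c j)).comp continuous_fst)
  let S : Y × S1 → Matrix κ κ ℂ := fun p => ∑ j : Fin (d+1), ((p.2:ℂ)-1) ^ ((j:ℕ)+1) • (c j).map (ev p.1)
  have hS : Continuous S := pw_cont c
  let A : Y × S1 → Fin (d+1) → Matrix κ κ ℂ := fun p j => if j = 0 then S p else 0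
  have hA : ∀ j, Continuous fun p => A p j := by
    intro j
    by_cases h : j = 0
    · simp only [A, h, if_true]; exact hS
    · simp only [A, h, if_false]; exact continuous_const
  have hb : Continuous fun p : Y × S1 => (p.2 : ℂ) - 1 := by fun_prop
  have hsum : ∀ (b : ℂ) p, ∑ j : Fin (d+1), b ^ (j:ℕ) • A p j = S p := by
    intro b p
    simp [A]
  have hsum1 : ∀ p : Y × S1, ∑ j : Fin (d+1), ((p.2:ℂ) - 1) ^ (j:ℕ) • (((p.2:ℂ)-1) • (c j).map (ev p.1)) = S p := by
    intro p
    simp only [S, smul_smul, pow_succ]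
  have hSu : ∀ p : Y × S1, (1 + S p).det ≠ 0 := fun p => hu p.1 p.2
  obtain ⟨g1, hg1⟩ := exists_glc (mk _ _ hc1 hb) (by
    intro p
    rw [hmk _ _ hc1 hb]
    apply Hc_det
    rw [hsum1]; exact hSu p)
  obtain ⟨g2, hg2⟩ := exists_glc (mk A _ hA hb) (by
    intro p
    rw [hmk _ _ hA hb]
    apply Hc_det
    rw [hsum]; exact hSu p)
  obtain ⟨g3, hg3⟩ := exists_glc (mk A (fun _ => 0) hA continuous_const) (by
    intro p
    rw [hmk _ _ hA continuous_const]
    apply Hc_det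
    rw [hsum]; exact hSu p)
  have e1 := cls_lin (Bc c) hB g1 (by intro y z; rw [hlm, hg1, hmk _ _ hc1 hb])
  have e2 : cls g1 = cls g2 := by
    refine cls_hom (fun s p => Hc (fun j => (1 - (s:ℝ) : ℂ) • (((p.2:ℂ)-1) • (c j).map (ev p.1)) + ((s:ℝ):ℂ) • A p j)
      ((p.2:ℂ)-1)) ?_ ?_ ?_ ?_
    · intro i j
      refine Continuous.matrix_elem (Hc_cont (fun k => ?_) (by fun_prop)) i j
      refine Continuous.add ?_ ?_
      · exact Continuous.smul (f := fun p : unitInterval × Y × S1 => (1 - ((p.1:ℝ) : ℂ))) (by fun_prop) ((hc1 k).comp continuous_snd)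
      · exact Continuous.smul (f := fun p : unitInterval × Y × S1 => ((p.1:ℝ) : ℂ)) (by fun_prop) ((hA k).comp continuous_snd)
    · intro s p
      apply Hc_det
      simp only [smul_add, Finset.sum_add_distrib]
      simp only [smul_comm _ (1 - (s:ℝ) : ℂ), smul_comm _ ((s:ℝ):ℂ)]
      rw [← Finset.smul_sum, ← Finset.smul_sum, hsum, hsum1, ← add_smul]
      simpa using hSu p
    · intro p; rw [hg1, hmk _ _ hc1 hb]; simp
    · intro p; rw [hg2, hmk _ _ hA hb]; simp
  have e3 : cls g2 = cls g3 := by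
    refine cls_hom (fun s p => Hc (A p) ((1 - (s:ℝ) : ℂ) * ((p.2:ℂ)-1))) ?_ ?_ ?_ ?_
    · intro i j
      exact Continuous.matrix_elem (Hc_cont (fun k => (hA k).comp continuous_snd) (by fun_prop)) i j
    · intro s p
      apply Hc_det
      rw [hsum]; exact hSu p
    · intro p; rw [hg2, hmk _ _ hA hb]; simp
    · intro p; rw [hg3, hmk _ _ hA continuous_const]; simp
  let σ : κ ⊕ (Fin d × κ) ≃ Fin (d+1) × κ :=
    { toFun := Sum.elim (fun k => (0, k)) (fun q => (q.1.succ, q.2))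
      invFun := fun q => Fin.cases (motive := fun _ => κ ⊕ (Fin d × κ)) (Sum.inl q.2) (fun i => Sum.inr (i, q.2)) q.1
      left_inv := by rintro (k | ⟨i, k⟩) <;> rfl
      right_inv := by
        rintro ⟨i, k⟩
        refine Fin.cases ?_ (fun i => ?_) i <;> rfl }
  have e4 : cls (uadd g (1 : GLc (Fin d × κ) Y)) = cls g3 := by
    refine cls_reindex _ σ _ ?_
    apply mat_ext
    intro p
    rw [hg3]
    have : ((mk A (fun _ => 0) hA continuous_const).submatrix σ σ).map (ev p) = (Hc (A p) 0).submatrix σ σ := rfl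
    rw [this]
    have h2 : ((uadd g (1 : GLc (Fin d × κ) Y)).val).map (ev p) =
        fromBlocks (1 + S p) 0 0 1 := by
      rw [uadd, Matrix.fromBlocks_map, ev_zero, ev_zero, hg p.1 p.2, pw, Units.val_one, ev_one]
    rw [h2]
    ext (i | ⟨i, k⟩) (j | ⟨j, l⟩)
    · simp [σ, Hc, A, Matrix.one_apply]
    · simp [σ, Hc, A, Matrix.one_apply, (Fin.succ_ne_zero _).symm]
    · simp [σ, Hc, A, Matrix.one_apply]
    · simp [σ, Hc, A, Matrix.one_apply]
  rw [cls_add, cls_one] at e4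
  refine ⟨kcl (sprC (Bc c) hB) (sprC_idem _ hB) , ?_⟩
  rw [← e3, ← e2, e1] at e4
  have cc : (Fintype.card (Fin (d+1) × κ) : K C(Y × S2, ℂ)) = Fintype.card κ + Fintype.card (Fin d × κ) := by
    rw [← Nat.cast_add]; congr 1; simp; ring
  rw [cc] at e4
  linear_combination e4

end Comp

end PK

namespace PK
open Matrix Topology
open scoped Kronecker
set_option linter.all false

section Approx
variable {Y : Type} [TopologicalSpace Y] [CompactSpace Y]

/-- Laurent functions -/
def IsLau (f : C(Y × S1, ℂ)) : Prop :=
  ∃ (m : ℕ) (p : Polynomial C(Y, ℂ)), ∀ (y : Y) (z : S1), (z:ℂ)^m * f (y, z) = p.eval₂ (ev y) ((z:ℂ)-1)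

theorem eval_z (y : Y) (z : ℂ) (m : ℕ) :
    ((Polynomial.X + 1 : Polynomial C(Y, ℂ))^m).eval₂ (ev y) (z-1) = z^m := by
  simp [Polynomial.eval₂_pow]

theorem IsLau.add {f g : C(Y × S1, ℂ)} (hf : IsLau f) (hg : IsLau g) : IsLau (f + g) := by
  obtain ⟨m, p, hp⟩ := hf
  obtain ⟨n, q, hq⟩ := hg
  refine ⟨m + n, p * (Polynomial.X + 1)^n + q * (Polynomial.X + 1)^m, fun y z => ?_⟩
  rw [Polynomial.eval₂_add, Polynomial.eval₂_mul, Polynomial.eval₂_mul, eval_z, eval_z, ← hp, ← hq,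
    ContinuousMap.add_apply]
  ring

theorem IsLau.mul {f g : C(Y × S1, ℂ)} (hf : IsLau f) (hg : IsLau g) : IsLau (f * g) := by
  obtain ⟨m, p, hp⟩ := hf
  obtain ⟨n, q, hq⟩ := hg
  refine ⟨m + n, p * q, fun y z => ?_⟩
  rw [Polynomial.eval₂_mul, ← hp, ← hq, ContinuousMap.mul_apply]
  ring

theorem isLau_base (a : C(Y, ℂ)) : IsLau (pb (ContinuousMap.fst : C(Y × S1, Y)) a) :=
  ⟨0, Polynomial.C a, fun y z => by simp⟩

theorem isLau_zf : IsLau (zf : C(Y × S1, ℂ)) :=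
  ⟨0, Polynomial.X + 1, fun y z => by simp⟩

theorem isLau_zi : IsLau (zi : C(Y × S1, ℂ)) :=
  ⟨1, 1, fun y z => by simp [mul_inv_cancel₀ (s1_ne z)]⟩

theorem star_zf : star (zf : C(Y × S1, ℂ)) = zi := by
  ext p
  simp only [ContinuousMap.star_apply, zf_apply, zi_apply]
  have : Complex.normSq p.2.1 = 1 := by rw [Complex.normSq_eq_norm_sq, p.2.2]; norm_num
  rw [Complex.inv_def, this]; simp

variable (Y) in
def lauAlg : StarSubalgebra ℂ C(Y × S1, ℂ) where
  carrier := {f | IsLau f ∧ IsLau (star f)}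
  mul_mem' {f g} hf hg := ⟨hf.1.mul hg.1, by rw [star_mul]; exact hg.2.mul hf.2⟩
  add_mem' {f g} hf hg := ⟨hf.1.add hg.1, by rw [star_add]; exact hf.2.add hg.2⟩
  algebraMap_mem' r := ⟨isLau_base (algebraMap ℂ C(Y, ℂ) r), by
    rw [← algebraMap_star_comm]
    exact isLau_base (algebraMap ℂ C(Y, ℂ) (star r))⟩
  star_mem' {f} hf := ⟨hf.2, by rw [star_star]; exact hf.1⟩

variable [T2Space Y]

theorem lau_dense (f : C(Y × S1, ℂ)) (ε : ℝ) (hε : 0 < ε) : ∃ g, IsLau g ∧ ∀ p, ‖f p - g p‖ < ε := by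
  have hsep : (lauAlg Y).toSubalgebra.SeparatesPoints := by
    rintro ⟨y, z⟩ ⟨y', z'⟩ hne
    by_cases hz : z = z'
    · subst hz
      have hy : y ≠ y' := fun h => hne (by rw [h])
      obtain ⟨a, ha0, ha1, -⟩ := exists_continuous_zero_one_of_isClosed (isClosed_singleton (x := y))
        (isClosed_singleton (x := y')) (by simpa using hy)
      let b : C(Y, ℂ) := ⟨fun y => (a y : ℂ), by fun_prop⟩
      refine ⟨_, ⟨pb ContinuousMap.fst b, ⟨isLau_base b, ?_⟩, rfl⟩, ?_⟩
      · exact isLau_base (star b)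
      · have h0 := ha0 (Set.mem_singleton y)
        have h1 := ha1 (Set.mem_singleton y')
        simp [b, h0, h1]
    · refine ⟨_, ⟨zf, ⟨isLau_zf, by rw [star_zf]; exact isLau_zi⟩, rfl⟩, ?_⟩
      simpa using fun h => hz (Subtype.ext h)
  have h := ContinuousMap.starSubalgebra_topologicalClosure_eq_top_of_separatesPoints (lauAlg Y) hsep
  have hf : f ∈ (lauAlg Y).topologicalClosure := h ▸ trivial
  have hf' : f ∈ closure ((lauAlg Y : Set C(Y × S1, ℂ))) := hf
  obtain ⟨g, hg, hfg⟩ := Metric.mem_closure_iff.1 hf' ε hε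
  refine ⟨g, hg.1, fun p => ?_⟩
  rw [dist_eq_norm] at hfg
  exact lt_of_le_of_lt ((f - g).norm_coe_le_norm p) hfg

variable {κ : Type} [Fintype κ] [DecidableEq κ]

theorem lau_mat (g : Matrix κ κ C(Y × S1, ℂ)) (ε : ℝ) (hε : 0 < ε) :
    ∃ (m : ℕ) (p : κ → κ → Polynomial C(Y, ℂ)), ∀ i j (y : Y) (z : S1),
      ‖(z:ℂ)^m * g i j (y, z) - (p i j).eval₂ (ev y) ((z:ℂ)-1)‖ < ε := by
  choose f hf hfg using fun i j => lau_dense (g i j) ε hε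
  choose m p hp using hf
  let M := ∑ i, ∑ j, m i j
  have hM : ∀ i j, m i j ≤ M := fun i j =>
    (Finset.single_le_sum (f := fun j => m i j) (fun _ _ => Nat.zero_le _) (Finset.mem_univ j)).trans
      (Finset.single_le_sum (f := fun i => ∑ j, m i j) (fun _ _ => Nat.zero_le _) (Finset.mem_univ i))
  refine ⟨M, fun i j => p i j * (Polynomial.X + 1)^(M - m i j), fun i j y z => ?_⟩
  rw [Polynomial.eval₂_mul, eval_z, ← hp, mul_right_comm, ← pow_add, Nat.add_sub_cancel' (hM i j),
    ← mul_sub, norm_mul, norm_pow, z.2, one_pow, one_mul]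
  exact hfg i j (y, z)

theorem unif_unit {Z : Type} [TopologicalSpace Z] [CompactSpace Z] (g : Matrix κ κ C(Z, ℂ))
    (hg : ∀ p, (g.map (ev p)).det ≠ 0) :
    ∃ ε > 0, ∀ p (M : Matrix κ κ ℂ), (∀ i j, ‖M i j - g i j p‖ < ε) → M.det ≠ 0 := by
  have hopen : ∀ p : Z, ∀ᶠ q : Matrix κ κ ℂ × Z in 𝓝 0 ×ˢ 𝓝 p, (g.map (ev q.2) + q.1).det ≠ 0 := by
    intro p
    rw [← nhds_prod_eq]
    have hc : Continuous fun q : Matrix κ κ ℂ × Z => (g.map (ev q.2) + q.1).det :=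
      (((mat_cont g).comp continuous_snd).add continuous_fst).matrix_det
    have := hc.tendsto (0, p)
    refine this.eventually_ne ?_
    simpa using hg p
  have h := isCompact_univ.eventually_forall_of_forall_eventually
    (x₀ := (0 : Matrix κ κ ℂ)) (P := fun E p => (g.map (ev p) + E).det ≠ 0) (K := (Set.univ : Set Z))
    (fun p _ => by rw [nhds_prod_eq]; exact hopen p)
  have h' : ∀ᶠ E : κ → κ → ℂ in 𝓝 0, ∀ p : Z, p ∈ Set.univ → (g.map (ev p) + Matrix.of E).det ≠ 0 := h
  obtain ⟨ε, hε, hb⟩ := Metric.eventually_nhds_iff.1 h'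
  refine ⟨ε, hε, fun p M hM => ?_⟩
  have := hb (y := fun i j => M i j - g i j p) ?_ p trivial
  · convert this using 2
    ext i j; simp
  · rw [dist_zero_right, pi_norm_lt_iff hε]
    intro i
    rw [pi_norm_lt_iff hε]
    exact hM i

end Approx

end PK

namespace PK
open Matrix Topology
open scoped Kronecker
set_option linter.all false

section BottG
variable {Y : Type} [TopologicalSpace Y] [CompactSpace Y]
variable {κ : Type} [Fintype κ] [DecidableEq κ]

/-- evaluation of a matrix of polynomials -/
noncomputable def pev (p : κ → κ → Polynomial C(Y, ℂ)) (y : Y) (w : ℂ) : Matrix κ κ ℂ :=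
  Matrix.of fun i j => (p i j).eval₂ (ev y) w

/-- coefficient matrices -/
noncomputable def pcf (p : κ → κ → Polynomial C(Y, ℂ)) (k : ℕ) : Matrix κ κ C(Y, ℂ) :=
  Matrix.of fun i j => (p i j).coeff k

theorem pnorm (p : κ → κ → Polynomial C(Y, ℂ)) (U : (Matrix κ κ C(Y, ℂ))ˣ)
    (hU : (U : Matrix κ κ C(Y, ℂ)) = pcf p 0) {d : ℕ} (hd : ∀ i j, (p i j).natDegree ≤ d + 1) (y : Y) (w : ℂ) :
    pw (fun k : Fin (d+1) => ((↑U⁻¹ : Matrix κ κ C(Y, ℂ)) * pcf p (k+1)).map (ev y)) w =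
      (↑U⁻¹ : Matrix κ κ C(Y, ℂ)).map (ev y) * pev p y w := by
  have h1 : pev p y w = (U : Matrix κ κ C(Y, ℂ)).map (ev y) +
      ∑ k : Fin (d+1), w ^ ((k:ℕ)+1) • (pcf p (k+1)).map (ev y) := by
    ext i j
    rw [Matrix.add_apply, Matrix.sum_apply, hU]
    simp only [pev, pcf, Matrix.of_apply, Matrix.map_apply, Matrix.smul_apply, smul_eq_mul]
    rw [Polynomial.eval₂_eq_sum_range' (ev y) (Nat.lt_succ_of_le (hd i j)), Finset.sum_range_succ', add_comm,
      ← Fin.sum_univ_eq_sum_range (fun k => (ev y) ((p i j).coeff (k+1)) * w ^ (k+1))]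
    congr 1
    · simp
    · exact Finset.sum_congr rfl fun k _ => mul_comm _ _
  have h2 : (↑U⁻¹ : Matrix κ κ C(Y, ℂ)).map (ev y) * (U : Matrix κ κ C(Y, ℂ)).map (ev y) = 1 := by
    rw [← Matrix.map_mul, Units.inv_mul, ev_one]
  rw [h1, pw, mul_add, h2, Finset.mul_sum]
  congr 1
  refine Finset.sum_congr rfl fun k _ => ?_
  rw [Matrix.map_mul, Matrix.mul_smul]

def NiceG (g : GLc κ Y) : Prop := ∃ x : K C(Y, ℂ), cls g =
  (Fintype.card κ : K C(Y × S2, ℂ)) + K.map (pb ContinuousMap.fst) x * tt Y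

theorem NiceG.mul {g h : GLc κ Y} (hg : NiceG g) (hh : NiceG h) : NiceG (g * h) := by
  obtain ⟨x, hx⟩ := hg
  obtain ⟨y, hy⟩ := hh
  refine ⟨x + y, ?_⟩
  have := cls_mul g h
  rw [map_add]
  linear_combination this + hx + hy

theorem NiceG.of_mul {g h : GLc κ Y} (hg : NiceG g) (hh : NiceG (g * h)) : NiceG h := by
  obtain ⟨x, hx⟩ := hg
  obtain ⟨y, hy⟩ := hh
  refine ⟨y - x, ?_⟩
  have := cls_mul g h
  rw [map_sub]
  linear_combination -this - hx + hy

theorem niceG_const (u : (Matrix κ κ C(Y, ℂ))ˣ) : NiceG (umap (pb (ContinuousMap.fst : C(Y × S1, Y))) u) :=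
  ⟨0, by rw [cls_const, map_zero]; ring⟩

theorem niceG_qu (Q : Matrix κ κ C(Y, ℂ)) (hQ : Q * Q = Q) : NiceG (qu Q hQ) := ⟨_, cls_qu Q hQ⟩

theorem niceG_pow (m : ℕ) : NiceG ((qu (1 : Matrix κ κ C(Y, ℂ)) (one_mul 1)) ^ m) := by
  induction m with
  | zero => exact ⟨0, by rw [pow_zero, cls_one, map_zero]; ring⟩
  | succ m ih => rw [pow_succ]; exact ih.mul (niceG_qu _ _)

theorem qu_one_ev (y : Y) (z : S1) : ((qu (1 : Matrix κ κ C(Y, ℂ)) (one_mul 1)) : Matrix κ κ C(Y × S1, ℂ)).map (ev (y, z))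
    = (z:ℂ) • 1 := by
  ext i j
  by_cases h : i = j <;> simp [qu, qmat_apply, h]

theorem qu_pow_ev (m : ℕ) (y : Y) (z : S1) :
    (((qu (1 : Matrix κ κ C(Y, ℂ)) (one_mul 1)) ^ m : GLc κ Y) : Matrix κ κ C(Y × S1, ℂ)).map (ev (y, z))
    = ((z:ℂ)^m) • 1 := by
  induction m with
  | zero => rw [pow_zero, Units.val_one, ev_one]; simp
  | succ m ih => rw [pow_succ, Units.val_mul, Matrix.map_mul, ih, qu_one_ev]; simp [pow_succ, smul_smul, mul_comm]

theorem pev_cont (p : κ → κ → Polynomial C(Y, ℂ)) : Continuous fun q : Y × S1 => pev p q.1 ((q.2:ℂ)-1) := by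
  refine continuous_matrix fun i j => ?_
  simp only [pev, Matrix.of_apply, Polynomial.eval₂_eq_sum_range, ev_apply]
  fun_prop

theorem niceG_pev (p : κ → κ → Polynomial C(Y, ℂ)) (g : GLc κ Y)
    (hg : ∀ (y : Y) (z : S1), (g : Matrix κ κ C(Y × S1, ℂ)).map (ev (y, z)) = pev p y ((z:ℂ)-1)) : NiceG g := by
  have h0 : ∀ y, (pcf p 0).map (ev y) = pev p y 0 := by
    intro y; ext i j
    simp [pcf, pev, Polynomial.eval₂_at_zero]
  have hu : IsUnit (pcf p 0) := by
    rw [isUnit_mat_iff]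
    intro y
    have := isUnit_mat_iff.1 g.isUnit (y, ⟨1, by simp⟩)
    rw [hg] at this
    rw [h0]; simpa using this
  obtain ⟨U, hU⟩ := hu
  let d := ∑ i, ∑ j, (p i j).natDegree
  have hd : ∀ i j, (p i j).natDegree ≤ d + 1 := fun i j =>
    ((Finset.single_le_sum (f := fun j => (p i j).natDegree) (fun _ _ => Nat.zero_le _) (Finset.mem_univ j)).trans
      (Finset.single_le_sum (f := fun i => ∑ j, (p i j).natDegree) (fun _ _ => Nat.zero_le _) (Finset.mem_univ i))).trans
      (Nat.le_succ _)
  let u := umap (pb (ContinuousMap.fst : C(Y × S1, Y))) U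
  have hn : NiceG (u⁻¹ * g) := by
    refine cls_poly (fun k : Fin (d+1) => (↑U⁻¹ : Matrix κ κ C(Y, ℂ)) * pcf p (k+1)) _ ?_
    intro y z
    rw [pnorm p U hU hd, ← hg, Units.val_mul, Matrix.map_mul]
    rfl
  have := (niceG_const U).mul hn
  rwa [mul_inv_cancel_left] at this

theorem det_twist {a : ℂ} (ha : ‖a‖ = 1) {g : κ → κ → ℂ} {ε : ℝ} 
    (hu : ∀ M : Matrix κ κ ℂ, (∀ i j, ‖M i j - g i j‖ < ε) → M.det ≠ 0) {M : Matrix κ κ ℂ}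
    (hM : ∀ i j, ‖a * g i j - M i j‖ < ε) : M.det ≠ 0 := by
  intro h0
  refine hu (a⁻¹ • M) ?_ (by rw [Matrix.det_smul, h0, mul_zero])
  intro i j
  have hz : a ≠ 0 := by rintro rfl; simp at ha
  rw [← one_mul ‖_‖, ← ha, ← norm_mul, mul_sub, Matrix.smul_apply, smul_eq_mul, mul_inv_cancel_left₀ hz,
      norm_sub_rev]
  exact hM i j

variable [T2Space Y]

/-- surjectivity part of Bott periodicity -/
theorem bottG (g : GLc κ Y) : ∃ x : K C(Y, ℂ), cls g =
    (Fintype.card κ : K C(Y × S2, ℂ)) + K.map (pb ContinuousMap.fst) x * tt Y := by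
  obtain ⟨ε, hε, hu⟩ := unif_unit (g : Matrix κ κ C(Y × S1, ℂ)) (isUnit_mat_iff.1 g.isUnit)
  obtain ⟨m, p, hp⟩ := lau_mat (g : Matrix κ κ C(Y × S1, ℂ)) ε hε
  have hdet : ∀ (y : Y) (z : S1) (M : Matrix κ κ ℂ),
      (∀ i j, ‖(z:ℂ)^m * (g : Matrix κ κ C(Y × S1, ℂ)) i j (y, z) - M i j‖ < ε) → M.det ≠ 0 := by
    intro y z M hM
    exact det_twist (a := (z:ℂ)^m) (by rw [norm_pow, z.2, one_pow]) (hu (y, z)) hM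
  let M : Matrix κ κ C(Y × S1, ℂ) := Matrix.of fun i j =>
    ⟨fun q => pev p q.1 ((q.2:ℂ)-1) i j, (pev_cont p).matrix_elem i j⟩
  have hM : ∀ y z, M.map (ev (y, z)) = pev p y ((z:ℂ)-1) := fun y z => rfl
  obtain ⟨g', hg'⟩ := exists_glc M (by rintro ⟨y, z⟩; rw [hM]; exact hdet y z _ (fun i j => hp i j y z))
  have hn : NiceG g' := niceG_pev p g' (by rw [hg']; exact hM)
  refine NiceG.of_mul (niceG_pow m) (?_ : NiceG (_ * g))
  obtain ⟨x, hx⟩ := hn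
  refine ⟨x, ?_⟩
  rw [← hx]
  refine cls_hom (fun s q => (1 - (s:ℝ) : ℂ) • ((q.2:ℂ)^m • (g : Matrix κ κ C(Y × S1, ℂ)).map (ev q)) +
    ((s:ℝ):ℂ) • pev p q.1 ((q.2:ℂ)-1)) ?_ ?_ ?_ ?_
  · intro i j
    refine Continuous.matrix_elem ?_ i j
    have h1 : Continuous fun q : unitInterval × Y × S1 => (g : Matrix κ κ C(Y × S1, ℂ)).map (ev q.2) :=
      (mat_cont _).comp continuous_snd
    have h2 : Continuous fun q : unitInterval × Y × S1 => pev p q.2.1 ((q.2.2:ℂ)-1) :=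
      (pev_cont p).comp continuous_snd
    have h3 : Continuous fun q : unitInterval × Y × S1 => (q.2.2:ℂ)^m := by fun_prop
    have h4 : Continuous fun q : unitInterval × Y × S1 => (1 - ((q.1:ℝ):ℂ)) := by fun_prop
    have h5 : Continuous fun q : unitInterval × Y × S1 => (((q.1:ℝ):ℂ)) := by fun_prop
    exact (h4.smul (h3.smul h1)).add (h5.smul h2)
  · rintro s ⟨y, z⟩
    apply hdet y z
    intro i j
    have e : (z:ℂ)^m * (g : Matrix κ κ C(Y × S1, ℂ)) i j (y, z) - ((1 - (s:ℝ) : ℂ) • ((z:ℂ)^m • (g : Matrix κ κ C(Y × S1, ℂ)).map (ev (y, z))) +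
        ((s:ℝ):ℂ) • pev p y ((z:ℂ)-1)) i j = ((s:ℝ):ℂ) * ((z:ℂ)^m * (g : Matrix κ κ C(Y × S1, ℂ)) i j (y, z)
          - (p i j).eval₂ (ev y) ((z:ℂ)-1)) := by
      simp only [Matrix.add_apply, Matrix.smul_apply, smul_eq_mul, Matrix.map_apply, ev_apply, pev, Matrix.of_apply]
      ring
    rw [e, norm_mul, Complex.norm_real, Real.norm_of_nonneg s.2.1]
    exact lt_of_le_of_lt (mul_le_of_le_one_left (norm_nonneg _) s.2.2) (hp i j y z)
  · rintro ⟨y, z⟩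
    rw [Units.val_mul, Matrix.map_mul, qu_pow_ev]
    simp
  · rintro ⟨y, z⟩
    rw [hg', hM]; simp

end BottG

end PK

namespace PK
open Matrix Topology
open scoped Kronecker
set_option linter.all false

section BottC
variable {κ : Type} [Fintype κ] [DecidableEq κ] {ν : Type} [Fintype ν] [DecidableEq ν]

theorem kq_mul {R : Type*} [CommRing R] {Q : Matrix κ κ R} (hQ : Q * Q = Q) (A B A' B' : Matrix ν ν R) :
    (A ⊗ₖ (1 - Q) + B ⊗ₖ Q) * (A' ⊗ₖ (1 - Q) + B' ⊗ₖ Q) = (A * A') ⊗ₖ (1 - Q) + (B * B') ⊗ₖ Q := by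
  have h1 : (1 - Q) * Q = 0 := by rw [sub_mul, one_mul, hQ, sub_self]
  have h2 : Q * (1 - Q) = 0 := by rw [mul_sub, mul_one, hQ, sub_self]
  have h3 : (1 - Q) * (1 - Q) = 1 - Q := by rw [mul_sub, h1, mul_one, sub_zero]
  rw [add_mul, mul_add, mul_add, ← mul_kronecker_mul, ← mul_kronecker_mul, ← mul_kronecker_mul,
    ← mul_kronecker_mul, h1, h2, h3, hQ, kronecker_zero, kronecker_zero, add_zero, zero_add]

theorem kq_one {R : Type*} [CommRing R] {Q : Matrix κ κ R} :
    (1 : Matrix ν ν R) ⊗ₖ (1 - Q) + (1 : Matrix ν ν R) ⊗ₖ Q = 1 := by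
  rw [← kronecker_add, sub_add_cancel, one_kronecker_one]

theorem lm_kq {Q : Matrix κ κ ℂ} (A B : Matrix ν ν ℂ) (z : ℂ) :
    lm (A ⊗ₖ (1 - Q) + B ⊗ₖ Q) z = lm A z ⊗ₖ (1 - Q) + lm B z ⊗ₖ Q := by
  simp only [lm, add_kronecker, smul_kronecker]
  rw [← kq_one (Q := Q), smul_add]
  abel

theorem good_kq {Q : Matrix κ κ ℂ} (hQ : Q * Q = Q) {A B : Matrix ν ν ℂ} (hA : Good A) (hB : Good B) (z : S1) :
    lm (A ⊗ₖ (1 - Q) + B ⊗ₖ Q) z * ((lm A z)⁻¹ ⊗ₖ (1 - Q) + (lm B z)⁻¹ ⊗ₖ Q) = 1 := by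
  rw [lm_kq, kq_mul hQ, lm_inv hA, lm_inv hB, kq_one]

theorem spr_kq {Q : Matrix κ κ ℂ} (hQ : Q * Q = Q) {A B : Matrix ν ν ℂ} (hA : Good A) (hB : Good B) :
    spr (A ⊗ₖ (1 - Q) + B ⊗ₖ Q) = spr A ⊗ₖ (1 - Q) + spr B ⊗ₖ Q := by
  have : fc (A ⊗ₖ (1 - Q) + B ⊗ₖ Q) 1 = fc A 1 ⊗ₖ (1 - Q) + fc B 1 ⊗ₖ Q := by
    ext ⟨i, k⟩ ⟨j, l⟩
    simp only [fc, Matrix.of_apply, Matrix.add_apply, kronecker_apply]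
    rw [← intervalIntegral.integral_mul_const, ← intervalIntegral.integral_mul_const,
      ← intervalIntegral.integral_add]
    · congr 1
      ext v
      rw [Matrix.inv_eq_right_inv (good_kq hQ hA hB (ee v))]
      simp only [Matrix.add_apply, kronecker_apply]
      ring
    · exact ((fi_cont hA 1 i j).mul_const _).intervalIntegrable _ _
    · exact ((fi_cont hB 1 i j).mul_const _).intervalIntegrable _ _
  rw [spr, this, kq_mul hQ, spr, spr]

/-- scalar companion matrix of `(1+w)^m` -/
def Bs (d m : ℕ) : Matrix (Fin (d+1)) (Fin (d+1)) ℂ := Matrix.of fun i j =>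
  (if i = 0 then (m.choose (j+1) : ℂ) else 0) - (if (i:ℕ) = j + 1 then 1 else 0)

theorem Bs_eig {d m : ℕ} (hm : m ≤ d + 1) {v : Fin (d+1) → ℂ} (hv : v ≠ 0) {μ : ℂ}
    (h : Bs d m *ᵥ v = μ • v) : μ = 0 ∨ μ = 1 := by
  by_cases h0 : μ = 0
  · exact Or.inl h0
  right
  have hs : ∀ i : Fin d, v i.succ = (-μ⁻¹) * v i.castSucc := by
    intro i
    have := congrFun h i.succ
    simp only [Matrix.mulVec, dotProduct, Bs, Matrix.of_apply, Fin.succ_ne_zero, if_false, zero_sub,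
      Pi.smul_apply, smul_eq_mul] at this
    have hc : ∀ j : Fin (d+1), ((i.succ : Fin (d+1)).val = j.val + 1) ↔ i.castSucc = j := by
      intro j; rw [Fin.ext_iff]; simp
    simp only [hc, neg_mul, ite_mul, one_mul, zero_mul, Finset.sum_neg_distrib, Finset.sum_ite_eq,
      Finset.mem_univ, if_true] at this
    rw [neg_mul, ← mul_neg, this, inv_mul_cancel_left₀ h0]
  have hp : ∀ i : Fin (d+1), v i = (-μ⁻¹)^(i:ℕ) * v 0 := by
    intro i
    induction i using Fin.induction with
    | zero => simp
    | succ i ih => rw [hs, ih]; simp [pow_succ]; ring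
  have hv0 : v 0 ≠ 0 := by
    intro h; apply hv; ext i; rw [hp, h, mul_zero]; rfl
  have hz := congrFun h 0
  simp only [Matrix.mulVec, dotProduct, Bs, Matrix.of_apply, if_true, Pi.smul_apply, smul_eq_mul] at hz
  have hz' : ∑ j : Fin (d+1), (m.choose (j+1) : ℂ) * (-μ⁻¹)^(j:ℕ) = μ := by
    apply mul_right_cancel₀ hv0
    rw [← hz, Finset.sum_mul]
    refine Finset.sum_congr rfl fun j _ => ?_
    rw [hp j]; simp [mul_assoc]
  have h1 : ∑ j ∈ Finset.range (d+2), (m.choose j : ℂ) * (-μ⁻¹)^j = 0 := by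
    rw [Finset.sum_range_succ', ← Fin.sum_univ_eq_sum_range (fun j => (m.choose (j+1) : ℂ) * (-μ⁻¹)^(j+1))]
    have : ∑ j : Fin (d+1), (m.choose (j+1) : ℂ) * (-μ⁻¹)^((j:ℕ)+1) = (-μ⁻¹) * μ := by
      rw [← hz', Finset.mul_sum]
      refine Finset.sum_congr rfl fun j _ => ?_
      rw [hz']; ring
    rw [this]; simp [h0]
  have h2 : (1 + (-μ⁻¹))^m = 0 := by
    rw [← h1, add_comm, add_pow]
    simp only [one_pow, mul_one]
    rw [Finset.sum_subset (s₁ := Finset.range (m+1)) (s₂ := Finset.range (d+2))]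
    · refine Finset.sum_congr rfl fun j _ => mul_comm _ _
    · intro x; simp only [Finset.mem_range]; omega
    · intro x _ hx
      rw [Nat.choose_eq_zero_of_lt (by simpa using hx)]; simp
  have h4 : 1 + (-μ⁻¹) = 0 := by
    by_contra hne
    exact pow_ne_zero m hne h2
  have : μ⁻¹ = 1 := by linear_combination -h4
  rwa [inv_eq_one] at this

theorem Bs_good {d m : ℕ} (hm : m ≤ d + 1) : Good (Bs d m) := by
  intro z h0
  obtain ⟨v, hv, hM, μ, hμ⟩ := exists_eig (B := Bs d m) (lm_comm rfl z) h0
  rw [lm, Matrix.add_mulVec, Matrix.one_mulVec, Matrix.smul_mulVec, hμ] at hM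
  have : (1 + ((z:ℂ)-1) * μ) • v = 0 := by rw [← hM, add_smul, one_smul, smul_smul]
  rcases smul_eq_zero.1 this with h | h
  · rcases Bs_eig hm hv hμ with rfl | rfl
    · simp at h
    · exact s1_ne z (by linear_combination h)
  · exact hv h

theorem Bs_trace {d m : ℕ} (hm : m ≤ d + 1) : (spr (Bs d m)).trace = m := by
  have h1 : (Bs d m).trace = m := by
    rw [Matrix.trace, Fin.sum_univ_succ]
    simp [Bs]
  have hg := Bs_good hm
  have h2 : (Bs d m - spr (Bs d m)).trace = 0 := by
    rw [Matrix.trace_eq_sum_roots_charpoly]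
    apply Multiset.sum_eq_zero
    intro x hx
    rw [Polynomial.mem_roots', Polynomial.IsRoot.def, Matrix.eval_charpoly] at hx
    obtain ⟨v, hv, hM, μ, hμ⟩ := exists_eig (B := Bs d m) (by
      rw [mul_sub, sub_mul, mul_sub, sub_mul, spr_comm hg]
      congr 1
      exact ((Matrix.scalar_commute x (fun r => mul_comm _ _) _).eq).symm) hx.2
    rw [Matrix.sub_mulVec, Matrix.sub_mulVec, hμ] at hM
    have hx' : (Matrix.scalar (Fin (d+1)) x) *ᵥ v = x • v := by
      ext i; simp [Matrix.scalar_apply, Matrix.mulVec_diagonal]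
    rw [hx'] at hM
    have hsp : spr (Bs d m) *ᵥ v = μ • v := by
      rcases spr_eig hg hv hμ with ⟨h1, h2⟩ | ⟨h1, h2⟩ <;> rcases Bs_eig hm hv hμ with rfl | rfl
      · simp [h2]
      · norm_num at h1
      · norm_num at h1
      · simp [h2]
    rw [hsp, sub_self, sub_zero] at hM
    exact (smul_eq_zero.1 hM).resolve_right hv
  rw [Matrix.trace_sub, sub_eq_zero] at h2
  rw [← h2, h1]

end BottC

end PK

namespace PK
open Matrix Topology
open scoped Kronecker
set_option linter.all false

section BottC2
variable {Y : Type} [TopologicalSpace Y] [CompactSpace Y]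
variable {κ : Type} [Fintype κ] [DecidableEq κ]

/-- constants -/
noncomputable def cst (Y : Type) [TopologicalSpace Y] : ℂ →+* C(Y, ℂ) where
  toFun a := ContinuousMap.const Y a
  map_one' := rfl
  map_zero' := rfl
  map_add' _ _ := rfl
  map_mul' _ _ := rfl

@[simp] theorem cst_apply (a : ℂ) (y : Y) : cst Y a y = a := rfl

theorem kcl_cst {ν : Type} [Fintype ν] [DecidableEq ν] {e : Matrix ν ν ℂ} (he : e * e = e) {r : ℕ}
    (hr : e.trace = r) : kcl (e.map (cst Y)) (idem_map _ he) = r := by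
  rw [← kcl_map (cst Y) he, kcl_eq (hf := by simp) (Iso.field he), kcl_one, map_natCast, Fintype.card_fin]
  rw [idem_trace he] at hr
  norm_cast at hr
  rw [hr]

theorem kcl_kq {d m : ℕ} (hm : m ≤ d) {Q : Matrix κ κ C(Y, ℂ)} (hQ : Q * Q = Q)
    {P : Matrix (Fin (d+1) × κ) (Fin (d+1) × κ) C(Y, ℂ)} (hP : P * P = P)
    (h : ∀ y, P.map (ev y) = spr (Bs d m ⊗ₖ (1 - Q.map (ev y)) + Bs d (m+1) ⊗ₖ Q.map (ev y))) :
    kcl P hP = m * Fintype.card κ + kcl Q hQ := by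
  have g0 : Good (Bs d m) := Bs_good (by omega)
  have g1 : Good (Bs d (m+1)) := Bs_good (by omega)
  have e : P = (spr (Bs d m)).map (cst Y) ⊗ₖ (1 - Q) + (spr (Bs d (m+1))).map (cst Y) ⊗ₖ Q := by
    apply mat_ext
    intro y
    rw [h, spr_kq (by rw [← Matrix.map_mul, hQ]) g0 g1]
    ext ⟨i, k⟩ ⟨j, l⟩
    by_cases hkl : k = l <;> simp [kronecker_apply, Matrix.one_apply, hkl]
  have a1 := idem_kron (idem_map (cst Y) (spr_idem g0)) (idem_compl hQ)
  have a2 := idem_kron (idem_map (cst Y) (spr_idem g1)) hQ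
  have b1 : ((spr (Bs d m)).map (cst Y) ⊗ₖ (1 - Q)) * ((spr (Bs d (m+1))).map (cst Y) ⊗ₖ Q) = 0 := by
    rw [← mul_kronecker_mul, sub_mul, one_mul, hQ, sub_self, kronecker_zero]
  have b2 : ((spr (Bs d (m+1))).map (cst Y) ⊗ₖ Q) * ((spr (Bs d m)).map (cst Y) ⊗ₖ (1 - Q)) = 0 := by
    rw [← mul_kronecker_mul, mul_sub, mul_one, hQ, sub_self, kronecker_zero]
  rw [kcl_congr (hf := by simp [add_mul, mul_add, *]) e, kcl_orth a1 a2 b1 b2, kcl_kron (idem_map (cst Y) (spr_idem g0)) (idem_compl hQ),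
    kcl_kron (idem_map (cst Y) (spr_idem g1)) hQ, kcl_cst (spr_idem g0) (Bs_trace (by omega)),
    kcl_cst (spr_idem g1) (Bs_trace (by omega)), kcl_compl hQ]
  push_cast
  ring

/-- polynomial `z^m(1-Q+zQ)` -/
noncomputable def Hp (m : ℕ) (Q : Matrix κ κ C(Y, ℂ)) (i j : κ) : Polynomial C(unitInterval × Y, ℂ) :=
  (Polynomial.X + 1)^m * Polynomial.C ((1 : Matrix κ κ C(unitInterval × Y, ℂ)) i j - pb ContinuousMap.snd (Q i j))
   + (Polynomial.X + 1)^(m+1) * Polynomial.C (pb ContinuousMap.snd (Q i j))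

theorem Hp_deg (m : ℕ) (Q : Matrix κ κ C(Y, ℂ)) (i j : κ) : (Hp m Q i j).natDegree ≤ m + 1 := by
  rw [Hp]; compute_degree

theorem Hp_eval (m : ℕ) (Q : Matrix κ κ C(Y, ℂ)) (i j : κ) (s : unitInterval) (y : Y) (z : ℂ) :
    (Hp m Q i j).eval₂ (ev (s, y)) (z-1) = z^m * ((1 : Matrix κ κ ℂ) i j - Q i j y + z * Q i j y) := by
  rw [Hp]
  have : (ev (s, y)) ((1 : Matrix κ κ C(unitInterval × Y, ℂ)) i j) = (1 : Matrix κ κ ℂ) i j := by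
    by_cases h : i = j <;> simp [Matrix.one_apply, h]
  simp only [Polynomial.eval₂_add, Polynomial.eval₂_mul, Polynomial.eval₂_pow, Polynomial.eval₂_X,
    Polynomial.eval₂_one, Polynomial.eval₂_C, sub_add_cancel]
  rw [map_sub (ev (s, y)), this]
  show z^m * (_ - Q i j y) + z^(m+1) * Q i j y = _
  ring

theorem Hp_coeff (m : ℕ) (Q : Matrix κ κ C(Y, ℂ)) (i j : κ) (s : unitInterval) (y : Y) (k : ℕ) :
    ev (s, y) ((Hp m Q i j).coeff k) = (m.choose k : ℂ) * ((1 : Matrix κ κ ℂ) i j - Q i j y) + ((m+1).choose k : ℂ) * Q i j y := by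
  rw [Hp]
  have : (ev (s, y)) ((1 : Matrix κ κ C(unitInterval × Y, ℂ)) i j) = (1 : Matrix κ κ ℂ) i j := by
    by_cases h : i = j <;> simp [Matrix.one_apply, h]
  rw [Polynomial.coeff_add, Polynomial.coeff_mul_C, Polynomial.coeff_mul_C, Polynomial.coeff_X_add_one_pow,
    Polynomial.coeff_X_add_one_pow, map_add, map_mul, map_mul, map_sub, this, map_natCast, map_natCast]
  rfl

def ip (Y : Type) [TopologicalSpace Y] (s : unitInterval) : C(unitInterval × Y, unitInterval × Y) :=
  ⟨fun p => (s, p.2), by fun_prop⟩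

noncomputable def tc (Y : Type) [TopologicalSpace Y] : C(unitInterval × Y, ℂ) := ⟨fun p => ((p.1:ℝ):ℂ), by fun_prop⟩

/-- corrected polynomial -/
noncomputable def pt (p : κ → κ → Polynomial C(unitInterval × Y, ℂ)) (H0 H1 : κ → κ → Polynomial C(unitInterval × Y, ℂ)) 
   (i j : κ) : Polynomial C(unitInterval × Y, ℂ) :=
  p i j - Polynomial.C (1 - tc Y) * ((p i j).map (pb (ip Y 0)) - H0 i j)
   - Polynomial.C (tc Y) * ((p i j).map (pb (ip Y 1)) - H1 i j)

theorem pt_eval (p H0 H1 : κ → κ → Polynomial C(unitInterval × Y, ℂ)) (i j : κ) (s : unitInterval) (y : Y) (w : ℂ) :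
    (pt p H0 H1 i j).eval₂ (ev (s, y)) w = (p i j).eval₂ (ev (s, y)) w
      - (1 - ((s:ℝ):ℂ)) * ((p i j).eval₂ (ev (0, y)) w - (H0 i j).eval₂ (ev (s, y)) w)
      - ((s:ℝ):ℂ) * ((p i j).eval₂ (ev (1, y)) w - (H1 i j).eval₂ (ev (s, y)) w) := by
  rw [pt]
  simp only [Polynomial.eval₂_sub, Polynomial.eval₂_mul, Polynomial.eval₂_C, Polynomial.eval₂_map]
  rfl

theorem pt_coeff (p H0 H1 : κ → κ → Polynomial C(unitInterval × Y, ℂ)) (i j : κ) (s : unitInterval) (y : Y) (k : ℕ) :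
    ev (s, y) ((pt p H0 H1 i j).coeff k) = ev (s, y) ((p i j).coeff k)
      - (1 - ((s:ℝ):ℂ)) * (ev (0, y) ((p i j).coeff k) - ev (s, y) ((H0 i j).coeff k))
      - ((s:ℝ):ℂ) * (ev (1, y) ((p i j).coeff k) - ev (s, y) ((H1 i j).coeff k)) := by
  rw [pt]
  simp only [Polynomial.coeff_sub, Polynomial.coeff_C_mul, Polynomial.coeff_map]
  rfl

theorem Bc_end {d m : ℕ} (c : Fin (d+1) → Matrix κ κ ℂ) (Q : Matrix κ κ ℂ)
    (hc : ∀ k i j, c k i j = (m.choose (k+1) : ℂ) * ((1 : Matrix κ κ ℂ) i j - Q i j) + ((m+1).choose (k+1) : ℂ) * Q i j) :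
    Bc c = Bs d m ⊗ₖ (1 - Q) + Bs d (m+1) ⊗ₖ Q := by
  ext ⟨i, k⟩ ⟨j, l⟩
  simp only [Bc, Bs, Matrix.of_apply, Matrix.add_apply, kronecker_apply, hc, Matrix.sub_apply, Matrix.one_apply, ite_and]
  split_ifs <;> ring

variable [T2Space Y]

theorem flow (Q0 Q1 : Matrix κ κ C(Y, ℂ)) (h0 : Q0 * Q0 = Q0) (h1 : Q1 * Q1 = Q1)
    (G : Matrix κ κ C((unitInterval × Y) × S1, ℂ)) (hG : ∀ p, (G.map (ev p)).det ≠ 0)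
    (hG0 : ∀ y (z : S1) i j, G i j ((0, y), z) = (1 : Matrix κ κ ℂ) i j - Q0 i j y + z * Q0 i j y)
    (hG1 : ∀ y (z : S1) i j, G i j ((1, y), z) = (1 : Matrix κ κ ℂ) i j - Q1 i j y + z * Q1 i j y) :
    kcl Q0 h0 = kcl Q1 h1 := by
  obtain ⟨ε, hε, hu⟩ := unif_unit G hG
  obtain ⟨m, p, hp⟩ := lau_mat G (ε/2) (by positivity)
  let p' := pt p (Hp m Q0) (Hp m Q1)
  have hdet : ∀ (s : unitInterval) (y : Y) (z : S1), (pev p' (s, y) ((z:ℂ)-1)).det ≠ 0 := by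
    intro s y z
    refine det_twist (a := (z:ℂ)^m) (by rw [norm_pow, z.2, one_pow]) (hu ((s, y), z)) ?_
    intro i j
    have hs0 : (0:ℝ) ≤ 1 - s := by linarith [s.2.2]
    have e0 := hp i j (0, y) z
    have e1 := hp i j (1, y) z
    rw [hG0, ← Hp_eval m Q0 i j s] at e0
    rw [hG1, ← Hp_eval m Q1 i j s] at e1
    have es := hp i j (s, y) z
    rw [pev, Matrix.of_apply, pt_eval]
    generalize (Polynomial.eval₂ (ev (s, y)) ((z:ℂ)-1) (Hp m Q0 i j) : ℂ) = a0 at *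
    generalize (Polynomial.eval₂ (ev (s, y)) ((z:ℂ)-1) (Hp m Q1 i j) : ℂ) = a1 at *
    generalize (Polynomial.eval₂ (ev (0, y)) ((z:ℂ)-1) (p i j) : ℂ) = b0 at *
    generalize (Polynomial.eval₂ (ev (1, y)) ((z:ℂ)-1) (p i j) : ℂ) = b1 at *
    generalize (Polynomial.eval₂ (ev (s, y)) ((z:ℂ)-1) (p i j) : ℂ) = bs at *
    generalize (z:ℂ)^m * G i j ((s, y), z) = as at *
    have : as - (bs - (1 - ((s:ℝ):ℂ)) * (b0 - a0) - ((s:ℝ):ℂ) * (b1 - a1)) =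
       (as - bs) - (((1 - s : ℝ):ℂ) * (a0 - b0) + ((s:ℝ):ℂ) * (a1 - b1)) := by push_cast; ring
    rw [this]
    refine (norm_sub_le _ _).trans_lt ?_
    have := norm_add_le (((1 - s : ℝ):ℂ) * (a0 - b0)) (((s:ℝ):ℂ) * (a1 - b1))
    rw [norm_mul, norm_mul, Complex.norm_real, Complex.norm_real, Real.norm_of_nonneg s.2.1, Real.norm_of_nonneg hs0] at this
    nlinarith [s.2.1, mul_le_mul_of_nonneg_left e0.le hs0, mul_le_mul_of_nonneg_left e1.le s.2.1]
  have hc0 : ∀ q, (pcf p' 0).map (ev q) = pev p' q 0 := by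
    intro y; ext i j
    simp [pcf, pev, Polynomial.eval₂_at_zero]
  obtain ⟨U, hU⟩ : IsUnit (pcf p' 0) := by
    rw [isUnit_mat_iff]
    rintro ⟨s, y⟩
    rw [hc0]
    have := hdet s y ⟨1, by simp⟩
    simpa using this
  let d := m + ∑ i, ∑ j, (p' i j).natDegree
  have hd : ∀ i j, (p' i j).natDegree ≤ d + 1 := fun i j =>
    ((Finset.single_le_sum (f := fun j => (p' i j).natDegree) (fun _ _ => Nat.zero_le _) (Finset.mem_univ j)).trans
      (Finset.single_le_sum (f := fun i => ∑ j, (p' i j).natDegree) (fun _ _ => Nat.zero_le _) (Finset.mem_univ i))).trans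
      (by omega)
  let c := fun k : Fin (d+1) => (↑U⁻¹ : Matrix κ κ C(unitInterval × Y, ℂ)) * pcf p' (k+1)
  have hB : GoodC (Bc c) := by
    rintro ⟨s, y⟩
    rw [Bc_map]
    apply Bc_good
    intro z
    rw [pnorm p' U hU hd, Matrix.det_mul]
    exact mul_ne_zero (isUnit_mat_iff.1 U⁻¹.isUnit _) (hdet s y z)
  have hI := Iso.slices (sprC_idem (Bc c) hB) 0 1
  have key : ∀ (s : unitInterval) (Q : Matrix κ κ C(Y, ℂ)) (hQ : Q * Q = Q)
      (hk : ∀ y k i j, ev (s, y) ((p' i j).coeff k) = ev (s, y) ((Hp m Q i j).coeff k)),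
      kcl ((sprC (Bc c) hB).map (pb (sl s))) (idem_map _ (sprC_idem (Bc c) hB)) = m * Fintype.card κ + kcl Q hQ := by
    intro s Q hQ hk
    refine kcl_kq (d := d) (by omega) hQ _ ?_
    intro y
    have : ((sprC (Bc c) hB).map (pb (sl s))).map (ev y) = (sprC (Bc c) hB).map (ev (s, y)) := rfl
    rw [this, sprC_ev, Bc_map]
    congr 1
    apply Bc_end
    intro k i j
    have hU1 : (↑U : Matrix κ κ C(unitInterval × Y, ℂ)).map (ev (s, y)) = 1 := by
      rw [hU]; ext i j
      simp only [pcf, Matrix.map_apply, Matrix.of_apply]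
      rw [hk, Hp_coeff]; simp
    have hU2 : (↑U⁻¹ : Matrix κ κ C(unitInterval × Y, ℂ)).map (ev (s, y)) = 1 := by
      have := congrArg (fun M => M.map (ev (s, y))) (Units.inv_mul U)
      simpa only [Matrix.map_mul, hU1, mul_one, ev_one] using this
    show (((↑U⁻¹ : Matrix κ κ C(unitInterval × Y, ℂ)) * pcf p' (k+1)).map (ev (s, y))) i j = _
    rw [Matrix.map_mul, hU2, one_mul, Matrix.map_apply, pcf, Matrix.of_apply, hk, Hp_coeff]
    rfl
  have k0 := key 0 Q0 h0 (by
    intro y k i j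
    rw [pt_coeff]; simp)
  have k1 := key 1 Q1 h1 (by
    intro y k i j
    rw [pt_coeff]; simp)
  have := kcl_eq (he := (idem_map _ (sprC_idem (Bc c) hB))) (hf := (idem_map _ (sprC_idem (Bc c) hB))) hI
  rw [k0, k1] at this
  exact add_left_cancel this

end BottC2

end PK

namespace PK
open Matrix Topology
open scoped Kronecker
set_option linter.all false

section BottC3
variable {Y : Type} [TopologicalSpace Y] [CompactSpace Y]
variable {κ : Type} [Fintype κ] [DecidableEq κ]

theorem kcl_zero {A : Type} [CommRing A] {ν : Type} [Fintype ν] [DecidableEq ν] :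
    kcl (0 : Matrix ν ν A) (mul_zero _) = 0 := by
  have h := kcl_blocks (mul_zero (0 : Matrix ν ν A)) (mul_zero (0 : Matrix ν ν A))
  have h2 : kcl (fromBlocks (0 : Matrix ν ν A) 0 0 (0 : Matrix ν ν A)) (by simp) = kcl (0 : Matrix ν ν A) (mul_zero _) := by
    apply kcl_eq
    exact ⟨0, 0, by simp, by simp⟩
  rw [h2] at h
  simpa using h

theorem conv_stab {g g' : GLc κ Y} (h : cls g = cls g') : ∃ (n : ℕ)
    (wp wm : (Matrix (κ ⊕ Fin n) (κ ⊕ Fin n) C(Y × Dsk, ℂ))ˣ),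
    (wm : Matrix (κ ⊕ Fin n) (κ ⊕ Fin n) C(Y × Dsk, ℂ)).map (pb (idx Y bd)) * (fromBlocks (g : Matrix κ κ C(Y × S1, ℂ)) 0 0 1) = 
    (fromBlocks (g' : Matrix κ κ C(Y × S1, ℂ)) 0 0 1) * (wp : Matrix (κ ⊕ Fin n) (κ ⊕ Fin n) C(Y × Dsk, ℂ)).map (pb (idx Y bd)) := by
  obtain ⟨n, hn⟩ := kcl_eq_iff.1 h
  obtain ⟨wp, wm, hw⟩ := Clut.conv (sq Y) (Clut.add _ (eg_clut g) (Clut.one (sq Y) (κ := Fin n)))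
    (Clut.add _ (eg_clut g') (Clut.one (sq Y) (κ := Fin n))) hn
  exact ⟨n, wp, wm, hw⟩

/-- contraction of the circle to 1 in the disc -/
noncomputable def ctr (Y : Type) [TopologicalSpace Y] : C((unitInterval × Y) × S1, Y × Dsk) :=
  ⟨fun p => (p.1.2, ⟨(1 - ((p.1.1:ℝ):ℂ)) * p.2.1 + ((p.1.1:ℝ):ℂ), by
    refine (norm_add_le _ _).trans ?_
    have : (1 - ((p.1.1:ℝ):ℂ)) = ((1 - p.1.1 : ℝ) : ℂ) := by push_cast; rfl
    rw [this, norm_mul, Complex.norm_real, Complex.norm_real, p.2.2, Real.norm_of_nonneg p.1.1.2.1,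
      Real.norm_of_nonneg (by linarith [p.1.1.2.2])]
    linarith⟩), by fun_prop⟩

def one1 : S1 := ⟨1, by simp⟩

theorem ctr_zero (y : Y) (z : S1) : ctr Y ((0, y), z) = (y, bd z) := by
  simp [ctr, bd]

theorem ctr_one (y : Y) (z : S1) : ctr Y ((1, y), z) = (y, bd one1) := by
  simp [ctr, bd, one1]

def sndm (Y : Type) [TopologicalSpace Y] : C((unitInterval × Y) × S1, Y × S1) := ⟨fun p => (p.1.2, p.2), by fun_prop⟩
noncomputable def oneD (Y : Type) [TopologicalSpace Y] : C(Y, Y × Dsk) := ⟨fun y => (y, bd one1), by fun_prop⟩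

variable [T2Space Y]

theorem bottC' {Q0 Q1 : Matrix κ κ C(Y, ℂ)} (h0 : Q0 * Q0 = Q0) (h1 : Q1 * Q1 = Q1)
    (h : cls (qu Q0 h0) = cls (qu Q1 h1)) : kcl Q0 h0 = kcl Q1 h1 := by
  obtain ⟨n, wp, wm, hw⟩ := conv_stab h
  let N := κ ⊕ Fin n
  let Z0 : Matrix N N C(Y, ℂ) := fromBlocks Q0 0 0 0
  let Z1 : Matrix N N C(Y, ℂ) := fromBlocks Q1 0 0 0
  have i0 : Z0 * Z0 = Z0 := idem_blocks h0 (by simp)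
  have i1 : Z1 * Z1 = Z1 := idem_blocks h1 (by simp)
  have hz : ∀ (Q : Matrix κ κ C(Y, ℂ)) (hQ : Q * Q = Q), kcl (fromBlocks Q 0 0 (0 : Matrix (Fin n) (Fin n) C(Y, ℂ)))
     (idem_blocks hQ (by simp)) = kcl Q hQ := by
    intro Q hQ
    rw [kcl_blocks hQ (by simp)]
    rw [kcl_zero, add_zero]
  let c := umap (pb (oneD Y)) wm
  let Z2 : Matrix N N C(Y, ℂ) := (c : Matrix N N C(Y, ℂ)) * Z0 * (↑c⁻¹ : Matrix N N C(Y, ℂ))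
  have i2 : Z2 * Z2 = Z2 := by
    show (c : Matrix N N C(Y, ℂ)) * Z0 * (↑c⁻¹ : Matrix N N C(Y, ℂ)) * ((c : Matrix N N C(Y, ℂ)) * Z0 * (↑c⁻¹ : Matrix N N C(Y, ℂ))) = _
    rw [← mul_assoc, ← mul_assoc, Units.inv_mul_cancel_right, mul_assoc _ Z0 Z0, i0]
  have hI : kcl Z0 i0 = kcl Z2 i2 := by
    apply kcl_eq
    refine ⟨(c : Matrix N N C(Y, ℂ)) * Z0, Z0 * (↑c⁻¹ : Matrix N N C(Y, ℂ)), ?_, ?_⟩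
    · rw [← mul_assoc, mul_assoc _ Z0 Z0, i0]
    · rw [← mul_assoc, mul_assoc Z0, Units.inv_mul, mul_one, i0]
  -- evaluation of clutching data
  have hgev : ∀ (Q : Matrix κ κ C(Y, ℂ)) (hQ : Q * Q = Q) (y : Y) (z : S1),
     (fromBlocks (qu Q hQ : Matrix κ κ C(Y × S1, ℂ)) 0 0 (1 : Matrix (Fin n) (Fin n) C(Y × S1, ℂ))).map (ev (y, z)) =
      1 - (fromBlocks Q 0 0 (0 : Matrix (Fin n) (Fin n) C(Y, ℂ))).map (ev y) + (z:ℂ) • (fromBlocks Q 0 0 (0 : Matrix (Fin n) (Fin n) C(Y, ℂ))).map (ev y) := by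
    intro Q hQ y z
    ext (i | i) (j | j)
    · by_cases hij : i = j <;> simp [qu, qmat_apply, Matrix.one_apply, hij]
    · simp
    · simp
    · by_cases hij : i = j <;> simp [Matrix.one_apply, hij]
  have hwev : ∀ (y : Y) (z : S1), (wm : Matrix (κ ⊕ Fin n) (κ ⊕ Fin n) C(Y × Dsk, ℂ)).map (ev (y, bd z)) *
      (1 - Z0.map (ev y) + (z:ℂ) • Z0.map (ev y)) = (1 - Z1.map (ev y) + (z:ℂ) • Z1.map (ev y)) *
      (wp : Matrix (κ ⊕ Fin n) (κ ⊕ Fin n) C(Y × Dsk, ℂ)).map (ev (y, bd z)) := by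
    intro y z
    have := congrArg (fun M => M.map (ev (y, z))) hw
    simp only [Matrix.map_mul, hgev] at this
    exact this
  have hpm : ∀ y : Y, (wm : Matrix (κ ⊕ Fin n) (κ ⊕ Fin n) C(Y × Dsk, ℂ)).map (ev (y, bd one1)) = (wp : Matrix (κ ⊕ Fin n) (κ ⊕ Fin n) C(Y × Dsk, ℂ)).map (ev (y, bd one1)) := by
    intro y
    have := hwev y one1
    simpa [one1] using this
  have hinv : ∀ (w : (Matrix N N C(Y × Dsk, ℂ))ˣ) q, (w : Matrix (κ ⊕ Fin n) (κ ⊕ Fin n) C(Y × Dsk, ℂ)).map (ev q) * (↑w⁻¹ : Matrix (κ ⊕ Fin n) (κ ⊕ Fin n) C(Y × Dsk, ℂ)).map (ev q) = 1 := by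
    intro w q
    rw [← Matrix.map_mul, Units.mul_inv, ev_one]
  have hpm' : ∀ y : Y, (↑wm⁻¹ : Matrix (κ ⊕ Fin n) (κ ⊕ Fin n) C(Y × Dsk, ℂ)).map (ev (y, bd one1)) = (↑wp⁻¹ : Matrix (κ ⊕ Fin n) (κ ⊕ Fin n) C(Y × Dsk, ℂ)).map (ev (y, bd one1)) := by
    intro y
    have h1 := hinv wm (y, bd one1)
    have h2 := hinv wp (y, bd one1)
    rw [← hpm] at h2
    rw [← Matrix.inv_eq_right_inv h1, ← Matrix.inv_eq_right_inv h2]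
  let G := (umap (pb (ctr Y)) wm) * (umap (pb (sndm Y)) (uadd (qu Q0 h0) (1 : GLc (Fin n) Y))) * (umap (pb (ctr Y)) wp)⁻¹
  have hGev : ∀ t y z, (G : Matrix N N C((unitInterval × Y) × S1, ℂ)).map (ev ((t, y), z)) = 
     (wm : Matrix (κ ⊕ Fin n) (κ ⊕ Fin n) C(Y × Dsk, ℂ)).map (ev (ctr Y ((t, y), z))) * (1 - Z0.map (ev y) + (z:ℂ) • Z0.map (ev y)) *
      (↑wp⁻¹ : Matrix (κ ⊕ Fin n) (κ ⊕ Fin n) C(Y × Dsk, ℂ)).map (ev (ctr Y ((t, y), z))) := by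
    intro t y z
    rw [← hgev Q0 h0]
    simp only [G, Units.val_mul, Matrix.map_mul]
    rfl
  rw [← hz Q0 h0, ← hz Q1 h1]
  show kcl Z0 i0 = kcl Z1 i1
  rw [hI]
  symm
  refine flow Z1 Z2 i1 i2 (G : Matrix N N C((unitInterval × Y) × S1, ℂ)) (isUnit_mat_iff.1 G.isUnit) ?_ ?_
  · intro y z i j
    have := hGev 0 y z
    rw [ctr_zero, hwev, mul_assoc, hinv, mul_one] at this
    exact congrFun (congrFun this i) j
  · intro y z i j
    have := hGev 1 y z
    rw [ctr_one, ← hpm'] at this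
    have h2 : Z2.map (ev y) = (wm : Matrix (κ ⊕ Fin n) (κ ⊕ Fin n) C(Y × Dsk, ℂ)).map (ev (y, bd one1)) * Z0.map (ev y) * 
      (↑wm⁻¹ : Matrix (κ ⊕ Fin n) (κ ⊕ Fin n) C(Y × Dsk, ℂ)).map (ev (y, bd one1)) := by
      simp only [Z2, Matrix.map_mul]
      rfl
    rw [mul_add, add_mul, mul_sub, sub_mul, mul_one, hinv, Matrix.mul_smul, Matrix.smul_mul, ← h2] at this
    exact congrFun (congrFun this i) j

theorem bottC {b : K C(Y, ℂ)} (h : K.map (pb (ContinuousMap.fst : C(Y × S2, Y))) b * tt Y = 0) : b = 0 := by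
  obtain ⟨a, n, rfl⟩ := K.exists_rep b
  obtain ⟨Q, rfl⟩ : ∃ Q : IdM C(Y, ℂ), a = vcl Q.e Q.he := by
    induction a using Quotient.inductionOn with
    | h Q => exact ⟨Q, rfl⟩
  have e1 : cl (vcl Q.e Q.he) = kcl Q.e Q.he := rfl
  rw [e1] at h ⊢
  have i0 := idem_blocks Q.he (mul_zero (0 : Matrix (Fin n) (Fin n) C(Y, ℂ)))
  have i1 := idem_blocks (mul_zero (0 : Matrix Q.ι Q.ι C(Y, ℂ))) (mul_one (1 : Matrix (Fin n) (Fin n) C(Y, ℂ)))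
  have k0 : kcl _ i0 = kcl Q.e Q.he := by rw [kcl_blocks Q.he (mul_zero _), kcl_zero, add_zero]
  have k1 : kcl _ i1 = n := by rw [kcl_blocks (mul_zero _) (mul_one _), kcl_zero, zero_add, kcl_one, Fintype.card_fin]
  have := bottC' i0 i1 (by
    rw [cls_qu, cls_qu, k0, k1]
    rw [map_sub, sub_mul, sub_eq_zero] at h
    rw [h])
  rw [k0, k1] at this
  rw [this, sub_self]

end BottC3

end PK

namespace PK
open Matrix Topology
open scoped Kronecker
set_option linter.all false

variable {Y : Type} [TopologicalSpace Y] [CompactSpace Y]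
variable {κ : Type} [Fintype κ] [DecidableEq κ]

theorem qmat_mul' {R : Type} [CommRing R] (a b : R) {Q : Matrix κ κ R} (hQ : Q * Q = Q) :
    qmat a Q * qmat b Q = qmat (a * b) Q := by
  simp only [qmat, add_mul, mul_add, sub_mul, mul_sub, one_mul, mul_one, Matrix.smul_mul,
      Matrix.mul_smul, hQ, smul_smul, (mul_comm b a)]
  abel

theorem qmat_det {a : ℂ} (h : a ≠ 0) {Q : Matrix κ κ ℂ} (hQ : Q * Q = Q) : (qmat a Q).det ≠ 0 := by
  intro h0
  have := congrArg Matrix.det (qmat_mul (mul_inv_cancel₀ h) hQ)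
  simp [h0] at this

/-- unit with constant coefficient -/
noncomputable def quc (c : ℂ) (hc : c ≠ 0) (Q : Matrix κ κ C(Y, ℂ)) (hQ : Q * Q = Q) :
    (Matrix κ κ C(Y, ℂ))ˣ where
  val := qmat (ContinuousMap.const _ c) Q
  inv := qmat (ContinuousMap.const _ c⁻¹) Q
  val_inv := qmat_mul (by ext; simp [hc]) hQ
  inv_val := qmat_mul (by ext; simp [hc]) hQ

theorem qu_ev (Q : Matrix κ κ C(Y, ℂ)) (hQ : Q * Q = Q) (y : Y) (z : S1) :
    (qu Q hQ : Matrix κ κ C(Y × S1, ℂ)).map (ev (y, z)) = qmat z.1 (Q.map (ev y)) :=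
  qmat_map _ _ _

theorem quc_ev (c : ℂ) (hc : c ≠ 0) (Q : Matrix κ κ C(Y, ℂ)) (hQ : Q * Q = Q) (y : Y) :
    (quc c hc Q hQ : Matrix κ κ C(Y, ℂ)).map (ev y) = qmat c (Q.map (ev y)) :=
  qmat_map _ _ _

theorem loopcls (E E0 : Matrix κ κ C(Y, ℂ)) (hE : E * E = E) (hE0 : E0 * E0 = E0) (g : GLc κ Y)
    (hg : ∀ y z, (g : Matrix κ κ C(Y × S1, ℂ)).map (ev (y, z)) =
      ((z.1.re : ℝ) : ℂ) • (1 : Matrix κ κ ℂ) + (Complex.I * ((max z.1.im 0 : ℝ) : ℂ)) • ((2:ℂ) • E.map (ev y) - 1)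
       + (Complex.I * ((max (-z.1.im) 0 : ℝ) : ℂ)) • ((2:ℂ) • E0.map (ev y) - 1)) :
    cls g = (Fintype.card κ : K C(Y × S2, ℂ)) +
      K.map (pb ContinuousMap.fst) (kcl E hE - kcl E0 hE0) * tt Y := by
  let w : GLc κ Y := umap (pb (ContinuousMap.fst : C(Y × S1, Y))) (quc Complex.I Complex.I_ne_zero E hE) *
    qu E hE * umap (pb (ContinuousMap.fst : C(Y × S1, Y))) (quc (-Complex.I) (neg_ne_zero.2 Complex.I_ne_zero) (1 - E0) (idem_compl hE0)) *
     qu (1 - E0) (idem_compl hE0)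
  have h1 : cls (qu 1 (by simp) * g) = cls w := by
    let aa : unitInterval → S1 → ℂ := fun s z => (1 - ((s:ℝ):ℂ)) * (z.1.re + Complex.I * ((|z.1.im| : ℝ) : ℂ)) + ((s:ℝ):ℂ) * Complex.I
    let bb : unitInterval → S1 → ℂ := fun s z => (1 - ((s:ℝ):ℂ)) * (z.1.re - Complex.I * ((|z.1.im| : ℝ) : ℂ)) - ((s:ℝ):ℂ) * Complex.I
    have hnz : ∀ (s : unitInterval) (z : S1), ¬ ((1 - (s:ℝ)) * z.1.re = 0 ∧ (1 - (s:ℝ)) * |z.1.im| + s = 0) := by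
      rintro s z ⟨h, h'⟩
      have hs0 := s.2.1
      have hs1 := s.2.2
      have := mul_nonneg (sub_nonneg.2 hs1) (abs_nonneg z.1.im)
      have hs : (s:ℝ) = 0 := by linarith
      rw [hs] at h h'
      simp at h h'
      exact s1_ne z (Complex.ext h h')
    have ha : ∀ s z, aa s z ≠ 0 := by
      intro s z h
      refine hnz s z ⟨?_, ?_⟩
      · simpa [aa] using congrArg Complex.re h
      · simpa [aa] using congrArg Complex.im h
    have hb : ∀ s z, bb s z ≠ 0 := by
      intro s z h
      refine hnz s z ⟨?_, ?_⟩
      · simpa [bb] using congrArg Complex.re h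
      · have h2 := congrArg Complex.im h
        simp [bb] at h2
        linarith
    refine cls_hom (fun s p => qmat (p.2.1 * aa s p.2) (E.map (ev p.1)) * qmat (p.2.1 * bb s p.2) ((1 - E0).map (ev p.1))) ?_ ?_ ?_ ?_
    · intro i j
      simp only [Matrix.mul_apply, qmat_apply, Matrix.map_apply, aa, bb]
      have h1 : ∀ i j, Continuous fun y : Y => (ev y (E i j) : ℂ) := fun i j => (E i j).continuous
      have h2 : ∀ i j, Continuous fun y : Y => (ev y ((1 - E0) i j) : ℂ) := fun i j => ((1 - E0) i j).continuous
      have h1' : ∀ i j, Continuous fun y : unitInterval × Y × S1 => (ev y.2.1 (E i j) : ℂ) := fun i j => (h1 i j).comp (by fun_prop)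
      have h2' : ∀ i j, Continuous fun y : unitInterval × Y × S1 => (ev y.2.1 ((1 - E0) i j) : ℂ) := fun i j => (h2 i j).comp (by fun_prop)
      fun_prop
    · intro t p
      rw [Matrix.det_mul]
      exact mul_ne_zero (qmat_det (mul_ne_zero (s1_ne _) (ha _ _)) (idem_map _ hE)) (qmat_det (mul_ne_zero (s1_ne _) (hb _ _)) (idem_map _ (idem_compl hE0)))
    · rintro ⟨y, z⟩
      rw [Units.val_mul, Matrix.map_mul, hg, qu_ev, ev_one]
      have e0 : (1 - E0).map (ev y) = 1 - E0.map (ev y) := by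
        rw [Matrix.map_sub _ (map_sub _), ev_one]
      rw [e0]
      have hn : (z.1.re:ℂ)^2 + (z.1.im:ℂ)^2 = 1 := by
        have := z.2
        rw [← sq_eq_sq₀ (norm_nonneg _) zero_le_one, ← Complex.normSq_eq_norm_sq, Complex.normSq_apply] at this
        have h3 : z.1.re^2 + z.1.im^2 = 1 := by nlinarith
        exact_mod_cast h3
      have hz : z.1 = (z.1.re:ℂ) + z.1.im * Complex.I := (Complex.re_add_im _).symm
      have hEE : E.map (ev y) * E.map (ev y) = E.map (ev y) := idem_map _ hE
      have hEE0 : E0.map (ev y) * E0.map (ev y) = E0.map (ev y) := idem_map _ hE0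
      generalize E.map (ev y) = e at *
      generalize E0.map (ev y) = e' at *
      rcases le_total 0 z.1.im with him | him
      · have hb1 : z.1 * bb 0 z = 1 := by
          simp only [bb, abs_of_nonneg him]
          simp only [Set.Icc.coe_zero]; push_cast
          linear_combination hn - (z.1.im:ℂ)^2 * Complex.I_sq + ((z.1.re:ℂ) - z.1.im * Complex.I) * hz
        have ha1 : aa 0 z = z.1 := by
          simp only [aa, abs_of_nonneg him]
          simp only [Set.Icc.coe_zero]; push_cast
          linear_combination - hz
        simp only [hb1, ha1]
        rw [max_eq_left him, max_eq_right (by linarith)]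
        ext i j
        simp [qmat, Matrix.add_apply, Matrix.sub_apply, Matrix.smul_apply]
        have hz2 : z.1 * ((z.1.re:ℂ) - z.1.im * Complex.I) = 1 := by
          linear_combination hn - (z.1.im:ℂ)^2 * Complex.I_sq + ((z.1.re:ℂ) - z.1.im * Complex.I) * hz
        have hz3 : z.1 * z.1 = z.1 * ((z.1.re:ℂ) - z.1.im * Complex.I) + 2 * z.1 * z.1.im * Complex.I := by
          linear_combination z.1 * hz
        by_cases hij : i = j
        · subst hij; simp
          linear_combination (e i i - 1) * hz2 + (e i i) * hz3
        · simp [hij]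
          linear_combination (e i j) * hz2 + (e i j) * hz3
      · have hb1 : z.1 * aa 0 z = 1 := by
          simp only [aa, abs_of_nonpos him]
          simp only [Set.Icc.coe_zero]; push_cast
          linear_combination hn - (z.1.im:ℂ)^2 * Complex.I_sq + ((z.1.re:ℂ) - z.1.im * Complex.I) * hz
        have ha1 : bb 0 z = z.1 := by
          simp only [bb, abs_of_nonpos him]
          simp only [Set.Icc.coe_zero]; push_cast
          linear_combination - hz
        simp only [hb1, ha1]
        rw [max_eq_right him, max_eq_left (by linarith)]
        ext i j
        simp [qmat, Matrix.add_apply, Matrix.sub_apply, Matrix.smul_apply]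
        have hz2 : z.1 * ((z.1.re:ℂ) - z.1.im * Complex.I) = 1 := by
          linear_combination hn - (z.1.im:ℂ)^2 * Complex.I_sq + ((z.1.re:ℂ) - z.1.im * Complex.I) * hz
        have hz3 : z.1 * z.1 = z.1 * ((z.1.re:ℂ) + z.1.im * Complex.I) := by
          linear_combination z.1 * hz
        by_cases hij : i = j
        · subst hij; simp
          linear_combination (-e' i i) * hz2 - (e' i i - 1) * hz3
        · simp [hij]
          linear_combination (-e' i j) * hz2 - (e' i j) * hz3
    · rintro ⟨y, z⟩
      simp only [w, Units.val_mul, Matrix.map_mul, qu_ev, umap_coe]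
      have e1 : ((quc Complex.I Complex.I_ne_zero E hE : Matrix κ κ C(Y, ℂ)).map (pb (ContinuousMap.fst : C(Y × S1, Y)))).map (ev (y, z)) = qmat Complex.I (E.map (ev y)) := quc_ev _ Complex.I_ne_zero _ hE y
      have e2 : ((quc (-Complex.I) (neg_ne_zero.2 Complex.I_ne_zero) (1 - E0) (idem_compl hE0) : Matrix κ κ C(Y, ℂ)).map (pb (ContinuousMap.fst : C(Y × S1, Y)))).map (ev (y, z)) = qmat (-Complex.I) ((1 - E0).map (ev y)) := quc_ev _ (neg_ne_zero.2 Complex.I_ne_zero) _ (idem_compl hE0) y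
      rw [e1, e2, qmat_mul' _ _ (idem_map _ hE), mul_assoc, qmat_mul' _ _ (idem_map _ (idem_compl hE0))]
      simp [aa, bb, mul_comm]
  have h2 := cls_mul (qu 1 (by simp) : GLc κ Y) g
  rw [h1, cls_qu, kcl_one, map_natCast] at h2
  have m1 := cls_mul (umap (pb (ContinuousMap.fst : C(Y × S1, Y))) (quc Complex.I Complex.I_ne_zero E hE) *
    qu E hE * umap (pb (ContinuousMap.fst : C(Y × S1, Y))) (quc (-Complex.I) (neg_ne_zero.2 Complex.I_ne_zero) (1 - E0) (idem_compl hE0))) (qu (1 - E0) (idem_compl hE0))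
  have m2 := cls_mul (umap (pb (ContinuousMap.fst : C(Y × S1, Y))) (quc Complex.I Complex.I_ne_zero E hE) *
    qu E hE) (umap (pb (ContinuousMap.fst : C(Y × S1, Y))) (quc (-Complex.I) (neg_ne_zero.2 Complex.I_ne_zero) (1 - E0) (idem_compl hE0)))
  have m3 := cls_mul (umap (pb (ContinuousMap.fst : C(Y × S1, Y))) (quc Complex.I Complex.I_ne_zero E hE)) (qu E hE)
  rw [cls_const] at m2 m3
  rw [cls_qu] at m1 m3
  rw [kcl_compl, map_sub, map_natCast] at m1
  rw [map_sub]
  swap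
  · exact hE0
  linear_combination -h2 + m1 + m2 + m3
end PK

namespace PK
open Matrix Topology
open scoped Kronecker
set_option linter.all false

section triv
variable {𝕜 : Type} [RCLike 𝕜]

/-- bundles over contractible spaces are trivial -/
theorem triv_contr {Z : Type} [TopologicalSpace Z] [CompactSpace Z] {ι : Type} [Fintype ι] [DecidableEq ι]
    {e : Matrix ι ι C(Z, 𝕜)} (he : e * e = e) (z0 : Z)
    (h : (ContinuousMap.id Z).Homotopic (ContinuousMap.const Z z0)) :
    ∃ (u : Matrix ι (Fin (e.map (ev z0)).rank) C(Z, 𝕜)) (v : Matrix (Fin (e.map (ev z0)).rank) ι C(Z, 𝕜)),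
      u * v = e ∧ v * u = 1 := by
  have h1 := Iso.homotopic he h
  have h2 : e.map (pb (ContinuousMap.id Z)) = e := by ext; rfl
  rw [h2] at h1
  let c : 𝕜 →+* C(Z, 𝕜) := ⟨⟨⟨fun a => ContinuousMap.const Z a, rfl⟩, fun _ _ => rfl⟩, rfl, fun _ _ => rfl⟩
  have h3 := Iso.map c (Iso.field (idem_map (ev z0) he))
  have h4 : (e.map (ev z0)).map c = e.map (pb (ContinuousMap.const Z z0)) := by ext; rfl
  rw [h4, Matrix.map_one _ (map_zero _) (map_one _)] at h3
  obtain ⟨u, v, h5, h6⟩ := h1.trans he (by simp) h3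
  exact ⟨v, u, h6, h5⟩
end triv

section sph
variable {ι : Type} [Fintype ι] [DecidableEq ι]

/-- unit sphere -/
abbrev Sph (ι : Type) [Fintype ι] : Type := {y : ι → ℝ // ∑ i, y i ^ 2 = 1}
/-- unit ball -/
abbrev Bal (ι : Type) [Fintype ι] : Type := {y : ι → ℝ // ∑ i, y i ^ 2 ≤ 1}

theorem coord_le {y : ι → ℝ} (h : ∑ i, y i ^ 2 ≤ 1) (i : ι) : |y i| ≤ 1 := by
  have := Finset.single_le_sum (f := fun i => y i ^ 2) (fun i _ => sq_nonneg _) (Finset.mem_univ i)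
  rw [← sq_le_one_iff_abs_le_one]
  exact this.trans h

instance : CompactSpace (Bal ι) := by
  refine isCompact_iff_compactSpace.1 (?_ : IsCompact {y : ι → ℝ | ∑ i, y i ^ 2 ≤ 1})
  refine Metric.isCompact_of_isClosed_isBounded (isClosed_le (by fun_prop) (by fun_prop)) ?_
  refine (Metric.isBounded_closedBall (x := (0 : ι → ℝ)) (r := 1)).subset ?_
  intro y hy
  rw [mem_closedBall_zero_iff, pi_norm_le_iff_of_nonneg zero_le_one]
  exact fun i => coord_le hy i

instance : CompactSpace (Sph ι) := by
  refine isCompact_iff_compactSpace.1 (?_ : IsCompact {y : ι → ℝ | ∑ i, y i ^ 2 = 1})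
  refine (isCompact_iff_compactSpace.2 (inferInstance : CompactSpace (Bal ι)) : IsCompact {y : ι → ℝ | ∑ i, y i ^ 2 ≤ 1}).of_isClosed_subset
    (isClosed_eq (by fun_prop) (by fun_prop)) (fun y hy => le_of_eq hy)

/-- cons for option -/
def oc {α : Type} (a : α) (y : ι → α) : Option ι → α := fun o => o.elim a y

@[simp] theorem oc_none {α : Type} (a : α) (y : ι → α) : oc a y none = a := rfl
@[simp] theorem oc_some {α : Type} (a : α) (y : ι → α) (i : ι) : oc a y (some i) = y i := rfl

theorem oc_eta {α : Type} (y : Option ι → α) : y = oc (y none) (fun i => y (some i)) := by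
  funext o; cases o <;> rfl

theorem oc_cont {Z : Type*} [TopologicalSpace Z] {α : Type} [TopologicalSpace α] {a : Z → α} {y : Z → ι → α} (ha : Continuous a)
    (hy : Continuous y) : Continuous fun z => oc (a z) (y z) := by
  refine continuous_pi fun o => ?_
  cases o with
  | none => exact ha
  | some i => exact (continuous_apply i).comp hy

theorem ball_sq (v : Bal ι) : 0 ≤ 1 - ∑ i, v.1 i ^ 2 := sub_nonneg.2 v.2

theorem nsq_cont : Continuous fun v : Bal ι => √(1 - ∑ i, v.1 i ^ 2) :=
  Real.continuous_sqrt.comp (continuous_const.sub (continuous_finset_sum _ fun i _ =>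
    (((continuous_apply i).comp continuous_subtype_val).pow 2)))

theorem hp_mem (v : Bal ι) : ∑ i, oc (√(1 - ∑ i, v.1 i ^ 2)) v.1 i ^ 2 = 1 := by
  simp [Fintype.sum_option, Real.sq_sqrt (ball_sq v)]
theorem hm_mem (v : Bal ι) : ∑ i, oc (-√(1 - ∑ i, v.1 i ^ 2)) v.1 i ^ 2 = 1 := by
  simp [Fintype.sum_option, Real.sq_sqrt (ball_sq v)]

/-- upper hemisphere -/
noncomputable def hp : C(Bal ι, Sph (Option ι)) :=
  ⟨fun v => ⟨oc (√(1 - ∑ i, v.1 i ^ 2)) v.1, hp_mem v⟩,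
    Continuous.subtype_mk (oc_cont nsq_cont continuous_subtype_val) _⟩
/-- lower hemisphere -/
noncomputable def hm : C(Bal ι, Sph (Option ι)) :=
  ⟨fun v => ⟨oc (-√(1 - ∑ i, v.1 i ^ 2)) v.1, hm_mem v⟩,
    Continuous.subtype_mk (oc_cont nsq_cont.neg continuous_subtype_val) _⟩

/-- boundary inclusion -/
def bdb : C(Sph ι, Bal ι) := ⟨fun y => ⟨y.1, y.2.le⟩, by fun_prop⟩

theorem hp_bdb (y : Sph ι) : hp (bdb y) = hm (bdb y) := by
  apply Subtype.ext
  simp [hp, hm, bdb, y.2]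

/-- centre -/
def b0 : Bal ι := ⟨0, by simp⟩

theorem bal_mem (p : unitInterval × Bal ι) : ∑ i, ((1 - (p.1:ℝ)) • p.2.1) i ^ 2 ≤ 1 := by
  have h1 : ∑ i, ((1 - (p.1:ℝ)) • p.2.1) i ^ 2 = (1 - (p.1:ℝ))^2 * ∑ i, p.2.1 i ^ 2 := by
    simp [mul_pow, Finset.mul_sum]
  rw [h1]
  have h2 := p.1.2.1
  have h3 := p.1.2.2
  have h4 : (1 - (p.1:ℝ))^2 ≤ 1 := by nlinarith
  have h5 : 0 ≤ ∑ i, p.2.1 i ^ 2 := Finset.sum_nonneg fun i _ => sq_nonneg _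
  nlinarith [p.2.2, sq_nonneg (1 - (p.1:ℝ))]

theorem bal_contr : (ContinuousMap.id (Bal ι)).Homotopic (ContinuousMap.const _ b0) := by
  refine ⟨⟨⟨fun p => ⟨(1 - (p.1:ℝ)) • p.2.1, bal_mem p⟩, Continuous.subtype_mk (by fun_prop) _⟩, ?_, ?_⟩⟩
  · intro v; apply Subtype.ext; simp
  · intro v; apply Subtype.ext; simp [b0]

theorem triv_bal {𝕜 : Type} [RCLike 𝕜] {ν : Type} [Fintype ν] [DecidableEq ν] {e : Matrix ν ν C(Bal ι, 𝕜)} (he : e * e = e) :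
    ∃ (r : ℕ) (u : Matrix ν (Fin r) C(Bal ι, 𝕜)) (v : Matrix (Fin r) ν C(Bal ι, 𝕜)), u * v = e ∧ v * u = 1 :=
  ⟨_, triv_contr he b0 bal_contr⟩


/-- point on the sphere -/
def sgl (i0 : ι) (s : ℝ) (hs : s ^ 2 = 1) : Sph ι := ⟨Pi.single i0 s, by simp [Pi.single_apply, hs]⟩

theorem sph_ne [Nonempty ι] : Nonempty (Sph ι) := by
  obtain ⟨i0⟩ := ‹Nonempty ι›
  exact ⟨sgl i0 1 (by simp)⟩

theorem rank_trace {𝕜 : Type} [RCLike 𝕜] {Z : Type} [TopologicalSpace Z] {ν : Type} [Fintype ν] [DecidableEq ν] {s : ℕ} {u : Matrix ν (Fin s) C(Z, 𝕜)} {v : Matrix (Fin s) ν C(Z, 𝕜)} {f : Matrix ν ν C(Z, 𝕜)}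
    (h1 : u * v = f) (h2 : v * u = 1) (z : Z) : (s : 𝕜) = (f.map (ev z)).trace := by
  rw [← h1, Matrix.map_mul, Matrix.trace_mul_comm, ← Matrix.map_mul, h2, Matrix.map_one _ (map_zero _) (map_one _)]
  simp

theorem bundle_clutch {𝕜 : Type} [RCLike 𝕜] [Nonempty ι] {ν : Type} [Fintype ν] [DecidableEq ν] {e : Matrix ν ν C(Sph (Option ι), 𝕜)} (he : e * e = e) :
    ∃ (r : ℕ) (up um : Matrix ν (Fin r) C(Bal ι, 𝕜)) (vp vm : Matrix (Fin r) ν C(Bal ι, 𝕜)),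
      up * vp = e.map (pb hp) ∧ um * vm = e.map (pb hm) ∧ vp * up = 1 ∧ vm * um = 1 := by
  obtain ⟨r, up, vp, h1, h2⟩ := triv_bal (e := e.map (pb (𝕜 := 𝕜) (hp (ι := ι)))) (idem_map _ he)
  obtain ⟨r', um, vm, h3, h4⟩ := triv_bal (e := e.map (pb (𝕜 := 𝕜) (hm (ι := ι)))) (idem_map _ he)
  obtain ⟨y⟩ := sph_ne (ι := ι)
  have e1 := rank_trace h1 h2 (bdb y)
  have e2 := rank_trace h3 h4 (bdb y)
  have e3 : (e.map (pb hp)).map (ev (𝕜 := 𝕜) (bdb y)) = (e.map (pb hm)).map (ev (bdb y)) := by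
    ext i j
    exact congrArg (e i j) (hp_bdb y)
  rw [e3, ← e2] at e1
  have : r = r' := Nat.cast_injective (R := 𝕜) e1
  subst this
  exact ⟨r, up, um, vp, vm, h1, h3, h2, h4⟩
end sph
end PK

namespace PK
open Matrix Topology
open scoped Kronecker
set_option linter.all false

variable {ι : Type} [Fintype ι] [DecidableEq ι]
variable {X : Type} [TopologicalSpace X] [CompactSpace X]
variable {κ : Type} [Fintype κ] [DecidableEq κ]

/-- polar coordinates -/
noncomputable def vec (y y0 : ι → ℝ) (z : ℂ) : Option ι → ℝ :=
  oc z.re (fun i => max z.im 0 * y i + max (-z.im) 0 * y0 i)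

theorem vec_sq (y y0 : Sph ι) (z : ℂ) : ∑ i, vec y.1 y0.1 z i ^ 2 = ‖z‖ ^ 2 := by
  rw [← Complex.normSq_eq_norm_sq, Complex.normSq_apply, Fintype.sum_option]
  simp only [vec, oc_none, oc_some]
  rcases le_total 0 z.im with h | h
  · rw [max_eq_left h, max_eq_right (by linarith)]
    simp only [zero_mul, add_zero, mul_pow, ← Finset.mul_sum, y.2]; ring
  · rw [max_eq_right h, max_eq_left (by linarith)]
    simp only [zero_mul, zero_add, mul_pow, ← Finset.mul_sum, y0.2]; ring

theorem vec_smul (y y0 : ι → ℝ) (r : ℝ) (hr : 0 ≤ r) (z : ℂ) : vec y y0 ((r:ℂ) * z) = fun i => r * vec y y0 z i := by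
  funext o
  cases o with
  | none => simp [vec]
  | some i =>
    simp only [vec, oc_some, Complex.re_ofReal_mul, Complex.im_ofReal_mul]
    have h1 : max (r * z.im) 0 = r * max z.im 0 := by
      rw [mul_max_of_nonneg _ _ hr, mul_zero]
    have h2 : max (-(r * z.im)) 0 = r * max (-z.im) 0 := by
      rw [mul_max_of_nonneg _ _ hr, mul_zero, mul_neg]
    rw [h1, h2]; ring

theorem vec_cont {Z : Type*} [TopologicalSpace Z] {y : Z → ι → ℝ} (hy : Continuous y) (y0 : ι → ℝ) {z : Z → ℂ} (hz : Continuous z) :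
    Continuous fun p => vec (y p) y0 (z p) := by
  unfold vec
  refine oc_cont (by fun_prop) (continuous_pi fun i => ?_)
  have : Continuous fun p => y p i := (continuous_apply i).comp hy
  fun_prop

variable (yv : C(X, Sph ι)) (y0 : Sph ι)

theorem yv_cont : Continuous fun x => (yv x).1 := continuous_subtype_val.comp yv.continuous

theorem pv_mem (p : X × S1) : ∑ i, vec (yv p.1).1 y0.1 p.2.1 i ^ 2 = 1 := by
  rw [vec_sq, p.2.2, one_pow]
theorem bv_mem (p : X × Dsk) : ∑ i, vec (yv p.1).1 y0.1 p.2.1 i ^ 2 ≤ 1 := by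
  rw [vec_sq]; exact pow_le_one₀ (norm_nonneg _) p.2.2
theorem sv_mem (p : X × S2) : ∑ i, oc p.2.1.2 (vec (yv p.1).1 y0.1 p.2.1.1) i ^ 2 = 1 := by
  rw [Fintype.sum_option]
  simp only [oc_none, oc_some]
  rw [vec_sq, add_comm, p.2.2]

/-- map to the odd sphere -/
noncomputable def pv : C(X × S1, Sph (Option ι)) :=
  ⟨fun p => ⟨vec (yv p.1).1 y0.1 p.2.1, pv_mem yv y0 p⟩, Continuous.subtype_mk (vec_cont ((yv_cont yv).comp continuous_fst) _ (continuous_subtype_val.comp continuous_snd)) _⟩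
/-- map to the ball -/
noncomputable def bv : C(X × Dsk, Bal (Option ι)) :=
  ⟨fun p => ⟨vec (yv p.1).1 y0.1 p.2.1, bv_mem yv y0 p⟩, Continuous.subtype_mk (vec_cont ((yv_cont yv).comp continuous_fst) _ (continuous_subtype_val.comp continuous_snd)) _⟩
/-- map to the next sphere -/
noncomputable def sv : C(X × S2, Sph (Option (Option ι))) :=
  ⟨fun p => ⟨oc p.2.1.2 (vec (yv p.1).1 y0.1 p.2.1.1), sv_mem yv y0 p⟩, Continuous.subtype_mk (oc_cont (continuous_snd.comp (continuous_subtype_val.comp continuous_snd)) (vec_cont ((yv_cont yv).comp continuous_fst) _ (continuous_fst.comp (continuous_subtype_val.comp continuous_snd)))) _⟩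

theorem hp_bv : (sv yv y0).comp (idx X jp) = hp.comp (bv yv y0) := by
  ext p : 1
  apply Subtype.ext
  show oc _ _ = oc _ _
  have := vec_sq (yv p.1) y0 p.2.1
  simp only [bv, ContinuousMap.coe_mk, this]
  rfl
theorem hm_bv : (sv yv y0).comp (idx X jm) = hm.comp (bv yv y0) := by
  ext p : 1
  apply Subtype.ext
  show oc _ _ = oc _ _
  have := vec_sq (yv p.1) y0 p.2.1
  simp only [bv, ContinuousMap.coe_mk, this]
  rfl
theorem bdb_pv : (bv yv y0).comp (idx X bd) = bdb.comp (pv yv y0) := rfl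

/-- all bundles on the even sphere come from clutching -/
theorem sv_clut {ν : Type} [Fintype ν] [DecidableEq ν] {e : Matrix ν ν C(Sph (Option (Option ι)), ℂ)} (he : e * e = e) :
    ∃ (r : ℕ) (h : (Matrix (Fin r) (Fin r) C(Sph (Option ι), ℂ))ˣ),
      K.map (pb (sv yv y0)) (kcl e he) = cls (umap (pb (pv yv y0)) h) := by
  obtain ⟨r, up, um, vp, vm, h1, h2, h3, h4⟩ := bundle_clutch (ι := Option ι) he
  have hpm : (e.map (pb (𝕜 := ℂ) (hp (ι := Option ι)))).map (pb bdb) = (e.map (pb hm)).map (pb bdb) := by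
    ext i j y
    exact congrArg (e i j) (hp_bdb y)
  have key : ∀ {a b : Matrix ν (Fin r) C(Bal (Option ι), ℂ)} {c d : Matrix (Fin r) ν C(Bal (Option ι), ℂ)},
      (a * d).map (pb (𝕜 := ℂ) bdb) = (b * c).map (pb bdb) → c * b = 1 → d * a = 1 → 
      (c.map (pb (𝕜 := ℂ) bdb) * a.map (pb bdb)) * (d.map (pb bdb) * b.map (pb bdb)) = 1 := by
    intro a b c d k1 k2 k3
    rw [Matrix.mul_assoc, ← Matrix.mul_assoc (a.map _), ← Matrix.map_mul (L := a), k1, ← Matrix.map_mul, ← Matrix.map_mul,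
      ← Matrix.mul_assoc, ← Matrix.mul_assoc, k2, Matrix.one_mul, k2, Matrix.map_one _ (map_zero _) (map_one _)]
  let h : (Matrix (Fin r) (Fin r) C(Sph (Option ι), ℂ))ˣ :=
    ⟨vm.map (pb bdb) * up.map (pb bdb), vp.map (pb bdb) * um.map (pb bdb),
      key (by rw [h1, h2, hpm]) h4 h3, key (by rw [h1, h2, hpm]) h3 h4⟩
  refine ⟨r, h, ?_⟩
  rw [kcl_map]
  symm
  refine cls_of_clut _ ⟨up.map (pb (bv yv y0)), um.map (pb (bv yv y0)), vp.map (pb (bv yv y0)), vm.map (pb (bv yv y0)), ?_, ?_, ?_, ?_, ?_⟩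
  · rw [← Matrix.map_mul, h1]
    ext i j p
    exact congrArg (e i j) (ContinuousMap.congr_fun (hp_bv yv y0) p).symm
  · rw [← Matrix.map_mul, h2]
    ext i j p
    exact congrArg (e i j) (ContinuousMap.congr_fun (hm_bv yv y0) p).symm
  · rw [← Matrix.map_mul, h3, Matrix.map_one _ (map_zero _) (map_one _)]
  · rw [← Matrix.map_mul, h4, Matrix.map_one _ (map_zero _) (map_one _)]
  · rw [umap_coe]
    show _ = (vm.map (pb bdb) * up.map (pb bdb)).map _
    rw [Matrix.map_mul]
    rfl
end PK

namespace PK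
open Matrix Topology
open scoped Kronecker
set_option linter.all false

section cliff
variable {ι : Type} [Fintype ι] [DecidableEq ι]
variable {κ κ' : Type} [Fintype κ] [DecidableEq κ]
variable {X : Type} [TopologicalSpace X] [CompactSpace X]

/-- continuous families of matrices -/
def mkC {Z : Type} [TopologicalSpace Z] {𝕜 : Type} [RCLike 𝕜] (M : Z → Matrix κ κ' 𝕜) (h : Continuous M) : Matrix κ κ' C(Z, 𝕜) :=
  Matrix.of fun i j => ⟨fun z => M z i j, h.matrix_elem i j⟩

@[simp] theorem mkC_ev {Z : Type} [TopologicalSpace Z] {𝕜 : Type} [RCLike 𝕜] (M : Z → Matrix κ κ' 𝕜) (h : Continuous M) (z : Z) :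
    (mkC M h).map (ev z) = M z := rfl

/-- linear combination of gamma matrices -/
def FC (γ : ι → Matrix κ κ ℂ) (y : ι → ℂ) : Matrix κ κ ℂ := ∑ i, y i • γ i

/-- Clifford relation -/
def Cl (γ : ι → Matrix κ κ ℂ) : Prop := ∀ y : ι → ℂ, FC γ y * FC γ y = (∑ i, y i ^ 2) • 1

/-- next gamma matrices -/
def gs (γ : ι → Matrix κ κ ℂ) : Option (Option ι) → Matrix (κ ⊕ κ) (κ ⊕ κ) ℂ :=
  oc (fromBlocks 1 0 0 (-1)) (oc (fromBlocks 0 1 1 0) (fun i => fromBlocks 0 (-Complex.I • γ i) (Complex.I • γ i) 0))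

theorem gs_FC (γ : ι → Matrix κ κ ℂ) (s x : ℂ) (y : ι → ℂ) : FC (gs γ) (oc s (oc x y)) =
    fromBlocks (s • 1) (x • 1 - Complex.I • FC γ y) (x • 1 + Complex.I • FC γ y) (-(s • 1)) := by
  have h : ∑ i, y i • fromBlocks (0 : Matrix κ κ ℂ) (-Complex.I • γ i) (Complex.I • γ i) 0 =
    fromBlocks 0 (- (Complex.I • FC γ y)) (Complex.I • FC γ y) 0 := by
    ext i j
    rcases i with i | i <;> rcases j with j | j <;>
      simp [Matrix.sum_apply, FC, Finset.mul_sum, mul_left_comm]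
  simp only [FC, Fintype.sum_option, gs, oc_none, oc_some]
  rw [h]
  simp only [fromBlocks_smul, fromBlocks_add, FC]
  congr 1 <;> simp [sub_eq_add_neg]

theorem gs_Cl {γ : ι → Matrix κ κ ℂ} (h : Cl γ) : Cl (gs γ) := by
  intro y
  have e1 := h (fun i => y (some (some i)))
  rw [oc_eta y, oc_eta (fun i => y (some i)), gs_FC, fromBlocks_multiply]
  simp only [Fintype.sum_option, oc_none, oc_some]
  generalize FC γ _ = F at *
  rw [← fromBlocks_one, fromBlocks_smul]
  have hI : Complex.I * Complex.I = -1 := Complex.I_mul_I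
  congr 1
  · simp only [sub_mul, mul_add, smul_mul_smul_comm, mul_one, one_mul, e1, hI]
    module
  · simp only [sub_mul, mul_add, mul_sub, smul_mul_smul_comm, mul_one, one_mul, e1, hI, mul_neg, neg_mul]
    module
  · simp only [sub_mul, mul_add, mul_sub, add_mul, smul_mul_smul_comm, mul_one, one_mul, e1, hI, mul_neg, neg_mul]
    module
  · simp only [sub_mul, mul_add, mul_sub, add_mul, smul_mul_smul_comm, mul_one, one_mul, e1, hI, mul_neg, neg_mul]
    module

theorem FC_cont (γ : ι → Matrix κ κ ℂ) {Z : Type*} [TopologicalSpace Z] {y : Z → ι → ℂ} (hy : Continuous y) :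
    Continuous fun z => FC γ (y z) := by
  unfold FC
  refine continuous_finset_sum _ fun i _ => ?_
  exact ((continuous_apply i).comp hy).smul continuous_const

/-- real version -/
def rF (γ : ι → Matrix κ κ ℂ) (y : ι → ℝ) : Matrix κ κ ℂ := FC γ (fun i => (y i : ℂ))

theorem rF_cont (γ : ι → Matrix κ κ ℂ) {Z : Type*} [TopologicalSpace Z] {y : Z → ι → ℝ} (hy : Continuous y) :
    Continuous fun z => rF γ (y z) :=
  FC_cont γ (continuous_pi fun i => Complex.continuous_ofReal.comp ((continuous_apply i).comp hy))

theorem rF_sq {γ : ι → Matrix κ κ ℂ} (h : Cl γ) (y : Sph ι) : rF γ y.1 * rF γ y.1 = 1 := by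
  rw [rF, h]
  have : ∑ i, (y.1 i : ℂ) ^ 2 = 1 := by exact_mod_cast y.2
  rw [this, one_smul]

theorem gs_rF (γ : ι → Matrix κ κ ℂ) (s x : ℝ) (y : ι → ℝ) : rF (gs γ) (oc s (oc x y)) =
    fromBlocks ((s:ℂ) • 1) ((x:ℂ) • 1 - Complex.I • rF γ y) ((x:ℂ) • 1 + Complex.I • rF γ y) (-((s:ℂ) • 1)) := by
  have h1 := gs_FC γ s x (fun i => (y i:ℂ))
  have h2 : (oc (s:ℂ) (oc (x:ℂ) (fun i => (y i:ℂ))) : Option (Option ι) → ℂ) = fun o => ((oc s (oc x y) o : ℝ) : ℂ) := by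
    funext o
    rcases o with _ | _ | i <;> rfl
  rw [h2] at h1
  exact h1

theorem half_idem {F : Matrix κ κ ℂ} (h : F * F = 1) :
    ((2⁻¹:ℂ) • (1 + F)) * ((2⁻¹:ℂ) • (1 + F)) = (2⁻¹:ℂ) • (1 + F) := by
  rw [smul_mul_smul_comm, add_mul, mul_add, mul_add, h, one_mul, mul_one, one_mul]
  module

theorem Em_cont (γ : ι → Matrix κ κ ℂ) : Continuous fun y : Sph ι => (2⁻¹:ℂ) • (1 + rF γ y.1) := by
  have h : Continuous fun y : Sph ι => rF γ y.1 := rF_cont γ continuous_subtype_val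
  fun_prop

/-- the tautological idempotent -/
noncomputable def Em (γ : ι → Matrix κ κ ℂ) : Matrix κ κ C(Sph ι, ℂ) :=
  mkC (fun y => (2⁻¹:ℂ) • (1 + rF γ y.1)) (Em_cont γ)

theorem Em_ev (γ : ι → Matrix κ κ ℂ) (y : Sph ι) : (Em γ).map (ev y) = (2⁻¹:ℂ) • (1 + rF γ y.1) := rfl

theorem Em_idem {γ : ι → Matrix κ κ ℂ} (h : Cl γ) : Em γ * Em γ = Em γ := by
  apply mat_ext
  intro y
  rw [Matrix.map_mul, Em_ev, half_idem (rF_sq h y)]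

/-- the clutching function (matrix) -/
noncomputable def cv (γ : ι → Matrix κ κ ℂ) (ε : ℂ) (y : Option ι → ℝ) : Matrix κ κ ℂ :=
  (y none : ℂ) • 1 + (ε * Complex.I) • rF γ (fun i => y (some i))

theorem cv_cont (γ : ι → Matrix κ κ ℂ) (ε : ℂ) : Continuous fun y : Sph (Option ι) => cv γ ε y.1 := by
  unfold cv
  have h1 : Continuous fun y : Sph (Option ι) => (y.1 none : ℂ) := Complex.continuous_ofReal.comp ((continuous_apply _).comp continuous_subtype_val)
  have h2 : Continuous fun y : Sph (Option ι) => rF γ (fun i => y.1 (some i)) :=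
    rF_cont γ (continuous_pi fun i => (continuous_apply _).comp continuous_subtype_val)
  fun_prop

theorem cv_mul {γ : ι → Matrix κ κ ℂ} (h : Cl γ) {ε : ℂ} (hε : ε * ε = 1) (y : Sph (Option ι)) :
    cv γ ε y.1 * cv γ (-ε) y.1 = 1 := by
  have e1 := h (fun i => (y.1 (some i) : ℂ))
  have e2 : (y.1 none : ℂ) ^ 2 + ∑ i, (y.1 (some i) : ℂ)^2 = 1 := by
    have := y.2
    rw [Fintype.sum_option] at this
    exact_mod_cast this
  have e3 : ((y.1 none : ℂ) ^ 2 + ∑ i, (y.1 (some i) : ℂ)^2) • (1 : Matrix κ κ ℂ) = 1 := by rw [e2, one_smul]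
  rw [cv, cv, rF]
  refine Eq.trans ?_ e3
  generalize FC γ _ = F at *
  have hI : Complex.I * Complex.I = -1 := Complex.I_mul_I
  have h3 : ε * Complex.I * (-ε * Complex.I) = 1 := by
    linear_combination - hI * (ε * ε) + hε
  simp only [mul_add, add_mul, smul_mul_smul_comm, mul_one, one_mul, e1, h3]
  module

/-- the clutching function -/
noncomputable def cu {γ : ι → Matrix κ κ ℂ} (h : Cl γ) : (Matrix κ κ C(Sph (Option ι), ℂ))ˣ where
  val := mkC (fun y => cv γ 1 y.1) (cv_cont γ 1)
  inv := mkC (fun y => cv γ (-1) y.1) (cv_cont γ (-1))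
  val_inv := by
    apply mat_ext; intro y
    rw [Matrix.map_mul, mkC_ev, mkC_ev, cv_mul h (by norm_num), ev_one]
  inv_val := by
    apply mat_ext; intro y
    have := cv_mul h (ε := -1) (by norm_num) y
    rw [neg_neg] at this
    rw [Matrix.map_mul, mkC_ev, mkC_ev, this, ev_one]

variable (yv : C(X, Sph ι)) (y0 : Sph ι)

theorem sv_Em {γ : ι → Matrix κ κ ℂ} (h : Cl γ) : (Em (gs γ)).map (pb (sv yv y0)) = eg (umap (pb (pv yv y0)) (cu h)) := by
  apply mat_ext
  rintro ⟨x, p⟩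
  rw [eg_ev]
  show (2⁻¹:ℂ) • (1 + rF (gs γ) (oc p.1.2 (vec (yv x).1 y0.1 p.1.1))) = _
  have e1 : (((umap (pb (pv yv y0)) (cu h) : GLc κ X) : Matrix κ κ C(X × S1, ℂ))).map (ev (x, dir p.1.1)) = cv γ 1 (vec (yv x).1 y0.1 (dir p.1.1).1) := rfl
  have e2 : ((↑(umap (pb (pv yv y0)) (cu h) : GLc κ X)⁻¹ : Matrix κ κ C(X × S1, ℂ))).map (ev (x, dir p.1.1)) = cv γ (-1) (vec (yv x).1 y0.1 (dir p.1.1).1) := rfl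
  rw [e1, e2]
  have e3 : vec (yv x).1 y0.1 p.1.1 = fun i => ‖p.1.1‖ * vec (yv x).1 y0.1 (dir p.1.1).1 i := by
    rw [← vec_smul _ _ _ (norm_nonneg _), norm_mul_dir]
  rw [e3]
  generalize vec (yv x).1 y0.1 (dir p.1.1).1 = v
  have e4 : (fun i => ‖p.1.1‖ * v i) = oc (‖p.1.1‖ * v none) (fun i => ‖p.1.1‖ * v (some i)) := oc_eta _
  have e5 : rF γ (fun i => ‖p.1.1‖ * v (some i)) = (‖p.1.1‖ : ℂ) • rF γ (fun i => v (some i)) := by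
    unfold rF FC
    rw [Finset.smul_sum]
    refine Finset.sum_congr rfl fun i _ => ?_
    rw [smul_smul]; dsimp only; rw [Complex.ofReal_mul]
  rw [e4, gs_rF, e5, ← fromBlocks_one, fromBlocks_add, fromBlocks_smul]
  simp only [cv]
  congr 1
  · module
  · push_cast; module
  · push_cast; module
  · push_cast; module

theorem cls_cu {γ : ι → Matrix κ κ ℂ} (h : Cl γ) : cls (umap (pb (pv yv y0)) (cu h)) =
    (Fintype.card κ : K C(X × S2, ℂ)) + K.map (pb ContinuousMap.fst) (K.map (pb yv) (kcl (Em γ) (Em_idem h)) - 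
      kcl ((((2⁻¹:ℂ) • (1 + rF γ y0.1))).map (cst X)) (idem_map _ (half_idem (rF_sq h y0)))) * tt X := by
  rw [kcl_map]
  apply loopcls
  intro x z
  show cv γ 1 (vec (yv x).1 y0.1 z.1) = _
  have e1 : ((Em γ).map (pb yv)).map (ev x) = (2⁻¹:ℂ) • (1 + rF γ (yv x).1) := rfl
  have e2 : ((((2⁻¹:ℂ) • (1 + rF γ y0.1))).map (cst X)).map (ev x) = (2⁻¹:ℂ) • (1 + rF γ y0.1) := rfl
  rw [e1, e2, cv]
  have e3 : rF γ (fun i => vec (yv x).1 y0.1 z.1 (some i)) = ((max z.1.im 0 : ℝ):ℂ) • rF γ (yv x).1 + ((max (-z.1.im) 0 : ℝ):ℂ) • rF γ y0.1 := by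
    simp only [rF, FC, Finset.smul_sum, smul_smul, vec, oc_some, ← Finset.sum_add_distrib, ← add_smul]
    push_cast; rfl
  rw [e3]
  simp only [vec, oc_none]
  module
end cliff
end PK

namespace PK
open Matrix Topology
open scoped Kronecker
set_option linter.all false

section ext
variable {m n l : Type} [Fintype m] [DecidableEq m] [Fintype n] [DecidableEq n] [Fintype l] [DecidableEq l]

/-- exterior algebra of column vectors -/
abbrev EA (m : Type) : Type := ExteriorAlgebra ℂ (m → ℂ)

/-- basis of the exterior algebra -/
noncomputable def bL (m : Type) [Fintype m] [DecidableEq m] : Module.Basis (Finset m) ℂ (EA m) :=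
  letI : LinearOrder m := LinearOrder.lift' (Fintype.equivFin m) (Fintype.equivFin m).injective
  Module.Basis.ExteriorAlgebra (Pi.basisFun ℂ m)

/-- functoriality -/
noncomputable def eam (M : Matrix m n ℂ) : EA n →ₐ[ℂ] EA m := ExteriorAlgebra.map (Matrix.toLin' M)

theorem eam_ι (M : Matrix m n ℂ) (v : n → ℂ) : eam M (ExteriorAlgebra.ι ℂ v) = ExteriorAlgebra.ι ℂ (M *ᵥ v) := by
  simp [eam]

theorem eam_mul (M : Matrix m n ℂ) (N : Matrix n l ℂ) (x : EA l) : eam (M * N) x = eam M (eam N x) := by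
  have := ExteriorAlgebra.map_comp_map (R := ℂ) (Matrix.toLin' N) (Matrix.toLin' M)
  rw [eam, Matrix.toLin'_mul, ← this]; rfl

theorem eam_one (x : EA m) : eam (1 : Matrix m m ℂ) x = x := by
  rw [eam, Matrix.toLin'_one, ExteriorAlgebra.map_id]; rfl

/-- exterior power matrix -/
noncomputable def Lm (M : Matrix m n ℂ) : Matrix (Finset m) (Finset n) ℂ :=
  LinearMap.toMatrix (bL n) (bL m) (eam M).toLinearMap

theorem Lm_mul (M : Matrix m n ℂ) (N : Matrix n l ℂ) : Lm (M * N) = Lm M * Lm N := by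
  rw [Lm, Lm, Lm, ← LinearMap.toMatrix_comp]
  congr 1
  ext x
  simp [eam_mul]

theorem Lm_one : Lm (1 : Matrix m m ℂ) = 1 := by
  rw [Lm, ← LinearMap.toMatrix_one (bL m)]
  congr 1
  ext x
  simp [eam_one]

/-- continuity of a family of exterior elements -/
theorem eam_cont {Z : Type*} [TopologicalSpace Z] {M : Z → Matrix m n ℂ} (h : Continuous M) (x : EA n) :
    Continuous fun z => (bL m).equivFun (eam (M z) x) := by
  induction x using ExteriorAlgebra.induction with
  | algebraMap r => simp only [AlgHom.commutes]; exact continuous_const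
  | ι v =>
    simp only [eam_ι]
    have : Continuous ((bL m).equivFun.toLinearMap ∘ₗ ExteriorAlgebra.ι ℂ) := LinearMap.continuous_of_finiteDimensional _
    exact this.comp (h.matrix_mulVec continuous_const)
  | add a b ha hb => simp only [map_add]; exact ha.add hb
  | mul a b ha hb =>
    have key : ∀ x y : EA m, (bL m).equivFun (x * y) = ∑ i, ∑ j, ((bL m).equivFun x i * (bL m).equivFun y j) • (bL m).equivFun (bL m i * bL m j) := by
      intro x y
      conv_lhs => rw [← (bL m).sum_equivFun x, ← (bL m).sum_equivFun y]
      simp only [Finset.sum_mul_sum, map_sum, smul_mul_smul_comm, map_smul]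
    have e0 : (fun z => (bL m).equivFun (eam (M z) (a * b))) = fun z => ∑ i, ∑ j, ((bL m).equivFun (eam (M z) a) i * (bL m).equivFun (eam (M z) b) j) • (bL m).equivFun (bL m i * bL m j) :=
      funext fun z => by rw [map_mul, key]
    rw [e0]
    refine continuous_finset_sum _ fun i _ => continuous_finset_sum _ fun j _ => ?_
    have h1 : Continuous fun z => (bL m).equivFun (eam (M z) a) i := (continuous_apply i).comp ha
    have h2 : Continuous fun z => (bL m).equivFun (eam (M z) b) j := (continuous_apply j).comp hb
    have h3 := h1.mul h2
    exact h3.smul continuous_const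

theorem Lm_cont {Z : Type*} [TopologicalSpace Z] {M : Z → Matrix m n ℂ} (h : Continuous M) :
    Continuous fun z => Lm (M z) := by
  refine continuous_matrix fun i j => ?_
  have := (continuous_apply i).comp (eam_cont h (bL n j))
  refine this.congr fun z => ?_
  simp [Lm, LinearMap.toMatrix_apply]

/- block decomposition -/
/-- the inclusion matrices -/
def jl (m n : Type) [Fintype m] [DecidableEq m] [Fintype n] [DecidableEq n] : Matrix (m ⊕ n) m ℂ := fromRows 1 0
def jr (m n : Type) [Fintype m] [DecidableEq m] [Fintype n] [DecidableEq n] : Matrix (m ⊕ n) n ℂ := fromRows 0 1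

theorem jr_swap (v : n → ℂ) (a : EA m) : ∃ a' : EA m, ∀ v : n → ℂ, ExteriorAlgebra.ι ℂ (jr m n *ᵥ v) * eam (jl m n) a = eam (jl m n) a' * ExteriorAlgebra.ι ℂ (jr m n *ᵥ v) := by
  induction a using ExteriorAlgebra.induction with
  | algebraMap r => exact ⟨algebraMap _ _ r, fun v => by rw [AlgHom.commutes]; exact (Algebra.commutes _ _).symm⟩
  | ι w => exact ⟨- ExteriorAlgebra.ι ℂ w, fun v => by
      rw [map_neg, eam_ι, neg_mul, eq_neg_iff_add_eq_zero]; exact ExteriorAlgebra.ι_add_mul_swap _ _⟩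
  | add a b ha hb =>
    obtain ⟨a', ha⟩ := ha
    obtain ⟨b', hb⟩ := hb
    exact ⟨a' + b', fun v => by rw [map_add, map_add, mul_add, add_mul, ha, hb]⟩
  | mul a b ha hb =>
    obtain ⟨a', ha⟩ := ha
    obtain ⟨b', hb⟩ := hb
    exact ⟨a' * b', fun v => by rw [map_mul, map_mul, ← mul_assoc, ha, mul_assoc, hb, mul_assoc]⟩

theorem prod_span (x : EA (m ⊕ n)) : x ∈ Submodule.span ℂ (Set.range fun p : EA m × EA n => eam (jl m n) p.1 * eam (jr m n) p.2) := by
  set R := Submodule.span ℂ (Set.range fun p : EA m × EA n => eam (jl m n) p.1 * eam (jr m n) p.2) with hR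
  have key : ∀ x : EA (m ⊕ n), ∀ y ∈ R, x * y ∈ R := by
    intro x
    induction x using ExteriorAlgebra.induction with
    | algebraMap r => intro y hy; rw [← Algebra.smul_def]; exact R.smul_mem r hy
    | add a b ha hb => intro y hy; rw [add_mul]; exact R.add_mem (ha y hy) (hb y hy)
    | mul a b ha hb => intro y hy; rw [mul_assoc]; exact ha _ (hb y hy)
    | ι v =>
      intro y hy
      have hv : v = jl m n *ᵥ (fun i => v (Sum.inl i)) + jr m n *ᵥ (fun i => v (Sum.inr i)) := by
        funext i
        rcases i with i | i <;> simp [jl, jr, fromRows_mulVec]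
      induction hy using Submodule.span_induction with
      | zero => simp
      | add a b _ _ ha hb => rw [mul_add]; exact R.add_mem ha hb
      | smul c a _ ha => rw [mul_smul_comm]; exact R.smul_mem c ha
      | mem a ha =>
        obtain ⟨⟨p, q⟩, rfl⟩ := ha
        rw [hv, map_add, add_mul]
        refine R.add_mem ?_ ?_
        · rw [← eam_ι, ← mul_assoc, ← map_mul]
          exact Submodule.subset_span ⟨(_, q), rfl⟩
        · obtain ⟨a', ha'⟩ := jr_swap (n := n) 0 p
          dsimp only
          rw [← mul_assoc, ha', mul_assoc, ← eam_ι, ← map_mul]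
          exact Submodule.subset_span ⟨(a', _), rfl⟩
  have := key x 1 (Submodule.subset_span ⟨(1, 1), by simp⟩)
  rwa [mul_one] at this

/-- comparison matrix -/
noncomputable def JL (m n : Type) [Fintype m] [DecidableEq m] [Fintype n] [DecidableEq n] : Matrix (Finset (m ⊕ n)) (Finset m × Finset n) ℂ :=
  Matrix.of fun u p => (bL (m ⊕ n)).repr (eam (jl m n) (bL m p.1) * eam (jr m n) (bL n p.2)) u

theorem JL_inv : ∃ J' : Matrix (Finset m × Finset n) (Finset (m ⊕ n)) ℂ, JL m n * J' = 1 ∧ J' * JL m n = 1 := by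
  have hs : Function.Surjective (JL m n).mulVecLin := by
    intro w
    set x := (bL (m ⊕ n)).equivFun.symm w with hx
    have hw : w = (bL (m ⊕ n)).equivFun x := by rw [hx, LinearEquiv.apply_symm_apply]
    rw [hw]
    have := prod_span x
    generalize x = x at this
    induction this using Submodule.span_induction with
    | zero => exact ⟨0, by simp⟩
    | add a b _ _ ha hb =>
      obtain ⟨a', ha⟩ := ha
      obtain ⟨b', hb⟩ := hb
      exact ⟨a' + b', by rw [map_add, map_add, ha, hb]⟩
    | smul c a _ ha =>
      obtain ⟨a', ha⟩ := ha
      exact ⟨c • a', by rw [map_smul, map_smul, ha]⟩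
    | mem a ha =>
      obtain ⟨⟨p, q⟩, rfl⟩ := ha
      refine ⟨fun s => (bL m).equivFun p s.1 * (bL n).equivFun q s.2, ?_⟩
      funext u
      dsimp only
      conv_rhs => rw [← (bL m).sum_equivFun p, ← (bL n).sum_equivFun q]
      simp only [map_sum, Finset.sum_mul_sum, map_smul, smul_mul_smul_comm]
      simp only [Finset.sum_apply, Pi.smul_apply]
      rw [Matrix.mulVecLin_apply, Matrix.mulVec, dotProduct, Fintype.sum_prod_type]
      refine Finset.sum_congr rfl fun i _ => Finset.sum_congr rfl fun j _ => ?_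
      simp [JL, mul_comm]
  obtain ⟨J', hJ'⟩ := Matrix.mulVec_surjective_iff_exists_right_inverse.1 hs
  refine ⟨J', hJ', ?_⟩
  exact (Matrix.mul_eq_one_comm_of_card_eq _ _ _ (by simp [Fintype.card_sum, pow_add])).1 hJ'

theorem JL_nat (A : Matrix m m ℂ) (B : Matrix n n ℂ) : Lm (fromBlocks A 0 0 B) * JL m n = JL m n * (Lm A ⊗ₖ Lm B) := by
  ext u ⟨s, t⟩
  have e1 : fromBlocks A 0 0 B * jl m n = jl m n * A := by
    simp [jl, fromBlocks_mul_fromRows]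
  have e2 : fromBlocks A 0 0 B * jr m n = jr m n * B := by
    simp [jr, fromBlocks_mul_fromRows]
  have e3 : (Lm (fromBlocks A 0 0 B) * JL m n) u (s, t) = (bL (m ⊕ n)).repr (eam (fromBlocks A 0 0 B) (eam (jl m n) (bL m s) * eam (jr m n) (bL n t))) u := by
    have := LinearMap.toMatrix_mulVec_repr (bL (m ⊕ n)) (bL (m ⊕ n)) (eam (fromBlocks A 0 0 B)).toLinearMap (eam (jl m n) (bL m s) * eam (jr m n) (bL n t))
    exact congrFun this u
  rw [e3, map_mul, ← eam_mul, ← eam_mul, e1, e2, eam_mul, eam_mul]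
  have e4 : ∀ p q, (bL (m ⊕ n)).repr (eam (jl m n) p * eam (jr m n) q) u = ∑ i, ∑ j, ((bL m).repr p i * (bL n).repr q j) * JL m n u (i, j) := by
    intro p q
    conv_lhs => rw [← (bL m).sum_repr p, ← (bL n).sum_repr q]
    simp only [map_sum, Finset.sum_mul_sum, map_smul, smul_mul_smul_comm, Finsupp.coe_finset_sum, Finset.sum_apply, Finsupp.smul_apply, smul_eq_mul]
    rfl
  rw [e4, Matrix.mul_apply, Fintype.sum_prod_type]
  refine Finset.sum_congr rfl fun i _ => Finset.sum_congr rfl fun j _ => ?_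
  simp [Lm, LinearMap.toMatrix_apply, mul_comm]
end ext
end PK

namespace PK
open Matrix Topology
open scoped Kronecker
set_option linter.all false

section extC
variable {m n l : Type} [Fintype m] [DecidableEq m] [Fintype n] [DecidableEq n] [Fintype l] [DecidableEq l]
variable {X Y : Type} [TopologicalSpace X] [TopologicalSpace Y]

theorem map_ev_cont (M : Matrix m n C(X, ℂ)) : Continuous fun x => M.map (ev x) :=
  continuous_matrix fun i j => (M i j).continuous

/-- exterior power of matrices over functions -/
noncomputable def LC (M : Matrix m n C(X, ℂ)) : Matrix (Finset m) (Finset n) C(X, ℂ) :=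
  mkC (fun x => Lm (M.map (ev x))) (Lm_cont (map_ev_cont M))

theorem LC_ev (M : Matrix m n C(X, ℂ)) (x : X) : (LC M).map (ev x) = Lm (M.map (ev x)) := rfl

theorem LC_pb (φ : C(X, Y)) (M : Matrix m n C(Y, ℂ)) : (LC M).map (pb φ) = LC (M.map (pb φ)) := rfl

theorem LC_mul (M : Matrix m n C(X, ℂ)) (N : Matrix n l C(X, ℂ)) : LC (M * N) = LC M * LC N := by
  apply mat_ext
  intro x
  rw [Matrix.map_mul, LC_ev, LC_ev, LC_ev, Matrix.map_mul, Lm_mul]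

theorem LC_one : LC (1 : Matrix m m C(X, ℂ)) = 1 := by
  apply mat_ext
  intro x
  rw [LC_ev, ev_one, ev_one, Lm_one]

theorem LC_idem {e : Matrix m m C(X, ℂ)} (he : e * e = e) : LC e * LC e = LC e := by rw [← LC_mul, he]

theorem LC_iso {e : Matrix m m C(X, ℂ)} {f : Matrix n n C(X, ℂ)} (h : Iso e f) : Iso (LC e) (LC f) := by
  obtain ⟨u, v, h1, h2⟩ := h
  exact ⟨LC u, LC v, by rw [← LC_mul, h1], by rw [← LC_mul, h2]⟩

theorem Iso.conj {A : Type} [CommRing A] {a : Matrix m m A} {b : Matrix n n A} (hb : b * b = b) {J : Matrix m n A} {J' : Matrix n m A}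
    (h1 : J * J' = 1) (h2 : J' * J = 1) (h : a * J = J * b) : Iso a b := by
  refine ⟨b * J', J * b, ?_, ?_⟩
  · rw [Matrix.mul_assoc, ← Matrix.mul_assoc J', h2, Matrix.one_mul, hb]
  · rw [Matrix.mul_assoc, ← Matrix.mul_assoc b, hb, ← Matrix.mul_assoc, ← h, Matrix.mul_assoc, h1, Matrix.mul_one]

theorem cst_ev (M : Matrix m n ℂ) (x : X) : (M.map (cst X)).map (ev x) = M := rfl

theorem LC_blocks {e : Matrix m m C(X, ℂ)} {f : Matrix n n C(X, ℂ)} (he : e * e = e) (hf : f * f = f) :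
    Iso (LC (fromBlocks e 0 0 f)) (LC e ⊗ₖ LC f) := by
  obtain ⟨J', h1, h2⟩ := JL_inv (m := m) (n := n)
  refine Iso.conj (idem_kron (LC_idem he) (LC_idem hf)) (J := (JL m n).map (cst X)) (J' := J'.map (cst X)) ?_ ?_ ?_
  · rw [← Matrix.map_mul, h1, Matrix.map_one _ (map_zero _) (map_one _)]
  · rw [← Matrix.map_mul, h2, Matrix.map_one _ (map_zero _) (map_one _)]
  · apply mat_ext
    intro x
    rw [Matrix.map_mul, Matrix.map_mul, cst_ev, LC_ev]
    have e1 : (LC e ⊗ₖ LC f).map (ev x) = Lm (e.map (ev x)) ⊗ₖ Lm (f.map (ev x)) := rfl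
    have e2 : (fromBlocks e 0 0 f).map (ev x) = fromBlocks (e.map (ev x)) 0 0 (f.map (ev x)) := by
      rw [fromBlocks_map, ev_zero, ev_zero]
    rw [e1, e2, JL_nat]

variable (X) in
/-- the exterior power on classes -/
noncomputable def LamV : V C(X, ℂ) → K C(X, ℂ) :=
  Quotient.lift (fun a : IdM C(X, ℂ) => kcl (LC a.e) (LC_idem a.he)) (fun a b h => kcl_eq (LC_iso h))

theorem LamV_vcl {e : Matrix m m C(X, ℂ)} (he : e * e = e) : LamV X (vcl e he) = kcl (LC e) (LC_idem he) := rfl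

theorem LamV_add (a b : V C(X, ℂ)) : LamV X (a + b) = LamV X a * LamV X b := by
  induction a using V.ind with
  | h m _ _ e he =>
  induction b using V.ind with
  | h n _ _ f hf =>
  rw [vcl_add, LamV_vcl, LamV_vcl, LamV_vcl, ← kcl_kron]
  exact kcl_eq (LC_blocks he hf)

theorem LamV_zero : LamV X 0 = 1 := by
  rw [vzero_def, LamV_vcl]
  have : (0 : Matrix Empty Empty C(X, ℂ)) = 1 := Subsingleton.elim _ _
  rw [kcl_congr (f := (1 : Matrix (Finset Empty) (Finset Empty) C(X, ℂ))) (hf := by simp) (by rw [this, LC_one]), kcl_one]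
  simp

theorem LamV_one : LamV X 1 = 2 := by
  rw [vone_def, LamV_vcl, kcl_congr (f := (1 : Matrix (Finset Unit) (Finset Unit) C(X, ℂ))) (hf := by simp) LC_one, kcl_one]
  simp

theorem LamV_nat (k : ℕ) : LamV X k = 2 ^ k := by
  induction k with
  | zero => rw [Nat.cast_zero, LamV_zero, pow_zero]
  | succ k ih => rw [Nat.cast_succ, LamV_add, ih, LamV_one, pow_succ]

/- lines -/
/-- rank at most one -/
def isLine {A : Type} [CommRing A] (e : Matrix m m A) : Prop := ∀ i j k l, e i j * e k l = e i l * e k j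

theorem ι_prop {p q : m → ℂ} (h : ∀ i k, p i * q k = p k * q i) : ExteriorAlgebra.ι ℂ p * ExteriorAlgebra.ι ℂ q = 0 := by
  by_cases hp : p = 0
  · simp [hp]
  · obtain ⟨i, hi⟩ := Function.ne_iff.1 hp
    have hi : p i ≠ 0 := hi
    have : q = (q i / p i) • p := by
      funext k
      have := h i k
      simp only [Pi.smul_apply, smul_eq_mul]
      field_simp
      linear_combination this
    rw [this, map_smul, mul_smul_comm, ExteriorAlgebra.ι_sq_zero, smul_zero]

theorem line_range {e : Matrix m m ℂ} (hl : isLine e) (x : EA m) : ∃ (c : ℂ) (w : m → ℂ), eam e x = algebraMap ℂ _ c + ExteriorAlgebra.ι ℂ (e *ᵥ w) := by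
  induction x using ExteriorAlgebra.induction with
  | algebraMap r => exact ⟨r, 0, by simp⟩
  | ι v => exact ⟨0, v, by simp [eam_ι]⟩
  | add a b ha hb =>
    obtain ⟨c, w, h⟩ := ha
    obtain ⟨c', w', h'⟩ := hb
    exact ⟨c + c', w + w', by rw [map_add, h, h', Matrix.mulVec_add, map_add, map_add]; abel⟩
  | mul a b ha hb =>
    obtain ⟨c, w, h⟩ := ha
    obtain ⟨c', w', h'⟩ := hb
    refine ⟨c * c', c • w' + c' • w, ?_⟩
    have h0 : ExteriorAlgebra.ι ℂ (e *ᵥ w) * ExteriorAlgebra.ι ℂ (e *ᵥ w') = 0 := by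
      apply ι_prop
      intro i k
      simp only [Matrix.mulVec, dotProduct, Finset.sum_mul_sum]
      refine Finset.sum_congr rfl fun a _ => Finset.sum_congr rfl fun b _ => ?_
      have := hl i a k b
      linear_combination w a * w' b * hl i a k b
    have h2 : ExteriorAlgebra.ι ℂ (e *ᵥ w) * algebraMap ℂ (EA m) c' = c' • ExteriorAlgebra.ι ℂ (e *ᵥ w) := by
      rw [← Algebra.commutes c', ← Algebra.smul_def]
    have h3 : algebraMap ℂ (EA m) c * ExteriorAlgebra.ι ℂ (e *ᵥ w') = c • ExteriorAlgebra.ι ℂ (e *ᵥ w') := by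
      rw [← Algebra.smul_def]
    have h4 : algebraMap ℂ (EA m) (c * c') = algebraMap ℂ (EA m) c * algebraMap ℂ (EA m) c' := map_mul _ _ _
    rw [map_mul, h, h', add_mul, mul_add, mul_add, h0, h2, h3, h4, Matrix.mulVec_add, Matrix.mulVec_smul, Matrix.mulVec_smul, map_add, map_smul, map_smul]
    abel

/-- low degree part -/
noncomputable def lowM (m : Type) [Fintype m] [DecidableEq m] : Matrix (Finset m) (Unit ⊕ m) ℂ :=
  Matrix.of fun s => Sum.elim (fun _ => (bL m).repr 1 s) (fun i => (bL m).repr (ExteriorAlgebra.ι ℂ (Pi.single i 1)) s)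

noncomputable def lowP (m : Type) [Fintype m] [DecidableEq m] : Matrix (Unit ⊕ m) (Finset m) ℂ :=
  Matrix.of fun i s => Sum.elim (fun _ => ExteriorAlgebra.algebraMapInv (bL m s)) (fun i => ExteriorAlgebra.ιInv (bL m s) i) i

theorem lowM_mul (v : Unit ⊕ m → ℂ) : lowM m *ᵥ v = (bL m).equivFun (algebraMap ℂ _ (v (Sum.inl ())) + ExteriorAlgebra.ι ℂ (fun i => v (Sum.inr i))) := by
  have e1 : (fun i => v (Sum.inr i)) = ∑ i, v (Sum.inr i) • (Pi.single i 1 : m → ℂ) := by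
    funext j; simp [Finset.sum_apply, Pi.single_apply]
  funext s
  rw [e1, Algebra.algebraMap_eq_smul_one]
  simp [Matrix.mulVec, dotProduct, lowM, Finset.sum_apply, mul_comm]

theorem lowP_mul (x : EA m) : lowP m *ᵥ (bL m).equivFun x = Sum.elim (fun _ => ExteriorAlgebra.algebraMapInv x) (fun i => ExteriorAlgebra.ιInv x i) := by
  funext o
  have key : ∀ f : EA m →ₗ[ℂ] ℂ, ∑ s, f (bL m s) * (bL m).equivFun x s = f x := by
    intro f
    conv_rhs => rw [← (bL m).sum_equivFun x]
    simp only [map_sum, map_smul, smul_eq_mul, mul_comm]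
  rcases o with o | i
  · exact key (ExteriorAlgebra.algebraMapInv).toLinearMap
  · exact key (LinearMap.proj i ∘ₗ ExteriorAlgebra.ιInv)

theorem mat_ext_vec {R : Type} [CommRing R] {A B : Matrix m n R} (h : ∀ v, A *ᵥ v = B *ᵥ v) : A = B := by
  apply Matrix.toLin'.injective
  apply LinearMap.ext
  intro v
  simpa using h v

theorem ιInv_algebraMap (c : ℂ) : ExteriorAlgebra.ιInv (algebraMap ℂ (EA m) c) = 0 := by
  simp [ExteriorAlgebra.ιInv]
  rfl

theorem algInv_ι (w : m → ℂ) : ExteriorAlgebra.algebraMapInv (ExteriorAlgebra.ι ℂ w) = (0:ℂ) := by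
  simp [ExteriorAlgebra.algebraMapInv]

theorem low_low : lowP m * lowM m = 1 := by
  apply mat_ext_vec
  intro v
  rw [← Matrix.mulVec_mulVec, lowM_mul, lowP_mul, Matrix.one_mulVec]
  funext o
  rcases o with o | i
  · simp [algInv_ι]
    
  · simp [ιInv_algebraMap, ExteriorAlgebra.ι_leftInverse _]

theorem Lm_mulVec (M : Matrix m n ℂ) (x : EA n) : Lm M *ᵥ (bL n).equivFun x = (bL m).equivFun (eam M x) :=
  LinearMap.toMatrix_mulVec_repr (bL n) (bL m) (eam M).toLinearMap x

theorem Lm_low (e : Matrix m m ℂ) : Lm e * lowM m = lowM m * fromBlocks (1 : Matrix Unit Unit ℂ) 0 0 e := by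
  apply mat_ext_vec
  intro v
  rw [← Matrix.mulVec_mulVec, ← Matrix.mulVec_mulVec, lowM_mul, lowM_mul, Lm_mulVec, map_add, AlgHom.commutes, eam_ι, fromBlocks_mulVec]
  simp
  rfl

theorem Lm_low' {e : Matrix m m ℂ} (hl : isLine e) : lowM m * lowP m * Lm e = Lm e := by
  apply mat_ext_vec
  intro v
  obtain ⟨x, rfl⟩ := (bL m).equivFun.surjective v
  rw [← Matrix.mulVec_mulVec, Lm_mulVec, ← Matrix.mulVec_mulVec, lowP_mul, lowM_mul]
  obtain ⟨c, w, h⟩ := line_range hl x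
  rw [h]
  congr 1
  simp [algInv_ι, ιInv_algebraMap, ExteriorAlgebra.ι_leftInverse _]

theorem LC_line {e : Matrix m m C(X, ℂ)} (he : e * e = e) (hl : isLine e) : kcl (LC e) (LC_idem he) = 1 + kcl e he := by
  have h1 : kcl (1 : Matrix Unit Unit C(X, ℂ)) (by simp) = 1 := by rw [kcl_one]; simp
  rw [← h1, ← kcl_blocks]
  apply kcl_eq
  have hb : ∀ x, (fromBlocks (1 : Matrix Unit Unit C(X, ℂ)) 0 0 e).map (ev x) = fromBlocks 1 0 0 (e.map (ev x)) := by
    intro x; rw [fromBlocks_map, ev_zero, ev_zero, ev_one]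
  have hle : ∀ x, isLine (e.map (ev x)) := by
    intro x i j k l
    have := congrArg (ev x) (hl i j k l)
    simpa using this
  have hDD := idem_blocks (show (1 : Matrix Unit Unit C(X, ℂ)) * 1 = 1 by simp) he
  refine ⟨(((lowP m).map (cst X) : Matrix (Unit ⊕ m) (Finset m) C(X, ℂ)) * LC e : Matrix (Unit ⊕ m) (Finset m) C(X, ℂ)),
    (((lowM m).map (cst X) : Matrix (Finset m) (Unit ⊕ m) C(X, ℂ)) * (fromBlocks (1 : Matrix Unit Unit C(X, ℂ)) 0 0 e : Matrix (Unit ⊕ m) (Unit ⊕ m) C(X, ℂ)) : Matrix (Finset m) (Unit ⊕ m) C(X, ℂ)), ?_, ?_⟩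
  · rw [Matrix.mul_assoc, ← Matrix.mul_assoc (LC e)]
    have e1 : LC e * (lowM m).map (cst X) = (lowM m).map (cst X) * fromBlocks (1 : Matrix Unit Unit C(X, ℂ)) 0 0 e := by
      apply mat_ext
      intro x
      rw [Matrix.map_mul, Matrix.map_mul, cst_ev, LC_ev, Lm_low, hb]
    rw [e1, Matrix.mul_assoc, hDD, ← Matrix.mul_assoc, ← Matrix.map_mul, low_low, Matrix.map_one _ (map_zero _) (map_one _), Matrix.one_mul]
  · apply mat_ext
    intro x
    rw [Matrix.map_mul, Matrix.map_mul, Matrix.map_mul, cst_ev, cst_ev, LC_ev, hb, ← Lm_low, Matrix.mul_assoc, ← Matrix.mul_assoc (lowM m), Lm_low' (hle x), ← Lm_mul,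
      ← Matrix.map_mul, he]

/-- units -/
noncomputable def Lu (g : (Matrix m m C(X, ℂ))ˣ) : (Matrix (Finset m) (Finset m) C(X, ℂ))ˣ where
  val := LC (g : Matrix m m C(X, ℂ))
  inv := LC (↑g⁻¹ : Matrix m m C(X, ℂ))
  val_inv := by rw [← LC_mul, Units.mul_inv, LC_one]
  inv_val := by rw [← LC_mul, Units.inv_mul, LC_one]

theorem cls_Lu [CompactSpace X] (g : GLc m X) : cls (Lu g) = kcl (LC (eg g)) (LC_idem (eg_idem g)) := by
  apply cls_of_clut
  obtain ⟨Up, Um, Wp, Wm, h1, h2, h3, h4, h5⟩ := eg_clut g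
  refine ⟨LC Up, LC Um, LC Wp, LC Wm, ?_, ?_, ?_, ?_, ?_⟩
  · rw [← LC_mul, h1]; rfl
  · rw [← LC_mul, h2]; rfl
  · rw [← LC_mul, h3, LC_one]
  · rw [← LC_mul, h4, LC_one]
  · show LC (Wm.map (pb (idx X bd))) * LC (Up.map (pb (idx X bd))) = LC (g : Matrix m m C(X × S1, ℂ))
    rw [← LC_mul]
    exact congrArg LC h5
end extC
end PK

namespace PK
open Matrix Topology
open scoped Kronecker
set_option linter.all false

section Lam
variable {X Y : Type} [TopologicalSpace X] [TopologicalSpace Y]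

theorem loc_exists (R : Type 1) [CommRing R] : ∃ (L : Type 1) (_ : CommRing L) (i : R →+* L), IsUnit (2 : L) ∧ ∀ x, i x = 0 → ∃ k : ℕ, 2 ^ k * x = 0 := by
  refine ⟨Localization.Away (2 : R), inferInstance, algebraMap R (Localization.Away (2 : R)), ?_, ?_⟩
  · have := IsLocalization.Away.algebraMap_isUnit (S := Localization.Away (2 : R)) (2 : R)
    rwa [map_ofNat] at this
  · intro x h
    rw [IsLocalization.map_eq_zero_iff (Submonoid.powers (2 : R))] at h
    obtain ⟨⟨m, k, rfl⟩, hm⟩ := h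
    exact ⟨k, hm⟩

variable (X) in
/-- K-theory with 2 inverted -/
def L2 : Type 1 := (loc_exists (K C(X, ℂ))).choose

noncomputable instance : CommRing (L2 X) := (loc_exists (K C(X, ℂ))).choose_spec.choose

/-- the localization map -/
noncomputable def il : K C(X, ℂ) →+* L2 X := (loc_exists (K C(X, ℂ))).choose_spec.choose_spec.choose

theorem il_two : IsUnit (2 : L2 X) := (loc_exists (K C(X, ℂ))).choose_spec.choose_spec.choose_spec.1

theorem il_inj {x : K C(X, ℂ)} (h : il x = 0) : ∃ k : ℕ, 2 ^ k * x = 0 :=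
  (loc_exists (K C(X, ℂ))).choose_spec.choose_spec.choose_spec.2 x h

/-- total exterior power of virtual bundles -/
def Lam (x : K C(X, ℂ)) (u : L2 X) : Prop :=
  ∃ a b : V C(X, ℂ), x = cl a - cl b ∧ IsUnit (il (LamV X b)) ∧ il (LamV X a) = u * il (LamV X b)

theorem LamV_unit (a : V C(X, ℂ)) : IsUnit (il (LamV X a)) := by
  obtain ⟨b, n, h⟩ := V.exists_compl a
  have h2 := congrArg (fun z => il (LamV X z)) h
  simp only [LamV_add, LamV_nat, map_mul, map_pow] at h2
  have : IsUnit (il (LamV X a) * il (LamV X b)) := by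
    rw [h2, map_ofNat]; exact il_two.pow _
  exact isUnit_of_mul_isUnit_left this

theorem Lam_unique {x : K C(X, ℂ)} {u v : L2 X} (h : Lam x u) (h' : Lam x v) : u = v := by
  obtain ⟨a, b, e1, e2, e3⟩ := h
  obtain ⟨a', b', f1, f2, f3⟩ := h'
  have h1 : cl (a + b') = cl (a' + b) := by
    rw [map_add, map_add]; linear_combination f1 - e1
  obtain ⟨c, hc⟩ := (cl_eq_iff _ _).1 h1
  have h2 := congrArg (fun z => il (LamV X z)) hc
  simp only [LamV_add, map_mul] at h2
  have h3 := (LamV_unit c).mul_right_cancel h2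
  rw [e3, f3] at h3
  apply (e2.mul f2).mul_right_cancel
  linear_combination h3

theorem Lam_sub {x y : K C(X, ℂ)} {u v w : L2 X} (h : Lam x u) (h' : Lam y v) (hw : w * v = u) : Lam (x - y) w := by
  obtain ⟨a, b, e1, e2, e3⟩ := h
  obtain ⟨a', b', f1, f2, f3⟩ := h'
  refine ⟨a + b', b + a', ?_, LamV_unit _, ?_⟩
  · rw [e1, f1, map_add, map_add]; ring
  · rw [LamV_add, LamV_add, map_mul, map_mul, e3, f3, ← hw]; ring

theorem Lam_add {x y : K C(X, ℂ)} {u v : L2 X} (h : Lam x u) (h' : Lam y v) : Lam (x + y) (u * v) := by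
  obtain ⟨a, b, e1, e2, e3⟩ := h
  obtain ⟨a', b', f1, f2, f3⟩ := h'
  refine ⟨a + a', b + b', ?_, LamV_unit _, ?_⟩
  · rw [e1, f1, map_add, map_add]; ring
  · rw [LamV_add, LamV_add, map_mul, map_mul, e3, f3]; ring

theorem Lam_kcl {m : Type} [Fintype m] [DecidableEq m] {e : Matrix m m C(X, ℂ)} (he : e * e = e) :
    Lam (kcl e he) (il (kcl (LC e) (LC_idem he))) :=
  ⟨vcl e he, 0, by rw [map_zero, sub_zero]; rfl, LamV_unit _, by rw [LamV_zero, map_one, mul_one, LamV_vcl]⟩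

theorem Lam_nat (n : ℕ) : Lam (n : K C(X, ℂ)) (2 ^ n) :=
  ⟨n, 0, by rw [map_zero, sub_zero, map_natCast], LamV_unit _, by rw [LamV_zero, map_one, mul_one, LamV_nat, map_pow, map_ofNat]⟩

theorem Lam_zero : Lam (0 : K C(X, ℂ)) 1 := by simpa using Lam_nat (X := X) 0

theorem Lam_nsmul {T : K C(X, ℂ)} {c S : L2 X} (hS : S * S = 0) (h : Lam T (1 + c * S)) (q : ℕ) :
    Lam ((q : K C(X, ℂ)) * T) (1 + (q : L2 X) * (c * S)) := by
  induction q with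
  | zero => simpa using Lam_zero
  | succ q ih =>
    have := Lam_add ih h
    convert this using 1
    · push_cast; ring
    · push_cast; linear_combination (- (q : L2 X) * c ^ 2) * hS

theorem Lam_zsmul {T : K C(X, ℂ)} {c S : L2 X} (hS : S * S = 0) (h : Lam T (1 + c * S)) (q : ℤ) :
    Lam ((q : K C(X, ℂ)) * T) (1 + (q : L2 X) * (c * S)) := by
  obtain ⟨n, rfl | rfl⟩ := q.eq_nat_or_neg
  · simpa using Lam_nsmul hS h n
  · have := Lam_sub Lam_zero (Lam_nsmul hS h n) (w := 1 - (n : L2 X) * (c * S)) (by linear_combination (- (n:L2 X) ^ 2 * c ^ 2) * hS)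
    convert this using 1
    · push_cast; ring
    · push_cast; ring

/-- line bundles classes -/
def LineC (x : K C(X, ℂ)) : Prop := ∃ (m : Type) (_ : Fintype m) (_ : DecidableEq m) (e : Matrix m m C(X, ℂ)) (he : e * e = e),
  isLine e ∧ x = kcl e he

theorem LineC.lam {x : K C(X, ℂ)} (h : LineC x) : Lam x (1 + il x) := by
  obtain ⟨m, _, _, e, he, hl, rfl⟩ := h
  have := Lam_kcl he
  rwa [LC_line he hl, map_add, map_one] at this

theorem LineC.mul {x y : K C(X, ℂ)} (h : LineC x) (h' : LineC y) : LineC (x * y) := by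
  obtain ⟨m, _, _, e, he, hl, rfl⟩ := h
  obtain ⟨n, _, _, f, hf, hl', rfl⟩ := h'
  refine ⟨m × n, inferInstance, inferInstance, e ⊗ₖ f, idem_kron he hf, ?_, (kcl_kron he hf).symm⟩
  intro i j k l
  simp only [Matrix.kroneckerMap_apply]
  have h1 := hl i.1 j.1 k.1 l.1
  have h2 := hl' i.2 j.2 k.2 l.2
  calc _ = (e i.1 j.1 * e k.1 l.1) * (f i.2 j.2 * f k.2 l.2) := by ring
    _ = _ := by rw [h1, h2]; ring

theorem LineC.one : LineC (1 : K C(X, ℂ)) := by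
  refine ⟨Unit, inferInstance, inferInstance, 1, by simp, ?_, by rw [kcl_one]; simp⟩
  intro i j k l
  rfl

theorem LineC.map (φ : C(X, Y)) {x : K C(Y, ℂ)} (h : LineC x) : LineC (K.map (pb φ) x) := by
  obtain ⟨m, _, _, e, he, hl, rfl⟩ := h
  refine ⟨m, inferInstance, inferInstance, e.map (pb φ), idem_map _ he, ?_, kcl_map _ _⟩
  intro i j k l
  simp only [Matrix.map_apply, ← map_mul, hl i j k l]

theorem LineC.zu [CompactSpace X] : LineC (cls (zu X)) := by
  refine ⟨Unit ⊕ Unit, inferInstance, inferInstance, eg (PK.zu X), eg_idem _, ?_, rfl⟩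
  intro i j k l
  ext ⟨x, p⟩
  have hg := eg_ev (PK.zu X) x p
  have hE : ∀ i j, eg (PK.zu X) i j (x, p) = ((eg (PK.zu X)).map (ev (x, p))) i j := fun _ _ => rfl
  have hp := p.2
  have hz : (zi : C(X × S1, ℂ)) (x, dir p.1.1) * (zf : C(X × S1, ℂ)) (x, dir p.1.1) = 1 := by
    have := congrArg (fun f : C(X × S1, ℂ) => f (x, dir p.1.1)) (zi_zf (X := X))
    simpa using this
  have hp' : ((‖p.1.1‖ : ℂ)) ^ 2 + (p.1.2 : ℂ) ^ 2 = 1 := by exact_mod_cast hp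
  have e1 : ((PK.zu X : GLc Unit X) : Matrix Unit Unit C(X × S1, ℂ)) = scalar Unit zf := rfl
  have e2 : ((↑(PK.zu X)⁻¹ : Matrix Unit Unit C(X × S1, ℂ))) = scalar Unit zi := rfl
  have hev : ∀ (f : C(X × S1, ℂ)) q, ev q f = f q := fun _ _ => rfl
  simp only [ContinuousMap.mul_apply, hE, hg, e1, e2]
  generalize hA : (zi : C(X × S1, ℂ)) (x, dir p.1.1) = A at hz
  generalize hB : (zf : C(X × S1, ℂ)) (x, dir p.1.1) = B at hz
  rcases i with i | i <;> rcases j with j | j <;> rcases k with k | k <;> rcases l with l | l <;>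
    simp [hev, hA, hB, -zi_apply, -zf_apply] <;> first | ring1 | linear_combination (- (‖p.1.1‖ : ℂ)^2 / 4) * hz - hp' / 4 | linear_combination ((‖p.1.1‖ : ℂ)^2 / 4) * hz + hp' / 4

end Lam
end PK

namespace PK
open Matrix Topology
open scoped Kronecker
set_option linter.all false

section tower

theorem pbpb {X Y Z : Type} [TopologicalSpace X] [TopologicalSpace Y] [TopologicalSpace Z] (f : C(X, Y)) (g : C(Z, X)) (x : K C(Y, ℂ)) :
    K.map (pb g) (K.map (pb f) x) = K.map (pb (f.comp g)) x := by
  rw [K.map_comp]; rfl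

theorem K_int_inj {X : Type} [TopologicalSpace X] [hX : Nonempty X] {m : ℤ} (h : (m : K C(X, ℂ)) = 0) : m = 0 := by
  have key : ∀ n : ℕ, (n : K C(X, ℂ)) = 0 → n = 0 := by
    intro n hn
    have h1 : kcl (1 : Matrix (Fin n) (Fin n) C(X, ℂ)) (by simp) = kcl (1 : Matrix (Fin 0) (Fin 0) C(X, ℂ)) (by simp) := by
      rw [kcl_one, kcl_one]; simpa using hn
    obtain ⟨k, u, v, h2, h3⟩ := kcl_eq_iff.1 h1
    obtain ⟨x⟩ := hX
    have h4 := congrArg (fun M => (ev x) (Matrix.trace M)) h2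
    have h5 := congrArg (fun M => (ev x) (Matrix.trace M)) h3
    simp only [Matrix.trace_mul_comm v u] at h5
    rw [h4] at h5
    simp [Matrix.trace, Fintype.sum_sum_type] at h5
    omega
  obtain ⟨n, rfl | rfl⟩ := m.eq_nat_or_neg
  · have := key n (by simpa using h)
    simp [this]
  · have := key n (by simpa using h)
    simp [this]

/-- tangent polynomials -/
noncomputable def Pp : ℕ → Polynomial ℤ
  | 0 => 1 + Polynomial.X
  | (k + 1) => (1 - Polynomial.X ^ 2) * Polynomial.derivative (Pp k)

/-- the Lambda formula -/
def LamT {X : Type} [TopologicalSpace X] (k : ℕ) (T : K C(X, ℂ)) : Prop :=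
  ∀ (Z : Type) [TopologicalSpace Z] (φ : C(Z, X)) (M : K C(Z, ℂ)), LineC M → IsUnit (1 + il M) → ∀ (w i2 : L2 Z),
    w * (1 + il M) = il M - 1 → i2 * 2 = 1 →
    Lam (M * K.map (pb φ) T) (1 + i2 ^ (k + 1) * Polynomial.aeval w (Pp k) * il (K.map (pb φ) T))

theorem unit_add_nil {R : Type*} [CommRing R] {a t : R} (ha : IsUnit a) (ht : t * t = 0) : IsUnit (a + t) := by
  obtain ⟨b, hb⟩ := ha.exists_right_inv
  refine IsUnit.of_mul_eq_one (b - b ^ 2 * t) ?_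
  linear_combination hb - (b ^ 2) * ht - b * t * hb

variable {X : Type} [TopologicalSpace X] [CompactSpace X]

theorem line_h {Z : Type} [TopologicalSpace Z] (φ : C(Z, X × S2)) : LineC (1 + K.map (pb φ) (tt X)) := by
  have : 1 + K.map (pb φ) (tt X) = K.map (pb φ) (cls (zu X)) := by
    rw [tt, map_sub, map_one]; ring
  rw [this]
  exact LineC.zu.map φ

theorem LamT_zero : LamT 0 (K.map (pb (ContinuousMap.fst : C(X × S2, X))) 1 * tt X) := by
  intro Z _ φ M hM hu w i2 hw h2
  have hL := line_h φ
  have hsq : K.map (pb φ) (tt X) * K.map (pb φ) (tt X) = 0 := by rw [← map_mul, tt_sq, map_zero]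
  rw [map_one, one_mul]
  generalize K.map (pb φ) (tt X) = t at *
  have hsq' : il t * il t = 0 := by rw [← map_mul, hsq, map_zero]
  have e : M * t = M * (1 + t) - M := by ring
  rw [e]
  refine Lam_sub (hM.mul hL).lam hM.lam ?_
  simp only [Pp, map_add, map_one, map_mul, Polynomial.aeval_X]
  generalize il M = m at *
  generalize il t = t at *
  linear_combination i2 * t * hw + m * t * h2

theorem LamT_succ {T : K C(X, ℂ)} (hT : T * T = 0) {k : ℕ} (h : LamT k T) :
    LamT (k + 1) (K.map (pb (ContinuousMap.fst : C(X × S2, X))) T * tt X) := by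
  intro Z _ φ M hM hu w i2 hw h2
  have hL := line_h φ
  have hsq : K.map (pb φ) (tt X) * K.map (pb φ) (tt X) = 0 := by rw [← map_mul, tt_sq, map_zero]
  rw [map_mul, pbpb]
  have h1 := h Z (ContinuousMap.fst.comp φ) M hM hu w i2 hw h2
  generalize K.map (pb φ) (tt X) = t at *
  have hTT : K.map (pb (ContinuousMap.fst.comp φ)) T * K.map (pb (ContinuousMap.fst.comp φ)) T = 0 := by rw [← map_mul, hT, map_zero]
  have hsq' : il t * il t = 0 := by rw [← map_mul, hsq, map_zero]
  have hu' : IsUnit (1 + il (M * (1 + t))) := by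
    rw [map_mul, map_add, map_one]
    have e : 1 + il M * (1 + il t) = (1 + il M) + il M * il t := by ring
    rw [e]
    apply unit_add_nil hu
    linear_combination (il M)^2 * hsq'
  have h3 := h Z (ContinuousMap.fst.comp φ) (M * (1 + t)) (hM.mul hL) hu' (w + i2 * (1 - w ^ 2) * il t) i2 ?_ h2
  · generalize K.map (pb (ContinuousMap.fst.comp φ)) T = τ at *
    have hTT' : il τ * il τ = 0 := by rw [← map_mul, hTT, map_zero]
    have e : M * (τ * t) = M * (1 + t) * τ - M * τ := by ring
    rw [e]
    refine Lam_sub h3 h1 ?_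
    rw [Polynomial.aeval_add_of_sq_eq_zero _ _ _ (by linear_combination (i2 * (1 - w^2))^2 * hsq')]
    simp only [Pp, map_mul, map_sub, map_one, map_pow, Polynomial.aeval_X]
    generalize (Polynomial.aeval w) (Pp k) = P0
    generalize (Polynomial.aeval w) (Polynomial.derivative (Pp k)) = P1
    linear_combination (i2 ^ (k + 1 + 1) * ((1 - w^2) * P1) * i2^(k+1) * P0 * il t) * hTT'
  · rw [map_mul, map_add, map_one]
    generalize il M = m at *
    generalize il t = t at *
    have h4 : (1 - w) * (1 + m) = 2 := by linear_combination -hw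
    linear_combination hw + (1 + w) * i2 * t * h4 + (i2 * (1 - w^2) * m) * hsq' + (1 + w) * t * h2 + t * hw

end tower
end PK

namespace PK
open Matrix Topology
open scoped Kronecker
set_option linter.all false

section good
/-- the inductive package -/
structure Twr (n : ℕ) (X κ ι : Type) [TopologicalSpace X] [CompactSpace X] [T2Space X] [Fintype κ] [DecidableEq κ] [Fintype ι] [DecidableEq ι]
    (γ : ι → Matrix κ κ ℂ) (yv : C(X, Sph ι)) (y0 : Sph ι) (T : K C(X, ℂ)) : Prop where
  ne : Nonempty X
  hcl : Cl γ
  cκ : Fintype.card κ = 2 ^ n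
  cι : Fintype.card ι = 2 * n + 1
  inj : ∀ m : ℤ, (m : K C(X, ℂ)) * T = 0 → m = 0
  base : T = 1 ∨ ∃ x0, yv x0 = y0
  sq : n ≠ 0 → T * T = 0
  inv : K.map (pb yv) (kcl (Em γ) (Em_idem hcl)) - 
      kcl ((((2⁻¹:ℂ) • (1 + rF γ y0.1))).map (cst X)) (idem_map _ (half_idem (rF_sq hcl y0))) = T
  even : ∀ (ν : Type) [Fintype ν] [DecidableEq ν] (e : Matrix ν ν C(Sph ι, ℂ)) (he : e * e = e), ∃ r q : ℤ,
    K.map (pb yv) (kcl e he) = r + q * T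
  lam0 : n = 0 → T = 1
  lamS : ∀ k, n = k + 1 → LamT k T
  gen : Algebra.adjoin ℂ (Set.range γ) = ⊤
  word : ∃ l : List ι, Odd l.length ∧ ∃ c : ℂ, c ≠ 0 ∧ (l.map γ).prod = c • 1

variable {n : ℕ} {X κ ι : Type} [TopologicalSpace X] [CompactSpace X] [T2Space X] [Fintype κ] [DecidableEq κ] [Fintype ι] [DecidableEq ι]
variable {γ : ι → Matrix κ κ ℂ} {yv : C(X, Sph ι)} {y0 : Sph ι} {T : K C(X, ℂ)}

/- the loop through the base point -/
theorem loop_mem (y0 : Sph ι) (w : Dsk) : ∑ i, oc w.1.re (fun i => Real.sqrt (1 - w.1.re ^ 2) * y0.1 i) i ^ 2 = 1 := by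
  have h1 : w.1.re ^ 2 ≤ 1 := by
    have := Complex.abs_re_le_norm w.1
    have h2 : |w.1.re| ≤ 1 := this.trans w.2
    exact (sq_le_one_iff_abs_le_one _).2 h2
  rw [Fintype.sum_option]
  simp only [oc_none, oc_some, mul_pow, ← Finset.mul_sum, y0.2]
  rw [Real.sq_sqrt (by linarith)]; ring

/-- extension of the loop -/
noncomputable def lpD (y0 : Sph ι) : C(Unit × Dsk, Sph (Option ι)) :=
  ⟨fun p => ⟨oc p.2.1.re (fun i => Real.sqrt (1 - p.2.1.re ^ 2) * y0.1 i), loop_mem y0 p.2⟩,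
    Continuous.subtype_mk (oc_cont (by fun_prop) (by fun_prop)) _⟩

theorem lpD_bd (y0 : Sph ι) : (lpD y0).comp (idx Unit bd) = pv (ContinuousMap.const Unit y0) y0 := by
  ext p : 1
  apply Subtype.ext
  show oc p.2.1.re (fun i => Real.sqrt (1 - p.2.1.re ^ 2) * y0.1 i) = vec y0.1 y0.1 p.2.1
  have h : p.2.1.re * p.2.1.re + p.2.1.im * p.2.1.im = 1 := by
    rw [← Complex.normSq_apply, Complex.normSq_eq_norm_sq, p.2.2]; norm_num
  have h2 : 1 - p.2.1.re ^ 2 = p.2.1.im ^ 2 := by linear_combination -h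
  rw [h2, Real.sqrt_sq_eq_abs]
  unfold vec
  congr 1
  funext i
  rcases le_total 0 p.2.1.im with h | h
  · rw [max_eq_left h, max_eq_right (by linarith), abs_of_nonneg h]; ring
  · rw [max_eq_right h, max_eq_left (by linarith), abs_of_nonpos h]; ring

theorem cls_loop {ν : Type} [Fintype ν] [DecidableEq ν] (y0 : Sph ι) (h : (Matrix ν ν C(Sph (Option ι), ℂ))ˣ) :
    cls (umap (pb (pv (ContinuousMap.const Unit y0) y0)) h) = Fintype.card ν := by
  rw [← lpD_bd, ← cls_ext (umap (pb (lpD y0)) h)]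
  rfl

theorem Twr.odd (G : Twr n X κ ι γ yv y0 T) {ν : Type} [Fintype ν] [DecidableEq ν] (h : (Matrix ν ν C(Sph (Option ι), ℂ))ˣ) :
    ∃ q : ℤ, cls (umap (pb (pv yv y0)) h) = (Fintype.card ν : K C(X × S2, ℂ)) + (q : K C(X × S2, ℂ)) * (K.map (pb ContinuousMap.fst) T * tt X) := by
  obtain ⟨x, hx⟩ := bottG (umap (pb (pv (ContinuousMap.id (Sph ι)) y0)) h)
  have hpull : ∀ {X' : Type} [TopologicalSpace X'] [CompactSpace X'] (yv : C(X', Sph ι)),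
      cls (umap (pb (pv yv y0)) h) = (Fintype.card ν : K C(X' × S2, ℂ)) + K.map (pb ContinuousMap.fst) (K.map (pb yv) x) * tt X' := by
    intro X' _ _ yv
    have h1 := congrArg (K.map (pb (lft S2 yv))) hx
    rw [cls_pb, map_add, map_natCast, map_mul, tt_pb, pbpb] at h1
    rw [pbpb]
    exact h1
  obtain ⟨a, k, rfl⟩ := K.exists_rep x
  obtain ⟨r, q, hrq⟩ : ∃ r q : ℤ, K.map (pb yv) (cl a) = r + q * T := by
    induction a using V.ind with
    | h ν' _ _ e he => exact G.even ν' e he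
  have h1 := hpull yv
  rw [map_sub, hrq, map_natCast] at h1
  rcases G.base with hT | ⟨x0, hx0⟩
  · refine ⟨r + q - k, ?_⟩
    rw [h1, hT]
    simp only [map_sub, map_add, map_mul, map_intCast, map_natCast, map_one]
    push_cast
    ring
  · have hrk : r - k = 0 := by
      have h2 := hpull (ContinuousMap.const Unit y0)
      rw [cls_loop] at h2
      have h3 := bottC (left_eq_add.1 h2)
      have h4 : K.map (pb (ContinuousMap.const Unit y0)) (cl a) = K.map (pb (ContinuousMap.const Unit x0)) (K.map (pb yv) (cl a)) := by
        rw [pbpb]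
        have : yv.comp (ContinuousMap.const Unit x0) = ContinuousMap.const Unit y0 := by
          ext u : 1; exact hx0
        rw [this]
      have h5 : K.map (pb (ContinuousMap.const Unit x0)) T = 0 := by
        rw [← G.inv, map_sub, pbpb, kcl_map, kcl_map, sub_eq_zero]
        apply kcl_congr
        apply mat_ext
        intro u
        show (2⁻¹:ℂ) • (1 + rF γ (yv x0).1) = (2⁻¹:ℂ) • (1 + rF γ y0.1)
        rw [hx0]
      rw [map_sub, h4, hrq, map_add, map_mul, h5, mul_zero, add_zero, map_intCast, map_natCast] at h3
      have : ((r - k : ℤ) : K C(Unit, ℂ)) = 0 := by push_cast; exact h3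
      exact K_int_inj this
    refine ⟨q, ?_⟩
    have : (r : ℤ) = k := by omega
    rw [h1, this]
    simp only [map_sub, map_add, map_mul, map_intCast, map_natCast, map_one]
    push_cast
    ring

theorem Twr.ccu (G : Twr n X κ ι γ yv y0 T) : cls (umap (pb (pv yv y0)) (cu G.hcl)) = (Fintype.card κ : K C(X × S2, ℂ)) + K.map (pb ContinuousMap.fst) T * tt X := by
  rw [cls_cu, G.inv]

theorem Twr.inj' (G : Twr n X κ ι γ yv y0 T) (m : ℤ) (h : (m : K C(X × S2, ℂ)) * (K.map (pb ContinuousMap.fst) T * tt X) = 0) : m = 0 := by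
  apply G.inj
  apply bottC
  rw [map_mul, map_intCast, mul_assoc, h]

theorem Twr.sq' (T : K C(X, ℂ)) : (K.map (pb (ContinuousMap.fst : C(X × S2, X))) T * tt X) * (K.map (pb ContinuousMap.fst) T * tt X) = 0 := by
  have := tt_sq (X := X)
  linear_combination (K.map (pb (ContinuousMap.fst : C(X × S2, X))) T)^2 * this

theorem Twr.lam' (G : Twr n X κ ι γ yv y0 T) : LamT n (K.map (pb (ContinuousMap.fst : C(X × S2, X))) T * tt X) := by
  rcases n with _ | k
  · rw [G.lam0 rfl]; exact LamT_zero
  · exact LamT_succ (G.sq (by omega)) (G.lamS k rfl)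

theorem Twr.lam1 (G : Twr n X κ ι γ yv y0 T) {i2 : L2 (X × S2)} (h2 : i2 * 2 = 1) :
    Lam (K.map (pb (ContinuousMap.fst : C(X × S2, X))) T * tt X) (1 + i2 ^ (n + 1) * (((Pp n).eval 0 : ℤ) : L2 (X × S2)) * il (K.map (pb (ContinuousMap.fst : C(X × S2, X))) T * tt X)) := by
  have := G.lam' (X × S2) (ContinuousMap.id _) 1 LineC.one (by rw [map_one]; convert il_two (X := X × S2) using 1; norm_num) 0 i2 (by rw [map_one]; ring) h2
  have e : ∀ x : K C(X × S2, ℂ), K.map (pb (ContinuousMap.id (X × S2))) x = x := fun x => K.map_id x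
  rw [e, one_mul] at this
  convert this using 4
  have := Polynomial.aeval_algebraMap_apply (L2 (X × S2)) (0 : ℤ) (Pp n)
  simpa using this.symm

theorem sv_base (yv : C(X, Sph ι)) (y0 : Sph ι) (x : X) : sv yv y0 (x, ⟨(0, -1), by simp⟩) = sgl none (-1) (by norm_num) := by
  apply Subtype.ext
  show oc (-1) (vec (yv x).1 y0.1 0) = Pi.single none (-1)
  funext o
  rcases o with _ | _ | i <;> simp [vec]

end good
end PK

namespace PK
open Matrix Topology
open scoped Kronecker
set_option linter.all false

section good2
variable {n : ℕ} {X κ ι : Type} [TopologicalSpace X] [CompactSpace X] [T2Space X] [Fintype κ] [DecidableEq κ] [Fintype ι] [DecidableEq ι]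
variable {γ : ι → Matrix κ κ ℂ} {yv : C(X, Sph ι)} {y0 : Sph ι} {T : K C(X, ℂ)}

theorem gs_none : gs γ none = fromBlocks 1 0 0 (-1) := rfl
theorem gs_sn : gs γ (some none) = fromBlocks 0 1 1 0 := rfl
theorem gs_ss (i : ι) : gs γ (some (some i)) = fromBlocks 0 (-Complex.I • γ i) (Complex.I • γ i) 0 := rfl

theorem gs_list (l : List ι) : (Even l.length → (l.map fun i => gs γ (some (some i))).prod = fromBlocks (l.map γ).prod 0 0 (l.map γ).prod) ∧
    (Odd l.length → (l.map fun i => gs γ (some (some i))).prod = fromBlocks 0 (-Complex.I • (l.map γ).prod) (Complex.I • (l.map γ).prod) 0) := by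
  induction l with
  | nil => simp
  | cons i l ih =>
    constructor
    · intro h
      have h' : Odd l.length := by rw [List.length_cons] at h; by_contra h2; rw [Nat.not_odd_iff_even] at h2; exact (Nat.not_odd_iff_even.2 h) h2.add_one
      rw [List.map_cons, List.prod_cons, ih.2 h', gs_ss, fromBlocks_multiply, List.map_cons, List.prod_cons]
      simp [smul_smul]
    · intro h
      have h' : Even l.length := by rw [List.length_cons] at h; by_contra h2; rw [Nat.not_even_iff_odd] at h2; exact (Nat.not_even_iff_odd.2 h) h2.add_one
      rw [List.map_cons, List.prod_cons, ih.1 h', gs_ss, fromBlocks_multiply, List.map_cons, List.prod_cons]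
      simp [smul_smul]

theorem d_list (l : List ι) : (l.map fun i => fromBlocks (γ i) 0 0 (-γ i)).prod = fromBlocks (l.map γ).prod 0 0 ((-1 : ℂ) ^ l.length • (l.map γ).prod) := by
  induction l with
  | nil => simp
  | cons i l ih =>
    rw [List.map_cons, List.prod_cons, ih, fromBlocks_multiply, List.map_cons, List.prod_cons, List.length_cons, pow_succ]
    simp

theorem gs_word (h : ∃ l : List ι, Odd l.length ∧ ∃ c : ℂ, c ≠ 0 ∧ (l.map γ).prod = c • 1) :
    ∃ l : List (Option (Option ι)), Odd l.length ∧ ∃ c : ℂ, c ≠ 0 ∧ (l.map (gs γ)).prod = c • 1 := by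
  obtain ⟨l, hl, c, hc, hp⟩ := h
  refine ⟨l.map (fun i => some (some i)) ++ [some none, none], by simp [parity_simps, hl], -Complex.I * c, by simp [hc], ?_⟩
  rw [List.map_append, List.prod_append, List.map_map]
  have e : (gs γ ∘ fun i => some (some i)) = fun i => gs γ (some (some i)) := rfl
  rw [e, (gs_list l).2 hl, hp, List.map_cons, List.map_cons, List.map_nil, List.prod_cons, List.prod_cons, List.prod_nil, mul_one, gs_none, gs_sn,
    fromBlocks_multiply, fromBlocks_multiply, ← fromBlocks_one, fromBlocks_smul]
  simp [smul_smul]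

theorem gen_some (hg : Algebra.adjoin ℂ (Set.range γ) = ⊤) (h : ∃ l : List ι, Odd l.length ∧ ∃ c : ℂ, c ≠ 0 ∧ (l.map γ).prod = c • 1) :
    Algebra.adjoin ℂ (Set.range fun i => gs γ (some i)) = ⊤ := by
  set S := Algebra.adjoin ℂ (Set.range fun i => gs γ (some i)) with hS
  have hA : fromBlocks (0 : Matrix κ κ ℂ) 1 1 0 ∈ S := Algebra.subset_adjoin ⟨none, rfl⟩
  have hC : ∀ i, fromBlocks 0 (-Complex.I • γ i) (Complex.I • γ i) 0 ∈ S := fun i => Algebra.subset_adjoin ⟨some i, rfl⟩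
  have hd : ∀ i, fromBlocks (γ i) 0 0 (-γ i) ∈ S := by
    intro i
    have := S.smul_mem (S.mul_mem hA (hC i)) (-Complex.I)
    rw [fromBlocks_multiply, fromBlocks_smul] at this
    convert this using 1
    simp [smul_smul]
  obtain ⟨l, hl, c, hc, hp⟩ := h
  have hω : fromBlocks (1 : Matrix κ κ ℂ) 0 0 (-1) ∈ S := by
    have h1 : (l.map fun i => fromBlocks (γ i) 0 0 (-γ i)).prod ∈ S := by
      apply S.list_prod_mem
      intro x hx
      obtain ⟨i, _, rfl⟩ := List.mem_map.1 hx
      exact hd i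
    rw [d_list, hp, hl.neg_one_pow] at h1
    have := S.smul_mem h1 c⁻¹
    rw [fromBlocks_smul] at this
    convert this using 1
    simp [smul_smul, hc]
  have hP : fromBlocks (1 : Matrix κ κ ℂ) 0 0 0 ∈ S := by
    have := S.smul_mem (S.add_mem hω S.one_mem) (2⁻¹ : ℂ)
    rw [← fromBlocks_one, fromBlocks_add, fromBlocks_smul] at this
    convert this using 1
    rw [← two_smul ℂ (1 : Matrix κ κ ℂ), smul_smul]
    norm_num
  have hx : ∀ x : Matrix κ κ ℂ, fromBlocks x 0 0 (0 : Matrix κ κ ℂ) ∈ S := by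
    intro x
    have hx : x ∈ Algebra.adjoin ℂ (Set.range γ) := by rw [hg]; trivial
    induction hx using Algebra.adjoin_induction with
    | mem x hx =>
      obtain ⟨i, rfl⟩ := hx
      have := S.mul_mem hP (hd i)
      rw [fromBlocks_multiply] at this
      simpa using this
    | algebraMap r =>
      have := S.smul_mem hP r
      rw [fromBlocks_smul] at this
      convert this using 1
      simp [Algebra.algebraMap_eq_smul_one]
    | add x y _ _ hx hy =>
      have := S.add_mem hx hy
      rw [fromBlocks_add] at this
      simpa using this
    | mul x y _ _ hx hy =>
      have := S.mul_mem hx hy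
      rw [fromBlocks_multiply] at this
      simpa using this
  rw [eq_top_iff]
  rintro M -
  have e : M = fromBlocks M.toBlocks₁₁ 0 0 0 + fromBlocks M.toBlocks₁₂ 0 0 0 * fromBlocks 0 1 1 0 + fromBlocks 0 1 1 0 * fromBlocks M.toBlocks₂₁ 0 0 0
      + fromBlocks 0 1 1 0 * fromBlocks M.toBlocks₂₂ 0 0 0 * fromBlocks 0 1 1 0 := by
    conv_lhs => rw [← fromBlocks_toBlocks M]
    simp [fromBlocks_multiply, fromBlocks_add]
  rw [e]
  exact S.add_mem (S.add_mem (S.add_mem (hx _) (S.mul_mem (hx _) hA)) (S.mul_mem hA (hx _))) (S.mul_mem (S.mul_mem hA (hx _)) hA)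

theorem Twr.succ (G : Twr n X κ ι γ yv y0 T) : Twr (n + 1) (X × S2) (κ ⊕ κ) (Option (Option ι)) (gs γ) (sv yv y0) (sgl none (-1) (by norm_num))
    (K.map (pb ContinuousMap.fst) T * tt X) where
  ne := by obtain ⟨x⟩ := G.ne; exact ⟨(x, ⟨(0, -1), by simp⟩)⟩
  hcl := gs_Cl G.hcl
  cκ := by rw [Fintype.card_sum, G.cκ]; ring
  cι := by rw [Fintype.card_option, Fintype.card_option, G.cι]; ring
  inj := G.inj'
  base := by obtain ⟨x⟩ := G.ne; exact Or.inr ⟨_, sv_base yv y0 x⟩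
  sq := fun _ => Twr.sq' T
  inv := by
    rw [kcl_map, kcl_congr (hf := eg_idem _) (sv_Em yv y0 G.hcl)]
    have h1 := G.ccu
    rw [cls] at h1
    rw [h1, kcl_cst (half_idem (rF_sq (gs_Cl G.hcl) _)) (r := Fintype.card κ)]
    · ring
    · have e : (sgl (none : Option (Option ι)) (-1) (by norm_num)).1 = oc (-1) (oc 0 0) := by
        funext o
        rcases o with _ | _ | i <;> simp [sgl]
      rw [e, gs_rF]
      simp [Matrix.trace, Fintype.sum_sum_type]
      ring
  even := by
    intro ν _ _ e he
    obtain ⟨r, h, hh⟩ := sv_clut yv y0 he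
    obtain ⟨q, hq⟩ := G.odd h
    refine ⟨r, q, ?_⟩
    rw [hh, hq]
    simp
  lam0 := by omega
  lamS := by
    intro k hk
    obtain rfl : n = k := by omega
    exact G.lam'
  gen := by
    rw [eq_top_iff, ← gen_some G.gen G.word]
    apply Algebra.adjoin_mono
    rintro _ ⟨i, rfl⟩
    exact ⟨some i, rfl⟩
  word := gs_word G.word

theorem Cl_one : Cl (fun _ : Unit => (1 : Matrix Unit Unit ℂ)) := by
  intro y
  simp [FC, smul_smul, pow_two]

theorem Twr.zero : Twr 0 Unit Unit Unit (fun _ => 1) (ContinuousMap.const Unit (sgl () 1 (by norm_num))) (sgl () (-1) (by norm_num)) 1 where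
  ne := ⟨()⟩
  hcl := Cl_one
  cκ := rfl
  cι := rfl
  inj := by
    intro m hm
    rw [mul_one] at hm
    exact K_int_inj hm
  base := Or.inl rfl
  sq := by omega
  inv := by
    have h1 : rF (fun _ => (1 : Matrix Unit Unit ℂ)) (sgl () 1 (by norm_num)).1 = 1 := by simp [rF, FC, sgl]
    have h2 : rF (fun _ => (1 : Matrix Unit Unit ℂ)) (sgl () (-1) (by norm_num)).1 = -1 := by simp [rF, FC, sgl]
    rw [kcl_cst (half_idem (rF_sq Cl_one _)) (r := 0), kcl_map, kcl_congr (f := 1) (hf := by simp), kcl_one]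
    · simp
    · apply mat_ext
      intro x
      show (2⁻¹:ℂ) • (1 + rF (fun _ => (1 : Matrix Unit Unit ℂ)) (sgl () 1 (by norm_num)).1) = _
      rw [h1, ev_one, ← two_smul ℂ (1 : Matrix Unit Unit ℂ), smul_smul]
      norm_num
    · rw [h2]; simp
  even := by
    intro ν _ _ e he
    have h1 : ∃ r : ℕ, (e.map (ev (sgl () 1 (by norm_num)))).trace = r := ⟨_, idem_trace (idem_map _ he)⟩
    obtain ⟨r, hr⟩ := h1
    refine ⟨r, 0, ?_⟩
    have := kcl_cst (Y := Unit) (idem_map _ he) hr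
    rw [kcl_map]
    simp only [Int.cast_natCast, Int.cast_zero, zero_mul, add_zero]
    rw [← this]
    apply kcl_congr
    rfl
  lam0 := fun _ => rfl
  lamS := by omega
  gen := by
    rw [eq_top_iff]
    rintro M -
    have : M = algebraMap ℂ _ (M () ()) := by
      ext ⟨⟩ ⟨⟩; simp [Matrix.algebraMap_matrix_apply]
    rw [this]
    exact Subalgebra.algebraMap_mem _ _
  word := ⟨[()], by simp, 1, one_ne_zero, by simp⟩

theorem Twr.exists (n : ℕ) : ∃ (X κ ι : Type) (_ : TopologicalSpace X) (_ : CompactSpace X) (_ : T2Space X) (_ : Fintype κ) (_ : DecidableEq κ) (_ : Fintype ι) (_ : DecidableEq ι)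
    (γ : ι → Matrix κ κ ℂ) (yv : C(X, Sph ι)) (y0 : Sph ι) (T : K C(X, ℂ)), Twr n X κ ι γ yv y0 T := by
  induction n with
  | zero => exact ⟨_, _, _, _, _, _, _, _, _, _, _, _, _, _, Twr.zero⟩
  | succ n ih =>
    obtain ⟨X, κ, ι, _, _, _, _, _, _, _, γ, yv, y0, T, G⟩ := ih
    exact ⟨_, _, _, _, _, _, _, _, _, _, _, _, _, _, G.succ⟩

end good2
end PK

namespace PK
open Matrix Topology
open scoped Kronecker
set_option linter.all false

section alg
variable {J N : Type} [Fintype J] [DecidableEq J] [Fintype N] [DecidableEq N]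

/-- the standard quadratic form -/
noncomputable def QJ (J : Type) [Fintype J] : QuadraticForm ℂ (J → ℂ) := QuadraticMap.weightedSumSquares ℂ (fun _ : J => (1:ℂ))

theorem QJ_apply (v : J → ℂ) : QJ J v = ∑ i, v i ^ 2 := by
  simp [QJ, QuadraticMap.weightedSumSquares_apply, pow_two]

/-- linear version of FC -/
noncomputable def FCl (c : J → Matrix N N ℂ) : (J → ℂ) →ₗ[ℂ] Matrix N N ℂ where
  toFun := FC c
  map_add' v w := by simp [FC, add_smul, Finset.sum_add_distrib]
  map_smul' a v := by simp [FC, mul_smul, Finset.smul_sum]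

/-- complex spin module: full matrix algebra -/
structure Spn (c : J → Matrix N N ℂ) : Prop where
  cl : Cl c
  gen : Algebra.adjoin ℂ (Set.range c) = ⊤
  dim : Fintype.card N * Fintype.card N = 2 ^ Fintype.card J

theorem FC_single (c : J → Matrix N N ℂ) (i : J) : FC c (Pi.single i 1) = c i := by
  simp [FC, Pi.single_apply, ite_smul]

theorem Spn.ind {c : J → Matrix N N ℂ} (h : Spn c) {P : Matrix N N ℂ → Prop} (m : Matrix N N ℂ)
    (h1 : ∀ a : ℂ, P (algebraMap ℂ _ a)) (h2 : ∀ v, P (FC c v)) (h3 : ∀ a b, P a → P b → P (a + b)) (h4 : ∀ a b, P a → P b → P (a * b)) : P m := by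
  have hm : m ∈ Algebra.adjoin ℂ (Set.range c) := by rw [h.gen]; trivial
  induction hm using Algebra.adjoin_induction with
  | mem x hx => obtain ⟨i, rfl⟩ := hx; have := h2 (Pi.single i 1); rwa [FC_single] at this
  | algebraMap r => exact h1 r
  | add x y _ _ hx hy => exact h3 _ _ hx hy
  | mul x y _ _ hx hy => exact h4 _ _ hx hy

theorem Spn.cond {c : J → Matrix N N ℂ} (h : Spn c) (v : J → ℂ) : FCl c v * FCl c v = algebraMap ℂ _ (QJ J v) := by
  rw [QJ_apply, Algebra.algebraMap_eq_smul_one]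
  exact h.cl v

theorem Spn.bij {c : J → Matrix N N ℂ} (h : Spn c) : Function.Bijective (CliffordAlgebra.lift (QJ J) ⟨FCl c, h.cond⟩) := by
  have hs : Function.Surjective (CliffordAlgebra.lift (QJ J) ⟨FCl c, h.cond⟩) := by
    rw [← AlgHom.range_eq_top, CliffordAlgebra.range_lift, eq_top_iff, ← h.gen]
    refine Algebra.adjoin_mono ?_
    rintro _ ⟨i, rfl⟩
    exact ⟨Pi.single i 1, FC_single c i⟩
  haveI : Invertible (2:ℂ) := invertibleOfNonzero two_ne_zero
  let B := (bL J).map (CliffordAlgebra.equivExterior (QJ J)).symm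
  haveI : Module.Finite ℂ (CliffordAlgebra (QJ J)) := Module.Finite.of_basis B
  have hd : Module.finrank ℂ (CliffordAlgebra (QJ J)) = Module.finrank ℂ (Matrix N N ℂ) := by
    rw [Module.finrank_eq_card_basis B, Module.finrank_matrix, Fintype.card_finset]
    simp [h.dim]
  exact ⟨(LinearMap.injective_iff_surjective_of_finrank_eq_finrank (f := (CliffordAlgebra.lift (QJ J) ⟨FCl c, h.cond⟩).toLinearMap) hd).2 hs, hs⟩

/-- the representation -/
noncomputable def Spn.rho {c : J → Matrix N N ℂ} (h : Spn c) : CliffordAlgebra (QJ J) ≃ₐ[ℂ] Matrix N N ℂ := AlgEquiv.ofBijective _ h.bij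

theorem Spn.rho_ι {c : J → Matrix N N ℂ} (h : Spn c) (v : J → ℂ) : h.rho (CliffordAlgebra.ι (QJ J) v) = FC c v :=
  CliffordAlgebra.lift_ι_apply _ _ _

theorem Spn.rho_symm {c : J → Matrix N N ℂ} (h : Spn c) (v : J → ℂ) : h.rho.symm (FC c v) = CliffordAlgebra.ι (QJ J) v := by
  rw [← h.rho_ι, AlgEquiv.symm_apply_apply]

theorem Spn.univ {c : J → Matrix N N ℂ} (h : Spn c) (d : (J → ℂ) →ₗ[ℂ] Matrix N N ℂ) (hd : ∀ v, d v * d v = (∑ i, v i ^ 2) • 1) :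
    ∃ Φ : Matrix N N ℂ →ₐ[ℂ] Matrix N N ℂ, ∀ v, Φ (FC c v) = d v := by
  refine ⟨(CliffordAlgebra.lift (QJ J) ⟨d, fun v => ?_⟩).comp h.rho.symm.toAlgHom, fun v => ?_⟩
  · rw [QJ_apply, Algebra.algebraMap_eq_smul_one]; exact hd v
  · have := h.rho_symm v
    simp [this, CliffordAlgebra.lift_ι_apply]

theorem Spn.center {c : J → Matrix N N ℂ} (h : Spn c) {m : Matrix N N ℂ} (hm : ∀ v, FC c v * m = m * FC c v) : ∃ a : ℂ, m = a • 1 := by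
  have : ∀ x : Matrix N N ℂ, x * m = m * x := by
    intro x
    refine h.ind (P := fun x => x * m = m * x) x ?_ hm ?_ ?_
    · intro a; exact Algebra.commutes a m
    · intro a b ha hb; rw [add_mul, mul_add, ha, hb]
    · intro a b ha hb; rw [mul_assoc, hb, ← mul_assoc, ha, mul_assoc]
  have h2 : m ∈ Set.range (Matrix.scalar N : ℂ → Matrix N N ℂ) := Matrix.mem_range_scalar_of_commute_single (fun i j _ => this _)
  obtain ⟨a, rfl⟩ := h2
  exact ⟨a, by rw [Matrix.scalar_apply, Matrix.smul_one_eq_diagonal]⟩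

theorem Spn.cont {c : J → Matrix N N ℂ} (h : Spn c) {Z : Type*} [TopologicalSpace Z] (Φ : Z → Matrix N N ℂ →ₐ[ℂ] Matrix N N ℂ)
    (hΦ : ∀ v, Continuous fun z => Φ z (FC c v)) (m : Matrix N N ℂ) : Continuous fun z => Φ z m := by
  refine h.ind (P := fun m => Continuous fun z => Φ z m) m ?_ hΦ ?_ ?_
  · intro a; simpa using continuous_const
  · intro a b ha hb; simp only [map_add]; exact ha.add hb
  · intro a b ha hb; simpa using ha.matrix_mul hb

theorem FC_mulVec_sq (O : Matrix J J ℂ) (hO : Oᵀ * O = 1) (v : J → ℂ) : ∑ i, (O *ᵥ v) i ^ 2 = ∑ i, v i ^ 2 := by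
  have : ∀ w : J → ℂ, ∑ i, w i ^ 2 = w ⬝ᵥ w := fun w => by simp [dotProduct, pow_two]
  rw [this, this, dotProduct_mulVec, ← mulVec_transpose, mulVec_mulVec, hO, one_mulVec]

theorem Spn.auto {c : J → Matrix N N ℂ} (h : Spn c) (O : Matrix J J ℂ) (hO : Oᵀ * O = 1) :
    ∃ Φ : Matrix N N ℂ →ₐ[ℂ] Matrix N N ℂ, ∀ v, Φ (FC c v) = FC c (O *ᵥ v) := by
  refine h.univ ((FCl c).comp (Matrix.toLin' O)) fun v => ?_
  have := h.cl (O *ᵥ v)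
  rw [FC_mulVec_sq O hO] at this
  exact this

theorem ctr_nat (O : Matrix J J ℂ) (d d' : Module.Dual ℂ (J → ℂ)) (hd : ∀ w, d' (O *ᵥ w) = d w) (x : EA J) :
    eam O (CliffordAlgebra.contractLeft d x) = CliffordAlgebra.contractLeft d' (eam O x) := by
  induction x using CliffordAlgebra.left_induction with
  | algebraMap r =>
    rw [CliffordAlgebra.contractLeft_algebraMap, map_zero]
    have : eam O (algebraMap ℂ (EA J) r) = algebraMap ℂ (EA J) r := AlgHom.commutes _ _
    erw [this]
    exact (CliffordAlgebra.contractLeft_algebraMap _ _ _).symm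
  | add x y hx hy => simp only [map_add, hx, hy]
  | ι_mul x m hx =>
    rw [CliffordAlgebra.contractLeft_ι_mul]
    have h1 : eam O (CliffordAlgebra.ι (0 : QuadraticForm ℂ (J → ℂ)) m) = CliffordAlgebra.ι (0 : QuadraticForm ℂ (J → ℂ)) (O *ᵥ m) := eam_ι O m
    rw [map_sub, map_smul, map_mul, map_mul, h1, hx, CliffordAlgebra.contractLeft_ι_mul, hd]

theorem Spn.ext {c : J → Matrix N N ℂ} (h : Spn c) : ∃ ψ : Matrix N N ℂ ≃ₗ[ℂ] EA J, ∀ (O : Matrix J J ℂ) (hO : Oᵀ * O = 1) (Φ : Matrix N N ℂ →ₐ[ℂ] Matrix N N ℂ)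
    (hΦ : ∀ v, Φ (FC c v) = FC c (O *ᵥ v)) (m : Matrix N N ℂ), ψ (Φ m) = eam O (ψ m) := by
  haveI : Invertible (2:ℂ) := invertibleOfNonzero two_ne_zero
  refine ⟨h.rho.symm.toLinearEquiv.trans (CliffordAlgebra.equivExterior (QJ J)), fun O hO Φ hΦ m => ?_⟩
  obtain ⟨x, rfl⟩ := h.rho.surjective m
  simp only [LinearEquiv.trans_apply, AlgEquiv.toLinearEquiv_apply, AlgEquiv.symm_apply_apply]
  induction x using CliffordAlgebra.left_induction with
  | algebraMap r =>
    simp only [AlgEquiv.commutes, AlgHom.commutes, CliffordAlgebra.equivExterior, CliffordAlgebra.changeFormEquiv_apply, CliffordAlgebra.changeForm_algebraMap]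
  | add x y hx hy => simp only [map_add, hx, hy]
  | ι_mul x m hx =>
    rw [map_mul, map_mul, map_mul, h.rho_ι, hΦ, h.rho_symm]
    simp only [CliffordAlgebra.equivExterior, CliffordAlgebra.changeFormEquiv_apply, CliffordAlgebra.changeForm_ι_mul, map_sub] at hx ⊢
    rw [hx]
    congr 1
    · rw [map_mul]
      congr 1
      exact (eam_ι O m).symm
    · rw [ctr_nat O]
      intro w
      have hb : ∀ v w : J → ℂ, QuadraticMap.associated (R := ℂ) (-QJ J) v w = -(v ⬝ᵥ w) := by
        intro v w
        have : ∀ u, QJ J u = u ⬝ᵥ u := fun u => by rw [QJ_apply]; simp [dotProduct, pow_two]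
        have h3 := congrArg (fun B => B v w) (QuadraticMap.two_nsmul_associated ℂ (-QJ J))
        simp only [LinearMap.smul_apply, QuadraticMap.polarBilin_apply_apply, QuadraticMap.polar, QuadraticMap.neg_apply, this, add_dotProduct, dotProduct_add, dotProduct_comm w v, nsmul_eq_mul, Nat.cast_ofNat] at h3
        linear_combination h3 / 2
      rw [hb, hb, dotProduct_mulVec, ← mulVec_transpose, mulVec_mulVec, hO, one_mulVec]
end alg
end PK

namespace PK
open Matrix Topology
open scoped Kronecker
set_option linter.all false

section inner
variable {ι N : Type} [Fintype ι] [DecidableEq ι] [Fintype N] [DecidableEq N]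

/-- families of automorphisms of the matrix algebra over a ball are inner -/
theorem inner_bal [Nonempty N] (Φ : Bal ι → Matrix N N ℂ →ₐ[ℂ] Matrix N N ℂ) (hΦ : ∀ m, Continuous fun z => Φ z m) :
    ∃ S S' : Bal ι → Matrix N N ℂ, Continuous S ∧ Continuous S' ∧ (∀ z, S z * S' z = 1) ∧ ∀ z m, Φ z m * S z = S z * m := by
  obtain ⟨i0⟩ := ‹Nonempty N›
  have hee : ∀ i j k : N, (Matrix.single i j (1:ℂ)) * Matrix.single j k 1 = Matrix.single i k 1 := fun i j k => by simp
  let e : Matrix N N C(Bal ι, ℂ) := mkC (fun z => Φ z (Matrix.single i0 i0 1)) (hΦ _)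
  have he : e * e = e := by
    refine mat_ext fun z => ?_
    rw [Matrix.map_mul]
    show Φ z _ * Φ z _ = Φ z _
    rw [← map_mul, hee]
  obtain ⟨r, u, v, h1, h2⟩ := triv_bal he
  have htr : ∀ z i, (Φ z (Matrix.single i i 1)).trace = (Φ z (Matrix.single i0 i0 1)).trace := by
    intro z i
    rw [← hee i i0 i, map_mul, Matrix.trace_mul_comm, ← map_mul, hee]
  have hone : ∑ i : N, Matrix.single i i (1:ℂ) = 1 := by
    ext a b
    rw [Matrix.sum_apply, Finset.sum_eq_single a]
    · simp [Matrix.single_apply, Matrix.one_apply]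
    · intro i _ hi; simp [Matrix.single_apply, hi]
    · simp
  have htr1 : ∀ z, (Φ z (Matrix.single i0 i0 1)).trace = 1 := by
    intro z
    have h3 : (Φ z (∑ i : N, Matrix.single i i (1:ℂ))).trace = Fintype.card N := by rw [hone, map_one, Matrix.trace_one]
    rw [map_sum, Matrix.trace_sum, Finset.sum_congr rfl fun i _ => htr z i, Finset.sum_const, Finset.card_univ, nsmul_eq_mul] at h3
    have h4 : (Fintype.card N : ℂ) ≠ 0 := by
      have : 0 < Fintype.card N := Fintype.card_pos_iff.2 ⟨i0⟩
      exact_mod_cast this.ne'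
    exact mul_left_cancel₀ h4 (h3.trans (mul_one _).symm)
  have hr : r = 1 := by
    have h3 := rank_trace h1 h2 b0
    have h4 : (e.map (ev b0)).trace = 1 := htr1 b0
    rw [h4] at h3
    exact_mod_cast h3
  subst hr
  have hu : ∀ i, Continuous fun z : Bal ι => u i 0 z := fun i => (u i 0).continuous
  have hv : ∀ i, Continuous fun z : Bal ι => v 0 i z := fun i => (v 0 i).continuous
  have huv : ∀ z a b, u a 0 z * v 0 b z = Φ z (Matrix.single i0 i0 1) a b := by
    intro z a b
    have h3 := congrArg (fun M => (M.map (ev z)) a b) h1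
    simp only [Matrix.map_mul] at h3
    refine Eq.trans ?_ h3
    simp [Matrix.mul_apply]
  let S : Bal ι → Matrix N N ℂ := fun z => Matrix.of fun a i => ((Φ z (Matrix.single i i0 1)) *ᵥ (fun b => u b 0 z)) a
  let S' : Bal ι → Matrix N N ℂ := fun z => Matrix.of fun i a => ((fun b => v 0 b z) ᵥ* (Φ z (Matrix.single i0 i 1))) a
  refine ⟨S, S', ?_, ?_, ?_, ?_⟩
  · refine continuous_matrix fun a i => ?_
    exact continuous_finset_sum _ fun b _ => ((hΦ _).matrix_elem a b).mul (hu b)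
  · refine continuous_matrix fun i a => ?_
    exact continuous_finset_sum _ fun b _ => (hv b).mul ((hΦ _).matrix_elem b a)
  · intro z
    have h3 : vecMulVec (fun b => u b 0 z) (fun b => v 0 b z) = Φ z (Matrix.single i0 i0 1) := by
      ext a b; exact huv z a b
    have h4 : S z * S' z = ∑ i, Φ z (Matrix.single i i0 1) * (vecMulVec (fun b => u b 0 z) (fun b => v 0 b z)) * Φ z (Matrix.single i0 i 1) := by
      ext a b
      rw [Matrix.sum_apply, Matrix.mul_apply]
      refine Finset.sum_congr rfl fun i _ => ?_
      rw [Matrix.mul_vecMulVec, Matrix.vecMulVec_mul]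
      rfl
    rw [h4]
    simp only [h3, ← map_mul, hee, ← map_sum, hone, map_one]
  · intro z m
    ext a i
    have h3 : (Φ z m * S z) a i = ((Φ z (m * Matrix.single i i0 1)) *ᵥ (fun b => u b 0 z)) a := by
      rw [map_mul, ← Matrix.mulVec_mulVec]; rfl
    have h4 : m * Matrix.single i i0 1 = ∑ j, m j i • Matrix.single j i0 (1:ℂ) := by
      ext p q
      by_cases hq : i0 = q <;> simp [Matrix.mul_apply, Matrix.sum_apply, Matrix.single_apply, hq]
    rw [h3, h4, map_sum, Matrix.sum_mulVec, Finset.sum_apply, Matrix.mul_apply]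
    refine Finset.sum_congr rfl fun j _ => ?_
    rw [map_smul, Matrix.smul_mulVec]
    simp [S, mul_comm]

/-- square roots on a ball -/
theorem sqrt_bal (μ : Bal ι → ℂ) (hμ : Continuous μ) (h0 : ∀ z, μ z ≠ 0) : ∃ s : Bal ι → ℂ, Continuous s ∧ ∀ z, s z * s z = μ z := by
  obtain ⟨H⟩ := (bal_contr (ι := ι)).symm
  let F : C(unitInterval × Bal ι, {z : ℂ // z ≠ 0}) := ⟨fun p => ⟨μ (H p), h0 _⟩, Continuous.subtype_mk (hμ.comp H.continuous) _⟩
  have hF : ∀ a, F (0, a) = (fun z : ℂ ↦ (⟨_, z.exp_ne_zero⟩ : {z : ℂ // z ≠ 0})) ((ContinuousMap.const (Bal ι) (Complex.log (μ b0))) a) := by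
    intro a
    apply Subtype.ext
    show μ (H (0, a)) = Complex.exp (Complex.log (μ b0))
    rw [Complex.exp_log (h0 _)]
    simp
  have hl := Complex.isCoveringMap_exp.liftHomotopy_lifts F _ hF
  let G := Complex.isCoveringMap_exp.liftHomotopy F _ hF
  refine ⟨fun z => Complex.exp (G (1, z) / 2), by fun_prop, fun z => ?_⟩
  rw [← Complex.exp_add, add_halves]
  have h3 := congrArg Subtype.val (congrFun hl (1, z))
  have h4 : Complex.exp (G (1, z)) = μ (H (1, z)) := h3
  rw [h4]; simp

/-- connectedness of the sphere -/
theorem sph_conn (h : 2 ≤ Fintype.card ι) : IsPreconnected (Set.univ : Set (Sph ι)) := by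
  have hc : IsPreconnected (Metric.sphere (0 : EuclideanSpace ℝ ι) 1) := by
    refine isPreconnected_sphere ?_ 0 1
    rw [← Module.finrank_eq_rank, finrank_euclideanSpace]
    exact_mod_cast h
  have hf : ∀ x : Metric.sphere (0 : EuclideanSpace ℝ ι) 1, ∑ i, x.1 i ^ 2 = 1 := by
    intro x
    have h1 := x.2
    rw [mem_sphere_zero_iff_norm, EuclideanSpace.norm_eq, Real.sqrt_eq_one] at h1
    simpa using h1
  haveI := isPreconnected_iff_preconnectedSpace.1 hc
  let F : Metric.sphere (0 : EuclideanSpace ℝ ι) 1 → Sph ι := fun x => ⟨fun i => x.1 i, hf x⟩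
  have hF : Continuous F := Continuous.subtype_mk (by fun_prop) _
  have hs : Function.Surjective F := by
    intro y
    refine ⟨⟨WithLp.toLp 2 y.1, ?_⟩, rfl⟩
    rw [mem_sphere_zero_iff_norm, EuclideanSpace.norm_eq, Real.sqrt_eq_one]
    simpa using y.2
  have := isPreconnected_univ.image F hF.continuousOn
  rwa [Set.image_univ, hs.range_eq] at this

/-- sign functions are constant -/
theorem sgn_const (h : 2 ≤ Fintype.card ι) (f : Sph ι → ℂ) (hf : Continuous f) (h1 : ∀ y, f y * f y = 1) :
    ∃ a : ℂ, a * a = 1 ∧ ∀ y, f y = a := by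
  haveI : Nonempty ι := Fintype.card_pos_iff.1 (by omega)
  obtain ⟨y0⟩ := sph_ne (ι := ι)
  refine ⟨f y0, h1 y0, fun y => ?_⟩
  have h2 : ∀ y ∈ (Set.univ : Set (Sph ι)), f y ∈ ({1, -1} : Set ℂ) := by
    intro y _
    have := mul_self_eq_one_iff.1 (h1 y)
    simpa using this
  have hT : (({1, -1} : Set ℂ)).Finite := by simp
  have hD := hT.isDiscrete
  exact (sph_conn h).constant_of_mapsTo (T := {1, -1}) hD hf.continuousOn h2 (Set.mem_univ _) (Set.mem_univ _)
end inner
end PK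

namespace PK
open Matrix Topology
open scoped Kronecker
set_option linter.all false

section glue
variable {ι : Type} [Fintype ι] [DecidableEq ι]

theorem rest_mem (y : Sph (Option ι)) : ∑ i, y.1 (some i) ^ 2 ≤ 1 := by
  have h := y.2
  rw [Fintype.sum_option] at h
  nlinarith [sq_nonneg (y.1 none)]

/-- projection to the ball -/
def rest (y : Sph (Option ι)) : Bal ι := ⟨fun i => y.1 (some i), rest_mem y⟩

theorem rest_cont : Continuous (rest (ι := ι)) :=
  Continuous.subtype_mk (f := fun y : Sph (Option ι) => fun i => y.1 (some i)) (continuous_pi fun i => (continuous_apply (some i)).comp continuous_subtype_val) _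

theorem rest_hp (z : Bal ι) : rest (hp z) = z := rfl
theorem rest_hm (z : Bal ι) : rest (hm z) = z := rfl

theorem rest_sqrt (y : Sph (Option ι)) : √(1 - ∑ i, (rest y).1 i ^ 2) = |y.1 none| := by
  have h := y.2
  rw [Fintype.sum_option] at h
  rw [← Real.sqrt_sq_eq_abs]
  congr 1
  show 1 - ∑ i, y.1 (some i) ^ 2 = _
  linarith

theorem hp_rest (y : Sph (Option ι)) (h : 0 ≤ y.1 none) : hp (rest y) = y := by
  apply Subtype.ext
  show oc (√(1 - ∑ i, (rest y).1 i ^ 2)) (rest y).1 = _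
  rw [rest_sqrt, abs_of_nonneg h]
  exact (oc_eta y.1).symm

theorem hm_rest (y : Sph (Option ι)) (h : y.1 none ≤ 0) : hm (rest y) = y := by
  apply Subtype.ext
  show oc (-√(1 - ∑ i, (rest y).1 i ^ 2)) (rest y).1 = _
  rw [rest_sqrt, abs_of_nonpos h, neg_neg]
  exact (oc_eta y.1).symm

theorem hem_cases {P : Sph (Option ι) → Prop} (h1 : ∀ z, P (hp z)) (h2 : ∀ z, P (hm z)) (y : Sph (Option ι)) : P y := by
  rcases le_total 0 (y.1 none) with h | h
  · rw [← hp_rest y h]; exact h1 _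
  · rw [← hm_rest y h]; exact h2 _

theorem rest_eq (y : Sph (Option ι)) (h : y.1 none = 0) : ∃ w : Sph ι, rest y = bdb w := by
  have h1 := y.2
  rw [Fintype.sum_option, h] at h1
  exact ⟨⟨fun i => y.1 (some i), by simpa using h1⟩, rfl⟩

theorem glue {E : Type*} [TopologicalSpace E] (A B : Bal ι → E) (hA : Continuous A) (hB : Continuous B) (h : ∀ w : Sph ι, A (bdb w) = B (bdb w)) :
    ∃ F : Sph (Option ι) → E, Continuous F ∧ (∀ z, F (hp z) = A z) ∧ ∀ z, F (hm z) = B z := by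
  classical
  refine ⟨fun y => if 0 ≤ y.1 none then A (rest y) else B (rest y), ?_, ?_, ?_⟩
  · refine Continuous.if_le (hA.comp rest_cont) (hB.comp rest_cont) continuous_const ((continuous_apply _).comp continuous_subtype_val) ?_
    intro y hy
    obtain ⟨w, hw⟩ := rest_eq y hy.symm
    rw [hw, h]
  · intro z
    have : 0 ≤ (hp z).1 none := Real.sqrt_nonneg _
    simp [this, rest_hp]
  · intro z
    dsimp only
    split_ifs with h0
    · have h1 : (hm z).1 none ≤ 0 := neg_nonpos.2 (Real.sqrt_nonneg _)
      obtain ⟨w, hw⟩ := rest_eq (hm z) (le_antisymm h1 h0)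
      rw [hw, h, ← hw, rest_hm]
    · rw [rest_hm]
end glue

section spin
variable {ι J N : Type} [Fintype ι] [DecidableEq ι] [Fintype J] [DecidableEq J] [Fintype N] [DecidableEq N]

theorem Spn.form [Nonempty N] {c : J → Matrix N N ℂ} (h : Spn c) : ∃ B B' : Matrix N N ℂ, B * B' = 1 ∧ B' * B = 1 ∧ ∀ v, (FC c v)ᵀ * B = B * FC c v := by
  let d : (J → ℂ) →ₗ[ℂ] Matrix N N ℂ := (Matrix.transposeLinearEquiv N N ℂ ℂ).toLinearMap.comp (FCl c)
  have hd : ∀ v, d v = (FC c v)ᵀ := fun v => rfl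
  obtain ⟨Ψ, hΨ⟩ := h.univ d (fun v => by rw [hd, ← Matrix.transpose_mul, h.cl, Matrix.transpose_smul, Matrix.transpose_one])
  obtain ⟨S, S', -, -, h1, h2⟩ := inner_bal (ι := Unit) (fun _ => Ψ) (fun m => continuous_const)
  refine ⟨S b0, S' b0, h1 _, mul_eq_one_comm.1 (h1 _), fun v => ?_⟩
  have := h2 b0 (FC c v)
  rwa [hΨ, hd] at this

theorem Spn.norm_bal [Nonempty N] {c : J → Matrix N N ℂ} (h : Spn c) {B B' : Matrix N N ℂ} (hB1 : B * B' = 1) (hB2 : B' * B = 1)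
    (hB : ∀ v, (FC c v)ᵀ * B = B * FC c v) (O : Bal ι → Matrix J J ℂ) (hO : Continuous O) (hO1 : ∀ z, (O z)ᵀ * O z = 1) :
    ∃ S : Bal ι → Matrix N N ℂ, Continuous S ∧ (∀ z v, FC c (O z *ᵥ v) * S z = S z * FC c v) ∧ ∀ z, (S z)ᵀ * B * S z = B := by
  choose Φ hΦ using fun z => h.auto (O z) (hO1 z)
  have hcΦ := h.cont Φ (fun v => by
    simp only [hΦ]
    exact FC_cont c (hO.matrix_mulVec continuous_const))
  obtain ⟨S, S', hS, hS', h1, h2⟩ := inner_bal Φ hcΦ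
  have h3 : ∀ z v, FC c (O z *ᵥ v) * S z = S z * FC c v := fun z v => by rw [← hΦ, h2]
  have hB' : ∀ v, FC c v * B' = B' * (FC c v)ᵀ := by
    intro v
    calc FC c v * B' = (B' * B) * FC c v * B' := by rw [hB2, one_mul]
      _ = B' * (B * FC c v) * B' := by simp only [mul_assoc]
      _ = B' * (FC c v)ᵀ * (B * B') := by rw [← hB]; simp only [mul_assoc]
      _ = _ := by rw [hB1, mul_one]
  have h4 : ∀ z, ∃ a : ℂ, B' * ((S z)ᵀ * B * S z) = a • 1 := by
    intro z
    refine h.center fun v => ?_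
    calc FC c v * (B' * ((S z)ᵀ * B * S z)) = (FC c v * B') * ((S z)ᵀ * B * S z) := by simp only [mul_assoc]
      _ = B' * (S z * FC c v)ᵀ * B * S z := by rw [hB', Matrix.transpose_mul]; simp only [mul_assoc]
      _ = B' * (S z)ᵀ * ((FC c (O z *ᵥ v))ᵀ * B) * S z := by rw [← h3, Matrix.transpose_mul]; simp only [mul_assoc]
      _ = B' * (S z)ᵀ * B * (FC c (O z *ᵥ v) * S z) := by rw [hB]; simp only [mul_assoc]
      _ = _ := by rw [h3]; simp only [mul_assoc]
  choose μ hμ using h4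
  have hm : ∀ z, (S z)ᵀ * B * S z = μ z • B := by
    intro z
    calc (S z)ᵀ * B * S z = (B * B') * ((S z)ᵀ * B * S z) := by rw [hB1, one_mul]
      _ = B * (B' * ((S z)ᵀ * B * S z)) := by simp only [mul_assoc]
      _ = _ := by rw [hμ]; simp
  obtain ⟨i0⟩ := ‹Nonempty N›
  have hμc : Continuous μ := by
    have e : μ = fun z => (B' * ((S z)ᵀ * B * S z)) i0 i0 := by
      funext z; rw [hμ]; simp
    rw [e]
    exact (continuous_const.matrix_mul ((hS.matrix_transpose.matrix_mul continuous_const).matrix_mul hS)).matrix_elem i0 i0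
  have hμ0 : ∀ z, μ z ≠ 0 := by
    intro z hz
    have h5 := hm z
    rw [hz, zero_smul] at h5
    have h6 : B = 0 := by
      calc B = (S z * S' z)ᵀ * B * (S z * S' z) := by rw [h1]; simp
        _ = (S' z)ᵀ * ((S z)ᵀ * B * S z) * S' z := by rw [Matrix.transpose_mul]; simp only [mul_assoc]
        _ = 0 := by rw [h5]; simp
    rw [h6, zero_mul] at hB1
    have := congrFun (congrFun hB1 i0) i0
    simp at this
  obtain ⟨s, hs, hs2⟩ := sqrt_bal μ hμc hμ0
  have hs0 : ∀ z, s z ≠ 0 := fun z hz => hμ0 z (by rw [← hs2, hz, zero_mul])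
  refine ⟨fun z => (s z)⁻¹ • S z, (hs.inv₀ hs0).smul hS, fun z v => ?_, fun z => ?_⟩
  · rw [Matrix.mul_smul, h3, Matrix.smul_mul]
  · rw [Matrix.transpose_smul, Matrix.smul_mul, Matrix.smul_mul, Matrix.mul_smul, smul_smul, hm, smul_smul, ← hs2]
    have : (s z)⁻¹ * (s z)⁻¹ * (s z * s z) = 1 := by have := hs0 z; field_simp
    rw [this, one_smul]

theorem Spn.lift [Nonempty N] (hι : 2 ≤ Fintype.card ι) {c : J → Matrix N N ℂ} (h : Spn c) {B B' : Matrix N N ℂ} (hB1 : B * B' = 1) (hB2 : B' * B = 1)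
    (hB : ∀ v, (FC c v)ᵀ * B = B * FC c v) (O : Sph (Option ι) → Matrix J J ℂ) (hO : Continuous O) (hO1 : ∀ z, (O z)ᵀ * O z = 1) :
    ∃ S : Sph (Option ι) → Matrix N N ℂ, Continuous S ∧ (∀ z v, FC c (O z *ᵥ v) * S z = S z * FC c v) ∧ ∀ z, (S z)ᵀ * B * S z = B := by
  obtain ⟨S, hS, h1, h2⟩ := h.norm_bal hB1 hB2 hB (fun z => O (hp z)) (hO.comp hp.continuous) (fun z => hO1 _)
  obtain ⟨R, hR, h3, h4⟩ := h.norm_bal hB1 hB2 hB (fun z => O (hm z)) (hO.comp hm.continuous) (fun z => hO1 _)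
  have hinv : ∀ z, R z * (B' * (R z)ᵀ * B) = 1 := by
    intro z
    rw [mul_eq_one_comm]
    calc B' * (R z)ᵀ * B * R z = B' * ((R z)ᵀ * B * R z) := by simp only [mul_assoc]
      _ = 1 := by rw [h4, hB2]
  obtain ⟨R', hR', hRR⟩ : ∃ R' : Bal ι → Matrix N N ℂ, Continuous R' ∧ ∀ z, R z * R' z = 1 :=
    ⟨_, (continuous_const.matrix_mul hR.matrix_transpose).matrix_mul continuous_const, hinv⟩
  have h5 : ∀ w : Sph ι, ∃ a : ℂ, R' (bdb w) * S (bdb w) = a • 1 := by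
    intro w
    refine h.center fun v => ?_
    have e1 : FC c v * R' (bdb w) = R' (bdb w) * FC c (O (hp (bdb w)) *ᵥ v) := by
      have e2 := h3 (bdb w) v
      rw [← hp_bdb] at e2
      calc FC c v * R' (bdb w) = (R' (bdb w) * R (bdb w)) * FC c v * R' (bdb w) := by rw [mul_eq_one_comm.1 (hRR _), one_mul]
        _ = R' (bdb w) * (R (bdb w) * FC c v) * R' (bdb w) := by simp only [mul_assoc]
        _ = R' (bdb w) * FC c (O (hp (bdb w)) *ᵥ v) * (R (bdb w) * R' (bdb w)) := by rw [← e2]; simp only [mul_assoc]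
        _ = _ := by rw [hRR, mul_one]
    rw [← mul_assoc, e1, mul_assoc, h1, mul_assoc]
  choose l hl using h5
  have hSl : ∀ w, S (bdb w) = l w • R (bdb w) := by
    intro w
    calc S (bdb w) = R (bdb w) * R' (bdb w) * S (bdb w) := by rw [hRR, one_mul]
      _ = _ := by rw [mul_assoc, hl]; simp
  obtain ⟨i0⟩ := ‹Nonempty N›
  have hlc : Continuous l := by
    have e : l = fun w => (R' (bdb w) * S (bdb w)) i0 i0 := by
      funext w; rw [hl]; simp
    rw [e]
    exact ((hR'.comp bdb.continuous).matrix_mul (hS.comp bdb.continuous)).matrix_elem i0 i0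
  have hB0 : B ≠ 0 := by
    intro h6
    rw [h6, zero_mul] at hB1
    have := congrFun (congrFun hB1 i0) i0
    simp at this
  have hl1 : ∀ w, l w * l w = 1 := by
    intro w
    have e := h2 (bdb w)
    rw [hSl, Matrix.transpose_smul, Matrix.smul_mul, Matrix.smul_mul, Matrix.mul_smul, smul_smul, h4] at e
    have e2 : (l w * l w - 1) • B = 0 := by rw [sub_smul, e, one_smul, sub_self]
    rcases smul_eq_zero.1 e2 with e3 | e3
    · linear_combination e3
    · exact absurd e3 hB0
  obtain ⟨a, ha, hla⟩ := sgn_const hι l hlc hl1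
  obtain ⟨F, hF, hFp, hFm⟩ := glue S (fun z => a • R z) hS (hR.const_smul a) (fun w => by rw [hSl, hla])
  refine ⟨F, hF, ?_, ?_⟩
  · refine hem_cases (fun z => ?_) (fun z => ?_)
    · rw [hFp]; exact h1 z
    · intro v
      rw [hFm]
      have := h3 z v
      simp only [Matrix.mul_smul, Matrix.smul_mul, this]
  · refine hem_cases (fun z => ?_) (fun z => ?_)
    · rw [hFp]; exact h2 z
    · rw [hFm, Matrix.transpose_smul, Matrix.smul_mul, Matrix.smul_mul, Matrix.mul_smul, smul_smul, h4, ha, one_smul]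
end spin
end PK

namespace PK
open Matrix Topology
open scoped Kronecker
set_option linter.all false

section kk
variable {X Y ν ν' : Type} [TopologicalSpace X] [CompactSpace X] [TopologicalSpace Y] [Fintype ν] [DecidableEq ν] [Fintype ν'] [DecidableEq ν']
variable (P : C(X × S1, Y))

/-- class of a clutching function pulled back -/
noncomputable def kk (h : (Matrix ν ν C(Y, ℂ))ˣ) : K C(X × S2, ℂ) := cls (umap (pb P) h)

theorem kk_mul (g h : (Matrix ν ν C(Y, ℂ))ˣ) : kk P (g * h) + Fintype.card ν = kk P g + kk P h := by
  rw [kk, map_mul, cls_mul]; rfl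

theorem kk_add (g : (Matrix ν ν C(Y, ℂ))ˣ) (h : (Matrix ν' ν' C(Y, ℂ))ˣ) : kk P (uadd g h) = kk P g + kk P h := by
  rw [kk, kk, kk, ← cls_add]
  congr 1
  apply Units.ext
  exact mat_ext fun x => by ext (i | i) (j | j) <;> first | rfl | simp [umap_coe, uadd]

theorem kk_kron (g : (Matrix ν ν C(Y, ℂ))ˣ) (h : (Matrix ν' ν' C(Y, ℂ))ˣ) : kk P (ukron g h) = kk P g * kk P h := by
  rw [kk, kk, kk, ← cls_kron]
  congr 1

theorem kk_const (b : (Matrix ν ν ℂ)ˣ) : kk P (umap (cst Y) b) = Fintype.card ν := by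
  rw [kk, ← cls_const (X := X) (umap (cst X) b)]
  congr 1

theorem kk_conj (b : (Matrix ν ν ℂ)ˣ) (b' : (Matrix ν ν ℂ)ˣ) (g : (Matrix ν ν C(Y, ℂ))ˣ) :
    kk P (umap (cst Y) b * g * umap (cst Y) b') = kk P g := by
  have h1 := kk_mul P (umap (cst Y) b * g) (umap (cst Y) b')
  have h2 := kk_mul P (umap (cst Y) b) g
  rw [kk_const] at h1 h2
  linear_combination h1 + h2

theorem cls_J (g : GLc ν X) (g' : GLc ν' X) (J0 : Matrix ν ν' ℂ) (J1 : Matrix ν' ν ℂ) (h1 : J0 * J1 = 1) (h2 : J1 * J0 = 1)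
    (h : (g : Matrix ν ν C(X × S1, ℂ)) * J0.map (cst (X × S1)) = J0.map (cst (X × S1)) * (g' : Matrix ν' ν' C(X × S1, ℂ))) : cls g' = cls g := by
  refine cls_of_clut (eg_idem g) (g := g') ?_
  obtain ⟨Up, Um, Wp, Wm, k1, k2, k3, k4, k5⟩ := eg_clut g
  have e1 : ∀ Z [TopologicalSpace Z], J0.map (cst Z) * J1.map (cst Z) = 1 := fun Z _ => by
    rw [← Matrix.map_mul, h1, Matrix.map_one _ (map_zero _) (map_one _)]
  have e2 : ∀ Z [TopologicalSpace Z], J1.map (cst Z) * J0.map (cst Z) = 1 := fun Z _ => by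
    rw [← Matrix.map_mul, h2, Matrix.map_one _ (map_zero _) (map_one _)]
  obtain ⟨A, hA⟩ : ∃ A : Matrix ν ν' C(X × Dsk, ℂ), A = J0.map (cst (X × Dsk)) := ⟨_, rfl⟩
  obtain ⟨A', hA'⟩ : ∃ A' : Matrix ν' ν C(X × Dsk, ℂ), A' = J1.map (cst (X × Dsk)) := ⟨_, rfl⟩
  have f1 : A * A' = 1 := by rw [hA, hA']; exact e1 _
  have f2 : A' * A = 1 := by rw [hA, hA']; exact e2 _
  have e3 : A.map (sq X).b = J0.map (cst (X × S1)) := by rw [hA]; rfl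
  have e4 : A'.map (sq X).b = J1.map (cst (X × S1)) := by rw [hA']; rfl
  refine ⟨Up * A, Um * A, A' * Wp, A' * Wm, ?_, ?_, ?_, ?_, ?_⟩
  · rw [← k1, ← Matrix.mul_assoc, Matrix.mul_assoc Up, f1, Matrix.mul_one]
  · rw [← k2, ← Matrix.mul_assoc, Matrix.mul_assoc Um, f1, Matrix.mul_one]
  · rw [← Matrix.mul_assoc, Matrix.mul_assoc _ Wp, k3, Matrix.mul_one, f2]
  · rw [← Matrix.mul_assoc, Matrix.mul_assoc _ Wm, k4, Matrix.mul_one, f2]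
  · rw [Matrix.map_mul, Matrix.map_mul, e3, e4, ← Matrix.mul_assoc, Matrix.mul_assoc _ (Wm.map _), k5, Matrix.mul_assoc, h, ← Matrix.mul_assoc, e2, Matrix.one_mul]

theorem kk_J (g : (Matrix ν ν C(Y, ℂ))ˣ) (g' : (Matrix ν' ν' C(Y, ℂ))ˣ) (J0 : Matrix ν ν' ℂ) (J1 : Matrix ν' ν ℂ) (h1 : J0 * J1 = 1) (h2 : J1 * J0 = 1)
    (h : (g : Matrix ν ν C(Y, ℂ)) * J0.map (cst Y) = J0.map (cst Y) * (g' : Matrix ν' ν' C(Y, ℂ))) : kk P g' = kk P g := by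
  refine cls_J _ _ J0 J1 h1 h2 ?_
  have := congrArg (fun M : Matrix ν ν' C(Y, ℂ) => M.map (pb P)) h
  simp only [Matrix.map_mul] at this
  exact this

theorem exists_unit (M : Y → Matrix ν ν ℂ) (hM : Continuous M) (M' : Y → Matrix ν ν ℂ) (h : ∀ y, M y * M' y = 1) :
    ∃ u : (Matrix ν ν C(Y, ℂ))ˣ, (u : Matrix ν ν C(Y, ℂ)) = mkC M hM := by
  have : IsUnit (mkC M hM) := by
    rw [isUnit_mat_iff]
    intro y
    rw [mkC_ev]
    intro h0
    have := congrArg Matrix.det (h y)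
    rw [Matrix.det_mul, h0, zero_mul, Matrix.det_one] at this
    exact zero_ne_one this
  exact ⟨this.unit, rfl⟩
end kk

section lam
variable {Y J N : Type} [TopologicalSpace Y] [Fintype J] [DecidableEq J] [Fintype N] [DecidableEq N]
variable {X : Type} [TopologicalSpace X] [CompactSpace X]

theorem Spn.Lu {c : J → Matrix N N ℂ} (h : Spn c) (P : C(X × S1, Y)) (f : (Matrix J J C(Y, ℂ))ˣ) (s r : (Matrix N N C(Y, ℂ))ˣ)
    (hf : ∀ y, ((f : Matrix J J C(Y, ℂ)).map (ev y))ᵀ * (f : Matrix J J C(Y, ℂ)).map (ev y) = 1)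
    (hs : ∀ y v, FC c ((f : Matrix J J C(Y, ℂ)).map (ev y) *ᵥ v) * (s : Matrix N N C(Y, ℂ)).map (ev y) = (s : Matrix N N C(Y, ℂ)).map (ev y) * FC c v)
    (hr : ∀ y, (s : Matrix N N C(Y, ℂ)).map (ev y) * ((r : Matrix N N C(Y, ℂ)).map (ev y))ᵀ = 1) :
    kk P (PK.Lu f) = kk P s * kk P r := by
  obtain ⟨ψ, hψ⟩ := h.ext
  let L : (N × N → ℂ) ≃ₗ[ℂ] (Finset J → ℂ) := ((LinearEquiv.curry ℂ ℂ N N).trans (Matrix.ofLinearEquiv ℂ)).trans (ψ.trans (bL J).equivFun)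
  have hL : ∀ x, L x = (bL J).equivFun (ψ (Matrix.of fun a b => x (a, b))) := fun x => rfl
  rw [← kk_kron]
  symm
  refine kk_J P _ _ (LinearMap.toMatrix' L.toLinearMap) (LinearMap.toMatrix' L.symm.toLinearMap) ?_ ?_ ?_
  · rw [← LinearMap.toMatrix'_comp]; simp
  · rw [← LinearMap.toMatrix'_comp]; simp
  · refine mat_ext fun y => ?_
    rw [Matrix.map_mul, Matrix.map_mul]
    have e1 : ((LinearMap.toMatrix' L.toLinearMap).map (cst Y)).map (ev y) = LinearMap.toMatrix' L.toLinearMap := rfl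
    have e2 : ((PK.Lu f : (Matrix (Finset J) (Finset J) C(Y, ℂ))ˣ) : Matrix (Finset J) (Finset J) C(Y, ℂ)).map (ev y) = Lm ((f : Matrix J J C(Y, ℂ)).map (ev y)) := rfl
    have e3 : ((ukron s r : (Matrix (N × N) (N × N) C(Y, ℂ))ˣ) : Matrix (N × N) (N × N) C(Y, ℂ)).map (ev y) = (s : Matrix N N C(Y, ℂ)).map (ev y) ⊗ₖ (r : Matrix N N C(Y, ℂ)).map (ev y) := rfl
    rw [e1, e2, e3]
    have hf' := hf y
    have hs' := hs y
    have hr' := hr y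
    generalize (f : Matrix J J C(Y, ℂ)).map (ev y) = O at *
    generalize (s : Matrix N N C(Y, ℂ)).map (ev y) = S at *
    generalize (r : Matrix N N C(Y, ℂ)).map (ev y) = R at *
    obtain ⟨Φ, hΦ⟩ := h.auto O hf'
    have hΦS : ∀ m, Φ m = S * m * Rᵀ := by
      intro m
      have h1 : Φ m * S = S * m := by
        refine h.ind (P := fun m => Φ m * S = S * m) m ?_ ?_ ?_ ?_
        · intro a; rw [AlgHom.commutes]; exact Algebra.commutes a S
        · intro v; rw [hΦ, hs']
        · intro a b ha hb; rw [map_add, add_mul, mul_add, ha, hb]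
        · intro a b ha hb; rw [map_mul, mul_assoc, hb, ← mul_assoc, ha, mul_assoc]
      rw [← h1, mul_assoc, hr', mul_one]
    apply mat_ext_vec
    intro x
    rw [← Matrix.mulVec_mulVec, ← Matrix.mulVec_mulVec, LinearMap.toMatrix'_mulVec, LinearMap.toMatrix'_mulVec]
    show Lm O *ᵥ (L x) = L _
    rw [hL, hL, Lm_mulVec, ← hψ O hf' Φ hΦ, hΦS]
    congr 2
    ext a b
    simp only [Matrix.mul_apply, Matrix.of_apply, Matrix.mulVec, dotProduct, Matrix.kroneckerMap_apply, Fintype.sum_prod_type, Matrix.transpose_apply, Finset.sum_mul]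
    rw [Finset.sum_comm]
    exact Finset.sum_congr rfl fun i _ => Finset.sum_congr rfl fun j _ => by ring
end lam
end PK

namespace PK
open Matrix Topology
open scoped Kronecker
set_option linter.all false

section odd1
variable {n : ℕ} {X κ ι : Type} [TopologicalSpace X] [CompactSpace X] [T2Space X] [Fintype κ] [DecidableEq κ] [Fintype ι] [DecidableEq ι]
variable {γ : ι → Matrix κ κ ℂ} {yv : C(X, Sph ι)} {y0 : Sph ι} {T : K C(X, ℂ)}

theorem FC_some (γ : ι → Matrix κ κ ℂ) (v : Option ι → ℂ) : FC (fun i => gs γ (some i)) v = FC (gs γ) (oc 0 v) := by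
  rw [FC, FC, Fintype.sum_option (f := fun o : Option (Option ι) => oc 0 v o • gs γ o)]
  simp

theorem FC_some' (γ : ι → Matrix κ κ ℂ) (v : Option ι → ℂ) : FC (fun i => gs γ (some i)) v =
    fromBlocks 0 ((v none) • 1 - Complex.I • FC γ (fun i => v (some i))) ((v none) • 1 + Complex.I • FC γ (fun i => v (some i))) 0 := by
  rw [FC_some, oc_eta v, gs_FC]
  simp

theorem FC_om (γ : ι → Matrix κ κ ℂ) (v : Option ι → ℂ) : FC (fun i => gs γ (some i)) v * fromBlocks 1 0 0 (-1) =
    - (fromBlocks 1 0 0 (-1) * FC (fun i => gs γ (some i)) v) := by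
  rw [FC_some', fromBlocks_multiply, fromBlocks_multiply, fromBlocks_neg]
  simp

theorem Twr.spn (G : Twr n X κ ι γ yv y0 T) : Spn (fun i : Option ι => gs γ (some i)) where
  cl := by
    intro v
    rw [FC_some, gs_Cl G.hcl, Fintype.sum_option (f := fun o : Option (Option ι) => oc 0 v o ^ 2)]
    simp
  gen := gen_some G.gen G.word
  dim := by
    rw [Fintype.card_sum, Fintype.card_option, G.cκ, G.cι]; ring

theorem spin_split (h : Spn (fun i : Option ι => gs γ (some i))) [Nonempty κ] {J0 : Type} [Fintype J0] [DecidableEq J0] (hJ : 2 ≤ Fintype.card J0) 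
    (O : Sph J0 → Matrix (Option ι) (Option ι) ℂ) (hO1 : ∀ z, (O z)ᵀ * O z = 1)
    (S S' : Sph J0 → Matrix (κ ⊕ κ) (κ ⊕ κ) ℂ) (hS : Continuous S) (hS' : Continuous S') (h1 : ∀ z, S z * S' z = 1)
    (h2 : ∀ z v, FC (fun i : Option ι => gs γ (some i)) (O z *ᵥ v) * S z = S z * FC (fun i : Option ι => gs γ (some i)) v) :
    ∃ ε : ℂ, ε * ε = 1 ∧ ∀ z, S z * fromBlocks 1 0 0 (-1) = ε • (fromBlocks 1 0 0 (-1) * S z) := by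
  obtain ⟨ω, hω⟩ : ∃ ω : Matrix (κ ⊕ κ) (κ ⊕ κ) ℂ, ω = fromBlocks 1 0 0 (-1) := ⟨_, rfl⟩
  have hωω : ω * ω = 1 := by rw [hω, fromBlocks_multiply, ← fromBlocks_one]; simp
  have hωF := FC_om γ
  rw [← hω] at hωF ⊢
  obtain ⟨c, hc⟩ : ∃ c : Option ι → Matrix (κ ⊕ κ) (κ ⊕ κ) ℂ, c = fun i : Option ι => gs γ (some i) := ⟨_, rfl⟩
  rw [← hc] at h h2 hωF
  have h1' : ∀ z, S' z * S z = 1 := fun z => mul_eq_one_comm.1 (h1 z)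
  have h3 : ∀ z v, S' z * FC c (O z *ᵥ v) = FC c v * S' z := by
    intro z v
    calc S' z * FC c (O z *ᵥ v) = S' z * (FC c (O z *ᵥ v) * S z) * S' z := by rw [mul_assoc, mul_assoc, h1, mul_one]
      _ = (S' z * S z) * FC c v * S' z := by rw [h2]; simp only [mul_assoc]
      _ = _ := by rw [h1', one_mul]
  have h4 : ∀ z, ∃ a : ℂ, ω * (S z * ω * S' z) = a • 1 := by
    intro z
    refine h.center fun u => ?_
    have hu : u = O z *ᵥ ((O z)ᵀ *ᵥ u) := by rw [mulVec_mulVec, mul_eq_one_comm.1 (hO1 z), one_mulVec]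
    generalize (O z)ᵀ *ᵥ u = v at hu
    have e1 : FC c u * (S z * ω * S' z) = - ((S z * ω * S' z) * FC c u) := by
      rw [hu]
      calc FC c (O z *ᵥ v) * (S z * ω * S' z) = (FC c (O z *ᵥ v) * S z) * ω * S' z := by simp only [mul_assoc]
        _ = S z * (FC c v * ω) * S' z := by rw [h2]; simp only [mul_assoc]
        _ = -(S z * ω * (FC c v * S' z)) := by rw [hωF]; simp only [mul_assoc, mul_neg, neg_mul]
        _ = _ := by rw [← h3]; simp only [mul_assoc]
    rw [← mul_assoc, hωF, neg_mul, mul_assoc, e1, mul_neg, neg_neg]; simp only [mul_assoc]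
  choose a ha using h4
  obtain ⟨i0⟩ := ‹Nonempty κ›
  have hac : Continuous a := by
    have e : a = fun z => (ω * (S z * ω * S' z)) (Sum.inl i0) (Sum.inl i0) := by
      funext z; rw [ha]; simp
    rw [e]
    have : Continuous fun z => ω * (S z * ω * S' z) := by fun_prop
    exact this.matrix_elem _ _
  have hW : ∀ z, S z * ω = a z • (ω * S z) := by
    intro z
    have := congrArg (fun m => ω * m * S z) (ha z)
    simp only [← mul_assoc, hωω, one_mul] at this
    rw [mul_assoc _ (S' z), h1', mul_one] at this
    rw [this]; simp
  have haa : ∀ z, a z * a z = 1 := by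
    intro z
    have e1 : S z * ω * ω = S z := by rw [mul_assoc, hωω, mul_one]
    rw [hW, smul_mul_assoc, mul_assoc, hW, mul_smul_comm, smul_smul, ← mul_assoc, hωω, one_mul] at e1
    have e2 := congrArg (fun m => (m * S' z) (Sum.inl i0) (Sum.inl i0)) e1
    simp only [smul_mul_assoc, h1] at e2
    simpa using e2
  obtain ⟨ε, hε, hz⟩ := sgn_const hJ a hac haa
  exact ⟨ε, hε, fun z => by rw [hW, hz]⟩

theorem spin_form (h : Spn (fun i : Option ι => gs γ (some i))) [Nonempty κ] (hι : 1 ≤ Fintype.card ι)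
    (O : Sph (Option ι) → Matrix (Option ι) (Option ι) ℂ) (hO1 : ∀ z, (O z)ᵀ * O z = 1) (hOe : ∀ z, O z *ᵥ (Pi.single none 1) = fun i => (z.1 i : ℂ))
    (S S' : Sph (Option ι) → Matrix (κ ⊕ κ) (κ ⊕ κ) ℂ) (hS : Continuous S) (hS' : Continuous S') (h1 : ∀ z, S z * S' z = 1)
    (h2 : ∀ z v, FC (fun i : Option ι => gs γ (some i)) (O z *ᵥ v) * S z = S z * FC (fun i : Option ι => gs γ (some i)) v) :
    ∃ (a : Sph (Option ι) → Matrix κ κ ℂ) (C : Matrix (κ ⊕ κ) (κ ⊕ κ) ℂ), Continuous a ∧ C * C = 1 ∧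
      ∀ z, S z = fromBlocks (a z) 0 0 (cv γ 1 z.1 * a z) * C := by
  obtain ⟨ε, hε, hz⟩ := spin_split h (by rw [Fintype.card_option]; omega) O hO1 S S' hS hS' h1 h2
  have hy : ∀ z, fromBlocks 0 (cv γ (-1) z.1) (cv γ 1 z.1) 0 * S z = S z * fromBlocks 0 1 1 0 := by
    intro z
    have := h2 z (Pi.single none 1)
    rw [FC_single, gs_sn, hOe, FC_some'] at this
    rw [← this]
    congr 2
    · rw [cv, sub_eq_add_neg, ← neg_smul, neg_one_mul]; rfl
    · rw [cv, one_mul]; rfl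
  have hd : ∀ z, S z = fromBlocks (S z).toBlocks₁₁ (S z).toBlocks₁₂ (S z).toBlocks₂₁ (S z).toBlocks₂₂ := fun z => (fromBlocks_toBlocks _).symm
  have hc11 : Continuous fun z => (S z).toBlocks₁₁ := continuous_matrix fun i j => hS.matrix_elem _ _
  have hc12 : Continuous fun z => (S z).toBlocks₁₂ := continuous_matrix fun i j => hS.matrix_elem _ _
  generalize hA : (fun z => (S z).toBlocks₁₁) = A at hc11
  generalize hB : (fun z => (S z).toBlocks₁₂) = B at hc12
  have hd : ∀ z, ∃ q r, S z = fromBlocks (A z) (B z) q r := fun z => ⟨_, _, by rw [← hA, ← hB]; exact hd z⟩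
  choose q r hd using hd
  have hdd : ∀ m : Matrix κ κ ℂ, m = -m → m = 0 := fun m hm => by
    ext i j
    have := congrFun (congrFun hm i) j
    exact self_eq_neg.1 this
  rcases mul_self_eq_one_iff.1 hε with rfl | rfl
  · refine ⟨A, 1, hc11, one_mul 1, fun z => ?_⟩
    have e1 := hz z
    have e2 := hy z
    rw [hd z] at e1 e2
    rw [one_smul, fromBlocks_multiply, fromBlocks_multiply, fromBlocks_inj] at e1
    rw [fromBlocks_multiply, fromBlocks_multiply, fromBlocks_inj] at e2
    simp only [Matrix.mul_one, Matrix.one_mul, Matrix.mul_zero, Matrix.zero_mul, add_zero, zero_add, Matrix.mul_neg, Matrix.neg_mul] at e1 e2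
    have f1 : B z = 0 := hdd _ e1.2.1.symm
    have f2 : q z = 0 := hdd _ e1.2.2.1
    rw [hd, Matrix.mul_one, f1, f2, e2.2.2.1]
  · refine ⟨B, fromBlocks 0 1 1 0, hc12, by rw [fromBlocks_multiply, ← fromBlocks_one]; simp, fun z => ?_⟩
    have e1 := hz z
    have e2 := hy z
    rw [hd z] at e1 e2
    rw [neg_one_smul, fromBlocks_multiply, fromBlocks_multiply, fromBlocks_neg, fromBlocks_inj] at e1
    rw [fromBlocks_multiply, fromBlocks_multiply, fromBlocks_inj] at e2
    simp only [Matrix.mul_one, Matrix.one_mul, Matrix.mul_zero, Matrix.zero_mul, add_zero, zero_add, Matrix.mul_neg, Matrix.neg_mul, neg_neg] at e1 e2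
    have f1 : A z = 0 := hdd _ e1.1
    have f2 : r z = 0 := hdd _ e1.2.2.2.symm
    rw [hd, fromBlocks_multiply, f1, f2, e2.2.2.2]
    simp
end odd1
end PK

namespace PK
open Matrix Topology
open scoped Kronecker
set_option linter.all false

section odd2
variable {n : ℕ} {X κ ι : Type} [TopologicalSpace X] [CompactSpace X] [T2Space X] [Fintype κ] [DecidableEq κ] [Fintype ι] [DecidableEq ι]
variable {γ : ι → Matrix κ κ ℂ} {yv : C(X, Sph ι)} {y0 : Sph ι} {T : K C(X, ℂ)}

theorem kk_spin (h : Cl γ) (P : C(X × S1, Sph (Option ι))) (s : (Matrix (κ ⊕ κ) (κ ⊕ κ) C(Sph (Option ι), ℂ))ˣ) (a : (Matrix κ κ C(Sph (Option ι), ℂ))ˣ)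
    (C : Matrix (κ ⊕ κ) (κ ⊕ κ) ℂ) (hC : C * C = 1)
    (hs : ∀ z, (s : Matrix (κ ⊕ κ) (κ ⊕ κ) C(Sph (Option ι), ℂ)).map (ev z) = fromBlocks ((a : Matrix κ κ C(Sph (Option ι), ℂ)).map (ev z)) 0 0 
      (cv γ 1 z.1 * (a : Matrix κ κ C(Sph (Option ι), ℂ)).map (ev z)) * C) :
    kk P s + Fintype.card κ = 2 * kk P a + kk P (cu h) := by
  obtain ⟨Cu, hCu⟩ : ∃ Cu : (Matrix (κ ⊕ κ) (κ ⊕ κ) ℂ)ˣ, (Cu : Matrix (κ ⊕ κ) (κ ⊕ κ) ℂ) = C := ⟨⟨C, C, hC, hC⟩, rfl⟩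
  have h1 : s = umap (cst _) 1 * uadd a (cu h * a) * umap (cst _) Cu := by
    apply Units.ext
    refine mat_ext fun z => ?_
    rw [hs, map_one, one_mul, Units.val_mul, Matrix.map_mul]
    congr 1
    · ext (i | i) (j | j)
      · rfl
      · rfl
      · rfl
      · have := congrFun (congrFun (Matrix.map_mul (L := ((cu h : (Matrix κ κ C(Sph (Option ι), ℂ))ˣ) : Matrix κ κ C(Sph (Option ι), ℂ))) (M := (a : Matrix κ κ C(Sph (Option ι), ℂ))) (f := ev z)) i) j
        exact this.symm
    · rw [← hCu]; rfl
  rw [h1, kk_conj, kk_add]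
  have := kk_mul P (cu h) a
  linear_combination this

theorem kk_Lam (P : C(X × S1, Sph (Option ι))) {ν : Type} [Fintype ν] [DecidableEq ν] (f : (Matrix ν ν C(Sph (Option ι), ℂ))ˣ) :
    Lam (kk P f) (il (kk P (Lu f))) := by
  have h1 : kk P (Lu f) = cls (Lu (umap (pb P) f)) := by
    rw [kk]; congr 1
  rw [h1, cls_Lu]
  exact Lam_kcl _

theorem Twr.core (G : Twr n X κ ι γ yv y0 T) (hn : 1 ≤ n) 
    (O : Sph (Option ι) → Matrix (Option ι) (Option ι) ℂ) (hO : Continuous O) (hO1 : ∀ z, (O z)ᵀ * O z = 1) (hOe : ∀ z, O z *ᵥ (Pi.single none 1) = fun i => (z.1 i : ℂ)) :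
    ∃ q d : ℤ, q * (Pp n).eval 0 = 2 * (2 * d + 1) := by
  have h := G.spn
  haveI : Nonempty κ := Fintype.card_pos_iff.1 (by rw [G.cκ]; positivity)
  obtain ⟨B, B', hB1, hB2, hB⟩ := h.form
  obtain ⟨S, hS, h1, h2⟩ := h.lift (by rw [G.cι]; omega) hB1 hB2 hB O hO hO1
  have h3 : ∀ z, S z * (B' * (S z)ᵀ * B) = 1 := by
    intro z
    rw [mul_eq_one_comm]
    calc B' * (S z)ᵀ * B * S z = B' * ((S z)ᵀ * B * S z) := by simp only [mul_assoc]
      _ = 1 := by rw [h2, hB2]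
  obtain ⟨a, C, ha, hC, hSa⟩ := spin_form h (by rw [G.cι]; omega) O hO1 hOe S (fun z => B' * (S z)ᵀ * B) hS (by fun_prop) h3 h1
  obtain ⟨f, hf⟩ := exists_unit O hO (fun z => (O z)ᵀ) (fun z => mul_eq_one_comm.1 (hO1 z))
  obtain ⟨s, hs⟩ := exists_unit S hS _ h3
  obtain ⟨b, hb⟩ : ∃ b : (Matrix (κ ⊕ κ) (κ ⊕ κ) ℂ)ˣ, (b : Matrix (κ ⊕ κ) (κ ⊕ κ) ℂ) = Bᵀ := 
    ⟨⟨Bᵀ, B'ᵀ, by rw [← transpose_mul, hB2, transpose_one], by rw [← transpose_mul, hB1, transpose_one]⟩, rfl⟩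
  obtain ⟨b', hb'⟩ : ∃ b : (Matrix (κ ⊕ κ) (κ ⊕ κ) ℂ)ˣ, (b : Matrix (κ ⊕ κ) (κ ⊕ κ) ℂ) = B'ᵀ := 
    ⟨⟨B'ᵀ, Bᵀ, by rw [← transpose_mul, hB1, transpose_one], by rw [← transpose_mul, hB2, transpose_one]⟩, rfl⟩
  have hau : ∀ z, (a z).det ≠ 0 := by
    intro z h0
    have := congrArg Matrix.det (h3 z)
    rw [Matrix.det_mul, hSa z, Matrix.det_mul, det_fromBlocks_zero₂₁, h0] at this
    simp at this
  obtain ⟨u, hu⟩ := exists_unit a ha (fun z => (a z)⁻¹) (fun z => Matrix.mul_nonsing_inv _ (isUnit_iff_ne_zero.2 (hau z)))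
  have k1 := kk_spin G.hcl (pv yv y0) s u C hC (fun z => by rw [hs, hu, mkC_ev, mkC_ev]; exact hSa z)
  have k2 : kk (pv yv y0) (Lu f) = kk (pv yv y0) s * kk (pv yv y0) s := by
    have := h.Lu (pv yv y0) f s (umap (cst _) b * s * umap (cst _) b') (fun y => by rw [hf]; exact hO1 y) (fun y v => by rw [hf, hs]; exact h1 y v) (fun y => by
      have e : ((umap (cst _) b * s * umap (cst _) b' : (Matrix (κ ⊕ κ) (κ ⊕ κ) C(Sph (Option ι), ℂ))ˣ) : Matrix (κ ⊕ κ) (κ ⊕ κ) C(Sph (Option ι), ℂ)).map (ev y) = Bᵀ * S y * B'ᵀ := by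
        rw [Units.val_mul, Units.val_mul, Matrix.map_mul, Matrix.map_mul, hs, ← hb, ← hb']
        rfl
      rw [e, hs, mkC_ev, transpose_mul, transpose_mul, transpose_transpose, transpose_transpose, ← h3 y]
      simp only [mul_assoc])
    rw [this, kk_conj]
  obtain ⟨q, hq⟩ := G.odd f
  obtain ⟨d, hd⟩ := G.odd u
  have hcu := G.ccu
  change kk (pv yv y0) f = _ at hq
  change kk (pv yv y0) u = _ at hd
  change kk (pv yv y0) (cu G.hcl) = _ at hcu
  have hL := kk_Lam (X := X) (pv yv y0) f
  obtain ⟨i2, hi2⟩ := (il_two (X := X × S2)).exists_left_inv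
  have hT := G.lam1 hi2
  have hsq := Twr.sq' (X := X) T
  have hinj := G.inj'
  generalize K.map (pb (ContinuousMap.fst : C(X × S2, X))) T * tt X = T' at *
  refine ⟨q, d, ?_⟩
  have hsq2 : il T' * il T' = 0 := by rw [← map_mul, hsq, map_zero]
  have hL2 := Lam_add (Lam_nat (X := X × S2) (Fintype.card (Option ι))) (Lam_zsmul hsq2 hT q)
  rw [← hq] at hL2
  have key := Lam_unique hL hL2
  rw [hd, hcu] at k1
  have k3 : kk (pv yv y0) s = 2 * (Fintype.card κ : K C(X × S2, ℂ)) + (2 * (d : K C(X × S2, ℂ)) + 1) * T' := by linear_combination k1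
  rw [k2, k3, Fintype.card_option, G.cι, G.cκ] at key
  have h22 : i2 ^ (n + 1) * 2 ^ (n + 1) = 1 := by rw [← mul_pow, hi2, one_pow]
  simp only [map_mul, map_add, map_one, map_ofNat, map_intCast, map_natCast] at key
  have key2 : il ((2 : K C(X × S2, ℂ)) ^ (n + 1) * (((2 * (2 * d + 1) - q * (Pp n).eval 0 : ℤ) : K C(X × S2, ℂ)) * T')) = 0 := by
    simp only [map_mul, map_pow, map_ofNat, map_intCast]
    push_cast at key ⊢
    generalize ((Polynomial.eval 0 (Pp n) : ℤ) : L2 (X × S2)) = p at *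
    generalize il T' = t at *
    have e : (2 : L2 (X × S2)) ^ (2 * n + 1 + 1) = 2 ^ (n + 1) * 2 ^ (n + 1) := by ring
    rw [e] at key
    have e2 : (2 : L2 (X × S2)) ^ (n + 1) = 2 * 2 ^ n := by ring
    linear_combination key + (2 ^ (n+1) * q * p * t) * h22 - (2 * (d : L2 (X × S2)) + 1) ^ 2 * hsq2
  obtain ⟨k, hk⟩ := il_inj key2
  have := hinj (2 ^ k * 2 ^ (n + 1) * (2 * (2 * d + 1) - q * (Pp n).eval 0)) (by rw [← hk]; push_cast; ring)
  have h5 : (2 * (2 * d + 1) - q * (Pp n).eval 0) = 0 := by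
    rcases mul_eq_zero.1 this with h6 | h6
    · exact absurd h6 (by positivity)
    · exact h6
  linarith

open Polynomial in
theorem Pp4 : ∃ R : Polynomial ℤ, Pp 4 = C 4 * R := by
  refine ⟨(1 - X ^ 2) * (C 4 * X - C 6 * X ^ 3), ?_⟩
  simp only [Pp]
  simp
  ring

open Polynomial in
theorem Pp_div (k : ℕ) : ∃ R : Polynomial ℤ, Pp (k + 4) = C 4 * R := by
  induction k with
  | zero => exact Pp4
  | succ k ih =>
    obtain ⟨R, hR⟩ := ih
    refine ⟨(1 - X ^ 2) * derivative R, ?_⟩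
    rw [show k + 1 + 4 = (k + 4) + 1 by ring, Pp, hR]
    simp
    ring

theorem Pp_fin {n : ℕ} {q d : ℤ} (h : q * (Pp n).eval 0 = 2 * (2 * d + 1)) : n = 0 ∨ n = 1 ∨ n = 3 := by
  by_contra hn
  have : (4 : ℤ) ∣ (Pp n).eval 0 := by
    rcases Nat.lt_or_ge n 4 with h4 | h4
    · have : n = 2 := by omega
      subst this
      simp [Pp]
    · obtain ⟨k, rfl⟩ : ∃ k, n = k + 4 := ⟨n - 4, by omega⟩
      obtain ⟨R, hR⟩ := Pp_div k
      rw [hR]; simp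
  obtain ⟨c, hc⟩ := this
  rw [hc] at h
  have h2 : 2 * (q * c) = 2 * d + 1 := by linarith
  omega

theorem odd_final {m : ℕ} {J : Type} [Fintype J] [DecidableEq J] (j0 : J) (hJ : Fintype.card J = 2 * m + 2)
    (O : Sph J → Matrix J J ℂ) (hO : Continuous O) (hO1 : ∀ z, (O z)ᵀ * O z = 1) (hOe : ∀ z i, O z i j0 = (z.1 i : ℂ)) : m = 0 ∨ m = 1 ∨ m = 3 := by
  rcases Nat.eq_zero_or_pos m with h | hm
  · exact Or.inl h
  obtain ⟨X, κ, ι, _, _, _, _, _, _, _, γ, yv, y0, T, G⟩ := Twr.exists m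
  obtain ⟨e0⟩ : Nonempty (J ≃ Option ι) := Fintype.card_eq.1 (by rw [Fintype.card_option, G.cι, hJ])
  let e : J ≃ Option ι := e0.trans (Equiv.swap (e0 j0) none)
  have he : e j0 = none := by simp [e]
  have hr : ∀ z : Sph (Option ι), ∑ i, (z.1 (e i)) ^ 2 = 1 := fun z => by
    rw [Equiv.sum_comp e (fun o => z.1 o ^ 2)]; exact z.2
  let r : Sph (Option ι) → Sph J := fun z => ⟨fun i => z.1 (e i), hr z⟩
  have hrc : Continuous r := Continuous.subtype_mk (f := fun z : Sph (Option ι) => fun i => z.1 (e i)) (continuous_pi fun i => (continuous_apply (e i)).comp continuous_subtype_val) _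
  obtain ⟨q, d, h⟩ := G.core hm (fun z => (O (r z)).submatrix e.symm e.symm) ((hO.comp hrc).matrix_submatrix _ _) (fun z => by
    rw [transpose_submatrix, submatrix_mul_equiv, hO1, submatrix_one_equiv]) (fun z => by
    funext i
    simp only [Matrix.mulVec_single_one]
    show O (r z) (e.symm i) (e.symm none) = _
    rw [← he, Equiv.symm_apply_apply, hOe]
    simp [r])
  exact Pp_fin h
end odd2
end PK

namespace PK
open Matrix Topology
open scoped Kronecker
set_option linter.all false

section even
variable {n : ℕ} {X κ ι : Type} [TopologicalSpace X] [CompactSpace X] [T2Space X] [Fintype κ] [DecidableEq κ] [Fintype ι] [DecidableEq ι]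
variable {γ : ι → Matrix κ κ ℂ} {yv : C(X, Sph ι)} {y0 : Sph ι} {T : K C(X, ℂ)}

theorem rF_anti (h : Cl γ) (y w : Sph ι) (hw : ∑ i, y.1 i * w.1 i = 0) : rF γ y.1 * rF γ w.1 = - (rF γ w.1 * rF γ y.1) := by
  have h1 := h (fun i => (y.1 i : ℂ) + (w.1 i : ℂ))
  have e : FC γ (fun i => (y.1 i : ℂ) + (w.1 i : ℂ)) = rF γ y.1 + rF γ w.1 := by
    simp [rF, FC, add_smul, Finset.sum_add_distrib]
  have e2 : ∑ i, ((y.1 i : ℂ) + (w.1 i : ℂ)) ^ 2 = 2 := by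
    have : ∑ i, ((y.1 i) + (w.1 i)) ^ 2 = 2 := by
      have hy := y.2
      have hw' := w.2
      have : ∑ i, ((y.1 i) + (w.1 i)) ^ 2 = ∑ i, y.1 i ^ 2 + 2 * ∑ i, y.1 i * w.1 i + ∑ i, w.1 i ^ 2 := by
        rw [Finset.mul_sum, ← Finset.sum_add_distrib, ← Finset.sum_add_distrib]
        exact Finset.sum_congr rfl fun i _ => by ring
      rw [this, hy, hw', hw]; norm_num
    exact_mod_cast this
  rw [e, e2, add_mul, mul_add, mul_add, rF_sq h y, rF_sq h w, two_smul] at h1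
  have h2 : rF γ y.1 * rF γ w.1 + rF γ w.1 * rF γ y.1 = 0 := by
    have h3 := sub_eq_zero.2 h1
    rw [← h3]; abel
  exact eq_neg_of_add_eq_zero_left h2

theorem Twr.even_core (G : Twr n X κ ι γ yv y0 T) (hn : n ≠ 0) (w : Sph ι → Sph ι) (hw : Continuous w) (hyw : ∀ y, ∑ i, y.1 i * (w y).1 i = 0) : False := by
  have hWc : Continuous fun y => rF γ (w y).1 := rF_cont γ (continuous_subtype_val.comp hw)
  obtain ⟨W, hW⟩ : ∃ W : Matrix κ κ C(Sph ι, ℂ), W = mkC (fun y => rF γ (w y).1) hWc := ⟨_, rfl⟩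
  have hWe : ∀ y, W.map (ev y) = rF γ (w y).1 := fun y => by rw [hW]; rfl
  have hWW : W * W = 1 := mat_ext fun y => by
    rw [Matrix.map_mul, hWe, rF_sq G.hcl, Matrix.map_one _ (map_zero _) (map_one _)]
  have hc : Em γ * W = W * (1 - Em γ) := mat_ext fun y => by
    rw [Matrix.mul_sub, Matrix.mul_one, Matrix.map_sub _ (fun a b => map_sub (ev y) a b), Matrix.map_mul, Matrix.map_mul, hWe, Em_ev]
    have := rF_anti G.hcl y (w y) (hyw y)
    rw [smul_mul_assoc, add_mul, one_mul, this, mul_smul_comm, mul_add, mul_one]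
    module
  have hiso := Iso.conj (idem_compl (Em_idem G.hcl)) hWW hWW hc
  have h1 := kcl_eq (he := Em_idem G.hcl) (hf := idem_compl (Em_idem G.hcl)) hiso
  rw [kcl_compl (Em_idem G.hcl)] at h1
  have h2 := congrArg (K.map (pb yv)) h1
  rw [map_sub, map_natCast] at h2
  have h3 := G.inv
  rw [kcl_cst (half_idem (rF_sq G.hcl y0)) (idem_trace (half_idem (rF_sq G.hcl y0)))] at h3
  have hsq := G.sq hn
  have hinj := G.inj
  generalize K.map (pb yv) (kcl (Em γ) (Em_idem G.hcl)) = E at *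
  generalize ((2⁻¹:ℂ) • (1 + rF γ y0.1)).rank = r at *
  have h4 := hinj (2 * r - Fintype.card κ) (by push_cast; linear_combination T * h2 - 2 * T * h3 - 2 * hsq)
  have h5 : 2 * (r : K C(X, ℂ)) = Fintype.card κ := by
    have : 2 * r = Fintype.card κ := by omega
    rw [← this]; push_cast; ring
  have := hinj 2 (by push_cast; linear_combination -2 * h3 + h2 - h5)
  omega

theorem even_final {m : ℕ} {J : Type} [Fintype J] [DecidableEq J] (hm : m ≠ 0) (hJ : Fintype.card J = 2 * m + 1)
    (w : Sph J → Sph J) (hw : Continuous w) (hyw : ∀ y, ∑ i, y.1 i * (w y).1 i = 0) : False := by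
  obtain ⟨X, κ, ι, _, _, _, _, _, _, _, γ, yv, y0, T, G⟩ := Twr.exists m
  obtain ⟨e⟩ : Nonempty (J ≃ ι) := Fintype.card_eq.1 (by rw [G.cι, hJ])
  have hr : ∀ z : Sph ι, ∑ i, (z.1 (e i)) ^ 2 = 1 := fun z => by
    rw [Equiv.sum_comp e (fun o => z.1 o ^ 2)]; exact z.2
  have hs : ∀ z : Sph J, ∑ i, (z.1 (e.symm i)) ^ 2 = 1 := fun z => by
    rw [Equiv.sum_comp e.symm (fun o => z.1 o ^ 2)]; exact z.2
  let r : Sph ι → Sph J := fun z => ⟨fun i => z.1 (e i), hr z⟩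
  let s : Sph J → Sph ι := fun z => ⟨fun i => z.1 (e.symm i), hs z⟩
  have hrc : Continuous r := Continuous.subtype_mk (f := fun z : Sph ι => fun i => z.1 (e i)) (continuous_pi fun i => (continuous_apply (e i)).comp continuous_subtype_val) _
  have hsc : Continuous s := Continuous.subtype_mk (f := fun z : Sph J => fun i => z.1 (e.symm i)) (continuous_pi fun i => (continuous_apply (e.symm i)).comp continuous_subtype_val) _
  refine G.even_core hm (fun z => s (w (r z))) (hsc.comp (hw.comp hrc)) fun y => ?_
  rw [← hyw (r y), ← Equiv.sum_comp e]
  simp [r, s]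

theorem frame_final {J : Type} [Fintype J] [DecidableEq J] (j0 : J) (hJ : 2 ≤ Fintype.card J)
    (O : Sph J → Matrix J J ℝ) (hO : Continuous O) (hO1 : ∀ z, (O z)ᵀ * O z = 1) (hOe : ∀ z i, O z i j0 = z.1 i) :
    Fintype.card J = 2 ∨ Fintype.card J = 4 ∨ Fintype.card J = 8 := by
  rcases Nat.even_or_odd' (Fintype.card J) with ⟨m, hm | hm⟩
  · obtain ⟨k, rfl⟩ : ∃ k, m = k + 1 := ⟨m - 1, by omega⟩
    have hc : Continuous fun z => (O z).map (algebraMap ℝ ℂ) := continuous_matrix fun i j => Complex.continuous_ofReal.comp (hO.matrix_elem i j)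
    have := odd_final (m := k) j0 (by omega) (fun z => (O z).map (algebraMap ℝ ℂ)) hc (fun z => by
      rw [← transpose_map, ← Matrix.map_mul, hO1, Matrix.map_one _ (map_zero _) (map_one _)]) (fun z i => by simp [hOe])
    omega
  · exfalso
    obtain ⟨j1, hj⟩ : ∃ j1, j1 ≠ j0 := Fintype.exists_ne_of_one_lt_card (by omega) j0
    have hcol : ∀ z j k, ∑ i, O z i j * O z i k = (1 : Matrix J J ℝ) j k := fun z j k => by
      rw [← hO1 z]; rfl
    have hmem : ∀ z, ∑ i, (fun i => O z i j1) i ^ 2 = 1 := fun z => by have := hcol z j1 j1; simpa [pow_two] using this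
    refine even_final (J := J) (m := m) (by omega) hm (fun z => ⟨fun i => O z i j1, hmem z⟩) 
      (Continuous.subtype_mk (f := fun z => fun i => O z i j1) (continuous_pi fun i => hO.matrix_elem i j1) hmem) fun y => ?_
    have := hcol y j0 j1
    rw [Matrix.one_apply_ne hj.symm] at this
    simpa [hOe] using this
end even
end PK

namespace PK
open Matrix Topology
open scoped Kronecker
set_option linter.all false

section lines
variable {ι J : Type} [Fintype ι] [DecidableEq ι] [Fintype J] [DecidableEq J]

theorem bal_line (p : Bal ι → Matrix J J ℝ) (hp0 : Continuous p) (h1 : ∀ z, p z * p z = p z) (h2 : ∀ z, (p z)ᵀ = p z)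
    (h3 : ∀ z, (p z).trace = 1) : ∃ σ : Bal ι → J → ℝ, Continuous σ ∧ ∀ z i j, p z i j = σ z i * σ z j := by
  let e : Matrix J J C(Bal ι, ℝ) := mkC p hp0
  have he : e * e = e := by
    apply mat_ext
    intro z
    rw [Matrix.map_mul]
    exact h1 z
  obtain ⟨r, u, v, huv, hvu⟩ := triv_bal he
  have hr : r = 1 := by
    have h := rank_trace huv hvu b0
    have h' : (e.map (ev b0)).trace = 1 := h3 b0
    rw [h'] at h
    exact_mod_cast h
  subst hr
  have hab : ∀ z i j, p z i j = u i 0 z * v 0 j z := by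
    intro z i j
    have h : (e i j) z = (u * v) i j z := by rw [huv]
    rw [Matrix.mul_apply] at h
    have h' : (e i j) z = p z i j := rfl
    rw [h'] at h
    simpa using h
  have hba : ∀ z, ∑ i, v 0 i z * u i 0 z = 1 := by
    intro z
    have h : (v * u) 0 0 z = (1 : Matrix (Fin 1) (Fin 1) C(Bal ι, ℝ)) 0 0 z := by rw [hvu]
    rw [Matrix.mul_apply] at h
    simpa [ContinuousMap.sum_apply] using h
  let q : Bal ι → ℝ := fun z => ∑ i, u i 0 z ^ 2
  have hq : ∀ z, 0 < q z := by
    intro z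
    apply lt_of_le_of_ne (Finset.sum_nonneg fun i _ => sq_nonneg _)
    intro h
    have h5 : ∀ i, u i 0 z = 0 := by
      intro i
      have := (Finset.sum_eq_zero_iff_of_nonneg (fun i _ => sq_nonneg (u i 0 z))).1 h.symm i (Finset.mem_univ i)
      simpa using this
    have h6 := hba z
    simp [h5] at h6
  have hqc : Continuous q := continuous_finset_sum _ fun i _ => (u i 0).continuous.pow 2
  have ha : ∀ z j, u j 0 z = q z * v 0 j z := by
    intro z j
    have hs : ∀ i, u i 0 z * v 0 j z = u j 0 z * v 0 i z := by
      intro i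
      rw [← hab, ← hab]
      exact congrFun (congrFun (h2 z) j) i
    calc u j 0 z = u j 0 z * ∑ i, v 0 i z * u i 0 z := by rw [hba, mul_one]
      _ = ∑ i, (u j 0 z * v 0 i z) * u i 0 z := by rw [Finset.mul_sum]; simp only [mul_assoc]
      _ = ∑ i, u i 0 z ^ 2 * v 0 j z := by
        refine Finset.sum_congr rfl fun i _ => ?_
        rw [← hs]; ring
      _ = _ := by rw [← Finset.sum_mul]
  refine ⟨fun z i => u i 0 z / √(q z), ?_, ?_⟩
  · exact continuous_pi fun i => (u i 0).continuous.div hqc.sqrt fun z => (Real.sqrt_pos.2 (hq z)).ne'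
  · intro z i j
    have h7 := Real.mul_self_sqrt (hq z).le
    have h8 := (Real.sqrt_pos.2 (hq z)).ne'
    have h9 := ha z j
    rw [hab]
    have h10 := (hq z).ne'
    show _ = u i 0 z / √(q z) * (u j 0 z / √(q z))
    rw [div_mul_div_comm, h7, eq_div_iff h10]
    rw [h9]; ring

theorem line_lift (hc : 2 ≤ Fintype.card ι) (p : Sph (Option ι) → Matrix J J ℝ) (hp0 : Continuous p) (h1 : ∀ z, p z * p z = p z) (h2 : ∀ z, (p z)ᵀ = p z)
    (h3 : ∀ z, (p z).trace = 1) : ∃ σ : Sph (Option ι) → J → ℝ, Continuous σ ∧ ∀ z i j, p z i j = σ z i * σ z j := by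
  obtain ⟨a, ha, ha'⟩ := bal_line (fun z => p (hp z)) (hp0.comp (hp (ι := ι)).continuous) (fun z => h1 _) (fun z => h2 _) (fun z => h3 _)
  obtain ⟨b, hb, hb'⟩ := bal_line (fun z => p (hm z)) (hp0.comp (hm (ι := ι)).continuous) (fun z => h1 _) (fun z => h2 _) (fun z => h3 _)
  have hab : ∀ w : Sph ι, ∀ i j, a (bdb w) i * a (bdb w) j = b (bdb w) i * b (bdb w) j := by
    intro w i j
    rw [← ha', ← hb', hp_bdb]
  have hb1 : ∀ z, ∑ i, b z i * b z i = 1 := by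
    intro z
    rw [← h3 (hm z)]
    exact Finset.sum_congr rfl fun i _ => (hb' z i i).symm
  let f : Sph ι → ℝ := fun w => ∑ i, a (bdb w) i * b (bdb w) i
  have hf : Continuous f := continuous_finset_sum _ fun i _ =>
    ((continuous_apply i).comp (ha.comp (bdb (ι := ι)).continuous)).mul ((continuous_apply i).comp (hb.comp (bdb (ι := ι)).continuous))
  have hf1 : ∀ w, f w * f w = 1 := by
    intro w
    show (∑ i, a (bdb w) i * b (bdb w) i) * (∑ i, a (bdb w) i * b (bdb w) i) = 1
    rw [Finset.sum_mul_sum]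
    calc _ = ∑ i, ∑ j, (b (bdb w) i * b (bdb w) i) * (b (bdb w) j * b (bdb w) j) := by
          refine Finset.sum_congr rfl fun i _ => Finset.sum_congr rfl fun j _ => ?_
          linear_combination (b (bdb w) i * b (bdb w) j) * hab w i j
      _ = 1 := by rw [← Finset.sum_mul_sum, hb1, one_mul]
  have hfb : ∀ w j, f w * b (bdb w) j = a (bdb w) j := by
    intro w j
    have ha1 : ∑ i, a (bdb w) i * a (bdb w) i = 1 := by
      refine Eq.trans ?_ (hb1 (bdb w))
      exact Finset.sum_congr rfl fun i _ => hab w i i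
    show (∑ i, a (bdb w) i * b (bdb w) i) * _ = _
    rw [Finset.sum_mul]
    calc _ = ∑ i, (a (bdb w) i * a (bdb w) i) * a (bdb w) j := by
          refine Finset.sum_congr rfl fun i _ => ?_
          linear_combination (-(a (bdb w) i)) * hab w i j
      _ = _ := by rw [← Finset.sum_mul, ha1, one_mul]
  obtain ⟨c, hc1, hc2⟩ := sgn_const hc (fun w => ((f w : ℝ) : ℂ)) (Complex.continuous_ofReal.comp hf) (fun y => by
    show ((f y : ℝ) : ℂ) * _ = 1
    rw [← Complex.ofReal_mul, hf1, Complex.ofReal_one])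
  haveI : Nonempty ι := Fintype.card_pos_iff.1 (by omega)
  obtain ⟨y0⟩ := sph_ne (ι := ι)
  have hfc : ∀ w, f w = f y0 := by
    intro w
    have := (hc2 w).trans (hc2 y0).symm
    exact_mod_cast this
  have hfb0 : Continuous (fun z => f y0 • b z) :=
    continuous_pi fun i => continuous_const.mul ((continuous_apply i).comp hb)
  obtain ⟨F, hF, hFp, hFm⟩ := glue a (fun z => f y0 • b z) ha hfb0 (fun w => by
    ext j
    rw [Pi.smul_apply, smul_eq_mul, ← hfc w, hfb])
  refine ⟨F, hF, ?_⟩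
  refine hem_cases (fun z => ?_) (fun z => ?_)
  · intro i j; rw [hFp, ha']
  · intro i j
    rw [hFm, hb', Pi.smul_apply, Pi.smul_apply, smul_eq_mul, smul_eq_mul]
    linear_combination (-(b z i * b z j)) * hf1 y0
end lines
end PK

namespace PK
open Matrix Topology
open scoped Kronecker
set_option linter.all false

section euc
/-- Euclidean space -/
abbrev EE (m : ℕ) := EuclideanSpace ℝ (Fin (m + 1))
/-- its unit sphere -/
abbrev SS (m : ℕ) := Metric.sphere (0 : EE m) 1

theorem ss_mem {m : ℕ} (x : SS m) : ∑ i, x.1 i ^ 2 = 1 := by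
  have h : ‖x.1‖ = 1 := by simpa using x.2
  have h2 := EuclideanSpace.norm_sq_eq x.1
  rw [h] at h2
  simpa [pow_two] using h2.symm

theorem norm_of_sum {m : ℕ} (w : EE m) (h : ∑ i, w i ^ 2 = 1) : ‖w‖ = 1 := by
  have h2 := EuclideanSpace.norm_sq_eq w
  have h3 : ‖w‖ ^ 2 = 1 := by
    rw [h2, ← h]
    exact Finset.sum_congr rfl fun i _ => by rw [Real.norm_eq_abs, sq_abs]
  nlinarith [norm_nonneg w]

theorem sum_of_norm {m : ℕ} (w : EE m) (h : ‖w‖ = 1) : ∑ i, w i ^ 2 = 1 :=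
  ss_mem ⟨w, by simpa using h⟩

theorem ec_cont {m : ℕ} (i : Fin (m + 1)) : Continuous (fun w : EE m => w i) :=
  (EuclideanSpace.proj (𝕜 := ℝ) i).continuous

/-- from coordinates to the sphere -/
def toSS {m : ℕ} {J : Type} [Fintype J] (e : Fin (m + 1) ≃ J) (y : Sph J) : SS m :=
  ⟨WithLp.toLp 2 (fun i => y.1 (e i)), by
    rw [mem_sphere_zero_iff_norm]
    apply norm_of_sum
    have h := y.2
    rw [← e.sum_comp] at h
    exact h⟩

/-- from the sphere to coordinates -/
def ofSS {m : ℕ} {J : Type} [Fintype J] (e : Fin (m + 1) ≃ J) (x : SS m) : Sph J :=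
  ⟨fun j => x.1 (e.symm j), by
    have h := ss_mem x
    rw [← e.symm.sum_comp] at h
    exact h⟩

theorem toSS_cont {m : ℕ} {J : Type} [Fintype J] (e : Fin (m + 1) ≃ J) : Continuous (toSS e) :=
  Continuous.subtype_mk (f := fun y : Sph J => (WithLp.toLp 2 (fun i => y.1 (e i)) : EE m)) ((PiLp.continuous_toLp 2 _).comp (continuous_pi fun i =>
    (show Continuous (fun y : Sph J => y.1 (e i)) from (continuous_apply (e i)).comp continuous_subtype_val))) _

theorem ofSS_cont {m : ℕ} {J : Type} [Fintype J] (e : Fin (m + 1) ≃ J) : Continuous (ofSS e) :=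
  Continuous.subtype_mk (continuous_pi fun i => (ec_cont (e.symm i)).comp continuous_subtype_val) _

theorem toSS_ofSS {m : ℕ} {J : Type} [Fintype J] (e : Fin (m + 1) ≃ J) (x : SS m) : toSS e (ofSS e x) = x := by
  apply Subtype.ext
  ext i
  simp [toSS, ofSS]

theorem lift2 {m : ℕ} (hm : 2 ≤ m) (ℓ : SS m → Submodule ℝ (EE m))
    (hr : ∀ x, Module.finrank ℝ (ℓ x) = 1)
    (hloc : ∀ x0, ∃ U ∈ 𝓝 x0, ∃ t : SS m → EE m, ContinuousOn t U ∧ ∀ x ∈ U, t x ∈ ℓ x ∧ t x ≠ 0) :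
    ∃ σ : SS m → EE m, Continuous σ ∧ ∀ x, σ x ∈ ℓ x ∧ ‖σ x‖ = 1 := by
  have hτ : ∀ x, ∃ w ∈ ℓ x, ‖w‖ = 1 := by
    intro x
    obtain ⟨U, hU, t, -, ht⟩ := hloc x
    obtain ⟨h1, h2⟩ := ht x (mem_of_mem_nhds hU)
    refine ⟨‖t x‖⁻¹ • t x, (ℓ x).smul_mem _ h1, ?_⟩
    rw [norm_smul, norm_inv, norm_norm, inv_mul_cancel₀ (norm_ne_zero_iff.2 h2)]
  choose τ hτ1 hτ2 using hτ
  have hτs := fun x => sum_of_norm (τ x) (hτ2 x)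
  let P : SS m → Matrix (Fin (m + 1)) (Fin (m + 1)) ℝ := fun x => Matrix.of fun i j => τ x i * τ x j
  have hP : Continuous P := by
    refine continuous_matrix fun i j => continuous_iff_continuousAt.2 fun x0 => ?_
    obtain ⟨U, hU, t, ht, htl⟩ := hloc x0
    have h1 : ContinuousAt (fun x => t x i * t x j / ‖t x‖ ^ 2) x0 := by
      have hc := ht.continuousAt hU
      refine ContinuousAt.div (((ec_cont i).continuousAt.comp hc).mul ((ec_cont j).continuousAt.comp hc)) (hc.norm.pow 2) ?_
      exact pow_ne_zero _ (norm_ne_zero_iff.2 (htl x0 (mem_of_mem_nhds hU)).2)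
    refine h1.congr ?_
    filter_upwards [hU] with x hx
    obtain ⟨h2, h3⟩ := htl x hx
    obtain ⟨c, hc⟩ := (finrank_eq_one_iff_of_nonzero' (⟨τ x, hτ1 x⟩ : ℓ x) (by
      intro h
      have := congrArg Subtype.val h
      have h5 := hτ2 x
      simp only [Submodule.coe_zero] at this
      rw [this] at h5
      simp at h5)).1 (hr x) ⟨t x, h2⟩
    have hc : t x = c • τ x := (congrArg Subtype.val hc).symm
    have hc0 : c ≠ 0 := by
      rintro rfl
      exact h3 (by rw [hc, zero_smul])
    rw [hc, norm_smul, hτ2, mul_one, Real.norm_eq_abs, sq_abs]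
    show c * τ x i * (c * τ x j) / c ^ 2 = τ x i * τ x j
    field_simp
  have hPP : ∀ x, P x * P x = P x := by
    intro x
    ext i j
    rw [Matrix.mul_apply]
    show ∑ k, (τ x i * τ x k) * (τ x k * τ x j) = τ x i * τ x j
    calc _ = (τ x i * τ x j) * ∑ k, τ x k ^ 2 := by
          rw [Finset.mul_sum]
          exact Finset.sum_congr rfl fun k _ => by ring
      _ = _ := by rw [hτs, mul_one]
  have hPt : ∀ x, (P x)ᵀ = P x := by
    intro x
    ext i j
    exact mul_comm _ _
  have hPtr : ∀ x, (P x).trace = 1 := by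
    intro x
    refine Eq.trans ?_ (hτs x)
    exact Finset.sum_congr rfl fun k _ => (pow_two _).symm
  obtain ⟨σ, hσ, hσ'⟩ := line_lift (ι := Fin m) (by simpa using hm) (fun y => P (toSS (finSuccEquiv m) y)) (hP.comp (toSS_cont _))
    (fun _ => hPP _) (fun _ => hPt _) (fun _ => hPtr _)
  refine ⟨fun x => WithLp.toLp 2 (σ (ofSS (finSuccEquiv m) x)), (PiLp.continuous_toLp 2 _).comp (hσ.comp (ofSS_cont _)), ?_⟩
  intro x
  have h1 : ∀ i j, τ x i * τ x j = σ (ofSS (finSuccEquiv m) x) i * σ (ofSS (finSuccEquiv m) x) j := by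
    intro i j
    rw [← hσ', toSS_ofSS]
    rfl
  show WithLp.toLp 2 (σ (ofSS (finSuccEquiv m) x)) ∈ ℓ x ∧ ‖(WithLp.toLp 2 (σ (ofSS (finSuccEquiv m) x)) : EE m)‖ = 1
  generalize σ (ofSS (finSuccEquiv m) x) = w at h1 ⊢
  have hw : ∑ i, w i ^ 2 = 1 := by
    refine Eq.trans ?_ (hτs x)
    exact Finset.sum_congr rfl fun k _ => by rw [pow_two, pow_two, h1]
  refine ⟨?_, norm_of_sum _ hw⟩
  have h2 : WithLp.toLp 2 w = (∑ i, w i * τ x i) • τ x := by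
    ext j
    show w j = (∑ i, w i * τ x i) * τ x j
    rw [Finset.sum_mul]
    calc w j = ∑ i, w i ^ 2 * w j := by rw [← Finset.sum_mul, hw, one_mul]
      _ = _ := Finset.sum_congr rfl fun i _ => by linear_combination (- w i) * h1 i j
  rw [h2]
  exact (ℓ x).smul_mem _ (hτ1 x)

theorem lift1 (ℓ : SS 1 → Submodule ℝ (EE 1))
    (hr : ∀ x, Module.finrank ℝ (ℓ x) = 1) (hperp : ∀ x, ℓ x ≤ (Submodule.span ℝ {x.1})ᗮ) :
    ∃ σ : SS 1 → EE 1, Continuous σ ∧ ∀ x, σ x ∈ ℓ x ∧ ‖σ x‖ = 1 := by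
  refine ⟨fun x => WithLp.toLp 2 ![- x.1 1, x.1 0], ?_, ?_⟩
  · refine (PiLp.continuous_toLp 2 _).comp (continuous_pi fun i => ?_)
    fin_cases i
    · exact ((ec_cont 1).comp continuous_subtype_val).neg
    · exact (ec_cont 0).comp continuous_subtype_val
  · intro x
    have hx := ss_mem x
    rw [Fin.sum_univ_two] at hx
    constructor
    · have h : ℓ x = (Submodule.span ℝ {x.1})ᗮ := by
        apply Submodule.eq_of_le_of_finrank_eq (hperp x)
        rw [hr]
        haveI : Fact (Module.finrank ℝ (EE 1) = 1 + 1) := ⟨by simp⟩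
        rw [Submodule.finrank_orthogonal_span_singleton (n := 1)]
        intro h0
        rw [h0] at hx
        simp at hx
      rw [h, Submodule.mem_orthogonal_singleton_iff_inner_right]
      simp [PiLp.inner_apply, Fin.sum_univ_two]
      try ring
    · apply norm_of_sum
      simp [Fin.sum_univ_two]
      linarith

theorem lift_all {m : ℕ} (hm : 1 ≤ m) (ℓ : SS m → Submodule ℝ (EE m))
    (hr : ∀ x, Module.finrank ℝ (ℓ x) = 1) (hperp : ∀ x, ℓ x ≤ (Submodule.span ℝ {x.1})ᗮ)
    (hloc : ∀ x0, ∃ U ∈ 𝓝 x0, ∃ t : SS m → EE m, ContinuousOn t U ∧ ∀ x ∈ U, t x ∈ ℓ x ∧ t x ≠ 0) :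
    ∃ σ : SS m → EE m, Continuous σ ∧ ∀ x, σ x ∈ ℓ x ∧ ‖σ x‖ = 1 := by
  rcases eq_or_lt_of_le hm with h | h
  · subst h
    exact lift1 ℓ hr hperp
  · exact lift2 h ℓ hr hloc

theorem gs_cont {m : ℕ} {X : Type} [TopologicalSpace X] (f : X → Fin (m + 1) → EE m) (hf : ∀ i, Continuous fun x => f x i)
    (hli : ∀ x, LinearIndependent ℝ (f x)) (i : Fin (m + 1)) : Continuous fun x => InnerProductSpace.gramSchmidt ℝ (f x) i := by
  induction i using WellFoundedLT.induction with
  | ind i ih =>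
    have h : (fun x => InnerProductSpace.gramSchmidt ℝ (f x) i) = fun x => f x i - ∑ j ∈ Finset.Iio i,
        (inner ℝ (InnerProductSpace.gramSchmidt ℝ (f x) j) (f x i) / ‖InnerProductSpace.gramSchmidt ℝ (f x) j‖ ^ 2) • InnerProductSpace.gramSchmidt ℝ (f x) j := by
      funext x
      exact eq_sub_of_add_eq (InnerProductSpace.gramSchmidt_def'' ℝ (f x) i).symm
    rw [h]
    refine (hf i).sub (continuous_finset_sum _ fun j hj => ?_)
    have hj' := ih j (Finset.mem_Iio.1 hj)
    refine Continuous.smul (Continuous.div (hj'.inner (hf i)) (hj'.norm.pow 2) fun x => ?_) hj'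
    exact pow_ne_zero _ (norm_ne_zero_iff.2 (InnerProductSpace.gramSchmidt_ne_zero j (hli x)))

theorem adams_frame {m : ℕ} (hm : 1 ≤ m) (σ : Fin m → SS m → EE m) (hσ : ∀ i, Continuous (σ i))
    (hperp : ∀ i x, σ i x ∈ (Submodule.span ℝ {x.1})ᗮ) (hli : ∀ x, LinearIndependent ℝ fun i => σ i x) :
    m + 1 = 2 ∨ m + 1 = 4 ∨ m + 1 = 8 := by
  let f : SS m → Fin (m + 1) → EE m := fun x => Fin.cons x.1 fun i => σ i x
  have hfc : ∀ i, Continuous fun x => f x i := by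
    intro i
    refine Fin.cases ?_ (fun i => ?_) i
    · exact continuous_subtype_val
    · exact hσ i
  have hx1 : ∀ x : SS m, ‖x.1‖ = 1 := fun x => by simpa using x.2
  have hf : ∀ x, LinearIndependent ℝ (f x) := by
    intro x
    refine LinearIndependent.finCons (hli x) ?_
    intro h
    have h2 : Submodule.span ℝ (Set.range fun i => σ i x) ≤ (Submodule.span ℝ {x.1})ᗮ := by
      rw [Submodule.span_le]
      rintro _ ⟨i, rfl⟩
      exact hperp i x
    have h3 := h2 h
    rw [Submodule.mem_orthogonal_singleton_iff_inner_right, inner_self_eq_zero] at h3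
    have := hx1 x
    rw [h3] at this
    simp at this
  let e := Equiv.refl (Fin (m + 1))
  let O : SS m → Matrix (Fin (m + 1)) (Fin (m + 1)) ℝ := fun x => Matrix.of fun i j => InnerProductSpace.gramSchmidtNormed ℝ (f x) j i
  have hO : Continuous O := by
    refine continuous_matrix fun i j => ?_
    have h1 := gs_cont f hfc hf j
    have h2 : Continuous fun x => InnerProductSpace.gramSchmidtNormed ℝ (f x) j := by
      refine Continuous.smul (h1.norm.inv₀ fun x => ?_) h1
      exact norm_ne_zero_iff.2 (InnerProductSpace.gramSchmidt_ne_zero j (hf x))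
    exact (ec_cont i).comp h2
  have h := frame_final (J := Fin (m + 1)) 0 (by simp; omega) (fun y => O (toSS e y)) (hO.comp (toSS_cont e)) ?_ ?_
  · simpa using h
  · intro z
    generalize toSS e z = x
    have ho := InnerProductSpace.gramSchmidtNormed_orthonormal (𝕜 := ℝ) (hf x)
    ext i j
    rw [Matrix.mul_apply, Matrix.one_apply]
    have h1 := (orthonormal_iff_ite.1 ho) i j
    rw [← h1, PiLp.inner_apply]
    refine Finset.sum_congr rfl fun k _ => ?_
    rw [real_inner_eq_re_inner]
    simp [O, mul_comm]
  · intro z i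
    have h1 : InnerProductSpace.gramSchmidtNormed ℝ (f (toSS e z)) 0 = (toSS e z).1 := by
      have h2 : InnerProductSpace.gramSchmidt ℝ (f (toSS e z)) 0 = (toSS e z).1 := InnerProductSpace.gramSchmidt_bot ℝ _
      rw [InnerProductSpace.gramSchmidtNormed, h2, hx1]
      simp
    show InnerProductSpace.gramSchmidtNormed ℝ (f (toSS e z)) 0 i = _
    rw [h1]
    rfl
end euc
end PK

namespace PK
set_option linter.all false
section mfd
open Topology
open scoped Manifold ContDiff

/-- differential of the inclusion -/
noncomputable def dd {m : ℕ} (x : SS m) : TangentSpace (𝓡 m) x →L[ℝ] EE m :=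
  mfderiv (𝓡 m) 𝓘(ℝ, EE m) (Subtype.val : SS m → EE m) x

theorem dd_inj {m : ℕ} (x : SS m) : Function.Injective (dd x) := by
  haveI := Fact.mk (@finrank_euclideanSpace_fin ℝ _ (m + 1))
  exact mfderiv_coe_sphere_injective (n := m) x

theorem dd_perp {m : ℕ} (x : SS m) (w : TangentSpace (𝓡 m) x) : dd x w ∈ (Submodule.span ℝ {x.1})ᗮ := by
  haveI := Fact.mk (@finrank_euclideanSpace_fin ℝ _ (m + 1))
  have h := range_mfderiv_coe_sphere (n := m) x
  exact h.le ⟨w, rfl⟩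

theorem dd_smooth {m : ℕ} (U : Set (SS m)) (s : ∀ x : SS m, TangentSpace (𝓡 m) x)
    (hs : ContMDiffOn (𝓡 m) (𝓡 m).tangent (⊤ : ℕ∞) (fun x => (⟨x, s x⟩ : TangentBundle (𝓡 m) (SS m))) U) :
    ContMDiffOn (𝓡 m) 𝓘(ℝ, EE m) (⊤ : ℕ∞) (fun x => dd x (s x)) U := by
  have h1 : ContMDiff (𝓡 m) 𝓘(ℝ, EE m) ω (Subtype.val : SS m → EE m) := by
    haveI := Fact.mk (@finrank_euclideanSpace_fin ℝ _ (m + 1))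
    exact contMDiff_coe_sphere (n := m)
  have h2 : ContMDiff (𝓡 m).tangent 𝓘(ℝ, EE m).tangent (⊤ : ℕ∞) (tangentMap (𝓡 m) 𝓘(ℝ, EE m) (Subtype.val : SS m → EE m)) :=
    h1.contMDiff_tangentMap (by simp)
  have h3 := h2.comp_contMDiffOn hs
  exact (contMDiff_snd_tangentBundle_modelSpace (EE m) 𝓘(ℝ, EE m)).comp_contMDiffOn h3

theorem line_smooth {m : ℕ} (L : ∀ x : SS m, Submodule ℝ (TangentSpace (𝓡 m) x))
    (hrank : ∀ x, Module.finrank ℝ (L x) = 1)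
    (hsmooth : ∀ x₀ : SS m, ∃ U ∈ nhds x₀, ∃ s : ∀ x : SS m, TangentSpace (𝓡 m) x,
          ContMDiffOn (𝓡 m) (𝓡 m).tangent (⊤ : ℕ∞) (fun x => (⟨x, s x⟩ : TangentBundle (𝓡 m) (SS m))) U ∧
          ∀ x ∈ U, s x ∈ L x ∧ s x ≠ 0)
    (v : ∀ x : SS m, TangentSpace (𝓡 m) x) (hv : ∀ x, v x ∈ L x) (hv1 : ∀ x, ‖dd x (v x)‖ = 1)
    (hvc : Continuous fun x => dd x (v x)) :
    ContMDiff (𝓡 m) (𝓡 m).tangent (⊤ : ℕ∞) (fun x => (⟨x, v x⟩ : TangentBundle (𝓡 m) (SS m))) := by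
  intro x0
  obtain ⟨U, hU, s, hs, hsL⟩ := hsmooth x0
  have hx0 := mem_of_mem_nhds hU
  have hv0 : ∀ x, v x ≠ 0 := by
    intro x h
    have h1 := hv1 x
    rw [h, map_zero, norm_zero] at h1
    exact zero_ne_one h1
  have hg : ∀ x ∈ U, ∃ c : ℝ, s x = c • v x := by
    intro x hx
    obtain ⟨c, hc⟩ := (finrank_eq_one_iff_of_nonzero' (⟨v x, hv x⟩ : L x) (fun h => hv0 x (congrArg Subtype.val h))).1 (hrank x) ⟨s x, (hsL x hx).1⟩
    exact ⟨c, (congrArg Subtype.val hc).symm⟩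
  let t : SS m → EE m := fun x => dd x (s x)
  have ht : ContMDiffAt (𝓡 m) 𝓘(ℝ, EE m) (⊤ : ℕ∞) t x0 := (dd_smooth U s hs).contMDiffAt hU
  let g : SS m → ℝ := fun x => inner ℝ (t x) (dd x (v x))
  have hgc : ContinuousAt g x0 := ht.continuousAt.inner hvc.continuousAt
  have hgs : ∀ x ∈ U, s x = g x • v x ∧ |g x| = ‖t x‖ ∧ g x ≠ 0 := by
    intro x hx
    obtain ⟨c, hc⟩ := hg x hx
    have htx : t x = c • dd x (v x) := by
      show dd x (s x) = _
      rw [hc, map_smul]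
    have hgx : g x = c := by
      show inner ℝ (t x) (dd x (v x)) = c
      rw [htx, real_inner_smul_left, real_inner_self_eq_norm_sq, hv1]
      simp
    refine ⟨by rw [hgx, hc], by rw [hgx, htx, norm_smul, hv1, mul_one, Real.norm_eq_abs], ?_⟩
    rw [hgx]
    rintro rfl
    exact (hsL x hx).2 (by rw [hc, zero_smul])
  have hg0 := (hgs x0 hx0).2.2
  have hpos : ∀ᶠ x in 𝓝 x0, 0 < g x * g x0 :=
    (hgc.mul continuousAt_const).eventually (lt_mem_nhds (mul_self_pos.2 hg0))
  let k : SS m → ℝ := fun x => (g x0 / |g x0|) * ‖t x‖⁻¹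
  have ht0 : ‖t x0‖ ≠ 0 := by
    rw [← (hgs x0 hx0).2.1]
    exact abs_ne_zero.2 hg0
  have hk : ContMDiffAt (𝓡 m) 𝓘(ℝ, ℝ) (⊤ : ℕ∞) k x0 := by
    have h1 : ContDiffAt ℝ (⊤ : ℕ∞) (fun w : EE m => (g x0 / |g x0|) * ‖w‖⁻¹) (t x0) :=
      contDiffAt_const.mul ((contDiffAt_norm ℝ (norm_ne_zero_iff.1 ht0)).inv ht0)
    exact h1.comp_contMDiffAt ht
  have hks := hk.smul_section (hs.contMDiffAt hU)
  refine hks.congr_of_eventuallyEq ?_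
  filter_upwards [hU, hpos] with x hx hp
  obtain ⟨h1, h2, h3⟩ := hgs x hx
  have h4 : k x * g x = 1 := by
    show (g x0 / |g x0|) * ‖t x‖⁻¹ * g x = 1
    rw [← h2]
    have h5 : g x * g x0 = |g x| * |g x0| := by rw [← abs_mul, abs_of_pos hp]
    have h6 := abs_ne_zero.2 h3
    have h7 := abs_ne_zero.2 hg0
    field_simp
    linarith
  have h8 : v x = k x • s x := by rw [h1, smul_smul, h4, one_smul]
  show (⟨x, v x⟩ : TangentBundle (𝓡 m) (SS m)) = ⟨x, k x • s x⟩
  rw [h8]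
end mfd
end PK


open scoped Manifold

/-- For `n = m + 1 ≥ 2`: if the tangent bundle of the sphere `S^{n-1} = S^m` splits as a
direct sum of `n - 1 = m` smooth line subbundles (projective parallelizability), then the
sphere admits a global smooth frame (it is parallelizable), and consequently
`n ∈ {2, 4, 8}`. -/
theorem stmt14 {m : ℕ} (hm : 1 ≤ m)
    (L : ∀ x : Metric.sphere (0 : EuclideanSpace ℝ (Fin (m + 1))) 1,
      Fin m → Submodule ℝ (TangentSpace (𝓡 m) x))
    (hL : ∀ x, DirectSum.IsInternal (L x))
    (hrank : ∀ x i, Module.finrank ℝ (L x i) = 1)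
    (hsmooth : ∀ (i : Fin m) (x₀ : Metric.sphere (0 : EuclideanSpace ℝ (Fin (m + 1))) 1),
      ∃ U ∈ nhds x₀,
        ∃ s : ∀ x : Metric.sphere (0 : EuclideanSpace ℝ (Fin (m + 1))) 1,
            TangentSpace (𝓡 m) x,
          ContMDiffOn (𝓡 m) (𝓡 m).tangent (⊤ : ℕ∞)
            (fun x => (⟨x, s x⟩ :
              TangentBundle (𝓡 m) (Metric.sphere (0 : EuclideanSpace ℝ (Fin (m + 1))) 1))) U ∧
          ∀ x ∈ U, s x ∈ L x i ∧ s x ≠ 0) :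
    (∃ v : Fin m → ∀ x : Metric.sphere (0 : EuclideanSpace ℝ (Fin (m + 1))) 1,
        TangentSpace (𝓡 m) x,
      (∀ i, ContMDiff (𝓡 m) (𝓡 m).tangent (⊤ : ℕ∞)
        (fun x => (⟨x, v i x⟩ :
          TangentBundle (𝓡 m) (Metric.sphere (0 : EuclideanSpace ℝ (Fin (m + 1))) 1)))) ∧
      ∀ x, LinearIndependent ℝ (fun i => v i x)) ∧
    m + 1 ∈ ({2, 4, 8} : Set ℕ) := by
  have key : ∀ i : Fin m, ∃ v : ∀ x : PK.SS m, TangentSpace (𝓡 m) x,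
      (∀ x, v x ∈ L x i) ∧ (∀ x, ‖PK.dd x (v x)‖ = 1) ∧ Continuous fun x => PK.dd x (v x) := by
    intro i
    obtain ⟨σ, hσ, hσ'⟩ := PK.lift_all hm (fun x => (L x i).map (PK.dd x).toLinearMap)
      (fun x => by
        exact (Submodule.equivMapOfInjective _ (PK.dd_inj x) (L x i)).finrank_eq.symm.trans (hrank x i))
      (fun x => by
        rintro _ ⟨w, -, rfl⟩
        exact PK.dd_perp x w)
      (fun x0 => by
        obtain ⟨U, hU, s, hs, hsL⟩ := hsmooth i x0
        refine ⟨U, hU, fun x => PK.dd x (s x), (PK.dd_smooth U s hs).continuousOn, fun x hx => ⟨⟨s x, (hsL x hx).1, rfl⟩, ?_⟩⟩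
        intro h
        exact (hsL x hx).2 (PK.dd_inj x (h.trans (map_zero _).symm)))
    have h1 : ∀ x, ∃ w ∈ L x i, PK.dd x w = σ x := fun x => (hσ' x).1
    choose v hv hv' using h1
    refine ⟨v, hv, fun x => ?_, ?_⟩
    · rw [hv']
      exact (hσ' x).2
    · have h2 : (fun x => PK.dd x (v x)) = σ := funext hv'
      rw [h2]
      exact hσ
  choose v hv hv1 hvc using key
  have hli : ∀ x, LinearIndependent ℝ (fun i => v i x) := by
    intro x
    refine (hL x).submodule_iSupIndep.linearIndependent (L x) (fun i => hv i x) (fun i h => ?_)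
    have h1 := hv1 i x
    rw [h, map_zero, norm_zero] at h1
    exact zero_ne_one h1
  refine ⟨⟨v, fun i => PK.line_smooth (fun x => L x i) (fun x => hrank x i) (hsmooth i) (v i) (hv i) (hv1 i) (hvc i), hli⟩, ?_⟩
  have h := PK.adams_frame hm (fun i x => PK.dd x (v i x)) hvc (fun i x => PK.dd_perp x _)
    (fun x => (hli x).map' (PK.dd x).toLinearMap (LinearMap.ker_eq_bot.2 (PK.dd_inj x)))
  simpa using h
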